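/- Let k > 2 be a fixed real number and q a large integer. Assume that every Dirichlet L-function L(s,χ) attached to a Dirichlet character χ mod q satisfies the Riemann Hypothesis. Then there is a constant C depending only on k such that for all real y with 2 ≤ y ≤ q^{1/2}, one has S_k(q,y) := ∑_{χ ∈ X_q^*} |∑_{n ≤ y} χ(n)|^{2k} ≤ C · φ(q) · y^k · (log y)^{(k−1)²}. -/

import Mathlib

open Complex Real Finset

def dirichletRH {q : ℕ} [NeZero q] (χ : DirichletCharacter ℂ q) : Prop :=
  ∀ s : ℂ, 0 < s.re → s.re < 1 → DirichletCharacter.LFunction χ s = 0 → s.re = 1 / 2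

open Complex Real Finset

namespace HP

set_option linter.unusedSectionVars false

variable {q : ℕ} [NeZero q]

lemma sum_block (χ : DirichletCharacter ℂ q) (hχ : χ ≠ 1) (n : ℕ) :
    ∑ i ∈ range q, χ ((n + i : ℕ) : ZMod q) = 0 := by
  have h1 : ∑ i ∈ range q, χ ((n + i : ℕ) : ZMod q) = ∑ x : ZMod q, χ ((n : ZMod q) + x) := by
    refine Finset.sum_nbij' (fun i => (i : ZMod q)) (fun x => x.val) ?_ ?_ ?_ ?_ ?_
    · intro i _; simp
    · intro x _; simpa using ZMod.val_lt x
    · intro i hi; exact ZMod.val_cast_of_lt (by simpa using hi)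
    · intro x _; simp
    · intro i _; push_cast; rfl
  rw [h1]
  refine (Equiv.sum_comp (Equiv.addLeft (n : ZMod q)) (fun x => χ x)).trans ?_
  exact MulChar.sum_eq_zero_of_ne_one hχ

/-- Partial sums. -/
noncomputable def psum (χ : DirichletCharacter ℂ q) (n : ℕ) : ℂ := ∑ k ∈ Icc 1 n, χ (k : ZMod q)

lemma psum_eq_range (χ : DirichletCharacter ℂ q) (n : ℕ) :
    psum χ n = ∑ i ∈ range n, χ ((1 + i : ℕ) : ZMod q) := by
  unfold psum
  rw [← Finset.Ico_add_one_right_eq_Icc, Finset.sum_Ico_eq_sum_range]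
  simp

lemma norm_psum_le_self (χ : DirichletCharacter ℂ q) (n : ℕ) : ‖psum χ n‖ ≤ n := by
  unfold psum
  refine (norm_sum_le _ _).trans ?_
  refine (Finset.sum_le_sum (fun k _ => χ.norm_le_one _)).trans ?_
  simp

lemma norm_psum_le (χ : DirichletCharacter ℂ q) (hχ : χ ≠ 1) (n : ℕ) : ‖psum χ n‖ ≤ q := by
  induction n using Nat.strong_induction_on with
  | _ n ih =>
    by_cases h : n < q
    · exact (norm_psum_le_self χ n).trans (by exact_mod_cast h.le)
    · push Not at h
      obtain ⟨m, rfl⟩ := Nat.exists_eq_add_of_le h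
      have : psum χ (q + m) = psum χ m := by
        rw [psum_eq_range, psum_eq_range, add_comm q m, Finset.sum_range_add]
        have := sum_block χ hχ (1 + m)
        simp only [add_assoc] at this ⊢
        rw [this, add_zero]
      rw [this]
      exact ih m (by have := NeZero.pos q; omega)

noncomputable def Fr (χ : DirichletCharacter ℂ q) (t : ℝ) : ℂ := psum χ ⌊t⌋₊

lemma measurable_Fr (χ : DirichletCharacter ℂ q) : Measurable (Fr χ) := by
  unfold Fr
  exact (measurable_from_nat (f := psum χ)).comp Nat.measurable_floor

lemma Fr_eq_zero (χ : DirichletCharacter ℂ q) {t : ℝ} (ht : t < 1) : Fr χ t = 0 := by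
  unfold Fr psum
  rw [Nat.floor_eq_zero.2 ht]; simp

lemma norm_Fr_le (χ : DirichletCharacter ℂ q) (hχ : χ ≠ 1) (t : ℝ) : ‖Fr χ t‖ ≤ q :=
  norm_psum_le χ hχ _

open Filter Topology MeasureTheory Asymptotics in
lemma LF_eq (χ : DirichletCharacter ℂ q) (hχ : χ ≠ 1) {s : ℂ} (hs : 0 < s.re) :
    χ.LFunction s = s * ∫ t in Set.Ioi (1 : ℝ), Fr χ t * (t : ℂ) ^ (-(s + 1)) := by
  -- mellin
  have key : ∀ s : ℂ, ∫ t in Set.Ioi (1 : ℝ), Fr χ t * (t : ℂ) ^ (-(s + 1))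
      = mellin (Fr χ) (-s) := by
    intro s
    unfold mellin
    rw [← integral_indicator measurableSet_Ioi, ← integral_indicator measurableSet_Ioi]
    apply integral_congr_ae
    have : ({1} : Set ℝ)ᶜ ∈ ae (volume : Measure ℝ) := by
      simp [mem_ae_iff]
    filter_upwards [this] with t ht
    rcases lt_or_gt_of_ne (show t ≠ 1 from ht) with h | h
    · rw [Set.indicator_of_notMem (by simp; linarith)]
      simp [Set.indicator_apply, Fr_eq_zero χ h]
    · rw [Set.indicator_of_mem (by simpa using h), Set.indicator_of_mem (by simp; linarith)]
      rw [smul_eq_mul, mul_comm]; congr 2; ring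
  have hd : DifferentiableOn ℂ (fun s => s * mellin (Fr χ) (-s)) {s : ℂ | 0 < s.re} := by
    intro s hs
    refine (differentiableAt_id.mul ?_).differentiableWithinAt
    have : DifferentiableAt ℂ (mellin (Fr χ)) (-s) := by
      refine mellin_differentiableAt_of_isBigO_rpow (a := 0) (b := (-s).re - 1) ?_ ?_ ?_ ?_ ?_
      · refine LocallyIntegrable.locallyIntegrableOn ?_ _
        refine LocallyIntegrable.mono (f := fun _ => (q : ℝ)) (locallyIntegrable_const _)
          (measurable_Fr χ).aestronglyMeasurable (ae_of_all _ fun t => ?_)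
        simpa using norm_Fr_le χ hχ t
      · simp only [neg_zero, Real.rpow_zero]
        refine IsBigO.of_bound (q : ℝ) (Eventually.of_forall fun t => ?_)
        simpa using norm_Fr_le χ hχ t
      · simpa using hs
      · refine IsBigO.of_bound 1 ?_
        filter_upwards [Ioo_mem_nhdsGT (zero_lt_one)] with t ht
        rw [Fr_eq_zero χ ht.2]; simp
      · linarith
    exact this.comp s differentiableAt_id.neg
  have hopen : IsOpen {s : ℂ | 0 < s.re} := isOpen_lt continuous_const Complex.continuous_re
  have e : Set.EqOn (χ.LFunction) (fun s => s * mellin (Fr χ) (-s)) {s : ℂ | 0 < s.re} := by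
    refine AnalyticOnNhd.eqOn_of_preconnected_of_eventuallyEq (𝕜 := ℂ) (z₀ := 2) ?_ ?_ ?_ ?_ ?_
    · exact ((DirichletCharacter.differentiable_LFunction hχ).differentiableOn).analyticOnNhd hopen
    · exact hd.analyticOnNhd hopen
    · exact (convex_halfSpace_re_gt 0).isPreconnected
    · simp
    · have : {s : ℂ | 1 < s.re} ∈ 𝓝 (2 : ℂ) :=
        (isOpen_lt continuous_const Complex.continuous_re).mem_nhds (by simp)
      filter_upwards [this] with s hs
      have hs : 1 < s.re := hs
      rw [DirichletCharacter.LFunction_eq_LSeries χ hs, ← key]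
      rw [LSeries_eq_mul_integral (fun n => χ (n : ZMod q)) (r := 0) le_rfl (by linarith)
        (DirichletCharacter.LSeriesSummable_of_one_lt_re χ hs)]
      · rfl
      · simp only [Real.rpow_zero]
        refine IsBigO.of_bound (q : ℝ) (Eventually.of_forall fun t => ?_)
        simpa [psum] using norm_psum_le χ hχ t
  rw [e hs, key]

open Filter Topology MeasureTheory Asymptotics in
lemma norm_LF_le (χ : DirichletCharacter ℂ q) (hχ : χ ≠ 1) {s : ℂ} (hs : 0 < s.re) :
    ‖χ.LFunction s‖ ≤ ‖s‖ * q / s.re := by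
  rw [LF_eq χ hχ hs, norm_mul, mul_div_assoc]
  gcongr
  calc ‖∫ t in Set.Ioi (1 : ℝ), Fr χ t * (t : ℂ) ^ (-(s + 1))‖
      ≤ ∫ t in Set.Ioi (1 : ℝ), q * t ^ (-(s.re + 1)) := by
        refine norm_integral_le_of_norm_le ?_ ?_
        · exact (integrableOn_Ioi_rpow_of_lt (by linarith) one_pos).const_mul _
        · refine (ae_restrict_mem measurableSet_Ioi).mono fun t ht => ?_
          have ht : 1 < t := ht
          rw [norm_mul, Complex.norm_cpow_eq_rpow_re_of_pos (by linarith)]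
          simp only [neg_re, add_re, one_re]
          gcongr
          exact norm_Fr_le χ hχ t
    _ = q / s.re := by
        rw [integral_const_mul, integral_Ioi_rpow_of_lt (by linarith) one_pos]
        simp; field_simp

end HP

open Complex Real Finset

namespace HP

open Metric in
/-- Borel-Caratheodory recentered. -/
lemma BC {f : ℂ → ℂ} {c z : ℂ} {ρ M : ℝ} (hρ : 0 < ρ) (hM : 0 ≤ M)
    (hf : DifferentiableOn ℂ f (ball c ρ)) (hre : ∀ w ∈ ball c ρ, (f w - f c).re ≤ M)
    (hz : ‖z - c‖ < ρ) : ‖f z - f c‖ ≤ 2 * M * ‖z - c‖ / (ρ - ‖z - c‖) := by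
  have step : ∀ M' : ℝ, M < M' → ‖f z - f c‖ ≤ 2 * M' * ‖z - c‖ / (ρ - ‖z - c‖) := by
    intro M' hM'
    have := Complex.borelCaratheodory_zero (f := fun w => f (c + w) - f c) (R := ρ) (z := z - c)
      (M := M') (by linarith) ?_ ?_ hρ (by simpa using hz) (by simp)
    · simpa using this
    · refine DifferentiableOn.sub_const ?_ _
      refine hf.comp (by fun_prop) ?_
      intro w hw; simpa [mem_ball, dist_eq_norm] using hw
    · intro w hw
      have := hre (c + w) (by simpa [mem_ball, dist_eq_norm] using hw)
      show (f (c + w) - f c).re ≤ M'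
      linarith
  have hpos : 0 < ρ - ‖z - c‖ := by linarith
  have hc : Filter.Tendsto (fun M' : ℝ => 2 * M' * ‖z - c‖ / (ρ - ‖z - c‖)) (nhdsWithin M (Set.Ioi M))
      (nhds (2 * M * ‖z - c‖ / (ρ - ‖z - c‖))) := by
    apply Filter.Tendsto.mono_left _ nhdsWithin_le_nhds
    apply Continuous.tendsto (by fun_prop)
  exact ge_of_tendsto hc (Filter.eventually_of_mem self_mem_nhdsWithin fun M' h => step M' h)

open Metric in
/-- derivative version -/
lemma BC_deriv {f : ℂ → ℂ} {c : ℂ} {ρ M : ℝ} (hρ : 0 < ρ) (hM : 0 ≤ M)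
    (hf : DifferentiableOn ℂ f (ball c ρ)) (hre : ∀ w ∈ ball c ρ, (f w - f c).re ≤ M) :
    ‖deriv f c‖ ≤ 4 * M / ρ := by
  have h2 : ‖deriv (fun w => f w - f c) c‖ ≤ (2 * M) / (ρ / 2) := by
    refine Complex.norm_deriv_le_of_forall_mem_sphere_norm_le (by positivity) ?_ ?_
    · refine DifferentiableOn.diffContOnCl (DifferentiableOn.sub_const (hf.mono ?_) _)
      rw [closure_ball _ (by positivity)]
      exact closedBall_subset_ball (by linarith)
    · intro z hz
      have hz' : ‖z - c‖ = ρ / 2 := by simpa [dist_eq_norm] using hz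
      have := BC hρ hM hf hre (z := z) (by rw [hz']; linarith)
      rw [hz'] at this
      refine this.trans (le_of_eq ?_)
      field_simp; ring
  rw [deriv_sub_const] at h2
  refine h2.trans (le_of_eq ?_)
  field_simp; ring

open Metric in
/-- holomorphic log on a convex open set -/
lemma exists_log {U : Set ℂ} (hU : IsOpen U) (hc : Convex ℝ U) (hne : U.Nonempty) {f : ℂ → ℂ}
    (hf : DifferentiableOn ℂ f U) (h0 : ∀ z ∈ U, f z ≠ 0) :
    ∃ g : ℂ → ℂ, DifferentiableOn ℂ g U ∧ (∀ z ∈ U, Complex.exp (g z) = f z) ∧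
      (∀ z ∈ U, deriv g z = deriv f z / f z) := by
  have hs : IsSimplyConnected U := by
    have := hc.contractibleSpace hne
    exact (inferInstance : SimplyConnectedSpace U)
  obtain ⟨g, hg, hge⟩ := Complex.exists_continuousOn_eqOn_exp_comp hs hU hf.continuousOn
    (by rintro ⟨z, hz, h⟩; exact h0 z hz h)
  have hd : ∀ z ∈ U, HasDerivAt g (deriv f z / f z) z := by
    intro z hz
    have hfz : HasDerivAt f (deriv f z) z := (hf.differentiableAt (hU.mem_nhds hz)).hasDerivAt
    have hex : Complex.exp (g z) = f z := hge hz
    have hcz : ContinuousAt g z := hg.continuousAt (hU.mem_nhds hz)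
    have hev : g =ᶠ[nhds z] fun w => g z + Complex.log (f w / f z) := by
      have h1 : ∀ᶠ w in nhds z, ‖g w - g z‖ < 1 := by
        have := (Metric.continuousAt_iff.1 hcz) 1 one_pos
        obtain ⟨δ, hδ, h⟩ := this
        filter_upwards [ball_mem_nhds z hδ] with w hw
        simpa [dist_eq_norm] using h hw
      filter_upwards [h1, hU.mem_nhds hz] with w hw hwU
      have him := (Complex.abs_im_le_norm (g w - g z)).trans_lt hw
      have hex' : Complex.exp (g w) = f w := hge hwU
      rw [← hex', ← hex, ← Complex.exp_sub, Complex.log_exp]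
      · ring
      · linarith [(abs_lt.1 him).1, Real.pi_gt_three]
      · linarith [(abs_lt.1 him).2, Real.pi_gt_three]
    refine HasDerivAt.congr_of_eventuallyEq ?_ hev
    have h3 : HasDerivAt (fun w => f w / f z) (deriv f z / f z) z := hfz.div_const _
    have h4 := h3.clog (by rw [div_self (h0 z hz)]; simp)
    have h5 := h4.const_add (g z)
    rwa [div_self (h0 z hz), div_one] at h5
  exact ⟨g, fun z hz => (hd z hz).differentiableAt.differentiableWithinAt, fun z hz => hge hz,
    fun z hz => (hd z hz).deriv⟩

open Metric in
lemma landau_base {f : ℂ → ℂ} (hf : Differentiable ℂ f) {D : ℝ} (hD : 0 ≤ D)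
    (hb : ∀ z, ‖z‖ < 39/4 → Real.log ‖f z‖ ≤ Real.log ‖f 0‖ + D)
    (h0 : ∀ z, ‖z‖ < 39/4 → f z ≠ 0) {z : ℂ} (hz : ‖z‖ ≤ 19/2) :
    ‖logDeriv f z‖ ≤ 1232 * D := by
  obtain ⟨g, hg, hge, hgd⟩ := exists_log (U := ball (0:ℂ) (39/4)) isOpen_ball (convex_ball _ _)
    ⟨0, by simp⟩ hf.differentiableOn (fun z hz => h0 z (by simpa using hz))
  have hlog : ∀ w, ‖w‖ < 39/4 → (g w).re = Real.log ‖f w‖ := by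
    intro w hw
    rw [← hge w (by simpa using hw), Complex.norm_exp, Real.log_exp]
  have hzU : z ∈ ball (0:ℂ) (39/4) := by simp; linarith
  have h1 : ‖g z - g 0‖ ≤ 2 * D * ‖z - 0‖ / (39/4 - ‖z - 0‖) := by
    refine BC (by norm_num) hD hg ?_ (by simp; linarith)
    intro w hw
    have hw : ‖w‖ < 39/4 := by simpa using hw
    rw [sub_re, hlog w hw, hlog 0 (by simp)]
    linarith [hb w hw]
  have h2 : ‖g z - g 0‖ ≤ 76 * D := by
    refine h1.trans ?_
    rw [div_le_iff₀ (by simp; linarith)]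
    simp only [sub_zero]
    nlinarith
  have h3 : -(76 * D) ≤ (g z - g 0).re := by
    linarith [(abs_le.1 ((Complex.abs_re_le_norm _).trans h2)).1]
  have h4 : ‖deriv g z‖ ≤ 4 * (77 * D) / (1/4) := by
    refine BC_deriv (by norm_num) (by positivity) (hg.mono ?_) ?_
    · intro w hw
      simp only [mem_ball, dist_eq_norm, sub_zero] at hw ⊢
      calc ‖w‖ = ‖(w - z) + z‖ := by ring_nf
        _ ≤ ‖w - z‖ + ‖z‖ := norm_add_le _ _
        _ < 39/4 := by linarith
    · intro w hw
      have hw : ‖w‖ < 39/4 := by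
        simp only [mem_ball, dist_eq_norm] at hw ⊢
        calc ‖w‖ = ‖(w - z) + z‖ := by ring_nf
          _ ≤ ‖w - z‖ + ‖z‖ := norm_add_le _ _
          _ < 39/4 := by linarith
      have := hb w hw
      rw [sub_re] at h3
      rw [sub_re, hlog w hw]
      rw [hlog 0 (by simp)] at h3
      linarith
  rw [hgd z hzU] at h4
  rw [logDeriv_apply]
  linarith

open Metric ComplexConjugate in
lemma blaschke {f : ℂ → ℂ} {M : ℝ} (hf : Differentiable ℂ f)
    (hb : ∀ z, ‖z‖ ≤ 79/8 → ‖f z‖ ≤ Real.exp M) (h0 : f 0 ≠ 0) {ρ : ℂ} (hρ : ‖ρ‖ < 39/4)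
    (hz : f ρ = 0) : ∃ g : ℂ → ℂ, Differentiable ℂ g ∧ (∀ z, ‖z‖ ≤ 79/8 → ‖g z‖ ≤ Real.exp M) ∧
      g 0 ≠ 0 ∧ Real.log ‖f 0‖ + Real.log (79/78) ≤ Real.log ‖g 0‖ ∧
      (∀ w, ‖w‖ < 39/4 → g w = 0 → f w = 0) ∧
      (∀ z, ‖z‖ ≤ 19/2 → f z ≠ 0 → ρ.re < z.re →
        (logDeriv g z).re - 2 ≤ (logDeriv f z).re) := by
  have hρ0 : ρ ≠ 0 := by rintro rfl; exact h0 hz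
  have hρn : 0 < ‖ρ‖ := by positivity
  have hd : Differentiable ℂ (dslope f ρ) := by
    have := (Complex.differentiableOn_dslope (f := f) (s := Set.univ) (c := ρ) Filter.univ_mem).2
      hf.differentiableOn
    exact differentiableOn_univ.1 this
  have hfd : ∀ z, f z = (z - ρ) * dslope f ρ z := by
    intro z
    have := sub_smul_dslope f ρ z
    rw [hz, sub_zero, smul_eq_mul] at this
    exact this.symm
  have hden : ∀ z : ℂ, ‖z‖ < 79/8 → ((79/8)^2 - conj ρ * z : ℂ) ≠ 0 := by
    intro z hz h
    have h1 : ‖(conj ρ * z : ℂ)‖ = (79/8)^2 := by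
      rw [← sub_eq_zero.1 h]; norm_num
    rw [norm_mul, RCLike.norm_conj] at h1
    nlinarith [norm_nonneg z]
  set g : ℂ → ℂ := fun z => dslope f ρ z * (((79/8)^2 - conj ρ * z) / (79/8)) with hg
  have hgd : Differentiable ℂ g := by
    refine hd.mul ?_
    fun_prop
  have hg0 : g 0 = - f 0 * (79/8) / ρ := by
    simp only [hg, hfd 0]
    field_simp; ring
  have hg0n : ‖g 0‖ = ‖f 0‖ * ((79/8) / ‖ρ‖) := by
    rw [hg0, norm_div, norm_mul, norm_neg]
    norm_num
    ring
  refine ⟨g, hgd, ?_, ?_, ?_, ?_, ?_⟩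
  · intro z hz
    refine Complex.norm_le_of_forall_mem_frontier_norm_le (U := ball 0 (79/8)) isBounded_ball
      hgd.diffContOnCl ?_ (by rw [closure_ball _ (by norm_num)]; simpa using hz)
    intro w hw
    rw [frontier_ball _ (by norm_num)] at hw
    have hw : ‖w‖ = 79/8 := by simpa using hw
    have e : ‖((79/8)^2 - conj ρ * w : ℂ)‖ = (79/8) * ‖w - ρ‖ := by
      have h2 : ((79/8)^2 : ℂ) = conj w * w := by
        rw [Complex.conj_mul', hw]; norm_num
      rw [h2, ← sub_mul, norm_mul, ← map_sub, RCLike.norm_conj, hw, mul_comm]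
    have : ‖g w‖ = ‖f w‖ := by
      rw [hfd w]
      simp only [hg, norm_mul, norm_div, e]
      norm_num
      ring
    rw [this]; exact hb w hw.le
  · rw [← norm_pos_iff, hg0n]; positivity
  · rw [hg0n, Real.log_mul (by positivity) (by positivity)]
    refine add_le_add le_rfl (Real.log_le_log (by norm_num) ?_)
    rw [div_le_div_iff₀ (by norm_num) hρn]
    linarith
  · intro w hw hgw
    have := hden w (by linarith)
    rw [hfd w]
    simp only [hg, mul_eq_zero, div_eq_zero_iff] at hgw
    rcases hgw with h | h | h
    · rw [h]; simp
    · exact absurd h this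
    · norm_num at h
  · intro z hz hfz hre
    have hzρ : z - ρ ≠ 0 := by
      intro h; rw [hfd z, h] at hfz; simp at hfz
    have hdz : dslope f ρ z ≠ 0 := by
      intro h; rw [hfd z, h] at hfz; simp at hfz
    have hden' := hden z (by linarith)
    have e1 : logDeriv f z = 1 / (z - ρ) + logDeriv (dslope f ρ) z := by
      have : f = fun z => (z - ρ) * dslope f ρ z := funext hfd
      conv_lhs => rw [this]
      rw [logDeriv_mul z hzρ hdz (by fun_prop) (hd z)]
      congr 1
      simp [logDeriv_apply]
    have e2 : logDeriv g z = logDeriv (dslope f ρ) z - conj ρ / ((79/8)^2 - conj ρ * z) := by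
      simp only [hg]
      rw [logDeriv_mul (f := dslope f ρ) (g := fun z => ((79/8)^2 - conj ρ * z) / (79/8)) z hdz (div_ne_zero hden' (by norm_num)) (hd z) (by fun_prop), sub_eq_add_neg]
      congr 1
      have : HasDerivAt (fun z => ((79/8)^2 - conj ρ * z) / (79/8) : ℂ → ℂ) (-(conj ρ) / (79/8)) z := by
        simpa using ((((hasDerivAt_id z).const_mul (conj ρ)).const_sub ((79/8)^2 : ℂ)).div_const (79/8))
      rw [logDeriv_apply, this.deriv]
      field_simp
    have hp : 0 ≤ (1 / (z - ρ)).re := by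
      rw [one_div, Complex.inv_re]
      have : 0 ≤ (z - ρ).re := by simp; linarith
      exact div_nonneg this (Complex.normSq_nonneg _)
    have hq : ‖conj ρ / ((79/8)^2 - conj ρ * z)‖ ≤ 2 := by
      rw [norm_div, RCLike.norm_conj]
      have h1 : (79/8:ℝ)^2 - ‖ρ‖ * ‖z‖ ≤ ‖((79/8)^2 - conj ρ * z : ℂ)‖ := by
        have := norm_sub_norm_le ((79/8)^2 : ℂ) (conj ρ * z)
        rw [norm_mul, RCLike.norm_conj] at this
        norm_num at this ⊢
        linarith
      have h3 : ‖ρ‖ * ‖z‖ ≤ 39/4 * (19/2) := by gcongr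
      rw [div_le_iff₀ (by norm_num at h1; linarith)]
      linarith
    have hq' := (abs_le.1 ((Complex.abs_re_le_norm _).trans hq)).1
    have e1' := congrArg Complex.re e1
    have e2' := congrArg Complex.re e2
    rw [add_re] at e1'
    rw [sub_re] at e2'
    linarith

lemma landau (β : ℝ) (n : ℕ) : ∀ (f : ℂ → ℂ) (M : ℝ), Differentiable ℂ f →
    (∀ z, ‖z‖ ≤ 79/8 → ‖f z‖ ≤ Real.exp M) → f 0 ≠ 0 →
    M - Real.log ‖f 0‖ ≤ n * Real.log (79/78) →
    (∀ ρ, ‖ρ‖ < 39/4 → f ρ = 0 → ρ.re ≤ β) →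
    ∀ z, ‖z‖ ≤ 19/2 → β < z.re → -(1232 * (M - Real.log ‖f 0‖)) ≤ (logDeriv f z).re := by
  have hκ : (1:ℝ)/79 ≤ Real.log (79/78) := by
    have := Real.one_sub_inv_le_log_of_pos (show (0:ℝ) < 79/78 by norm_num)
    norm_num at this ⊢; linarith
  have base : ∀ (f : ℂ → ℂ) (M : ℝ), Differentiable ℂ f →
    (∀ z, ‖z‖ ≤ 79/8 → ‖f z‖ ≤ Real.exp M) → f 0 ≠ 0 → (∀ ρ, ‖ρ‖ < 39/4 → f ρ ≠ 0) →
    ∀ z, ‖z‖ ≤ 19/2 → -(1232 * (M - Real.log ‖f 0‖)) ≤ (logDeriv f z).re := by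
    intro f M hf hb h0 hz z hzr
    have hlb : ∀ w, ‖w‖ < 39/4 → Real.log ‖f w‖ ≤ M := by
      intro w hw
      have := hz w hw
      rw [Real.log_le_iff_le_exp (by positivity)]; exact hb w (by linarith)
    have := landau_base hf (D := M - Real.log ‖f 0‖) (by linarith [hlb 0 (by simp)])
      (fun w hw => by linarith [hlb w hw]) hz hzr
    exact (abs_le.1 ((Complex.abs_re_le_norm _).trans this)).1
  induction n with
  | zero =>
    intro f M hf hb h0 hn hz z hzr hzβ
    by_cases h : ∀ ρ, ‖ρ‖ < 39/4 → f ρ ≠ 0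
    · exact base f M hf hb h0 h z hzr
    push Not at h
    obtain ⟨ρ, hρ, hρz⟩ := h
    obtain ⟨g, h1, h2, h3, h4, h5, h6⟩ := blaschke hf hb h0 hρ hρz
    have : Real.log ‖g 0‖ ≤ M := by
      rw [Real.log_le_iff_le_exp (by positivity)]; exact h2 0 (by norm_num)
    simp at hn
    linarith
  | succ n ih =>
    intro f M hf hb h0 hn hz z hzr hzβ
    by_cases h : ∀ ρ, ‖ρ‖ < 39/4 → f ρ ≠ 0
    · exact base f M hf hb h0 h z hzr
    push Not at h
    obtain ⟨ρ, hρ, hρz⟩ := h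
    obtain ⟨g, h1, h2, h3, h4, h5, h6⟩ := blaschke hf hb h0 hρ hρz
    push_cast at hn
    have := ih g M h1 h2 h3 (by linarith) (fun w hw hgw => hz w hw (h5 w hw hgw)) z hzr hzβ
    have h7 := h6 z hzr (fun h => by linarith [hz z (by linarith) h])
      (by linarith [hz ρ hρ hρz])
    linarith

end HP

open Complex Real Finset

namespace HP
set_option linter.unusedSectionVars false

/-- analytic conductor log -/
noncomputable def LL (q : ℕ) (t : ℝ) : ℝ := Real.log (q * (|t| + 3))

lemma one_le_LL (q : ℕ) [NeZero q] (t : ℝ) : 1 ≤ LL q t := by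
  unfold LL
  rw [Real.le_log_iff_exp_le (by have := NeZero.pos q; positivity)]
  have h1 : (1:ℝ) ≤ q := by exact_mod_cast NeZero.one_le
  have := Real.exp_one_lt_d9
  nlinarith [abs_nonneg t]

open ArithmeticFunction in
noncomputable def lc (n : ℕ) : ℝ := vonMangoldt n / Real.log n

open ArithmeticFunction in
lemma lc_nonneg (n : ℕ) : 0 ≤ lc n :=
  div_nonneg vonMangoldt_nonneg (Real.log_natCast_nonneg n)

open ArithmeticFunction in
lemma lc_le_one (n : ℕ) : lc n ≤ 1 :=
  div_le_one_of_le₀ vonMangoldt_le_log (Real.log_natCast_nonneg n)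

lemma summable_nat_rpow {σ : ℝ} (hσ : 1 < σ) : Summable (fun n : ℕ => (n:ℝ)^(-σ)) := by
  simpa using hσ

lemma norm_LSeries_le {f : ℕ → ℂ} (hf : ∀ n, ‖f n‖ ≤ 1) {s : ℂ} (hs : 2 ≤ s.re) :
    ‖LSeries f s‖ ≤ ∑' n : ℕ, (n:ℝ)^(-2:ℝ) := by
  unfold LSeries
  refine tsum_of_norm_bounded (summable_nat_rpow (by norm_num)).hasSum ?_
  intro n
  rcases eq_or_ne n 0 with rfl | hn
  · simp
  · rw [LSeries.term_of_ne_zero hn, norm_div, Complex.norm_natCast_cpow_of_pos (by positivity)]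
    rw [Real.rpow_neg (by positivity), ← one_div]
    have hn1 : (1:ℝ) ≤ n := by exact_mod_cast Nat.one_le_iff_ne_zero.2 hn
    gcongr
    exact hf n

variable {q : ℕ} [NeZero q]

lemma norm_LF_ge : ∃ c : ℝ, 0 < c ∧ ∀ (q : ℕ) [NeZero q] (χ : DirichletCharacter ℂ q) (s : ℂ),
    2 ≤ s.re → -c ≤ Real.log ‖χ.LFunction s‖ := by
  refine ⟨∑' n : ℕ, (n:ℝ)^(-2:ℝ) + 1, by positivity, fun q _ χ s hs => ?_⟩
  have h1 : 1 < s.re := by linarith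
  rw [DirichletCharacter.LFunction_eq_LSeries χ h1, ← DirichletCharacter.LSeries_eq_exp_LSeries χ h1,
    Complex.norm_exp, Real.log_exp]
  have := norm_LSeries_le (f := fun n => χ n * ArithmeticFunction.vonMangoldt n / Real.log n)
    (fun n => ?_) hs
  · linarith [(abs_le.1 ((Complex.abs_re_le_norm _).trans this)).1]
  · rw [mul_div_assoc, norm_mul, norm_div, ← norm_div]
    have h3 := lc_le_one n
    have h4 := lc_nonneg n
    unfold lc at h3 h4
    have : ‖((ArithmeticFunction.vonMangoldt n : ℂ) / (Real.log n : ℂ))‖ ≤ 1 := by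
      rw [← Complex.ofReal_div, Complex.norm_real, Real.norm_of_nonneg h4]; exact h3
    exact mul_le_one₀ (χ.norm_le_one _) (norm_nonneg _) this

lemma norm_logDeriv_le : ∃ c : ℝ, 0 < c ∧ ∀ (q : ℕ) [NeZero q] (χ : DirichletCharacter ℂ q) (s : ℂ),
    10 ≤ s.re → ‖logDeriv χ.LFunction s‖ ≤ c := by
  refine ⟨∑' n : ℕ, (n:ℝ)^(-2:ℝ) + 1, by positivity, fun q _ χ s hs => ?_⟩
  have h1 : 1 < s.re := by linarith
  rw [logDeriv_apply, DirichletCharacter.deriv_LFunction_eq_deriv_LSeries χ h1,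
    DirichletCharacter.LFunction_eq_LSeries χ h1]
  have h2 := DirichletCharacter.LSeries_twist_vonMangoldt_eq χ h1
  rw [← norm_neg, ← neg_div, ← h2]
  have : ‖LSeries ((fun n : ℕ => χ n) * fun n : ℕ => (ArithmeticFunction.vonMangoldt n : ℂ)) s‖
      ≤ ∑' n : ℕ, (n:ℝ)^(-2:ℝ) := by
    unfold LSeries
    refine tsum_of_norm_bounded (summable_nat_rpow (by norm_num)).hasSum ?_
    intro n
    rcases eq_or_ne n 0 with rfl | hn
    · simp
    · have hn1 : (1:ℝ) ≤ n := by exact_mod_cast Nat.one_le_iff_ne_zero.2 hn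
      rw [LSeries.term_of_ne_zero hn, norm_div, Complex.norm_natCast_cpow_of_pos (by positivity)]
      simp only [Pi.mul_apply, norm_mul, Complex.norm_real,
        Real.norm_of_nonneg ArithmeticFunction.vonMangoldt_nonneg]
      have h5 : ArithmeticFunction.vonMangoldt n ≤ n :=
        ArithmeticFunction.vonMangoldt_le_log.trans (Real.log_le_self (by positivity))
      calc ‖χ n‖ * ArithmeticFunction.vonMangoldt n / (n:ℝ)^s.re
          ≤ 1 * n / (n:ℝ)^(3:ℝ) := by
            gcongr
            · exact χ.norm_le_one _
            · linarith
        _ = (n:ℝ)^(-2:ℝ) := by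
            rw [one_mul, ← Real.rpow_one_sub' (by positivity) (by norm_num)]; norm_num
  linarith

lemma LF_ne_zero {χ : DirichletCharacter ℂ q} (hχ : χ ≠ 1) (hRH : dirichletRH χ) {s : ℂ}
    (hs : 1/2 < s.re) : χ.LFunction s ≠ 0 := by
  intro h
  rcases lt_or_ge s.re 1 with h1 | h1
  · have := hRH s (by linarith) h1 h; linarith
  · exact DirichletCharacter.LFunction_ne_zero_of_one_le_re χ (.inl hχ) h1 h

lemma re_logDeriv_ge : ∃ A : ℝ, 1 ≤ A ∧ ∀ (q : ℕ) [NeZero q] (χ : DirichletCharacter ℂ q), χ ≠ 1 →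
    dirichletRH χ → ∀ z : ℂ, 1/2 < z.re → -(A * LL q z.im) ≤ (logDeriv χ.LFunction z).re := by
  obtain ⟨c0, hc0, h0⟩ := norm_LF_ge
  obtain ⟨c1, hc1, h1⟩ := norm_logDeriv_le
  refine ⟨1 + c1 + 1232 * (6 + c0), by nlinarith, fun q _ χ hχ hRH z hz => ?_⟩
  have hLL := one_le_LL q z.im
  rcases le_or_gt 10 z.re with h | h
  · have := h1 q χ z h
    have := (abs_le.1 ((Complex.abs_re_le_norm _).trans this)).1
    nlinarith
  · set c : ℂ := ⟨10, z.im⟩ with hc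
    have hqp : (1:ℝ) ≤ q := by exact_mod_cast NeZero.one_le
    have hcn : ‖c‖ ≤ 10 + |z.im| := by
      refine (Complex.norm_le_abs_re_add_abs_im c).trans ?_
      simp [hc]
    have ha := abs_nonneg z.im
    obtain ⟨n, hn⟩ := exists_nat_ge ((Real.log (8 * q * (|z.im| + 20)) - Real.log ‖χ.LFunction (c + 0)‖)
      / Real.log (79/78))
    have hlp : 0 < Real.log (79/78) := Real.log_pos (by norm_num)
    rw [div_le_iff₀ hlp] at hn
    have hL := landau (-19/2) n (fun w => χ.LFunction (c + w)) (Real.log (8 * q * (|z.im| + 20)))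
      ?_ ?_ ?_ hn ?_ (z - c) ?_ ?_
    · have e : logDeriv (fun w => χ.LFunction (c + w)) (z - c) = logDeriv χ.LFunction z := by
        simp only [logDeriv_apply]
        rw [deriv_comp_const_add]
        simp
      rw [e] at hL
      have h3 := h0 q χ (c + 0) (by simp [hc]; norm_num)
      have h4 : Real.log (8 * q * (|z.im| + 20)) ≤ 6 * LL q z.im := by
        unfold LL
        have h5 : (0:ℝ) < q * (|z.im| + 3) := by positivity
        rw [← Real.log_rpow h5]
        refine Real.log_le_log (by positivity) ?_
        have h6 : (3:ℝ) ≤ q * (|z.im| + 3) := by nlinarith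
        have h7 : (3:ℝ)^5 ≤ (q * (|z.im| + 3))^5 := by gcongr
        calc 8 * (q:ℝ) * (|z.im| + 20) ≤ 3^5 * (q * (|z.im| + 3)) := by nlinarith
          _ ≤ (q * (|z.im| + 3))^5 * (q * (|z.im| + 3)) := by gcongr
          _ = (q * (|z.im| + 3))^(6:ℝ) := by norm_cast
      nlinarith
    · exact (DirichletCharacter.differentiable_LFunction hχ).comp (by fun_prop)
    · intro w hw
      have hre := (abs_le.1 (Complex.abs_re_le_norm w)).1
      have hre2 : 1/8 ≤ (c + w).re := by simp [hc]; linarith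
      rw [Real.exp_log (by positivity)]
      refine (norm_LF_le χ hχ (by linarith)).trans ?_
      rw [div_le_iff₀ (by linarith)]
      have h8 : ‖c + w‖ ≤ |z.im| + 20 := (norm_add_le _ _).trans (by linarith)
      calc ‖c + w‖ * q ≤ (|z.im| + 20) * q := by gcongr
        _ = 8 * q * (|z.im| + 20) * (1/8) := by ring
        _ ≤ _ := by gcongr
    · exact LF_ne_zero hχ hRH (by simp [hc]; norm_num)
    · intro w hw hwz
      by_contra hcon
      push Not at hcon
      exact LF_ne_zero hχ hRH (s := c + w) (by simp [hc]; linarith) hwz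
    · have : z - c = ((z.re - 10 : ℝ) : ℂ) := by
        apply Complex.ext <;> simp [hc]
      rw [this, Complex.norm_real, Real.norm_eq_abs, abs_le]
      constructor <;> linarith
    · simp [hc]; linarith

end HP

open Complex Real Finset

namespace HP
set_option linter.unusedSectionVars false
open Metric

/-- Harnack two-sided bound. -/
lemma harnack {f : ℂ → ℂ} {c z : ℂ} {ρ X : ℝ} (hX : 0 ≤ X) (hXρ : X < ρ)
    (hf : DifferentiableOn ℂ f (ball c ρ)) (hre : ∀ w ∈ ball c ρ, 0 < (f w).re)
    (hz : ‖z - c‖ ≤ X) : (f c).re * (ρ - X) ≤ (f z).re * (ρ + X) ∧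
      (f z).re * (ρ - X) ≤ (f c).re * (ρ + X) := by
  have hρ : 0 < ρ := by linarith
  have hcb : c ∈ ball c ρ := by simpa using hρ
  have hzb : z ∈ ball c ρ := by simp [dist_eq_norm]; linarith
  have hc := hre c hcb
  have hz0 := hre z hzb
  have hne : ∀ w ∈ ball c ρ, f w + (starRingEnd ℂ) (f c) ≠ 0 := by
    intro w hw h
    have := congrArg Complex.re h
    simp at this
    linarith [hre w hw]
  have h1 := Complex.dist_le_div_mul_dist_of_mapsTo_ball (c := c) (R₁ := ρ) (R₂ := 1) (z := z)
    (f := fun w => (f w - f c) / (f w + (starRingEnd ℂ) (f c))) ?_ ?_ hzb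
  · simp only [sub_self, zero_div, dist_zero_right, norm_div] at h1
    have hn := hne z hzb
    rw [div_le_iff₀ (by positivity), dist_eq_norm] at h1
    set k := X / ρ with hk
    have hk1 : k < 1 := by rw [hk, div_lt_one hρ]; exact hXρ
    have hk0 : 0 ≤ k := by positivity
    have h2 : ‖f z - f c‖ ≤ k * ‖f z + (starRingEnd ℂ) (f c)‖ := by
      refine h1.trans ?_
      gcongr
      rw [hk, one_div, ← div_eq_inv_mul]
      gcongr
    have h3 : ‖f z - f c‖ ^ 2 ≤ k ^ 2 * ‖f z + (starRingEnd ℂ) (f c)‖ ^ 2 := by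
      rw [← mul_pow]; gcongr
    rw [← Complex.normSq_eq_norm_sq, ← Complex.normSq_eq_norm_sq, Complex.normSq_apply,
      Complex.normSq_apply] at h3
    simp only [sub_re, sub_im, add_re, add_im, conj_re, conj_im] at h3
    have h4 : ((f z).re - (f c).re) ^ 2 ≤ (k * ((f z).re + (f c).re)) ^ 2 := by
      have : k ^ 2 ≤ 1 := by nlinarith
      nlinarith [mul_self_nonneg ((f z).im - (f c).im)]
    have h5 := abs_le.1 (abs_le_of_sq_le_sq h4 (by positivity))
    have hkρ : k * ρ = X := by rw [hk]; field_simp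
    rw [← hkρ]
    constructor <;> nlinarith
  · exact (hf.sub_const _).div (hf.add_const _) hne
  · intro w hw
    apply ball_subset_closedBall
    simp only [sub_self, zero_div, mem_ball, dist_zero_right, norm_div]
    have hw0 := hre w hw
    rw [div_lt_one (norm_pos_iff.2 (hne w hw))]
    rw [← sq_lt_sq₀ (norm_nonneg _) (norm_nonneg _), ← Complex.normSq_eq_norm_sq, ← Complex.normSq_eq_norm_sq, Complex.normSq_apply,
      Complex.normSq_apply]
    simp only [sub_re, sub_im, add_re, add_im, conj_re, conj_im]
    nlinarith [mul_pos hw0 hc]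

lemma deriv_bound {f : ℂ → ℂ} {c : ℂ} {ρ : ℝ} (hρ : 0 < ρ)
    (hf : DifferentiableOn ℂ f (ball c ρ)) (hre : ∀ w ∈ ball c ρ, 0 ≤ (f w).re) :
    ‖deriv f c‖ ≤ 4 * (f c).re / ρ := by
  have := BC_deriv (f := fun w => - f w) hρ (hre c (by simpa using hρ)) hf.neg
    (fun w hw => by have := hre w hw; simp; exact this)
  simpa using this

/-- second difference -/
lemma second_diff {ψ ψ' ψ'' : ℝ → ℂ} {S v : ℝ} (h1 : ∀ x, HasDerivAt ψ (ψ' x) x)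
    (h2 : ∀ x, HasDerivAt ψ' (ψ'' x) x) (hv : 0 ≤ v) (hS : ∀ x, |x| ≤ v → ‖ψ'' x‖ ≤ S) :
    ‖ψ v + ψ (-v) - 2 * ψ 0‖ ≤ 2 * S * v ^ 2 := by
  have hS0 : 0 ≤ S := (norm_nonneg _).trans (hS 0 (by simpa using hv))
  have hconv : Convex ℝ (Set.Icc (-v) v) := convex_Icc _ _
  have a1 : ∀ x ∈ Set.Icc (-v) v, ‖ψ' x - ψ' 0‖ ≤ S * v := by
    intro x hx
    have := hconv.norm_image_sub_le_of_norm_hasDerivWithin_le (f := ψ') (f' := ψ'') (C := S)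
      (fun y _ => (h2 y).hasDerivWithinAt) (fun y hy => hS y (abs_le.2 ⟨hy.1, hy.2⟩))
      (show (0:ℝ) ∈ Set.Icc (-v) v by constructor <;> linarith) hx
    refine this.trans ?_
    gcongr
    rw [sub_zero, Real.norm_eq_abs]; exact abs_le.2 ⟨hx.1, hx.2⟩
  have a2 : ∀ x ∈ Set.Icc (-v) v, ‖ψ x - ψ 0 - x * ψ' 0‖ ≤ S * v * v := by
    intro x hx
    have := hconv.norm_image_sub_le_of_norm_hasDerivWithin_le (f := fun x => ψ x - x * ψ' 0)
      (f' := fun x => ψ' x - ψ' 0) (C := S * v) (x := 0) (y := x)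
      (fun y _ => ?_) a1
      (show (0:ℝ) ∈ Set.Icc (-v) v by constructor <;> linarith) hx
    · have e : ψ x - ψ 0 - x * ψ' 0 = ψ x - x * ψ' 0 - (ψ 0 - ((0:ℝ):ℂ) * ψ' 0) := by
        simp; ring
      rw [e]
      refine this.trans ?_
      gcongr
      rw [sub_zero, Real.norm_eq_abs]; exact abs_le.2 ⟨hx.1, hx.2⟩
    · have := (h1 y).sub ((Complex.ofRealCLM.hasDerivAt (x := y)).mul_const (ψ' 0))
      simpa [Pi.sub_def] using this.hasDerivWithinAt
  have b1 := a2 v ⟨by linarith, le_rfl⟩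
  have b2 := a2 (-v) ⟨le_rfl, by linarith⟩
  calc ‖ψ v + ψ (-v) - 2 * ψ 0‖
      = ‖(ψ v - ψ 0 - v * ψ' 0) + (ψ (-v) - ψ 0 - ((-v:ℝ):ℂ) * ψ' 0)‖ := by
        congr 1; push_cast; ring
    _ ≤ S * v * v + S * v * v := (norm_add_le _ _).trans (add_le_add b1 b2)
    _ = _ := by ring

/-- Comparison on vertical line. `g` is a log of `L`, `h1 = Re g'(s1) + H`. -/
lemma vertical {g : ℂ → ℂ} (hg : DifferentiableOn ℂ g {z | 1/2 < z.re}) {s1 : ℂ} {b v H : ℝ}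
    (hb : 0 < b) (hs : 1/2 + b ≤ s1.re) (hv : 0 ≤ v)
    (hH : ∀ z : ℂ, 1/2 < z.re → |z.im - s1.im| ≤ 2 * v + 2 * b → -H < (deriv g z).re) :
    0 < (deriv g s1).re + H ∧
    ‖g (s1 + v * I) + g (s1 + (-v:ℝ) * I) - 2 * g s1‖
      ≤ 8 * (3 + 2 * v / b) ^ 3 * v ^ 2 * ((deriv g s1).re + H) / b := by
  have hUo : IsOpen {z : ℂ | 1/2 < z.re} := isOpen_lt continuous_const Complex.continuous_re
  set f : ℂ → ℂ := fun z => deriv g z + H with hf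
  have hfd : DifferentiableOn ℂ f {z | 1/2 < z.re} := (hg.deriv hUo).add_const _
  have hsub : ∀ (c : ℂ) (ρ : ℝ), 1/2 + ρ ≤ c.re → ball c ρ ⊆ {z : ℂ | 1/2 < z.re} := by
    intro c ρ h w hw
    have h1 := (abs_lt.1 ((Complex.abs_re_le_norm (w - c)).trans_lt (by simpa [dist_eq_norm] using hw))).1
    rw [sub_re] at h1
    show 1/2 < w.re
    linarith
  have hpos : ∀ (c : ℂ) (ρ : ℝ), 1/2 + ρ ≤ c.re → |c.im - s1.im| + ρ ≤ 2 * v + 2 * b →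
      ∀ w ∈ ball c ρ, 0 < (f w).re := by
    intro c ρ h h2 w hw
    have h1 := ((Complex.abs_im_le_norm (w - c)).trans_lt (by simpa [dist_eq_norm] using hw))
    have h3 : |w.im - s1.im| ≤ |(w - c).im| + |c.im - s1.im| := by
      rw [sub_im]
      exact abs_sub_le _ _ _
    have := hH w (hsub c ρ h hw) (by linarith)
    simp [hf]; linarith
  set X := v + b with hX
  set τ := 3 + 2 * v / b with hτ
  have hτb : τ * b = 2 * X + b := by
    rw [hX, hτ]; field_simp; ring
  have hτ1 : 1 ≤ τ := by
    have : 0 ≤ 2 * v / b := by positivity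
    linarith
  have hf1 : 0 < (f s1).re := hpos s1 b hs (by simp; linarith) s1 (by simpa using hb)
  have hre1 : (f s1).re = (deriv g s1).re + H := by simp [hf]
  refine ⟨hre1 ▸ hf1, ?_⟩
  have hb1 : ∀ x : ℝ, |x| ≤ v → (f (s1 + x * I)).re ≤ τ ^ 3 * (f s1).re := by
    intro x hx
    have p1 := hpos (s1 + X) (X + b) (by simp; linarith) (by simp; linarith)
    have p2 := hpos (s1 + X + x * I) (X + b) (by simp; linarith) (by simp; linarith)
    have d1 := hfd.mono (hsub (s1 + X) (X + b) (by simp; linarith))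
    have d2 := hfd.mono (hsub (s1 + X + x * I) (X + b) (by simp; linarith))
    have hX0 : 0 ≤ X := by positivity
    have nX : ‖(X:ℂ)‖ = X := by rw [Complex.norm_real, Real.norm_of_nonneg hX0]
    have i1 := (harnack (z := s1) hX0 (by linarith) d1 p1 (by simp [abs_of_nonneg hX0])).1
    have i2 := (harnack (z := s1 + X + x * I) hX0 (by linarith) d1 p1 (by simp; linarith)).2
    have i3 := (harnack (z := s1 + x * I) hX0 (by linarith) d2 p2 (by
      have : s1 + x * I - (s1 + X + x * I) = -(X:ℂ) := by ring
      rw [this, norm_neg, nX])).2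
    have e1 : X + b - X = b := by ring
    have e2 : X + b + X = τ * b := by rw [hτb]; ring
    rw [e1, e2] at i1 i2 i3
    have j1 : (f (s1 + X)).re ≤ (f s1).re * τ := le_of_mul_le_mul_right (by linarith) hb
    have j2 : (f (s1 + X + x * I)).re ≤ (f (s1 + X)).re * τ := le_of_mul_le_mul_right (by linarith) hb
    have j3 : (f (s1 + x * I)).re ≤ (f (s1 + X + x * I)).re * τ :=
      le_of_mul_le_mul_right (by linarith) hb
    calc (f (s1 + x * I)).re ≤ (f (s1 + X + x * I)).re * τ := j3
      _ ≤ ((f s1).re * τ * τ) * τ := by gcongr; exact j2.trans (by gcongr)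
      _ = _ := by ring
  have hU : ∀ x : ℝ, s1 + x * I ∈ {z : ℂ | 1/2 < z.re} := by
    intro x; simp; linarith
  have hl : ∀ x : ℝ, HasDerivAt (fun x : ℝ => s1 + x * I) I x := by
    intro x
    simpa using ((Complex.ofRealCLM.hasDerivAt (x := x)).mul_const I).const_add s1
  have k1 : ∀ x : ℝ, HasDerivAt (fun x : ℝ => g (s1 + x * I)) (deriv g (s1 + x * I) * I) x := by
    intro x
    exact ((hg.differentiableAt (hUo.mem_nhds (hU x))).hasDerivAt).comp_of_eq x (hl x) rfl
  have k2 : ∀ x : ℝ, HasDerivAt (fun x : ℝ => deriv g (s1 + x * I) * I)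
      (deriv (deriv g) (s1 + x * I) * I * I) x := by
    intro x
    exact (((hg.deriv hUo).differentiableAt (hUo.mem_nhds (hU x))).hasDerivAt.comp_of_eq x (hl x) rfl).mul_const I
  have main := second_diff (S := 4 * (τ ^ 3 * (f s1).re) / b) k1 k2 hv ?_
  · rw [← hre1]
    simp only [ofReal_zero, zero_mul, add_zero] at main
    refine main.trans (le_of_eq ?_)
    ring
  · intro x hx
    have : deriv (deriv g) (s1 + x * I) = deriv f (s1 + x * I) := by
      simp [hf]
    rw [norm_mul, norm_mul, Complex.norm_I, mul_one, mul_one, this]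
    refine (deriv_bound hb (hfd.mono (hsub _ b (by simp; linarith)))
      (fun w hw => (hpos _ b (by simp; linarith) (by simp; linarith) w hw).le)).trans ?_
    gcongr
    exact hb1 x hx

/-- horizontal comparison -/
lemma horizontal {g : ℂ → ℂ} (hg : DifferentiableOn ℂ g {z | 1/2 < z.re}) {s0 : ℂ} {b H : ℝ}
    (hb : 0 < b) (hs : 1/2 < s0.re) 
    (hH : ∀ z : ℂ, 1/2 < z.re → |z.im - s0.im| ≤ 2 * b → -H < (deriv g z).re) :
    (g s0).re ≤ (g (s0 + b)).re - (b / 8) * ((deriv g (s0 + b)).re + H) + b * H := by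
  have hUo : IsOpen {z : ℂ | 1/2 < z.re} := isOpen_lt continuous_const Complex.continuous_re
  set h1 := (deriv g (s0 + b)).re + H with hh1
  have hU : ∀ x : ℝ, 0 ≤ x → s0 + x ∈ {z : ℂ | 1/2 < z.re} := by
    intro x hx; simp; linarith
  have k1 : ∀ x : ℝ, 0 ≤ x → HasDerivAt (fun x : ℝ => (g (s0 + x)).re + H * x) ((deriv g (s0 + x)).re + H) x := by
    intro x hx
    have := ((hg.differentiableAt (hUo.mem_nhds (hU x hx))).hasDerivAt).comp_of_eq x
      (((Complex.ofRealCLM.hasDerivAt (x := x))).const_add s0) rfl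
    have h2 := (Complex.reCLM.hasFDerivAt.comp_hasDerivAt x this).add ((hasDerivAt_id x).const_mul H)
    simpa [Function.comp_def, Pi.add_def] using h2
  have hp : ∀ x : ℝ, 0 ≤ x → 0 < (deriv g (s0 + x)).re + H := by
    intro x hx
    have := hH (s0 + x) (hU x hx) (by simp; linarith)
    linarith
  have mono1 : (g (s0 + 0)).re + H * 0 ≤ (g (s0 + (3 * b / 4 : ℝ))).re + H * (3 * b / 4) := by
    have := monotoneOn_of_deriv_nonneg (D := Set.Icc 0 b) (f := fun x : ℝ => (g (s0 + x)).re + H * x)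
      (convex_Icc _ _) (fun x hx => (k1 x hx.1).continuousAt.continuousWithinAt)
      (fun x hx => (k1 x (by simp at hx; exact hx.1.le)).differentiableAt.differentiableWithinAt)
      (fun x hx => by
        have hx0 : 0 ≤ x := by simp at hx; exact hx.1.le
        rw [(k1 x hx0).deriv]; exact (hp x hx0).le)
    have := this (a := 0) ⟨le_rfl, hb.le⟩ (b := 3 * b / 4) ⟨by positivity, by linarith⟩ (by positivity)
    simpa using this
  have mono2 : h1 / 2 * (b - 3 * b / 4) ≤ ((g (s0 + b)).re + H * b) - ((g (s0 + (3 * b / 4 : ℝ))).re + H * (3 * b / 4)) := by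
    have := (convex_Icc (3 * b / 4) b).mul_sub_le_image_sub_of_le_deriv (f := fun x : ℝ => (g (s0 + x)).re + H * x)
      (C := h1 / 2)
      (fun x hx => (k1 x (by linarith [hx.1])).continuousAt.continuousWithinAt)
      (fun x hx => (k1 x (by simp at hx; linarith [hx.1])).differentiableAt.differentiableWithinAt)
      (fun x hx => by
        simp only [interior_Icc, Set.mem_Ioo] at hx
        have hx0 : 0 ≤ x := by linarith
        rw [(k1 x hx0).deriv]
        set f : ℂ → ℂ := fun z => deriv g z + H with hf
        have hfd : DifferentiableOn ℂ f {z | 1/2 < z.re} := (hg.deriv hUo).add_const _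
        have hsub : ball (s0 + b) b ⊆ {z : ℂ | 1/2 < z.re} := by
          intro w hw
          have h1 := (abs_lt.1 ((Complex.abs_re_le_norm (w - _)).trans_lt (by simpa [dist_eq_norm] using hw))).1
          simp at h1
          show 1/2 < w.re
          linarith
        have := (harnack (f := f) (c := s0 + b) (z := s0 + x) (ρ := b) (X := b / 4) (by positivity) (by linarith)
          (hfd.mono hsub) ?_ ?_).1
        · simp [hf] at this
          have h0 := hp b hb.le
          have h00 := hp x hx0
          nlinarith
        · intro w hw
          have h1 := ((Complex.abs_im_le_norm (w - _)).trans_lt (by simpa [dist_eq_norm] using hw))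
          simp at h1
          have := hH w (hsub hw) (by linarith)
          simp [hf]; linarith
        · have : s0 + x - (s0 + b) = ((x - b : ℝ) : ℂ) := by push_cast; ring
          rw [this, Complex.norm_real, Real.norm_eq_abs, abs_le]
          constructor <;> linarith)
      (3 * b / 4) ⟨le_rfl, by linarith⟩ b ⟨by linarith, le_rfl⟩ (by linarith)
    simpa using this
  simp only [add_zero, mul_zero] at mono1
  nlinarith

end HP

open Complex Real Finset

namespace HP
set_option linter.unusedSectionVars false
open Metric MeasureTheory FourierTransform SchwartzMap

lemma kernel : ∃ K : ℝ → ℝ, ∃ w : ℝ → ℂ, Continuous K ∧ (∀ v, 0 ≤ K v) ∧ (∀ v, K (-v) = K v) ∧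
    (∀ n : ℕ, Integrable (fun v => |v| ^ n * K v)) ∧ ∫ v, K v = 1 ∧
    (∀ ξ : ℝ, ∫ v, (K v : ℂ) * Complex.exp (-(ξ * v) * I) = w ξ) ∧
    (∀ ξ : ℝ, 1 ≤ |ξ| → w ξ = 0) ∧ ∀ ξ, ‖w ξ‖ ≤ 1 := by
  let φ : ContDiffBump (0:ℝ) := ⟨1/32, 1/16, by norm_num, by norm_num⟩
  have hφc : HasCompactSupport (fun x : ℝ => ((φ x : ℝ) : ℂ)) :=
    φ.hasCompactSupport.comp_left (g := fun x : ℝ => (x:ℂ)) (by simp)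
  have hφs : ContDiff ℝ (⊤ : ℕ∞) (fun x : ℝ => ((φ x : ℝ) : ℂ)) :=
    Complex.ofRealCLM.contDiff.comp φ.contDiff
  have hac : ∀ a : ℝ, HasCompactSupport (fun x : ℝ => ((φ (x - a) : ℝ) : ℂ)) := fun a =>
    hφc.comp_homeomorph (Homeomorph.subRight a)
  have has : ∀ a : ℝ, ContDiff ℝ (⊤ : ℕ∞) (fun x : ℝ => ((φ (x - a) : ℝ) : ℂ)) := fun a =>
    hφs.comp (contDiff_id.sub contDiff_const)
  let f : 𝓢(ℝ, ℂ) := hφc.toSchwartzMap hφs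
  let fa : ℝ → 𝓢(ℝ, ℂ) := fun a => (hac a).toSchwartzMap (has a)
  let F : 𝓢(ℝ, ℂ) := 𝓕 f
  have hF : ∀ v : ℝ, F v = ∫ x : ℝ, Complex.exp (↑(-2 * π * x * v) * I) • ((φ x : ℝ) : ℂ) := by
    intro v
    show (𝓕 f) v = _
    rw [SchwartzMap.fourier_coe, Real.fourier_real_eq_integral_exp_smul]
    rfl
  have hFa : ∀ a v : ℝ, (𝓕 (fa a)) v = Complex.exp (↑(-2 * π * a * v) * I) * F v := by
    intro a v
    rw [SchwartzMap.fourier_coe, Real.fourier_real_eq_integral_exp_smul, hF]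
    have e1 : ∀ x, (fa a) x = ((φ (x - a) : ℝ) : ℂ) := fun x => rfl
    simp_rw [e1]
    rw [← integral_add_right_eq_self _ a, ← integral_const_mul]
    congr 1; ext x
    simp only [smul_eq_mul, add_sub_cancel_right]
    rw [← mul_assoc, ← Complex.exp_add]
    congr 2
    push_cast; ring
  have hFneg : ∀ v, ‖F (-v)‖ = ‖F v‖ := by
    intro v
    have : F (-v) = F v := by
      rw [hF, hF, ← integral_neg_eq_self]
      congr 1; ext x
      rw [φ.neg]
      congr 3; ring_nf
    rw [this]
  have hplan : ∀ a : ℝ, ∫ v, (starRingEnd ℂ) (F v) * (Complex.exp (↑(-2 * π * a * v) * I) * F v)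
      = ∫ x, (starRingEnd ℂ) (f x) * fa a x := by
    intro a
    have := SchwartzMap.integral_inner_fourier_fourier f (fa a)
    simp only [RCLike.inner_apply] at this
    rw [show ∫ x, (starRingEnd ℂ) (f x) * fa a x = ∫ x, fa a x * (starRingEnd ℂ) (f x) by
      congr 1; ext x; ring]
    rw [← this]
    congr 1; ext v
    rw [hFa]; ring
  obtain ⟨BF, hBF⟩ : ∃ B, ∀ v, ‖F v‖ ≤ B := ⟨_, fun v => SchwartzMap.norm_le_seminorm ℝ F v⟩
  have hintegr : ∀ n : ℕ, Integrable (fun v : ℝ => |v| ^ n * ‖F v‖ ^ 2) := by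
    intro n
    have h1 := (F.integrable_pow_mul volume n).mul_const BF
    refine h1.mono' (by have := F.continuous; fun_prop) (Filter.Eventually.of_forall fun v => ?_)
    rw [Real.norm_of_nonneg (by positivity), sq, ← mul_assoc]
    simp only [Real.norm_eq_abs]
    gcongr
    exact hBF v
  have hI0 : 0 < ∫ v, ‖F v‖ ^ 2 := by
    rw [SchwartzMap.integral_norm_sq_fourier]
    rw [integral_pos_iff_support_of_nonneg (fun x => by positivity)]
    · have : ball (0:ℝ) (1/16) ⊆ Function.support (fun x => ‖f x‖ ^ 2) := by
        intro x hx
        have : 0 < φ x := φ.pos_of_mem_ball hx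
        have e : f x = ((φ x : ℝ) : ℂ) := rfl
        simp [e, this.ne']
      refine lt_of_lt_of_le ?_ (measure_mono this)
      exact Metric.measure_ball_pos _ _ (by norm_num)
    · obtain ⟨Bf, hBf⟩ : ∃ B, ∀ v, ‖f v‖ ≤ B := ⟨_, fun v => SchwartzMap.norm_le_seminorm ℝ f v⟩
      have h1 := ((f.integrable (μ := volume)).norm).mul_const Bf
      refine h1.mono' (by have := f.continuous; fun_prop) (Filter.Eventually.of_forall fun v => ?_)
      rw [Real.norm_of_nonneg (by positivity), sq]
      gcongr
      exact hBf v
  set M := ∫ v, ‖F v‖ ^ 2 with hM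
  let K : ℝ → ℝ := fun v => ‖F v‖ ^ 2 / M
  have hK0 : ∀ v, 0 ≤ K v := fun v => by positivity
  have hK1 : ∫ v, K v = 1 := by
    simp only [K]
    rw [integral_div, ← hM, div_self hI0.ne']
  refine ⟨K, fun ξ => ∫ v, (K v : ℂ) * Complex.exp (-(ξ * v) * I), ?_, hK0, ?_, ?_, hK1, ?_, ?_, ?_⟩
  · have := F.continuous
    fun_prop
  · intro v; simp only [K, hFneg]
  · intro n
    have := (hintegr n).div_const M
    refine this.congr (Filter.Eventually.of_forall fun v => ?_)
    simp only [K]; ring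
  · intro ξ; rfl
  · intro ξ hξ
    set a := ξ / (2 * π) with ha
    have hp := hplan a
    have h0 : ∀ x, (starRingEnd ℂ) (f x) * fa a x = 0 := by
      intro x
      have e : f x = ((φ x : ℝ) : ℂ) := rfl
      have e' : fa a x = ((φ (x - a) : ℝ) : ℂ) := rfl
      by_cases hx : |x| < 1/16
      · have : φ (x - a) = 0 := by
          apply φ.zero_of_le_dist
          show (1/16 : ℝ) ≤ _
          rw [dist_zero_right, Real.norm_eq_abs]
          have h1 : 1 / 8 ≤ |a| := by
            rw [ha, abs_div, abs_of_pos (by positivity : (0:ℝ) < 2 * π), le_div_iff₀ (by positivity)]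
            linarith [Real.pi_lt_four]
          have h2 := abs_sub_abs_le_abs_sub a x
          rw [abs_sub_comm]
          linarith
        rw [e', this]; simp
      · have : φ x = 0 := by
          apply φ.zero_of_le_dist
          show (1/16 : ℝ) ≤ _
          rw [dist_zero_right, Real.norm_eq_abs]
          linarith
        rw [e, this]; simp
    simp_rw [h0] at hp
    rw [integral_zero] at hp
    have : ∀ v : ℝ, (K v : ℂ) * Complex.exp (-(ξ * v) * I) =
      (starRingEnd ℂ) (F v) * (Complex.exp (↑(-2 * π * a * v) * I) * F v) / M := by
      intro v
      have e1 : ((‖F v‖ ^ 2 : ℝ) : ℂ) = (starRingEnd ℂ) (F v) * F v := by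
        rw [Complex.conj_mul']; push_cast; rfl
      have e2 : (-(ξ * v) * I : ℂ) = ↑(-2 * π * a * v) * I := by
        have : -2 * π * a * v = -(ξ * v) := by rw [ha]; field_simp
        rw [this]; push_cast; ring
      simp only [K]
      rw [Complex.ofReal_div, e1, e2]; ring
    simp_rw [this]
    rw [integral_div, hp, zero_div]
  · intro ξ
    refine (norm_integral_le_integral_norm _).trans ?_
    rw [← hK1]
    apply le_of_eq
    congr 1; ext v
    rw [norm_mul]
    have : (-(ξ * v) * I : ℂ) = ((-(ξ * v) : ℝ) : ℂ) * I := by push_cast; ring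
    rw [this, Complex.norm_exp_ofReal_mul_I, mul_one, Complex.norm_real, Real.norm_of_nonneg (hK0 v)]

end HP

open Complex Real Finset

namespace HP
set_option linter.unusedSectionVars false
open Metric MeasureTheory

/-- smoothing data -/
structure IsKer (K : ℝ → ℝ) (w : ℝ → ℂ) : Prop where
  cont : Continuous K
  nonneg : ∀ v, 0 ≤ K v
  even : ∀ v, K (-v) = K v
  mom : ∀ n : ℕ, Integrable (fun v => |v| ^ n * K v)
  tot : ∫ v, K v = 1
  ft : ∀ ξ : ℝ, ∫ v, (K v : ℂ) * Complex.exp (-(ξ * v) * I) = w ξ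
  supp : ∀ ξ : ℝ, 1 ≤ |ξ| → w ξ = 0
  bdd : ∀ ξ, ‖w ξ‖ ≤ 1

lemma exists_ker : ∃ K w, IsKer K w := by
  obtain ⟨K, w, h1, h2, h3, h4, h5, h6, h7, h8⟩ := kernel
  exact ⟨K, w, h1, h2, h3, h4, h5, h6, h7, h8⟩

lemma IsKer.int {K w} (h : IsKer K w) : Integrable K := by simpa using h.mom 0

lemma isOpen_half : IsOpen {z : ℂ | 1/2 < z.re} := isOpen_lt continuous_const Complex.continuous_re

lemma smooth_aux {K : ℝ → ℝ} {w : ℝ → ℂ} (hK : IsKer K w) {g : ℂ → ℂ}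
    (hg : DifferentiableOn ℂ g {z | 1/2 < z.re})
    (hD : ∀ σ0 : ℝ, 1/2 < σ0 → ∃ D : ℝ, 0 ≤ D ∧ ∀ z : ℂ, σ0 ≤ z.re → z.re ≤ 10 →
      ‖deriv g z‖ ≤ D * (1 + |z.im|)) {L : ℝ} (hL : 1 ≤ L) {s : ℂ} (hs : 1/2 < s.re) (hs3 : s.re < 3) :
    Integrable (fun v : ℝ => (K v : ℂ) * g (s + (v / L : ℝ) * I)) ∧
    DifferentiableAt ℂ (fun s => ∫ v : ℝ, (K v : ℂ) * g (s + (v / L : ℝ) * I)) s := by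
  have hU : ∀ (z : ℂ) (v : ℝ), 1/2 < z.re → z + (v / L : ℝ) * I ∈ {z : ℂ | 1/2 < z.re} := by
    intro z v hz; simpa using hz
  have hvL : ∀ v : ℝ, |v / L| ≤ |v| := by
    intro v; rw [abs_div, abs_of_pos (by linarith : (0:ℝ) < L)]
    exact div_le_self (abs_nonneg _) hL
  have hcont : ∀ z : ℂ, 1/2 < z.re → Continuous (fun v : ℝ => (K v : ℂ) * g (z + (v / L : ℝ) * I)) := by
    intro z hz
    have h1 := hK.cont
    refine Continuous.mul (by fun_prop) ?_
    exact hg.continuousOn.comp_continuous (by fun_prop) (fun v => hU z v hz)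
  have hcont' : Continuous (fun v : ℝ => (K v : ℂ) * deriv g (s + (v / L : ℝ) * I)) := by
    have h1 := hK.cont
    refine Continuous.mul (by fun_prop) ?_
    exact (hg.deriv isOpen_half).continuousOn.comp_continuous (by fun_prop) (fun v => hU s v hs)
  obtain ⟨D, hD0, hD⟩ := hD ((s.re + 1/2) / 2) (by linarith)
  have hintegr : Integrable (fun v : ℝ => (K v : ℂ) * g (s + (v / L : ℝ) * I)) := by
    have b : ∀ v : ℝ, ‖g (s + (v / L : ℝ) * I)‖ ≤ ‖g s‖ + D * (1 + |s.im| + |v|) * |v| := by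
      intro v
      have := (convex_Icc (-|v/L|) (|v/L|)).norm_image_sub_le_of_norm_hasDerivWithin_le
        (f := fun x : ℝ => g (s + x * I)) (f' := fun x : ℝ => deriv g (s + x * I) * I)
        (C := D * (1 + |s.im| + |v|)) (x := 0) (y := v / L)
        (fun x _ => ?_) (fun x hx => ?_) ⟨by simp, by simp⟩ ⟨neg_abs_le _, le_abs_self _⟩
      · simp only [ofReal_zero, zero_mul, add_zero, sub_zero, Real.norm_eq_abs] at this
        have h2 := norm_le_norm_add_norm_sub' (g (s + (v / L : ℝ) * I)) (g s)
        refine h2.trans ?_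
        gcongr
        refine this.trans ?_
        exact mul_le_mul_of_nonneg_left (hvL v) (by positivity)
      · have hl : HasDerivAt (fun x : ℝ => s + x * I) I x := by
          simpa using ((Complex.ofRealCLM.hasDerivAt (x := x)).mul_const I).const_add s
        have hx : s + x * I ∈ {z : ℂ | 1/2 < z.re} := by simpa using hs
        exact (((hg.differentiableAt (isOpen_half.mem_nhds hx)).hasDerivAt).comp_of_eq x hl rfl).hasDerivWithinAt
      · rw [norm_mul, Complex.norm_I, mul_one]
        refine (hD _ (by simp; linarith) (by simp; linarith)).trans ?_
        refine mul_le_mul_of_nonneg_left ?_ hD0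
        simp only [add_im, mul_im, ofReal_re, I_im, mul_one, ofReal_im, I_re, mul_zero, add_zero]
        rw [add_assoc]
        gcongr
        refine (abs_add_le _ _).trans ?_
        exact add_le_add le_rfl ((abs_le.2 hx).trans (hvL v))
    have m0 := (hK.mom 0).mul_const ‖g s‖
    have m1 := (hK.mom 1).mul_const (D * (1 + |s.im|))
    have m2 := (hK.mom 2).mul_const D
    refine ((m0.add m1).add m2).mono' (hcont s hs).aestronglyMeasurable (Filter.Eventually.of_forall fun v => ?_)
    rw [norm_mul, Complex.norm_real, Real.norm_of_nonneg (hK.nonneg v)]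
    refine (mul_le_mul_of_nonneg_left (b v) (hK.nonneg v)).trans (le_of_eq ?_)
    simp only [Pi.add_apply]; ring
  refine ⟨hintegr, ?_⟩
  set ε := min ((s.re - 1/2) / 2) 1 with hε
  have hε0 : 0 < ε := lt_min (by linarith) one_pos
  have hε1 : ε ≤ 1 := min_le_right _ _
  have hε2 : ε ≤ (s.re - 1/2) / 2 := min_le_left _ _
  have hball : ∀ z ∈ ball s ε, (s.re + 1/2) / 2 ≤ z.re ∧ z.re ≤ 10 ∧ |z.im| ≤ |s.im| + 1 := by
    intro z hz
    have h0 : ‖z - s‖ < ε := by simpa [dist_eq_norm] using hz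
    have h1 := abs_lt.1 ((Complex.abs_re_le_norm (z - s)).trans_lt h0)
    have h2 := ((Complex.abs_im_le_norm (z - s)).trans_lt h0)
    rw [sub_re] at h1
    rw [sub_im] at h2
    have := abs_sub_abs_le_abs_sub z.im s.im
    refine ⟨by linarith, by linarith, by linarith⟩
  have := (hasDerivAt_integral_of_dominated_loc_of_deriv_le (μ := volume) (s := ball s ε)
    (F := fun z (v : ℝ) => (K v : ℂ) * g (z + (v / L : ℝ) * I))
    (F' := fun z (v : ℝ) => (K v : ℂ) * deriv g (z + (v / L : ℝ) * I)) (x₀ := s)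
    (bound := fun v => |v| ^ 0 * K v * (D * (1 + |s.im| + 1)) + |v| ^ 1 * K v * D)
    (ball_mem_nhds s hε0) ?_ hintegr hcont'.aestronglyMeasurable ?_ ?_ ?_).2
  · exact this.differentiableAt
  · filter_upwards [isOpen_half.mem_nhds hs] with z hz
    exact (hcont z hz).aestronglyMeasurable
  · refine Filter.Eventually.of_forall fun v z hz => ?_
    obtain ⟨h1, h2, h3⟩ := hball z hz
    rw [norm_mul, Complex.norm_real, Real.norm_of_nonneg (hK.nonneg v)]
    have : ‖deriv g (z + (v / L : ℝ) * I)‖ ≤ D * (1 + |s.im| + 1 + |v|) := by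
      refine (hD _ (by simp; linarith) (by simp; linarith)).trans ?_
      refine mul_le_mul_of_nonneg_left ?_ hD0
      simp only [add_im, mul_im, ofReal_re, I_im, mul_one, ofReal_im, I_re, mul_zero, add_zero]
      have := abs_add_le z.im (v/L)
      have := hvL v
      linarith
    refine (mul_le_mul_of_nonneg_left this (hK.nonneg v)).trans (le_of_eq ?_)
    ring
  · exact ((hK.mom 0).mul_const _).add ((hK.mom 1).mul_const _)
  · refine Filter.Eventually.of_forall fun v z hz => ?_
    have hz2 : 1/2 < z.re := by linarith [(hball z hz).1]
    have := ((hg.differentiableAt (isOpen_half.mem_nhds (hU z v hz2))).hasDerivAt).comp_of_eq z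
      ((hasDerivAt_id z).add_const ((v / L : ℝ) * I)) rfl
    simpa using this.const_mul (K v : ℂ)

/-- finite (smoothed) Dirichlet polynomial equals the smoothed logarithm (up to an imaginary constant) -/
lemma smooth_eq {K : ℝ → ℝ} {w : ℝ → ℂ} (hK : IsKer K w) {g : ℂ → ℂ}
    (hg : DifferentiableOn ℂ g {z | 1/2 < z.re})
    (hD : ∀ σ0 : ℝ, 1/2 < σ0 → ∃ D : ℝ, 0 ≤ D ∧ ∀ z : ℂ, σ0 ≤ z.re → z.re ≤ 10 →
      ‖deriv g z‖ ≤ D * (1 + |z.im|)) {x : ℝ} (hx : 1 ≤ Real.log x) (hx0 : 0 < x) {a : ℕ → ℂ} (ha : ∀ n, ‖a n‖ ≤ 1)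
    (ha0 : a 0 = 0)
    (hga : ∀ s : ℂ, 1 < s.re → (g s).re = (LSeries a s).re) {s : ℂ} (hs : 1/2 < s.re) (hs3 : s.re < 3) :
    (∫ v : ℝ, (K v : ℂ) * g (s + (v / Real.log x : ℝ) * I)).re =
      (∑ n ∈ Icc 1 ⌊x⌋₊, a n * w (Real.log n / Real.log x) * (n:ℂ) ^ (-s)).re := by
  set L := Real.log x with hL
  set G : ℂ → ℂ := fun s => ∫ v : ℝ, (K v : ℂ) * g (s + (v / L : ℝ) * I) with hG
  set P : ℂ → ℂ := fun s => ∑ n ∈ Icc 1 ⌊x⌋₊, a n * w (Real.log n / L) * (n:ℂ) ^ (-s) with hP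
  set U : Set ℂ := {z | 1/2 < z.re} ∩ {z | z.re < 3} with hU
  have hUo : IsOpen U := isOpen_half.inter (isOpen_lt Complex.continuous_re continuous_const)
  have hUc : Convex ℝ U := (convex_halfSpace_re_gt _).inter (convex_halfSpace_re_lt _)
  have hPd : Differentiable ℂ P := by
    intro z
    refine DifferentiableAt.fun_sum fun n hn => ?_
    have hn1 : (n:ℂ) ≠ 0 := by
      have := (Finset.mem_Icc.1 hn).1
      exact_mod_cast (by omega : n ≠ 0)
    refine DifferentiableAt.const_mul (DifferentiableAt.const_cpow (by fun_prop) (.inl hn1)) _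
  have hd : DifferentiableOn ℂ (fun z => G z - P z) U := by
    intro z hz
    exact ((smooth_aux hK hg hD hx hz.1 hz.2).2.sub (hPd z)).differentiableWithinAt
  have hre : ∀ z ∈ U, 1 < z.re → (G z - P z).re = 0 := by
    intro z hz h1
    have hGi := (smooth_aux hK hg hD hx hz.1 hz.2).1
    -- real part of G
    have e1 : (G z).re = (∫ v : ℝ, (K v : ℂ) * LSeries a (z + (v / L : ℝ) * I)).re := by
      have hnorm : ∀ (v : ℝ) (n : ℕ), ‖LSeries.term a (z + (v / L : ℝ) * I) n‖ ≤ (n:ℝ) ^ (-z.re) := by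
        intro v n
        rcases eq_or_ne n 0 with rfl | hn
        · simp; positivity
        · rw [LSeries.term_of_ne_zero hn, norm_div, Complex.norm_natCast_cpow_of_pos (Nat.pos_of_ne_zero hn),
            Real.rpow_neg (by positivity), ← one_div]
          simp only [add_re, mul_re, ofReal_re, I_re, mul_zero, ofReal_im, I_im, mul_one, sub_self, add_zero]
          gcongr
          exact ha n
      have hc : Continuous (fun v : ℝ => LSeries a (z + (v / L : ℝ) * I)) := by
        unfold LSeries
        refine continuous_tsum (fun n => ?_) (summable_nat_rpow h1) (fun n v => hnorm v n)
        rcases eq_or_ne n 0 with rfl | hn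
        · simp; exact continuous_const
        · simp_rw [LSeries.term_of_ne_zero hn]
          have hn1 : (n:ℂ) ≠ 0 := by exact_mod_cast hn
          refine Continuous.div continuous_const ?_ (fun v => by simp [hn1])
          exact Continuous.const_cpow (by fun_prop) (.inl hn1)
      have hi2 : Integrable (fun v : ℝ => (K v : ℂ) * LSeries a (z + (v / L : ℝ) * I)) := by
        refine (hK.int.mul_const (∑' n : ℕ, (n:ℝ) ^ (-z.re))).mono' ?_ (Filter.Eventually.of_forall fun v => ?_)
        · have := hK.cont
          exact (Continuous.mul (by fun_prop) hc).aestronglyMeasurable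
        · rw [norm_mul, Complex.norm_real, Real.norm_of_nonneg (hK.nonneg v)]
          refine mul_le_mul_of_nonneg_left ?_ (hK.nonneg v)
          exact tsum_of_norm_bounded (summable_nat_rpow h1).hasSum (hnorm v)
      rw [hG]
      have t1 := integral_re (𝕜 := ℂ) hGi
      have t2 := integral_re (𝕜 := ℂ) hi2
      simp only [RCLike.re_eq_complex_re] at t1 t2
      rw [← t1, ← t2]
      congr 1; ext v
      rw [re_ofReal_mul, re_ofReal_mul, hga _ (by simpa using h1)]
    have e2 : (∫ v : ℝ, (K v : ℂ) * LSeries a (z + (v / L : ℝ) * I)) =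
        ∑' n : ℕ, a n * w (Real.log n / L) * (n:ℂ) ^ (-z) := by
      have hterm : ∀ (v : ℝ) (n : ℕ), LSeries.term a (z + (v / L : ℝ) * I) n =
          a n * (n:ℂ) ^ (-z) * Complex.exp (-((Real.log n / L : ℝ) * v) * I) := by
        intro v n
        rcases eq_or_ne n 0 with rfl | hn
        · simp [ha0]
        · have hn1 : (n:ℂ) ≠ 0 := by exact_mod_cast hn
          rw [LSeries.term_of_ne_zero hn, div_eq_mul_inv, ← Complex.cpow_neg, mul_assoc]
          congr 1
          rw [neg_add, Complex.cpow_add _ _ hn1]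
          congr 1
          rw [Complex.cpow_def_of_ne_zero hn1, ← Complex.natCast_log]
          congr 1
          push_cast; ring
      have hs2 := hasSum_integral_of_summable_integral_norm (μ := volume)
        (F := fun (n : ℕ) (v : ℝ) => (K v : ℂ) * LSeries.term a (z + (v / L : ℝ) * I) n) ?_ ?_
      · rw [show (fun v : ℝ => (K v : ℂ) * LSeries a (z + (v / L : ℝ) * I)) =
          fun v : ℝ => ∑' n : ℕ, (K v : ℂ) * LSeries.term a (z + (v / L : ℝ) * I) n by
            ext v; rw [tsum_mul_left]; rfl]
        rw [← hs2.tsum_eq]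
        congr 1; ext n
        simp_rw [hterm]
        rw [← hK.ft, ← integral_const_mul, ← integral_mul_const]
        congr 1; ext v; ring
      · intro n
        simp_rw [hterm]
        have h1 : Integrable (fun v : ℝ => (K v : ℂ) * Complex.exp (-((Real.log n / L : ℝ) * v) * I)) := by
          refine hK.int.mono' ?_ (Filter.Eventually.of_forall fun v => ?_)
          · have := hK.cont
            exact (by fun_prop : Continuous _).aestronglyMeasurable
          · have : (-((Real.log n / L : ℝ) * v) * I : ℂ) = ((-(Real.log n / L * v) : ℝ) : ℂ) * I := by
              push_cast; ring
            rw [norm_mul, this, Complex.norm_exp_ofReal_mul_I, mul_one, Complex.norm_real,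
              Real.norm_of_nonneg (hK.nonneg v)]
        refine (h1.const_mul (a n * (n:ℂ) ^ (-z))).congr (Filter.Eventually.of_forall fun v => ?_)
        simp only; ring
      · refine Summable.of_nonneg_of_le (fun n => integral_nonneg fun v => norm_nonneg _) (fun n => ?_)
          (summable_nat_rpow h1)
        have : ∀ v : ℝ, ‖(K v : ℂ) * LSeries.term a (z + (v / L : ℝ) * I) n‖ = K v * ‖a n * (n:ℂ) ^ (-z)‖ := by
          intro v
          have e : (-((Real.log n / L : ℝ) * v) * I : ℂ) = ((-(Real.log n / L * v) : ℝ) : ℂ) * I := by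
            push_cast; ring
          rw [hterm, norm_mul, norm_mul, e, Complex.norm_exp_ofReal_mul_I, mul_one, Complex.norm_real,
              Real.norm_of_nonneg (hK.nonneg v)]
        simp_rw [this]
        rw [integral_mul_const, hK.tot, one_mul]
        rcases eq_or_ne n 0 with rfl | hn
        · simp [ha0]; positivity
        · rw [norm_mul, Complex.norm_natCast_cpow_of_pos (Nat.pos_of_ne_zero hn), neg_re]
          exact mul_le_of_le_one_left (by positivity) (ha n)
    have e3 : ∑' n : ℕ, a n * w (Real.log n / L) * (n:ℂ) ^ (-z) = P z := by
      rw [hP]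
      refine tsum_eq_sum fun n hn => ?_
      rcases eq_or_ne n 0 with rfl | hn0
      · simp [ha0]
      · have : x < n := by
          rw [Finset.mem_Icc, not_and] at hn
          have := hn (Nat.one_le_iff_ne_zero.2 hn0)
          exact Nat.lt_of_floor_lt (not_le.1 this)
        rw [hK.supp, mul_zero, zero_mul]
        rw [le_abs]; left
        rw [le_div_iff₀ (by linarith), one_mul]
        exact Real.log_le_log hx0 this.le
    rw [sub_re, e1, e2, e3, sub_self]
  have key : ∀ z ∈ U, (G z - P z).re = 0 := by
    rcases (hd.analyticOnNhd hUo).is_constant_or_isOpen hUc.isPreconnected with ⟨c, hc⟩ | hop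
    · have h2 : (2:ℂ) ∈ U := by simp [hU]; norm_num
      intro z hz
      rw [hc z hz, ← hc 2 h2]
      exact hre 2 h2 (by simp)
    · exfalso
      set V : Set ℂ := U ∩ {z | 1 < z.re}
      have hV := hop V Set.inter_subset_left (hUo.inter (isOpen_lt continuous_const Complex.continuous_re))
      have h2 : (2:ℂ) ∈ V := ⟨by simp [hU]; norm_num, by simp⟩
      rw [Metric.isOpen_iff] at hV
      obtain ⟨ε, hε, hb⟩ := hV (G 2 - P 2) ⟨2, h2, rfl⟩
      have : (G 2 - P 2) + ((ε / 2 : ℝ) : ℂ) ∈ ball (G 2 - P 2) ε := by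
        rw [mem_ball, dist_eq_norm, add_sub_cancel_left, Complex.norm_real, Real.norm_of_nonneg (by positivity)]
        linarith
      obtain ⟨z, hz, hz2⟩ := hb this
      have r1 := hre z hz.1 hz.2
      have r2 := hre 2 h2.1 h2.2
      simp only at hz2
      rw [hz2, add_re, r2, ofReal_re] at r1
      linarith
  have := key s ⟨hs, hs3⟩
  rw [sub_re] at this
  linarith

end HP

open Complex Real Finset

namespace HP
set_option linter.unusedSectionVars false
open Metric MeasureTheory

lemma LL_shift (q : ℕ) [NeZero q] (t t' u : ℝ) (hu : 0 ≤ u) (h : |t' - t| ≤ u) : LL q t' ≤ LL q t + u / 3 := by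
  unfold LL
  have hq : (0:ℝ) < q := by exact_mod_cast NeZero.pos q
  have h1 : |t'| ≤ |t| + u := by
    have := abs_sub_abs_le_abs_sub t' t
    linarith
  have h2 : Real.log (q * (|t'| + 3)) ≤ Real.log (q * (|t| + 3) * (1 + u / 3)) := by
    apply Real.log_le_log (by positivity)
    rw [mul_assoc]
    gcongr
    nlinarith [abs_nonneg t]
  refine h2.trans ?_
  rw [Real.log_mul (by positivity) (by positivity)]
  have := Real.log_le_sub_one_of_pos (by positivity : 0 < 1 + u / 3)
  linarith

lemma LL_le_lin (q : ℕ) [NeZero q] (t : ℝ) : LL q t ≤ q * 3 * (1 + |t|) := by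
  unfold LL
  have hq : (0:ℝ) < q := by exact_mod_cast NeZero.pos q
  refine (Real.log_le_sub_one_of_pos (by positivity)).trans ?_
  nlinarith [abs_nonneg t]

lemma growth {q : ℕ} [NeZero q] {g : ℂ → ℂ} (hg : DifferentiableOn ℂ g {z | 1/2 < z.re}) {A c : ℝ}
    (hA : 1 ≤ A) (hc : 0 < c)
    (h1 : ∀ z : ℂ, 1/2 < z.re → -(A * LL q z.im) ≤ (deriv g z).re)
    (h2 : ∀ z : ℂ, 10 ≤ z.re → ‖deriv g z‖ ≤ c) (σ0 : ℝ) (hσ : 1/2 < σ0) :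
    ∃ D : ℝ, 0 ≤ D ∧ ∀ z : ℂ, σ0 ≤ z.re → z.re ≤ 10 → ‖deriv g z‖ ≤ D * (1 + |z.im|) := by
  refine ⟨c + 2 * (A * (q * 3 * 12) + c) * 10 / (σ0 - 1/2), by
    have : 0 < σ0 - 1/2 := by linarith
    positivity, fun z hz hz' => ?_⟩
  have hd : 0 < σ0 - 1/2 := by linarith
  set c0 : ℂ := 10 + z.im * I with hc0
  set M : ℝ := (A * (q * 3 * 12) + c) * (1 + |z.im|) with hM
  have hzc : ‖z - c0‖ = 10 - z.re := by
    have : z - c0 = ((z.re - 10 : ℝ) : ℂ) := by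
      apply Complex.ext <;> simp [hc0]
    rw [this, Complex.norm_real, Real.norm_eq_abs, abs_of_nonpos (by linarith)]; ring
  have hsub : ball c0 9.5 ⊆ {z : ℂ | 1/2 < z.re} := by
    intro w hw
    have h1 := (abs_lt.1 ((Complex.abs_re_le_norm (w - c0)).trans_lt (by simpa [dist_eq_norm] using hw))).1
    simp [hc0] at h1
    show 1/2 < w.re
    linarith
  have hcn := h2 c0 (by simp [hc0])
  have := BC (f := fun w => - deriv g w) (c := c0) (z := z) (ρ := 9.5) (M := M) (by norm_num) (by positivity)
    ((hg.deriv isOpen_half).mono hsub).neg ?_ (by rw [hzc]; linarith)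
  · rw [hzc] at this
    have h3 : ‖deriv g z‖ ≤ ‖deriv g c0‖ + ‖-deriv g z - -deriv g c0‖ := by
      have : deriv g z = deriv g c0 - (-deriv g z - -deriv g c0) := by ring
      nth_rewrite 1 [this]
      exact norm_sub_le _ _
    have h4 : 2 * M * (10 - z.re) / (9.5 - (10 - z.re)) ≤ 2 * M * 10 / (σ0 - 1/2) := by
      apply div_le_div₀ (by positivity) _ hd (by norm_num; linarith)
      exact mul_le_mul_of_nonneg_left (by linarith) (by positivity)
    calc ‖deriv g z‖ ≤ c + 2 * M * 10 / (σ0 - 1/2) := by linarith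
      _ ≤ c * (1 + |z.im|) + 2 * M * 10 / (σ0 - 1/2) := by nlinarith [abs_nonneg z.im]
      _ = _ := by rw [hM]; ring
  · intro w hw
    have e1 := h1 w (hsub hw)
    have e2 := LL_le_lin q w.im
    have e3 : |w.im| ≤ |z.im| + 9.5 := by
      have h1 := ((Complex.abs_im_le_norm (w - c0)).trans_lt (by simpa [dist_eq_norm] using hw))
      simp [hc0] at h1
      have := abs_sub_abs_le_abs_sub w.im z.im
      linarith
    have e4 := (Complex.abs_re_le_norm (deriv g c0)).trans hcn
    have e5 := (abs_le.1 e4).2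
    simp only [sub_re, neg_re]
    have hq : (0:ℝ) < q := by exact_mod_cast NeZero.pos q
    have e6 : A * LL q w.im ≤ A * (q * 3 * 12 * (1 + |z.im|)) := by
      gcongr
      refine e2.trans ?_
      rw [mul_assoc _ (12:ℝ)]
      gcongr
      linarith [abs_nonneg z.im]
    rw [hM]
    nlinarith [abs_nonneg z.im]

set_option maxHeartbeats 1000000 in
/-- GRH bound for `log |L|` by a short Dirichlet polynomial. -/
lemma logL_bound : ∃ (w : ℝ → ℂ) (B C X0 : ℝ), 1 ≤ B ∧ 0 < C ∧ 3 ≤ X0 ∧ (∀ ξ, ‖w ξ‖ ≤ 1) ∧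
    ∀ (q : ℕ) [NeZero q] (χ : DirichletCharacter ℂ q), χ ≠ 1 → dirichletRH χ →
    ∀ (a t x : ℝ), 0 < a → a ≤ 1/2 → X0 ≤ x →
    Real.log ‖χ.LFunction (1/2 + a + t * I)‖ ≤
      (∑ n ∈ Icc 1 ⌊x⌋₊, (lc n : ℂ) * χ n * w (Real.log n / Real.log x) *
        (n:ℂ) ^ (-((1/2 + a + B / Real.log x : ℝ) + t * I : ℂ))).re + C * LL q t / Real.log x := by
  obtain ⟨K, w, hK⟩ := exists_ker
  obtain ⟨A, hA, hAA⟩ := re_logDeriv_ge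
  obtain ⟨c, hc, hcc⟩ := norm_logDeriv_le
  set c1 := ∫ v, K v * (8 * (3 + 2 * |v|) ^ 3 * v ^ 2) with hc1
  set c2 := ∫ v, K v * (8 * (3 + 2 * |v|) ^ 3 * v ^ 2 * |v|) with hc2
  have hsq : ∀ v : ℝ, v ^ 2 = |v| ^ 2 := fun v => (sq_abs v).symm
  have i1 : Integrable (fun v => K v * (8 * (3 + 2 * |v|) ^ 3 * v ^ 2)) := by
    have := ((((hK.mom 2).const_mul 216).add ((hK.mom 3).const_mul 432)).add ((hK.mom 4).const_mul 288)).add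
      ((hK.mom 5).const_mul 64)
    refine this.congr (Filter.Eventually.of_forall fun v => ?_)
    simp only [Pi.add_apply]; rw [hsq v]; ring
  have i2 : Integrable (fun v => K v * (8 * (3 + 2 * |v|) ^ 3 * v ^ 2 * |v|)) := by
    have := ((((hK.mom 3).const_mul 216).add ((hK.mom 4).const_mul 432)).add ((hK.mom 5).const_mul 288)).add
      ((hK.mom 6).const_mul 64)
    refine this.congr (Filter.Eventually.of_forall fun v => ?_)
    simp only [Pi.add_apply]; rw [hsq v]; ring
  have c10 : 0 ≤ c1 := integral_nonneg fun v => mul_nonneg (hK.nonneg v) (by positivity)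
  have c20 : 0 ≤ c2 := integral_nonneg fun v => mul_nonneg (hK.nonneg v) (by positivity)
  set B := 1 + 4 * c1 with hB
  have hB1 : 1 ≤ B := by linarith
  refine ⟨w, B, A * c2 + 3 * B * A, Real.exp B + 3, hB1, by positivity, by linarith [Real.exp_pos B], hK.bdd,
    fun q _ χ hχ hRH a t x ha ha' hx => ?_⟩
  have hx0 : 0 < x := by linarith [Real.exp_pos B]
  set L := Real.log x with hL
  have hLB : B ≤ L := by
    rw [hL, Real.le_log_iff_exp_le hx0]; linarith
  have hL1 : 1 ≤ L := hB1.trans hLB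
  have hL0 : 0 < L := by linarith
  have hUne : ({z : ℂ | 1/2 < z.re}).Nonempty := ⟨1, by simp; norm_num⟩
  obtain ⟨g, hg, hge, hgd⟩ := exists_log isOpen_half (convex_halfSpace_re_gt _) hUne (f := χ.LFunction)
    (DirichletCharacter.differentiable_LFunction hχ).differentiableOn (fun z hz => LF_ne_zero hχ hRH hz)
  have hgre : ∀ z : ℂ, 1/2 < z.re → (g z).re = Real.log ‖χ.LFunction z‖ := by
    intro z hz
    rw [← hge z hz, Complex.norm_exp, Real.log_exp]
  have hd1 : ∀ z : ℂ, 1/2 < z.re → -(A * LL q z.im) ≤ (deriv g z).re := by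
    intro z hz; rw [hgd z hz]; exact hAA q χ hχ hRH z hz
  have hd2 : ∀ z : ℂ, 10 ≤ z.re → ‖deriv g z‖ ≤ c := by
    intro z hz; rw [hgd z (show 1/2 < z.re by linarith)]; exact hcc q χ z hz
  have hD := growth hg hA hc hd1 hd2
  set b := B / L with hb
  have hb0 : 0 < b := by positivity
  have hb1 : b ≤ 1 := by rw [hb, div_le_one hL0]; exact hLB
  set s0 : ℂ := 1/2 + a + t * I with hs0
  have hs0re : s0.re = 1/2 + a := by simp [hs0]
  have hs0im : s0.im = t := by simp [hs0]
  set s1 : ℂ := s0 + b with hs1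
  have hs1re : s1.re = 1/2 + a + b := by simp [hs1, hs0re]
  have hs1im : s1.im = t := by simp [hs1, hs0im]
  set H0 := A * (LL q t + 2) with hH0
  set h0 := (deriv g s1).re + H0 with hh0
  have hA0 : 0 < A := by linarith
  have hvert : ∀ v : ℝ, 0 < h0 + A * |v| ∧ 2 * (g s1).re ≤ (g (s1 + (v / L : ℝ) * I)).re + (g (s1 + (-v / L : ℝ) * I)).re +
      (8 * (3 + 2 * |v|) ^ 3 * v ^ 2) * (h0 + A * |v|) / (L * B) := by
    intro v
    have := vertical hg (s1 := s1) (b := b) (v := |v| / L) (H := H0 + A * |v|) hb0 (by rw [hs1re]; linarith)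
      (by positivity) (fun z hz hzi => by
        have h1 := hd1 z hz
        have h2 : |v| / L ≤ |v| := div_le_self (abs_nonneg _) hL1
        rw [hs1im] at hzi
        have h3 := LL_shift q t z.im (2 * |v| + 2) (by positivity) (by linarith)
        rw [hH0]
        have : A * LL q z.im ≤ A * (LL q t + (2 * |v| + 2) / 3) := by gcongr
        nlinarith [abs_nonneg v])
    obtain ⟨p1, p2⟩ := this
    have p1' : 0 < h0 + A * |v| := by rw [hh0]; linarith
    refine ⟨p1', ?_⟩
    have e0 : (deriv g s1).re + (H0 + A * |v|) = h0 + A * |v| := by rw [hh0]; ring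
    rw [e0] at p2
    have p3 : (g (s1 + (|v| / L : ℝ) * I) + g (s1 + (-(|v| / L) : ℝ) * I)).re =
        (g (s1 + (v / L : ℝ) * I)).re + (g (s1 + (-v / L : ℝ) * I)).re := by
      rcases abs_choice v with h | h
      · rw [h, add_re, neg_div]
      · rw [h, add_re, neg_div, neg_neg, add_comm]
    have p4 := (Complex.abs_re_le_norm _).trans p2
    have p5 := (abs_le.1 p4).1
    rw [sub_re, p3] at p5
    have e1 : (2 * g s1).re = 2 * (g s1).re := by simp
    rw [e1] at p5
    have e2 : 8 * (3 + 2 * (|v| / L) / b) ^ 3 * (|v| / L) ^ 2 * (h0 + A * |v|) / b ≤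
        (8 * (3 + 2 * |v|) ^ 3 * v ^ 2) * (h0 + A * |v|) / (L * B) := by
      have e3 : 2 * (|v| / L) / b ≤ 2 * |v| := by
        have : 2 * (|v| / L) / b = 2 * |v| / B := by rw [hb]; field_simp
        rw [this]; exact div_le_self (by positivity) hB1
      have e4 : 8 * (3 + 2 * (|v| / L) / b) ^ 3 * (|v| / L) ^ 2 * (h0 + A * |v|) / b =
        (8 * (3 + 2 * (|v| / L) / b) ^ 3 * v ^ 2) * (h0 + A * |v|) / (L * B) := by
        rw [← sq_abs v]
        rw [hb]; field_simp
      rw [e4]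
      gcongr
    linarith
  -- integrate
  have hsm := (smooth_aux hK hg hD hL1 (s := s1) (by rw [hs1re]; linarith) (by rw [hs1re]; linarith)).1
  have hre_int : Integrable (fun v : ℝ => K v * (g (s1 + (v / L : ℝ) * I)).re) := by
    have := hsm.re
    refine this.congr (Filter.Eventually.of_forall fun v => ?_)
    simp
  have hre_eq : ∫ v : ℝ, K v * (g (s1 + (v / L : ℝ) * I)).re =
      (∫ v : ℝ, (K v : ℂ) * g (s1 + (v / L : ℝ) * I)).re := by
    have t1 := integral_re (𝕜 := ℂ) hsm
    simp only [RCLike.re_eq_complex_re] at t1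
    rw [← t1]
    congr 1; ext v; rw [re_ofReal_mul]
  have hneg_int : Integrable (fun v : ℝ => K v * (g (s1 + (-v / L : ℝ) * I)).re) := by
    have := hre_int.comp_neg
    refine this.congr (Filter.Eventually.of_forall fun v => ?_)
    simp only [hK.even]
  have hneg_eq : ∫ v : ℝ, K v * (g (s1 + (-v / L : ℝ) * I)).re = ∫ v : ℝ, K v * (g (s1 + (v / L : ℝ) * I)).re := by
    rw [← integral_neg_eq_self (fun v : ℝ => K v * (g (s1 + (v / L : ℝ) * I)).re)]
    simp only [hK.even]
  have hmono := integral_mono (μ := volume) (f := fun v => K v * (2 * (g s1).re))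
    (g := fun v : ℝ => (K v * (g (s1 + (v / L : ℝ) * I)).re + K v * (g (s1 + (-v / L : ℝ) * I)).re) +
      ((K v * (8 * (3 + 2 * |v|) ^ 3 * v ^ 2)) * (h0 / (L * B)) +
       (K v * (8 * (3 + 2 * |v|) ^ 3 * v ^ 2 * |v|)) * (A / (L * B)))) (hK.int.mul_const _)
    ((hre_int.add hneg_int).add ((i1.mul_const _).add (i2.mul_const _))) (fun v => by
      refine (mul_le_mul_of_nonneg_left (hvert v).2 (hK.nonneg v)).trans (le_of_eq ?_)
      ring)
  have j1 : Integrable (fun v : ℝ => K v * (g (s1 + (v / L : ℝ) * I)).re + K v * (g (s1 + (-v / L : ℝ) * I)).re) :=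
    hre_int.add hneg_int
  have j2 : Integrable (fun v : ℝ => (K v * (8 * (3 + 2 * |v|) ^ 3 * v ^ 2)) * (h0 / (L * B)) +
       (K v * (8 * (3 + 2 * |v|) ^ 3 * v ^ 2 * |v|)) * (A / (L * B))) := (i1.mul_const _).add (i2.mul_const _)
  rw [integral_mul_const, hK.tot, one_mul, integral_add j1 j2,
    integral_add hre_int hneg_int, integral_add (i1.mul_const _) (i2.mul_const _), integral_mul_const,
    integral_mul_const, hneg_eq, ← hc1, ← hc2, hre_eq] at hmono
  have hhor := horizontal hg (s0 := s0) (b := b) (H := H0) hb0 (by rw [hs0re]; linarith) (fun z hz hzi => by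
        have h1 := hd1 z hz
        rw [hs0im] at hzi
        have h3 := LL_shift q t z.im 2 (by positivity) (by linarith)
        rw [hH0]
        have : A * LL q z.im ≤ A * (LL q t + 2 / 3) := by gcongr
        nlinarith)
  rw [← hs1, ← hh0] at hhor
  have hh0pos : 0 < h0 := by simpa using (hvert 0).1
  have hse := smooth_eq hK hg hD (x := x) hL1 hx0 (a := fun n => (lc n : ℂ) * χ n) (fun n => ?_) ?_ ?_
    (s := s1) (by rw [hs1re]; linarith) (by rw [hs1re]; linarith)
  · rw [← hL] at hse
    rw [hse] at hmono
    rw [← hgre s0 (by rw [hs0re]; linarith)]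
    have es : ((1/2 + a + b : ℝ) + t * I : ℂ) = s1 := by
      rw [hs1, hs0]; push_cast; ring
    rw [es]
    have f1 : c1 * (h0 / (L * B)) ≤ 2 * (b / 8 * h0) := by
      have : c1 * (h0 / (L * B)) = (c1 / B) * (h0 / L) := by field_simp
      rw [this]
      have : 2 * (b / 8 * h0) = (B / 4) * (h0 / L) := by rw [hb]; field_simp; norm_num
      rw [this]
      refine mul_le_mul_of_nonneg_right ?_ (by positivity)
      rw [div_le_iff₀ (by linarith)]
      clear_value c1 B
      clear * - hB c10
      subst hB
      nlinarith
    have hLL := one_le_LL q t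
    have f2 : c2 * (A / (L * B)) ≤ 2 * (A * c2 * LL q t / L) := by
      have : c2 * (A / (L * B)) = (A * c2 / L) * (1 / B) := by field_simp
      rw [this]
      have : 2 * (A * c2 * LL q t / L) = (A * c2 / L) * (2 * LL q t) := by ring
      rw [this]
      refine mul_le_mul_of_nonneg_left ?_ (by positivity)
      have : 1 / B ≤ 1 := by rw [div_le_one (by linarith)]; exact hB1
      linarith
    have f3 : b * H0 ≤ 3 * B * A * LL q t / L := by
      rw [hb, hH0, div_mul_eq_mul_div]
      refine div_le_div_of_nonneg_right ?_ hL0.le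
      have : 0 < B * A := by positivity
      clear_value B
      clear * - this hLL
      nlinarith
    have f4 : (A * c2 + 3 * B * A) * LL q t / L = A * c2 * LL q t / L + 3 * B * A * LL q t / L := by ring
    rw [f4]
    linarith
  · rw [norm_mul, Complex.norm_real, Real.norm_of_nonneg (lc_nonneg n)]
    exact mul_le_one₀ (lc_le_one n) (norm_nonneg _) (DirichletCharacter.norm_le_one χ n)
  · simp [lc]
  · intro s hs
    rw [hgre s (by linarith), DirichletCharacter.LFunction_eq_LSeries χ hs,
      ← DirichletCharacter.LSeries_eq_exp_LSeries χ hs, Complex.norm_exp, Real.log_exp]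
    congr 2; ext n
    simp only [lc]; push_cast; ring

end HP

open Complex Real Finset
namespace HP
set_option linter.unusedSectionVars false

/-! ### Random model -/

abbrev Om (q : ℕ) := Fin (q+1) → Fin 5

noncomputable def EE {q : ℕ} (Y : Om q → ℂ) : ℂ := (∑ ω, Y ω) / 5^(q+1)

noncomputable def chr {q : ℕ} (η : Fin (q+1) → ℂ) (ω : Om q) : ℂ := ∏ i, η i ^ (ω i).val

lemma EE_prod {q : ℕ} (g : Fin (q+1) → Fin 5 → ℂ) :
    EE (fun ω : Om q => ∏ i, g i (ω i)) = ∏ i, ((∑ z, g i z) / 5) := by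
  unfold EE
  rw [Finset.prod_div_distrib, Finset.prod_univ_sum]
  simp

lemma EE_add {q : ℕ} (Y Z : Om q → ℂ) : EE (Y + Z) = EE Y + EE Z := by
  simp [EE, Finset.sum_add_distrib, add_div]

lemma EE_const_mul {q : ℕ} (b : ℂ) (Y : Om q → ℂ) : EE (fun ω => b * Y ω) = b * EE Y := by
  simp [EE, ← Finset.mul_sum, mul_div_assoc]

lemma geom5 (η : ℂ) (h : η ^ 5 = 1) : ∑ z : Fin 5, η ^ z.val = 0 ∨ ∑ z : Fin 5, η ^ z.val = 5 := by
  by_cases h1 : η = 1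
  · right; simp [h1]
  · left
    have h0 : (η - 1) * ∑ z : Fin 5, η ^ z.val = 0 := by
      have : ∑ z : Fin 5, η ^ z.val = 1 + η + η^2 + η^3 + η^4 := by
        simp [Fin.sum_univ_succ]; ring
      rw [this]
      linear_combination h
    rcases mul_eq_zero.mp h0 with h2 | h2
    · exact absurd (sub_eq_zero.mp h2) h1
    · exact h2

lemma EE_chr {q : ℕ} (η : Fin (q+1) → ℂ) (h : ∀ i, η i ^ 5 = 1) :
    ∃ r : ℝ, 0 ≤ r ∧ EE (chr η) = r := by
  have h1 : EE (chr η) = ∏ i, ((∑ z : Fin 5, η i ^ z.val) / 5) := EE_prod (fun i z => η i ^ z.val)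
  have h2 : ∀ i, ∃ r : ℝ, 0 ≤ r ∧ (∑ z : Fin 5, η i ^ z.val) / 5 = r := by
    intro i
    rcases geom5 (η i) (h i) with h | h
    · exact ⟨0, le_refl _, by rw [h]; simp⟩
    · exact ⟨1, zero_le_one, by rw [h]; simp⟩
  choose r hr hr' using h2
  refine ⟨∏ i, r i, Finset.prod_nonneg fun i _ => hr i, ?_⟩
  rw [h1]; push_cast
  exact Finset.prod_congr rfl fun i _ => hr' i

lemma chr_mul {q : ℕ} (η η' : Fin (q+1) → ℂ) (ω : Om q) :
    chr (fun i => η i * η' i) ω = chr η ω * chr η' ω := by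
  simp [chr, mul_pow, Finset.prod_mul_distrib]

def gens (q : ℕ) : Submonoid (Om q → ℂ) where
  carrier := {Y | ∃ b : ℝ, 0 ≤ b ∧ ∃ η : Fin (q+1) → ℂ, (∀ i, η i ^ 5 = 1) ∧ Y = fun ω => b * chr η ω}
  one_mem' := ⟨1, zero_le_one, fun _ => 1, by simp, by funext ω; simp [chr]⟩
  mul_mem' := by
    rintro _ _ ⟨b, hb, η, hη, rfl⟩ ⟨b', hb', η', hη', rfl⟩
    refine ⟨b * b', mul_nonneg hb hb', fun i => η i * η' i, fun i => by rw [mul_pow, hη, hη', one_mul], ?_⟩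
    funext ω
    simp only [Pi.mul_apply, chr_mul]; push_cast; ring

noncomputable def cone (q : ℕ) : Subsemiring (Om q → ℂ) :=
  (gens q).subsemiringClosure.topologicalClosure

lemma cone_closed (q : ℕ) : IsClosed (cone q : Set (Om q → ℂ)) :=
  Subsemiring.isClosed_topologicalClosure _

lemma gens_sub_cone {q : ℕ} {Y : Om q → ℂ} (h : Y ∈ gens q) : Y ∈ cone q :=
  Subsemiring.le_topologicalClosure _ (AddSubmonoid.subset_closure h)

lemma cone_induction {q : ℕ} (P : (Om q → ℂ) → Prop) (hc : IsClosed {Y | P Y})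
    (h0 : P 0) (ha : ∀ Y Z, P Y → P Z → P (Y + Z))
    (hg : ∀ b : ℝ, 0 ≤ b → ∀ η : Fin (q+1) → ℂ, (∀ i, η i ^ 5 = 1) → P (fun ω => b * chr η ω))
    {Y : Om q → ℂ} (hY : Y ∈ cone q) : P Y := by
  have h1 : ((gens q).subsemiringClosure : Set (Om q → ℂ)) ⊆ {Y | P Y} := by
    intro Z hZ
    have hZ' : Z ∈ AddSubmonoid.closure (gens q : Set (Om q → ℂ)) := hZ
    refine AddSubmonoid.closure_induction (motive := fun Z _ => P Z) ?_ h0 ?_ hZ'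
    · rintro _ ⟨b, hb, η, hη, rfl⟩
      exact hg b hb η hη
    · intro x y _ _ hx hy; exact ha x y hx hy
  exact closure_minimal h1 hc hY

lemma continuous_EE {q : ℕ} : Continuous (EE : (Om q → ℂ) → ℂ) := by
  unfold EE; fun_prop

lemma cone_EE {q : ℕ} {Y : Om q → ℂ} (hY : Y ∈ cone q) : 0 ≤ (EE Y).re := by
  refine cone_induction (fun Y => 0 ≤ (EE Y).re) ?_ ?_ ?_ ?_ hY
  · exact isClosed_le continuous_const (Complex.continuous_re.comp continuous_EE)
  · simp [EE]
  · intro Y Z h1 h2; rw [EE_add]; simp; linarith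
  · intro b hb η hη
    rw [EE_const_mul]
    obtain ⟨r, hr, h⟩ := EE_chr η hη
    rw [h, ← Complex.ofReal_mul, Complex.ofReal_re]; positivity

lemma cone_conj {q : ℕ} {Y : Om q → ℂ} (hY : Y ∈ cone q) :
    (fun ω => (starRingEnd ℂ) (Y ω)) ∈ cone q := by
  refine cone_induction (fun Y => (fun ω => (starRingEnd ℂ) (Y ω)) ∈ cone q) ?_ ?_ ?_ ?_ hY
  · exact (cone_closed q).preimage (by fun_prop : Continuous fun Y : Om q → ℂ => fun ω => (starRingEnd ℂ) (Y ω))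
  · have h := (cone q).zero_mem
    have h2 : (fun ω : Om q => (starRingEnd ℂ) ((0 : Om q → ℂ) ω)) = 0 := by funext ω; simp
    rw [h2]; exact h
  · intro Y Z h1 h2
    have := (cone q).add_mem h1 h2
    convert this using 1
    funext ω; simp
  · intro b hb η hη
    apply gens_sub_cone
    refine ⟨b, hb, fun i => (starRingEnd ℂ) (η i), fun i => by rw [← map_pow, hη, map_one], ?_⟩
    funext ω; simp [chr]

lemma cone_const {q : ℕ} {b : ℝ} (hb : 0 ≤ b) : (fun _ => (b:ℂ)) ∈ cone q :=
  gens_sub_cone ⟨b, hb, fun _ => 1, by simp, by funext ω; simp [chr]⟩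

/-- Order -/
def Led {q : ℕ} (Y Z : Om q → ℂ) : Prop := Y ∈ cone q ∧ Z - Y ∈ cone q

lemma Led.right {q : ℕ} {Y Z : Om q → ℂ} (h : Led Y Z) : Z ∈ cone q := by
  have := (cone q).add_mem h.1 h.2
  simpa using this

lemma Led.refl {q : ℕ} {Y : Om q → ℂ} (h : Y ∈ cone q) : Led Y Y := ⟨h, by simp⟩

lemma Led.mul {q : ℕ} {Y Z Y' Z' : Om q → ℂ} (h : Led Y Z) (h' : Led Y' Z') : Led (Y * Y') (Z * Z') := by
  refine ⟨(cone q).mul_mem h.1 h'.1, ?_⟩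
  have := (cone q).add_mem ((cone q).mul_mem h.2 h'.right) ((cone q).mul_mem h.1 h'.2)
  convert this using 1; ring

lemma Led.prod {q : ℕ} {ι : Type*} (J : Finset ι) {Y Z : ι → Om q → ℂ} (h : ∀ j ∈ J, Led (Y j) (Z j)) :
    Led (∏ j ∈ J, Y j) (∏ j ∈ J, Z j) := by
  classical
  induction J using Finset.induction_on with
  | empty => simpa using Led.refl (cone q).one_mem
  | insert a s ha ih =>
    rw [Finset.prod_insert ha, Finset.prod_insert ha]
    exact (h a (by simp)).mul (ih fun j hj => h j (by simp [hj]))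

lemma Led.EE_sq {q : ℕ} {Y Z : Om q → ℂ} (h : Led Y Z) :
    (EE (fun ω => Y ω * (starRingEnd ℂ) (Y ω))).re ≤ (EE (fun ω => Z ω * (starRingEnd ℂ) (Z ω))).re := by
  have hc : Led (fun ω => (starRingEnd ℂ) (Y ω)) (fun ω => (starRingEnd ℂ) (Z ω)) := by
    refine ⟨cone_conj h.1, ?_⟩
    have := cone_conj h.2
    convert this using 1; funext ω; simp
  have h1 := cone_EE (h.mul hc).2
  have h2 : EE (fun ω => Z ω * (starRingEnd ℂ) (Z ω)) =
    EE (Z * (fun ω => (starRingEnd ℂ) (Z ω)) - Y * (fun ω => (starRingEnd ℂ) (Y ω))) + EE (fun ω => Y ω * (starRingEnd ℂ) (Y ω)) := by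
    rw [← EE_add]; congr 1; funext ω; simp
  rw [h2, Complex.add_re]; linarith

lemma Led_exp {q : ℕ} {Y : Om q → ℂ} (hY : Y ∈ cone q) (s : Finset ℕ) :
    Led (fun ω => ∑ n ∈ s, Y ω ^ n / (n.factorial : ℂ)) (fun ω => Complex.exp (Y ω)) := by
  classical
  have hmem : ∀ t : Finset ℕ, (fun ω => ∑ n ∈ t, Y ω ^ n / (n.factorial : ℂ)) ∈ cone q := by
    intro t
    have : (∑ n ∈ t, (Y ^ n * (fun _ => (((n.factorial : ℝ)⁻¹ : ℝ) : ℂ)))) ∈ cone q :=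
      (cone q).sum_mem fun n _ => (cone q).mul_mem ((cone q).pow_mem hY n) (cone_const (by positivity))
    convert this using 1
    funext ω
    simp [Finset.sum_apply, div_eq_mul_inv]
  refine ⟨hmem s, ?_⟩
  have hlim : Filter.Tendsto (fun t : Finset ℕ => (fun ω => ∑ n ∈ t, Y ω ^ n / (n.factorial : ℂ)) -
      (fun ω => ∑ n ∈ s, Y ω ^ n / (n.factorial : ℂ))) Filter.atTop
      (nhds ((fun ω => Complex.exp (Y ω)) - (fun ω => ∑ n ∈ s, Y ω ^ n / (n.factorial : ℂ)))) := by
    refine Filter.Tendsto.sub_const ?_ _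
    rw [tendsto_pi_nhds]
    intro ω
    have := NormedSpace.expSeries_div_hasSum_exp (𝔸 := ℂ) (Y ω)
    rw [← Complex.exp_eq_exp_ℂ] at this
    exact this
  refine (cone_closed q).mem_of_tendsto hlim ?_
  filter_upwards [Filter.eventually_ge_atTop s] with t ht
  have := hmem (t \ s)
  change _ ∈ cone q
  convert this using 1
  funext ω
  simp only [Pi.sub_apply]
  rw [sub_eq_iff_eq_add, Finset.sum_sdiff ht]

/-! ### Majorants -/

noncomputable def z5 : ℂ := Complex.exp (2 * Real.pi * I / 5)

lemma z5_pow : z5 ^ 5 = 1 := by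
  unfold z5
  rw [← Complex.exp_nat_mul, Complex.exp_eq_one_iff]
  exact ⟨1, by push_cast; ring⟩

noncomputable def fm (q n : ℕ) : Om q → ℂ := chr (fun i => z5 ^ (n.factorization i))

lemma fm_eta (n : ℕ) (i : ℕ) : (z5 ^ (n.factorization i)) ^ 5 = 1 := by
  rw [← pow_mul, mul_comm, pow_mul, z5_pow, one_pow]

lemma fm_mem (q n : ℕ) : fm q n ∈ cone q :=
  gens_sub_cone ⟨1, zero_le_one, _, fun i => fm_eta n i, by funext ω; simp [fm]⟩

lemma fm_mul (q : ℕ) {n m : ℕ} (hn : n ≠ 0) (hm : m ≠ 0) : fm q (n * m) = fm q n * fm q m := by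
  funext ω
  simp only [fm, Pi.mul_apply, ← chr_mul]
  congr 1; funext i
  rw [Nat.factorization_mul hn hm]; simp [pow_add]

lemma fm_prime (q : ℕ) {p : ℕ} (hp : p.Prime) (hpq : p ≤ q) (ω : Om q) :
    fm q p ω = z5 ^ (ω ⟨p, by omega⟩).val := by
  unfold fm chr
  rw [Finset.prod_eq_single (⟨p, by omega⟩ : Fin (q+1))]
  · simp [hp.factorization]
  · intro i _ hi
    have : (i : ℕ) ≠ p := fun h => hi (Fin.ext h)
    simp [hp.factorization, this.symm]
  · simp

lemma norm_z5 : ‖z5‖ = 1 := Complex.norm_eq_one_of_pow_eq_one z5_pow (by norm_num)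

lemma norm_fm (q n : ℕ) (ω : Om q) : ‖fm q n ω‖ = 1 := by
  simp [fm, chr, norm_prod, norm_z5]

def majset (q : ℕ) [NeZero q] (N : ℝ) : Set ((DirichletCharacter ℂ q → ℂ) × (Om q → ℂ)) :=
  {P | ∃ (a : ℂ) (b : ℝ) (n : ℕ), ‖a‖ ≤ b ∧ 1 ≤ n ∧ (n:ℝ) ≤ N ∧
    P = (fun χ => a * χ n, fun ω => b * fm q n ω)}

def Maj (q : ℕ) [NeZero q] (N : ℝ) : AddSubmonoid ((DirichletCharacter ℂ q → ℂ) × (Om q → ℂ)) :=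
  AddSubmonoid.closure (majset q N)

variable {q : ℕ} [NeZero q]

lemma Maj_gen {N : ℝ} {a : ℂ} {b : ℝ} {n : ℕ} (h : ‖a‖ ≤ b) (hn : 1 ≤ n) (hN : (n:ℝ) ≤ N) :
    ((fun χ => a * χ n, fun ω => b * fm q n ω) : (DirichletCharacter ℂ q → ℂ) × (Om q → ℂ)) ∈ Maj q N :=
  AddSubmonoid.subset_closure ⟨a, b, n, h, hn, hN, rfl⟩

lemma Maj_mono {N N' : ℝ} (h : N ≤ N') : Maj q N ≤ Maj q N' := by
  apply AddSubmonoid.closure_mono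
  rintro _ ⟨a, b, n, h1, h2, h3, rfl⟩
  exact ⟨a, b, n, h1, h2, h3.trans h, rfl⟩

lemma Maj_mul {N N' : ℝ} (hN : 0 ≤ N) {P P' : (DirichletCharacter ℂ q → ℂ) × (Om q → ℂ)}
    (h : P ∈ Maj q N) (h' : P' ∈ Maj q N') : P * P' ∈ Maj q (N * N') := by
  have h1 := AddSubmonoid.mul_mem_mul h h'
  unfold Maj at h1
  rw [AddSubmonoid.closure_mul_closure] at h1
  refine AddSubmonoid.closure_mono ?_ h1
  rintro _ ⟨_, ⟨a, b, n, h1, h2, h3, rfl⟩, _, ⟨a', b', n', h1', h2', h3', rfl⟩, rfl⟩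
  refine ⟨a * a', b * b', n * n', ?_, Nat.mul_pos h2 h2', ?_, ?_⟩
  · rw [norm_mul]; exact mul_le_mul h1 h1' (norm_nonneg _) ((norm_nonneg _).trans h1)
  · push_cast; exact mul_le_mul h3 h3' (by positivity) hN
  · simp only [Prod.mk_mul_mk]
    congr 1
    · funext χ; simp; ring
    · funext ω; simp [fm_mul q (n := n) (m := n') (by omega) (by omega)]; ring

lemma Maj_one : (1 : (DirichletCharacter ℂ q → ℂ) × (Om q → ℂ)) ∈ Maj q 1 := by
  have := Maj_gen (q := q) (N := 1) (a := 1) (b := 1) (n := 1) (by simp) le_rfl (by simp)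
  convert this using 1
  ext
  · simp
  · simp [fm, chr]

lemma Maj_const {a : ℂ} {b : ℝ} (h : ‖a‖ ≤ b) :
    ((fun _ => a, fun _ => (b:ℂ)) : (DirichletCharacter ℂ q → ℂ) × (Om q → ℂ)) ∈ Maj q 1 := by
  have := Maj_gen (q := q) (N := 1) (a := a) (b := b) (n := 1) h le_rfl (by simp)
  convert this using 1
  ext
  · simp
  · simp [fm, chr]

lemma Maj_pow {N : ℝ} (hN : 0 ≤ N) {P : (DirichletCharacter ℂ q → ℂ) × (Om q → ℂ)}
    (h : P ∈ Maj q N) (k : ℕ) : P ^ k ∈ Maj q (N ^ k) := by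
  induction k with
  | zero => simpa using Maj_one
  | succ k ih => rw [pow_succ, pow_succ]; exact Maj_mul (by positivity) ih h

lemma Maj_prod {ι : Type*} (J : Finset ι) {N : ι → ℝ} (hN : ∀ j ∈ J, 0 ≤ N j)
    {P : ι → (DirichletCharacter ℂ q → ℂ) × (Om q → ℂ)} (h : ∀ j ∈ J, P j ∈ Maj q (N j)) :
    ∏ j ∈ J, P j ∈ Maj q (∏ j ∈ J, N j) := by
  classical
  induction J using Finset.induction_on with
  | empty => simpa using Maj_one
  | insert a s ha ih =>
    rw [Finset.prod_insert ha, Finset.prod_insert ha]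
    exact Maj_mul (hN a (by simp)) (h a (by simp)) (ih (fun j hj => hN j (by simp [hj])) (fun j hj => h j (by simp [hj])))

lemma sum_char_conj {n m : ℕ} (hn : n < q) (hm : m < q) :
    ‖∑ χ : DirichletCharacter ℂ q, χ n * (starRingEnd ℂ) (χ m)‖ ≤ if n = m then (q.totient : ℝ) else 0 := by
  by_cases hu : IsUnit (m : ZMod q)
  · have h1 : ∑ χ : DirichletCharacter ℂ q, χ n * (starRingEnd ℂ) (χ m) = ∑ χ : DirichletCharacter ℂ q, χ (m : ZMod q)⁻¹ * χ n := by
      refine Finset.sum_congr rfl fun χ _ => ?_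
      rw [mul_comm]
      congr 1
      obtain ⟨u, hu⟩ := hu
      rw [← hu, ZMod.inv_coe_unit]
      have := MulChar.star_apply' χ (u : ZMod q)
      rw [starRingEnd_apply, this, MulChar.inv_apply]
      simp
    rw [h1, DirichletCharacter.sum_char_inv_mul_char_eq ℂ hu]
    have h2 : ((m : ZMod q) = n) ↔ n = m := by
      rw [ZMod.natCast_eq_natCast_iff', Nat.mod_eq_of_lt hn, Nat.mod_eq_of_lt hm]; exact eq_comm
    simp only [h2]
    split_ifs <;> simp
  · have : ∀ χ : DirichletCharacter ℂ q, χ (m : ZMod q) = 0 := fun χ => χ.map_nonunit hu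
    simp [this]
    split_ifs <;> simp

lemma EE_fm_conj (n m : ℕ) : (if n = m then (1:ℝ) else 0) ≤ (EE (fun ω => fm q n ω * (starRingEnd ℂ) (fm q m ω))).re := by
  split_ifs with h
  · subst h
    have : (fun ω => fm q n ω * (starRingEnd ℂ) (fm q n ω)) = fun _ => 1 := by
      funext ω; rw [Complex.mul_conj, Complex.normSq_eq_norm_sq, norm_fm]; simp
    rw [this]; simp [EE]
  · exact cone_EE ((cone q).mul_mem (fm_mem q n) (cone_conj (fm_mem q m)))

lemma MV_bilin {N : ℝ} (hN : N < q) {P P' : (DirichletCharacter ℂ q → ℂ) × (Om q → ℂ)}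
    (h : P ∈ Maj q N) (h' : P' ∈ Maj q N) :
    ‖∑ χ : DirichletCharacter ℂ q, P.1 χ * (starRingEnd ℂ) (P'.1 χ)‖ ≤
      q.totient * (EE (fun ω => P.2 ω * (starRingEnd ℂ) (P'.2 ω))).re := by
  refine AddSubmonoid.closure_induction₂ (motive := fun P P' _ _ => ‖∑ χ : DirichletCharacter ℂ q, P.1 χ * (starRingEnd ℂ) (P'.1 χ)‖ ≤
      q.totient * (EE (fun ω => P.2 ω * (starRingEnd ℂ) (P'.2 ω))).re) ?_ ?_ ?_ ?_ ?_ h h'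
  · rintro _ _ ⟨a, b, n, h1, h2, h3, rfl⟩ ⟨a', b', n', h1', h2', h3', rfl⟩
    have e1 : ∑ χ : DirichletCharacter ℂ q, a * χ n * (starRingEnd ℂ) (a' * χ n') =
      (a * (starRingEnd ℂ) a') * ∑ χ : DirichletCharacter ℂ q, χ n * (starRingEnd ℂ) (χ n') := by
      rw [Finset.mul_sum]; refine Finset.sum_congr rfl fun χ _ => ?_
      rw [map_mul]; ring
    have e2 : (fun ω => (b:ℂ) * fm q n ω * (starRingEnd ℂ) ((b':ℂ) * fm q n' ω)) =
      fun ω => ((b * b' : ℝ) : ℂ) * (fm q n ω * (starRingEnd ℂ) (fm q n' ω)) := by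
      funext ω; rw [map_mul, Complex.conj_ofReal]; push_cast; ring
    simp only
    rw [e1, e2, EE_const_mul (((b * b' : ℝ)) : ℂ) (fun ω => fm q n ω * (starRingEnd ℂ) (fm q n' ω)), Complex.re_ofReal_mul, norm_mul, norm_mul, RCLike.norm_conj]
    have hn : n < q := by exact_mod_cast h3.trans_lt hN
    have hn' : n' < q := by exact_mod_cast h3'.trans_lt hN
    have i1 := sum_char_conj (q := q) hn hn'
    have i2 := EE_fm_conj (q := q) n n'
    have hb : 0 ≤ b := (norm_nonneg _).trans h1
    have hb' : 0 ≤ b' := (norm_nonneg _).trans h1'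
    calc _ ≤ (b * b') * (q.totient * if n = n' then (1:ℝ) else 0) := by
          refine mul_le_mul (mul_le_mul h1 h1' (norm_nonneg _) hb) (i1.trans ?_) (norm_nonneg _) (by positivity)
          split_ifs <;> simp
      _ = q.totient * ((b * b') * if n = n' then (1:ℝ) else 0) := by ring
      _ ≤ _ := by gcongr
  · intro x _; simp [EE]
  · intro x _; simp [EE]
  · intro x y z _ _ _ h1 h2
    have e1 : ∑ χ : DirichletCharacter ℂ q, (x+y).1 χ * (starRingEnd ℂ) (z.1 χ) = ∑ χ : DirichletCharacter ℂ q, x.1 χ * (starRingEnd ℂ) (z.1 χ) + ∑ χ : DirichletCharacter ℂ q, y.1 χ * (starRingEnd ℂ) (z.1 χ) := by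
      rw [← Finset.sum_add_distrib]; refine Finset.sum_congr rfl fun χ _ => ?_
      simp; ring
    have e2 : EE (fun ω => (x+y).2 ω * (starRingEnd ℂ) (z.2 ω)) = EE (fun ω => x.2 ω * (starRingEnd ℂ) (z.2 ω)) + EE (fun ω => y.2 ω * (starRingEnd ℂ) (z.2 ω)) := by
      rw [← EE_add]; congr 1; funext ω; simp; ring
    rw [e1, e2, Complex.add_re, mul_add]
    exact (norm_add_le _ _).trans (add_le_add h1 h2)
  · intro y z x _ _ _ h1 h2
    have e1 : ∑ χ : DirichletCharacter ℂ q, x.1 χ * (starRingEnd ℂ) ((y+z).1 χ) = ∑ χ : DirichletCharacter ℂ q, x.1 χ * (starRingEnd ℂ) (y.1 χ) + ∑ χ : DirichletCharacter ℂ q, x.1 χ * (starRingEnd ℂ) (z.1 χ) := by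
      rw [← Finset.sum_add_distrib]; refine Finset.sum_congr rfl fun χ _ => ?_
      simp; ring
    have e2 : EE (fun ω => x.2 ω * (starRingEnd ℂ) ((y+z).2 ω)) = EE (fun ω => x.2 ω * (starRingEnd ℂ) (y.2 ω)) + EE (fun ω => x.2 ω * (starRingEnd ℂ) (z.2 ω)) := by
      rw [← EE_add]; congr 1; funext ω; simp; ring
    rw [e1, e2, Complex.add_re, mul_add]
    exact (norm_add_le _ _).trans (add_le_add h1 h2)

lemma MV_sq {N : ℝ} (hN : N < q) {P : (DirichletCharacter ℂ q → ℂ) × (Om q → ℂ)}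
    (h : P ∈ Maj q N) :
    ∑ χ : DirichletCharacter ℂ q, ‖P.1 χ‖ ^ 2 ≤
      q.totient * (EE (fun ω => P.2 ω * (starRingEnd ℂ) (P.2 ω))).re := by
  refine le_trans (le_of_eq ?_) (MV_bilin hN h h)
  have : ∑ χ : DirichletCharacter ℂ q, P.1 χ * (starRingEnd ℂ) (P.1 χ) = ((∑ χ : DirichletCharacter ℂ q, ‖P.1 χ‖ ^ 2 : ℝ) : ℂ) := by
    push_cast
    refine Finset.sum_congr rfl fun χ _ => ?_
    rw [Complex.mul_conj, Complex.normSq_eq_norm_sq]; push_cast; rfl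
  rw [this, Complex.norm_real, Real.norm_of_nonneg]
  positivity

end HP

open Complex Real Finset
namespace HP
set_option linter.unusedSectionVars false

variable {q : ℕ} [NeZero q]

noncomputable def PX (c e : ℕ → ℂ) (A : Finset ℕ) (χ : DirichletCharacter ℂ q) : ℂ :=
  ∑ p ∈ A, (c p * χ p + e p * χ p ^ 2)

noncomputable def PY (m d : ℕ → ℝ) (A : Finset ℕ) (ω : Om q) : ℂ :=
  ∑ p ∈ A, ((m p : ℂ) * fm q p ω + (d p : ℂ) * fm q p ω ^ 2)

noncomputable def Tr (M : ℕ) (z : ℂ) : ℂ := ∑ n ∈ range (M+1), z ^ n / (n.factorial : ℂ)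

noncomputable def E5 (θ m d : ℝ) : ℝ :=
  (∑ z : Fin 5, Real.exp (θ * ((m:ℂ) * z5 ^ z.val + (d:ℂ) * (z5 ^ z.val) ^ 2).re)) / 5

lemma PX_maj {c e : ℕ → ℂ} {m d : ℕ → ℝ} {A : Finset ℕ} {x : ℝ} (hx : 1 ≤ x)
    (hA : ∀ p ∈ A, p.Prime ∧ (p:ℝ) ≤ x) (hc : ∀ p ∈ A, ‖c p‖ ≤ m p) (he : ∀ p ∈ A, ‖e p‖ ≤ d p) :
    ((PX c e A, PY m d A) : (DirichletCharacter ℂ q → ℂ) × (Om q → ℂ)) ∈ Maj q (x^2) := by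
  have h0 : ((PX c e A, PY m d A) : (DirichletCharacter ℂ q → ℂ) × (Om q → ℂ)) =
      ∑ p ∈ A, (((fun χ => c p * χ p, fun ω => m p * fm q p ω) : (DirichletCharacter ℂ q → ℂ) × (Om q → ℂ))
        + (fun χ => e p * χ (p^2 : ℕ), fun ω => d p * fm q (p^2) ω)) := by
    ext i
    · simp [PX, Finset.sum_apply, Prod.fst_sum]
    · simp only [PY, Prod.snd_sum, Finset.sum_apply, Prod.mk_add_mk, Pi.add_apply]
      refine Finset.sum_congr rfl fun p hp => ?_
      have hp0 := (hA p hp).1.ne_zero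
      rw [sq p, fm_mul q hp0 hp0, Pi.mul_apply]; ring
  rw [h0]
  refine AddSubmonoid.sum_mem _ fun p hp => AddSubmonoid.add_mem _ ?_ ?_
  · refine Maj_gen (hc p hp) (hA p hp).1.one_le ?_
    nlinarith [(hA p hp).2]
  · refine Maj_gen (he p hp) (Nat.one_le_pow _ _ (hA p hp).1.pos) ?_
    push_cast
    exact pow_le_pow_left₀ (by positivity) (hA p hp).2 2

lemma PY_cone {m d : ℕ → ℝ} {A : Finset ℕ} (hm : ∀ p ∈ A, 0 ≤ m p) (hd : ∀ p ∈ A, 0 ≤ d p) :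
    (PY m d A : Om q → ℂ) ∈ cone q := by
  have : (PY m d A : Om q → ℂ) = ∑ p ∈ A, ((fun _ => (m p : ℂ)) * fm q p + (fun _ => (d p : ℂ)) * fm q p ^ 2) := by
    funext ω; simp [PY, Finset.sum_apply]
  rw [this]
  refine (cone q).sum_mem fun p hp => (cone q).add_mem ((cone q).mul_mem (cone_const (hm p hp)) (fm_mem q p))
    ((cone q).mul_mem (cone_const (hd p hp)) ((cone q).pow_mem (fm_mem q p) 2))

lemma Tr_maj {N : ℝ} (hN : 1 ≤ N) {X : DirichletCharacter ℂ q → ℂ} {Y : Om q → ℂ}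
    (h : (X, Y) ∈ Maj q N) (M : ℕ) :
    ((fun χ => Tr M (X χ / 2), fun ω => Tr M (Y ω / 2)) : (DirichletCharacter ℂ q → ℂ) × (Om q → ℂ))
      ∈ Maj q (N ^ M) := by
  have h0 : ((fun χ => Tr M (X χ / 2), fun ω => Tr M (Y ω / 2)) : (DirichletCharacter ℂ q → ℂ) × (Om q → ℂ))
      = ∑ n ∈ range (M+1), ((fun _ => ((((2:ℝ)^n)⁻¹ * (n.factorial:ℝ)⁻¹ : ℝ) : ℂ), fun _ => ((((2:ℝ)^n)⁻¹ * (n.factorial:ℝ)⁻¹ : ℝ) : ℂ)) : (DirichletCharacter ℂ q → ℂ) × (Om q → ℂ)) * (X, Y) ^ n := by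
    ext i
    · simp only [Tr, Prod.fst_sum, Finset.sum_apply]
      refine Finset.sum_congr rfl fun p hp => ?_
      simp [div_pow]; ring
    · simp only [Tr, Prod.snd_sum, Finset.sum_apply]
      refine Finset.sum_congr rfl fun p hp => ?_
      simp [div_pow]; ring
  rw [h0]
  refine AddSubmonoid.sum_mem _ fun n hn => ?_
  have h1 : (1:ℝ) * N ^ n ≤ N ^ M := by
    rw [one_mul]; exact pow_le_pow_right₀ hN (by simp at hn; omega)
  refine Maj_mono h1 (Maj_mul zero_le_one (Maj_const ?_) (Maj_pow (by linarith) h n))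
  rw [Complex.norm_real, Real.norm_of_nonneg (by positivity)]

lemma EE_exp {m d : ℕ → ℝ} {U A' : Finset ℕ} (hU : ∀ p ∈ U, p.Prime ∧ p ≤ q) (hA' : ∀ p ∈ A', p.Prime ∧ p ≤ q)
    (l : ℝ) :
    EE (fun ω : Om q => ((Real.exp ((PY m d U ω).re + 2 * l * (PY m d A' ω).re) : ℝ) : ℂ)) =
      ∏ i : Fin (q+1), ((∑ z : Fin 5, (((if (i:ℕ) ∈ U then Real.exp (1 * ((m i:ℂ) * z5 ^ z.val + (d i:ℂ) * (z5 ^ z.val) ^ 2).re) else 1) *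
        (if (i:ℕ) ∈ A' then Real.exp ((2*l) * ((m i:ℂ) * z5 ^ z.val + (d i:ℂ) * (z5 ^ z.val) ^ 2).re) else 1) : ℝ) : ℂ)) / 5) := by
  rw [← EE_prod]
  congr 1
  funext ω
  rw [← Complex.ofReal_prod]
  congr 1
  rw [Finset.prod_mul_distrib, Real.exp_add]
  have key : ∀ (A : Finset ℕ) (hA : ∀ p ∈ A, p.Prime ∧ p ≤ q) (θ : ℝ), Real.exp (θ * (PY m d A ω).re) =
      ∏ i : Fin (q+1), if (i:ℕ) ∈ A then Real.exp (θ * ((m i:ℂ) * z5 ^ (ω i).val + (d i:ℂ) * (z5 ^ (ω i).val) ^ 2).re) else 1 := by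
    intro A hA θ
    have e1 : ∏ i : Fin (q+1), (if (i:ℕ) ∈ A then Real.exp (θ * ((m i:ℂ) * z5 ^ (ω i).val + (d i:ℂ) * (z5 ^ (ω i).val) ^ 2).re) else 1)
      = ∏ i : Fin (q+1), (if (i:ℕ) ∈ A then Real.exp (θ * ((m i:ℂ) * fm q i ω + (d i:ℂ) * fm q i ω ^ 2).re) else 1) := by
      refine Finset.prod_congr rfl fun i _ => ?_
      split_ifs with h
      · rw [fm_prime q (hA i h).1 (hA i h).2]
      · rfl
    rw [e1, ← Finset.prod_range (fun i => if i ∈ A then Real.exp (θ * ((m i:ℂ) * fm q i ω + (d i:ℂ) * fm q i ω ^ 2).re) else 1), Finset.prod_ite_mem]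
    have e2 : range (q+1) ∩ A = A := by
      apply Finset.inter_eq_right.mpr; intro p hp; simp; have := (hA p hp).2; omega
    rw [e2, PY, Complex.re_sum, Finset.mul_sum, Real.exp_sum]
  rw [← key U hU 1, ← key A' hA' (2*l), one_mul]

lemma EE_exp' {m d : ℕ → ℝ} {U A' : Finset ℕ} (hU : ∀ p ∈ U, p.Prime ∧ p ≤ q) (hA' : ∀ p ∈ A', p.Prime ∧ p ≤ q)
    (hd : Disjoint U A') (l : ℝ) :
    EE (fun ω : Om q => ((Real.exp ((PY m d U ω).re + 2 * l * (PY m d A' ω).re) : ℝ) : ℂ)) =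
      (((∏ p ∈ U, E5 1 (m p) (d p)) * ∏ p ∈ A', E5 (2*l) (m p) (d p) : ℝ) : ℂ) := by
  rw [EE_exp hU hA']
  have key : ∀ (A : Finset ℕ) (hA : ∀ p ∈ A, p.Prime ∧ p ≤ q) (θ : ℝ), ∏ p ∈ A, E5 θ (m p) (d p) =
      ∏ i : Fin (q+1), if (i:ℕ) ∈ A then E5 θ (m i) (d i) else 1 := by
    intro A hA θ
    rw [← Finset.prod_range (fun i => if i ∈ A then E5 θ (m i) (d i) else 1), Finset.prod_ite_mem]
    have e2 : range (q+1) ∩ A = A := by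
      apply Finset.inter_eq_right.mpr; intro p hp; simp; have := (hA p hp).2; omega
    rw [e2]
  rw [key U hU, key A' hA', ← Finset.prod_mul_distrib, Complex.ofReal_prod]
  refine Finset.prod_congr rfl fun i _ => ?_
  by_cases h1 : (i:ℕ) ∈ U
  · have h2 : (i:ℕ) ∉ A' := Finset.disjoint_left.mp hd h1
    simp only [h1, h2, if_true, if_false, E5, mul_one]
    push_cast; rfl
  · by_cases h2 : (i:ℕ) ∈ A'
    · simp only [h1, h2, if_true, if_false, E5, one_mul]
      push_cast; rfl
    · simp only [h1, h2, if_false]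
      simp

lemma MV_main {ι : Type*} [DecidableEq ι] (J : Finset ι) (A : ι → Finset ℕ) (x : ι → ℝ) (M : ι → ℕ)
    (A' : Finset ℕ) (x' : ℝ) (N : ℕ) (l : ℝ) (hl : 0 < l) (c e c' e' : ℕ → ℂ) (m d : ℕ → ℝ)
    (hc : ∀ p, ‖c p‖ ≤ m p) (he : ∀ p, ‖e p‖ ≤ d p) (hc' : ∀ p, ‖c' p‖ ≤ m p) (he' : ∀ p, ‖e' p‖ ≤ d p)
    (hx : ∀ j ∈ J, 1 ≤ x j) (hx' : 1 ≤ x')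
    (hA : ∀ j ∈ J, ∀ p ∈ A j, p.Prime ∧ (p:ℝ) ≤ x j ∧ p ≤ q)
    (hA' : ∀ p ∈ A', p.Prime ∧ (p:ℝ) ≤ x' ∧ p ≤ q)
    (hd : (J : Set ι).PairwiseDisjoint A) (hd' : ∀ j ∈ J, Disjoint (A j) A')
    (hdeg : (∏ j ∈ J, (x j ^ 2) ^ M j) * (x' ^ 2) ^ N < q) :
    ∑ χ : DirichletCharacter ℂ q, (∏ j ∈ J, ‖Tr (M j) (PX c e (A j) χ / 2)‖ ^ 2) * ‖PX c' e' A' χ‖ ^ (2 * N) ≤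
      q.totient * (((N.factorial : ℝ) / l ^ N) ^ 2 * ((∏ j ∈ J, ∏ p ∈ A j, E5 1 (m p) (d p)) * ∏ p ∈ A', E5 (2*l) (m p) (d p))) := by
  have hm0 : ∀ p, 0 ≤ m p := fun p => (norm_nonneg _).trans (hc p)
  have hd0 : ∀ p, 0 ≤ d p := fun p => (norm_nonneg _).trans (he p)
  have m1 : ∀ j ∈ J, ((fun χ => Tr (M j) (PX c e (A j) χ / 2), fun ω => Tr (M j) (PY m d (A j) ω / 2)) :
      (DirichletCharacter ℂ q → ℂ) × (Om q → ℂ)) ∈ Maj q ((x j ^ 2) ^ M j) := fun j hj =>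
    Tr_maj (one_le_pow₀ (hx j hj)) (PX_maj (hx j hj) (fun p hp => ⟨(hA j hj p hp).1, (hA j hj p hp).2.1⟩)
      (fun p _ => hc p) (fun p _ => he p)) _
  have m2 := Maj_prod J (fun j _ => by positivity) m1
  have m3 := Maj_pow (by positivity) (PX_maj (q := q) hx' (fun p hp => ⟨(hA' p hp).1, (hA' p hp).2.1⟩)
      (fun p _ => hc' p) (fun p _ => he' p)) N
  have m4 := MV_sq hdeg (Maj_mul (by positivity) m2 m3)
  have e1 : ∀ χ : DirichletCharacter ℂ q, (∏ j ∈ J, ‖Tr (M j) (PX c e (A j) χ / 2)‖ ^ 2) * ‖PX c' e' A' χ‖ ^ (2 * N) =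
      ‖((∏ j ∈ J, ((fun χ => Tr (M j) (PX c e (A j) χ / 2), fun ω => Tr (M j) (PY m d (A j) ω / 2)) :
      (DirichletCharacter ℂ q → ℂ) × (Om q → ℂ))) * ((PX c' e' A', PY m d A') : (DirichletCharacter ℂ q → ℂ) × (Om q → ℂ)) ^ N).1 χ‖ ^ 2 := by
    intro χ
    simp only [Prod.fst_mul, Prod.fst_prod, Prod.pow_fst, Pi.mul_apply, Finset.prod_apply, Pi.pow_apply, norm_mul, norm_prod, norm_pow, mul_pow]
    rw [Finset.prod_pow, ← pow_mul, mul_comm 2 N]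
  rw [Finset.sum_congr rfl fun χ _ => e1 χ]
  refine m4.trans (mul_le_mul_of_nonneg_left ?_ (by positivity))
  -- pass to exponentials
  have hcs : ∀ B : Finset ℕ, ∀ t : ℝ, 0 ≤ t → (fun ω : Om q => (t:ℂ) * PY m d B ω) ∈ cone q := fun B t ht =>
    (cone q).mul_mem (cone_const ht) (PY_cone (fun p _ => hm0 p) (fun p _ => hd0 p))
  have l1 : ∀ j ∈ J, Led (fun ω : Om q => Tr (M j) (PY m d (A j) ω / 2)) (fun ω => Complex.exp (PY m d (A j) ω / 2)) := by
    intro j _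
    have := Led_exp (hcs (A j) (1/2) (by norm_num)) (range (M j + 1))
    have h2 : ∀ z : ℂ, ((1/2 : ℝ) : ℂ) * z = z / 2 := by intro z; push_cast; ring
    simp only [h2] at this
    exact this
  have l2 := Led.prod J l1
  have l3 : Led ((PY m d A' : Om q → ℂ) ^ N) ((fun _ => (((N.factorial : ℝ) / l ^ N : ℝ) : ℂ)) * fun ω => Complex.exp (l * PY m d A' ω)) := by
    have h1 := Led_exp (hcs A' l hl.le) {N}
    have h2 := (Led.refl (cone_const (q := q) (b := (N.factorial : ℝ) / l ^ N) (by positivity))).mul h1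
    convert h2 using 1
    funext ω
    simp only [Pi.pow_apply, Pi.mul_apply, Finset.sum_singleton]
    have : (l:ℂ) ≠ 0 := by exact_mod_cast hl.ne'
    have : (N.factorial : ℂ) ≠ 0 := by exact_mod_cast N.factorial_ne_zero
    push_cast
    rw [mul_pow]
    field_simp
  have l4 := (l2.mul l3).EE_sq
  have e2 : ∀ W : Om q → ℂ, W = ((∏ j ∈ J, ((fun χ => Tr (M j) (PX c e (A j) χ / 2), fun ω => Tr (M j) (PY m d (A j) ω / 2)) :
      (DirichletCharacter ℂ q → ℂ) × (Om q → ℂ))) * ((PX c' e' A', PY m d A') : (DirichletCharacter ℂ q → ℂ) × (Om q → ℂ)) ^ N).2 →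
      W = (∏ j ∈ J, fun ω : Om q => Tr (M j) (PY m d (A j) ω / 2)) * (PY m d A' : Om q → ℂ) ^ N := by
    intro W hW
    rw [hW]; simp [Prod.snd_prod]
  rw [e2 _ rfl]
  refine l4.trans (le_of_eq ?_)
  have e3 : ∀ ω : Om q, ((∏ j ∈ J, fun ω : Om q => Complex.exp (PY m d (A j) ω / 2)) * ((fun _ => (((N.factorial : ℝ) / l ^ N : ℝ) : ℂ)) * fun ω => Complex.exp (l * PY m d A' ω)) : Om q → ℂ) ω
      = (((N.factorial : ℝ) / l ^ N : ℝ) : ℂ) * Complex.exp (PY m d (J.biUnion A) ω / 2 + l * PY m d A' ω) := by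
    intro ω
    have : PY m d (J.biUnion A) ω = ∑ j ∈ J, PY m d (A j) ω := by
      unfold PY; rw [Finset.sum_biUnion hd]
    rw [this, Complex.exp_add, Finset.sum_div, Complex.exp_sum]
    simp only [Pi.mul_apply, Finset.prod_apply]; ring
  have e4 : (fun ω : Om q => ((∏ j ∈ J, fun ω : Om q => Complex.exp (PY m d (A j) ω / 2)) * ((fun _ => (((N.factorial : ℝ) / l ^ N : ℝ) : ℂ)) * fun ω => Complex.exp (l * PY m d A' ω)) : Om q → ℂ) ω * (starRingEnd ℂ) (((∏ j ∈ J, fun ω : Om q => Complex.exp (PY m d (A j) ω / 2)) * ((fun _ => (((N.factorial : ℝ) / l ^ N : ℝ) : ℂ)) * fun ω => Complex.exp (l * PY m d A' ω)) : Om q → ℂ) ω)) =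
    fun ω => ((((N.factorial : ℝ) / l ^ N) ^ 2 : ℝ) : ℂ) * ((Real.exp ((PY m d (J.biUnion A) ω).re + 2 * l * (PY m d A' ω).re) : ℝ) : ℂ) := by
    funext ω
    rw [e3, Complex.mul_conj, Complex.normSq_eq_norm_sq, norm_mul, Complex.norm_real, Complex.norm_exp, mul_pow, ← Real.exp_nat_mul, ← Complex.ofReal_mul,
      Real.norm_of_nonneg (by positivity)]
    congr 3
    simp
    ring
  rw [e4, EE_const_mul, EE_exp' (q := q) (U := J.biUnion A) (A' := A') ?_ ?_ ?_ l, ← Complex.ofReal_mul, Complex.ofReal_re,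
    Finset.prod_biUnion hd]
  · intro p hp
    obtain ⟨j, hj, hp⟩ := Finset.mem_biUnion.mp hp
    exact ⟨(hA j hj p hp).1, (hA j hj p hp).2.2⟩
  · intro p hp; exact ⟨(hA' p hp).1, (hA' p hp).2.2⟩
  · rw [Finset.disjoint_biUnion_left]; exact hd'

end HP

open Complex Real Finset
namespace HP
set_option linter.unusedSectionVars false

lemma z5_prim : IsPrimitiveRoot z5 5 := by
  have := Complex.isPrimitiveRoot_exp 5 (by norm_num)
  unfold z5; exact_mod_cast this

lemma z5_rel : z5.re + (z5^2).re = -1/2 ∧ z5.re * (z5^2).re = -1/4 ∧ (z5^3).re = (z5^2).re ∧ (z5^4).re = z5.re := by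
  have h5 := z5_pow
  have hn : z5.re * z5.re + z5.im * z5.im = 1 := by
    have := norm_z5
    rw [← Complex.normSq_apply, Complex.normSq_eq_norm_sq, this]; norm_num
  have hc : z5 * (starRingEnd ℂ) z5 = 1 := by
    rw [Complex.mul_conj, Complex.normSq_eq_norm_sq, norm_z5]; simp
  have h4 : z5^4 = (starRingEnd ℂ) z5 := by
    linear_combination (starRingEnd ℂ) z5 * h5 - z5^4 * hc
  have h3 : z5^3 = (starRingEnd ℂ) (z5^2) := by
    rw [map_pow, ← h4]; linear_combination (-z5^3) * h5
  have r4 : (z5^4).re = z5.re := by rw [h4, Complex.conj_re]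
  have r3 : (z5^3).re = (z5^2).re := by rw [h3, Complex.conj_re]
  have hs := congrArg Complex.re (z5_prim.geom_sum_eq_zero (by norm_num))
  simp [Finset.sum_range_succ, r3, r4, -pow_succ] at hs
  have h2 : (z5^2).re = z5.re * z5.re - z5.im * z5.im := by rw [sq, Complex.mul_re]
  have s1 : z5.re + (z5^2).re = -1/2 := by linarith
  refine ⟨s1, ?_, r3, r4⟩
  nlinarith

/-- The five values of the random variable. -/
lemma E5_eq (θ m d : ℝ) : ∃ c1 c2 : ℝ, c1 + c2 = -1/2 ∧ c1 * c2 = -1/4 ∧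
    E5 θ m d = (Real.exp (θ * (m + d)) + 2 * Real.exp (θ * (m * c1 + d * c2)) + 2 * Real.exp (θ * (m * c2 + d * c1))) / 5 := by
  obtain ⟨h1, h2, h3, h4⟩ := z5_rel
  refine ⟨z5.re, (z5^2).re, h1, h2, ?_⟩
  have h6 : z5 ^ 6 = z5 := by linear_combination z5 * z5_pow
  have h8 : z5 ^ 8 = z5^3 := by linear_combination z5^3 * z5_pow
  have e : ∀ j : ℕ, ((m:ℂ) * z5 ^ j + (d:ℂ) * (z5 ^ j) ^ 2).re = m * (z5^j).re + d * (z5^(2*j)).re := by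
    intro j; rw [← pow_mul, Complex.add_re, Complex.re_ofReal_mul, Complex.re_ofReal_mul, mul_comm j 2]
  unfold E5
  simp only [e]
  rw [Fin.sum_univ_five]
  simp only [Fin.val_zero, Fin.val_one, Fin.val_two]
  rw [show ((3 : Fin 5)).val = 3 from rfl, show ((4 : Fin 5)).val = 4 from rfl]
  norm_num [h6, h8, h3, h4]
  ring

lemma c_bounds {c1 c2 : ℝ} (h1 : c1 + c2 = -1/2) (h2 : c1 * c2 = -1/4) : |c1| ≤ 1 ∧ |c2| ≤ 1 := by
  have : c1^2 + c2^2 = 3/4 := by nlinarith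
  constructor <;> rw [abs_le] <;> constructor <;> nlinarith [sq_nonneg c1, sq_nonneg c2]

lemma exp_taylor (u B : ℝ) (h : |u| ≤ B) : Real.exp u ≤ 1 + u + u^2/2 + B^3 * Real.exp B := by
  have h0 := Complex.norm_exp_sub_sum_le_norm_mul_exp (u:ℂ) 3
  have e : Complex.exp (u:ℂ) - ∑ m ∈ range 3, (u:ℂ)^m / (m.factorial : ℂ) = ((Real.exp u - (1 + u + u^2/2) : ℝ) : ℂ) := by
    simp [Finset.sum_range_succ, Nat.factorial]
  rw [e, Complex.norm_real, Complex.norm_real, Real.norm_eq_abs, Real.norm_eq_abs] at h0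
  have h1 := le_abs_self (Real.exp u - (1 + u + u^2/2))
  have h2 : |u|^3 * Real.exp |u| ≤ B^3 * Real.exp B := by
    have := abs_nonneg u
    exact mul_le_mul (pow_le_pow_left₀ this h 3) (Real.exp_le_exp.mpr h) (Real.exp_pos _).le (by have := this.trans h; positivity)
  linarith

lemma lin_bd {m d c1 c2 : ℝ} (hm : 0 ≤ m) (hd : 0 ≤ d) (h1 : |c1| ≤ 1) (h2 : |c2| ≤ 1) : |m * c1 + d * c2| ≤ m + d := by
  rw [abs_le] at *
  constructor <;> nlinarith

lemma E5_one {m d : ℝ} (hm : 0 ≤ m) (hd : 0 ≤ d) :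
    E5 1 m d ≤ Real.exp (m^2/4 + d^2/4 + (m+d)^3 * Real.exp (m+d)) := by
  obtain ⟨c1, c2, h1, h2, h⟩ := E5_eq 1 m d
  obtain ⟨b1, b2⟩ := c_bounds h1 h2
  rw [h]; simp only [one_mul]
  have t0 := exp_taylor (m+d) (m+d) (by rw [abs_of_nonneg (by positivity)])
  have t1 := exp_taylor (m*c1+d*c2) (m+d) (lin_bd hm hd b1 b2)
  have t2 := exp_taylor (m*c2+d*c1) (m+d) (lin_bd hm hd b2 b1)
  have t3 := Real.add_one_le_exp (m^2/4 + d^2/4 + (m+d)^3 * Real.exp (m+d))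
  have s : c1^2 + c2^2 = 3/4 := by nlinarith
  have k1 : (m+d) + 2 * (m*c1+d*c2) + 2 * (m*c2+d*c1) = 0 := by linear_combination 2*(m+d)*h1
  have k2 : (m+d)^2 + 2 * (m*c1+d*c2)^2 + 2 * (m*c2+d*c1)^2 = 5/2*(m^2+d^2) := by
    linear_combination 2*(m^2+d^2)*s + 8*m*d*h2
  linarith

lemma exp_conv {θ u B : ℝ} (hB : 0 < B) (h : |u| ≤ B) :
    Real.exp (θ * u) ≤ Real.cosh (θ*B) + u/B * Real.sinh (θ*B) := by
  rw [abs_le] at h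
  have h1 : -1 ≤ u/B := by rw [le_div_iff₀ hB]; linarith
  have h2 : u/B ≤ 1 := by rw [div_le_iff₀ hB]; linarith
  have := convexOn_exp.2 (Set.mem_univ (θ*B)) (Set.mem_univ (-(θ*B))) (show (0:ℝ) ≤ (1+u/B)/2 by linarith) (show (0:ℝ) ≤ (1-u/B)/2 by linarith) (by ring)
  have e : ((1+u/B)/2) • (θ*B) + ((1-u/B)/2) • (-(θ*B)) = θ * u := by
    simp only [smul_eq_mul]; field_simp; ring
  rw [e] at this
  refine this.trans (le_of_eq ?_)
  simp only [smul_eq_mul]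
  rw [Real.cosh_eq, Real.sinh_eq]; ring

lemma E5_hoeff {θ m d : ℝ} (hm : 0 ≤ m) (hd : 0 ≤ d) :
    E5 θ m d ≤ Real.exp ((θ*(m+d))^2/2) := by
  obtain ⟨c1, c2, h1, h2, h⟩ := E5_eq θ m d
  obtain ⟨b1, b2⟩ := c_bounds h1 h2
  rcases (add_nonneg hm hd).eq_or_lt with h0 | h0
  · have : m = 0 := by linarith
    have : d = 0 := by linarith
    subst_vars
    rw [h]; simp
    norm_num
  rw [h]
  refine le_trans ?_ (Real.cosh_le_exp_half_sq _)
  have t0 := exp_conv (θ := θ) (u := m+d) h0 (by rw [abs_of_nonneg (by positivity)])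
  have t1 := exp_conv (θ := θ) h0 (lin_bd hm hd b1 b2)
  have t2 := exp_conv (θ := θ) h0 (lin_bd hm hd b2 b1)
  have k1 : (m+d) + 2 * (m*c1+d*c2) + 2 * (m*c2+d*c1) = 0 := by linear_combination 2*(m+d)*h1
  have k2 : (m+d)/(m+d) * Real.sinh (θ*(m+d)) + 2 * ((m*c1+d*c2)/(m+d) * Real.sinh (θ*(m+d))) + 2 * ((m*c2+d*c1)/(m+d) * Real.sinh (θ*(m+d))) = 0 := by
    have : (m+d)/(m+d) * Real.sinh (θ*(m+d)) + 2 * ((m*c1+d*c2)/(m+d) * Real.sinh (θ*(m+d))) + 2 * ((m*c2+d*c1)/(m+d) * Real.sinh (θ*(m+d))) = ((m+d) + 2 * (m*c1+d*c2) + 2 * (m*c2+d*c1)) / (m+d) * Real.sinh (θ*(m+d)) := by ring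
    rw [this, k1]; simp
  linarith

lemma E5_pos (θ m d : ℝ) : 0 < E5 θ m d := by unfold E5; positivity

lemma Tr_lower {V : ℝ} (hV : 0 < V) {P : ℂ} (hP : ‖P‖ ≤ V) {M : ℕ} (hM : 10 * V ≤ M) :
    Real.exp P.re ≤ Real.exp (2/V) * ‖Tr M (P/2)‖^2 := by
  set n := M + 1 with hn
  have hn0 : (0:ℝ) < n := by positivity
  have hnV : 10 * V + 1 ≤ n := by rw [hn]; push_cast; linarith
  have hw : ‖P/2‖ ≤ V/2 := by rw [norm_div]; simp; linarith
  have h1 : ‖Complex.exp (P/2) - Tr M (P/2)‖ ≤ ‖P/2‖^n / (n.factorial : ℝ) * 2 := by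
    refine Complex.exp_bound' ?_
    rw [div_le_iff₀ (by positivity)]; push_cast; linarith
  have h2 : ‖P/2‖^n / (n.factorial : ℝ) * 2 ≤ Real.exp (-(15*V)) := by
    have f1 := Real.pow_div_factorial_le_exp (n:ℝ) hn0.le n
    have f2 : (1:ℝ) / (n.factorial : ℝ) ≤ Real.exp n / (n:ℝ)^n := by
      rw [div_le_div_iff₀ (by positivity) (by positivity)]
      rw [div_le_iff₀ (by positivity)] at f1; linarith
    have f3 : ‖P/2‖^n ≤ (V/2)^n := pow_le_pow_left₀ (norm_nonneg _) hw n
    have f4 : ‖P/2‖^n / (n.factorial : ℝ) ≤ (V/2)^n * (Real.exp n / (n:ℝ)^n) := by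
      rw [div_eq_mul_one_div]; exact mul_le_mul f3 f2 (by positivity) (by positivity)
    have f5 : (V/2)^n * (Real.exp n / (n:ℝ)^n) = (V/2 * Real.exp 1 / n)^n := by
      rw [div_pow (V/2 * Real.exp 1), mul_pow, ← Real.exp_nat_mul, mul_one]; ring
    have he : Real.exp 1 ≤ 2.7182818286 := Real.exp_one_lt_d9.le
    have f6 : V/2 * Real.exp 1 / n ≤ Real.exp (-1.5) := by
      have : V / n ≤ 1/10 := by rw [div_le_div_iff₀ hn0 (by norm_num)]; linarith
      have h25 : Real.exp 2.5 ≤ 20 := by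
        have h0 : Real.exp 2.5 ^ 2 = Real.exp 1 ^ 5 := by
          rw [← Real.exp_nat_mul, ← Real.exp_nat_mul]; norm_num
        have h00 : Real.exp 1 ^ 5 ≤ 2.7182818286^5 := by gcongr
        have : (2.7182818286:ℝ)^5 ≤ 400 := by norm_num
        by_contra hcon
        push Not at hcon
        nlinarith
      have : V/2 * Real.exp 1 / n = V/n * Real.exp 1 / 2 := by ring
      rw [this]
      have hh : Real.exp 1 = Real.exp 2.5 * Real.exp (-1.5) := by rw [← Real.exp_add]; norm_num
      have hpos := Real.exp_pos (-1.5)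
      have : V/n * Real.exp 1 ≤ 1/10 * (20 * Real.exp (-1.5)) := by
        rw [hh]; refine mul_le_mul ‹_› (mul_le_mul_of_nonneg_right h25 hpos.le) (by positivity) (by norm_num)
      linarith
    have f7 : (V/2 * Real.exp 1 / n)^n ≤ Real.exp (-1.5 * n) := by
      refine (pow_le_pow_left₀ (by positivity) f6 n).trans (le_of_eq ?_)
      rw [← Real.exp_nat_mul]; congr 1; ring
    have f8 : (2:ℝ) ≤ Real.exp 1.5 := by have := Real.add_one_le_exp (1.5:ℝ); linarith
    calc ‖P/2‖^n / (n.factorial : ℝ) * 2 ≤ Real.exp (-1.5*n) * Real.exp 1.5 :=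
          mul_le_mul (f4.trans (f5.le.trans f7)) f8 (by norm_num) (Real.exp_pos _).le
      _ = Real.exp (-1.5*n + 1.5) := by rw [← Real.exp_add]
      _ ≤ _ := Real.exp_le_exp.mpr (by linarith)
  have h3 : ‖Complex.exp (P/2)‖ = Real.exp (P.re/2) := by rw [Complex.norm_exp]; simp
  have hre : -V ≤ P.re := (abs_le.mp ((Complex.abs_re_le_norm P).trans hP)).1
  have h4 : Real.exp (-(15*V)) ≤ Real.exp (-V) * Real.exp (P.re/2) := by
    rw [← Real.exp_add]; apply Real.exp_le_exp.mpr; linarith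
  have h5 : (1 - Real.exp (-V)) * Real.exp (P.re/2) ≤ ‖Tr M (P/2)‖ := by
    have := norm_sub_norm_le (Complex.exp (P/2)) (Tr M (P/2))
    rw [h3] at this; linarith
  have h6 : 1 ≤ Real.exp (1/V) * (1 - Real.exp (-V)) := by
    have g1 : Real.exp (-V) ≤ 1/(1+V) := by
      rw [Real.exp_neg, ← one_div]; apply one_div_le_one_div_of_le (by positivity)
      have := Real.add_one_le_exp V; linarith
    have g2 : 1 - 1/(1+V) = V/(1+V) := by field_simp; ring
    have g3 : 1 + 1/V ≤ Real.exp (1/V) := by have := Real.add_one_le_exp (1/V); linarith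
    calc (1:ℝ) = (1+1/V) * (V/(1+V)) := by field_simp; ring
      _ ≤ _ := mul_le_mul g3 (by linarith) (by positivity) (Real.exp_pos _).le
  have h7 : Real.exp (P.re/2) ≤ Real.exp (1/V) * ‖Tr M (P/2)‖ := by
    calc Real.exp (P.re/2) = 1 * Real.exp (P.re/2) := by ring
      _ ≤ Real.exp (1/V) * (1 - Real.exp (-V)) * Real.exp (P.re/2) := mul_le_mul_of_nonneg_right h6 (Real.exp_pos _).le
      _ = Real.exp (1/V) * ((1 - Real.exp (-V)) * Real.exp (P.re/2)) := by ring
      _ ≤ _ := mul_le_mul_of_nonneg_left h5 (Real.exp_pos _).le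
  have h8 := pow_le_pow_left₀ (Real.exp_pos _).le h7 2
  rw [mul_pow, ← Real.exp_nat_mul, ← Real.exp_nat_mul] at h8
  have e1 : ((2:ℕ):ℝ) * (P.re/2) = P.re := by push_cast; ring
  have e2 : ((2:ℕ):ℝ) * (1/V) = 2/V := by push_cast; ring
  rwa [e1, e2] at h8

/-! ### Prime sums -/

noncomputable def Ap (x : ℝ) : Finset ℕ := (Icc 1 ⌊x⌋₊).filter Nat.Prime

lemma mem_Ap {x : ℝ} {p : ℕ} (hx : 0 ≤ x) : p ∈ Ap x ↔ p.Prime ∧ (p:ℝ) ≤ x := by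
  unfold Ap
  rw [mem_filter, mem_Icc, Nat.le_floor_iff hx]
  exact ⟨fun h => ⟨h.2, h.1.2⟩, fun h => ⟨⟨h.1.one_le, h.2⟩, h.1⟩⟩

lemma mertens {x : ℝ} (hx : 1 ≤ x) : ∑ p ∈ Ap x, Real.log p / p ≤ Real.log x + 3 := by
  set N := ⌊x⌋₊ with hN
  have hN1 : 1 ≤ N := Nat.le_floor (by simpa using hx)
  have hNx : (N:ℝ) ≤ x := Nat.floor_le (by linarith)
  have hNr : (1:ℝ) ≤ N := by exact_mod_cast hN1
  have h1 : ∑ n ∈ Ioc 0 N, ∑ p ∈ Ap x, (if p ∣ n then Real.log p else 0) ≤ N * Real.log x := by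
    have : ∀ n ∈ Ioc 0 N, ∑ p ∈ Ap x, (if p ∣ n then Real.log p else 0) ≤ Real.log x := by
      intro n hn
      rw [mem_Ioc] at hn
      rw [← Finset.sum_filter]
      have hs : (Ap x).filter (fun p => p ∣ n) ⊆ n.primeFactors := by
        intro p hp
        rw [mem_filter, mem_Ap (by linarith)] at hp
        rw [Nat.mem_primeFactors]; exact ⟨hp.1.1, hp.2, by omega⟩
      have hlog : ∀ p : ℕ, 0 ≤ Real.log p := fun p => Real.log_natCast_nonneg p
      refine (Finset.sum_le_sum_of_subset_of_nonneg hs fun p _ _ => hlog p).trans ?_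
      have : ∑ p ∈ n.primeFactors, Real.log p = Real.log ((∏ p ∈ n.primeFactors, p : ℕ) : ℝ) := by
        push_cast
        rw [Real.log_prod]
        intro p hp; have := (Nat.prime_of_mem_primeFactors hp).ne_zero; exact_mod_cast this
      rw [this]
      apply Real.log_le_log
      · have : 0 < ∏ p ∈ n.primeFactors, p := Finset.prod_pos fun p hp => (Nat.prime_of_mem_primeFactors hp).pos
        exact_mod_cast this
      · have h1 : ∏ p ∈ n.primeFactors, p ≤ n := Nat.le_of_dvd hn.1 (Nat.prod_primeFactors_dvd n)
        have h2 : ∏ p ∈ n.primeFactors, p ≤ N := h1.trans hn.2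
        exact (Nat.cast_le.mpr h2).trans hNx
    refine (Finset.sum_le_sum this).trans (le_of_eq ?_)
    simp
  rw [Finset.sum_comm] at h1
  have h2 : ∀ p ∈ Ap x, N * (Real.log p / p) - Real.log p ≤ ∑ n ∈ Ioc 0 N, (if p ∣ n then Real.log p else 0) := by
    intro p hp
    rw [← Finset.sum_filter, Finset.sum_const, Nat.Ioc_filter_dvd_card_eq_div, nsmul_eq_mul]
    have hp0 : (0:ℝ) < p := by exact_mod_cast ((mem_Ap (by linarith)).mp hp).1.pos
    have : (N:ℝ)/p - 1 ≤ ((N/p : ℕ) : ℝ) := by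
      have := Nat.lt_floor_add_one ((N:ℝ)/p)
      rw [Nat.floor_div_eq_div] at this; linarith
    calc N * (Real.log p / p) - Real.log p = ((N:ℝ)/p - 1) * Real.log p := by ring
      _ ≤ _ := mul_le_mul_of_nonneg_right this (Real.log_natCast_nonneg p)
  have h3 := (Finset.sum_le_sum h2).trans h1
  rw [Finset.sum_sub_distrib, ← Finset.mul_sum] at h3
  have h4 : ∑ p ∈ Ap x, Real.log p ≤ Real.log 4 * N := by
    have := Chebyshev.theta_le_log4_mul_x (x := (N:ℝ)) (by positivity)
    refine le_trans (le_of_eq ?_) this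
    unfold Chebyshev.theta Ap
    rw [Nat.floor_natCast]
    refine Finset.sum_congr ?_ fun _ _ => rfl
    rfl
  have h5 : Real.log 4 ≤ 3 := by
    have := Real.log_le_sub_one_of_pos (show (0:ℝ) < 4 by norm_num); linarith
  have h6 : N * ∑ p ∈ Ap x, Real.log p / p ≤ N * (Real.log x + 3) := by nlinarith
  exact le_of_mul_le_mul_left h6 (by linarith)

lemma block_sum {x : ℝ} (hx : 3 ≤ x) : ∑ p ∈ Ap (x^16) \ Ap x, (1:ℝ)/p ≤ 19 := by
  have hl : 1 ≤ Real.log x := by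
    rw [Real.le_log_iff_exp_le (by linarith)]
    have := Real.exp_one_lt_d9; linarith
  have h0 : 0 ≤ x := by linarith
  have h1 : ∀ p ∈ Ap (x^16) \ Ap x, (1:ℝ)/p ≤ (Real.log p / p) / Real.log x := by
    intro p hp
    rw [mem_sdiff, mem_Ap (by positivity), mem_Ap h0] at hp
    have hpx : x < p := by
      by_contra h; exact hp.2 ⟨hp.1.1, by linarith⟩
    have hp0 : (0:ℝ) < p := by linarith
    have : Real.log x ≤ Real.log p := Real.log_le_log (by linarith) hpx.le
    rw [div_div, div_le_div_iff₀ hp0 (by positivity)]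
    nlinarith
  have h2 : ∑ p ∈ Ap (x^16) \ Ap x, (Real.log p / p) / Real.log x ≤ ∑ p ∈ Ap (x^16), (Real.log p / p) / Real.log x := by
    refine Finset.sum_le_sum_of_subset_of_nonneg sdiff_subset fun p _ _ => ?_
    have := Real.log_natCast_nonneg p
    positivity
  have h3 := mertens (x := x^16) (one_le_pow₀ (by linarith))
  refine (Finset.sum_le_sum h1).trans (h2.trans ?_)
  rw [← Finset.sum_div, div_le_iff₀ (by linarith)]
  rw [Real.log_pow] at h3; push_cast at h3
  linarith

lemma sum_inv_sqrt (N : ℕ) : ∑ n ∈ Icc 1 N, (1:ℝ)/Real.sqrt n ≤ 2 * Real.sqrt N := by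
  induction N with
  | zero => simp
  | succ N ih =>
    rw [Finset.sum_Icc_succ_top (by omega)]
    have h1 : (0:ℝ) < Real.sqrt ((N+1 : ℕ):ℝ) := Real.sqrt_pos.mpr (by positivity)
    have h2 : Real.sqrt ((N+1 : ℕ):ℝ)^2 = N + 1 := by rw [Real.sq_sqrt (by positivity)]; push_cast; ring
    have h3 : Real.sqrt (N:ℝ)^2 = N := Real.sq_sqrt (by positivity)
    have h4 : (1:ℝ)/Real.sqrt ((N+1 : ℕ):ℝ) ≤ 2 * Real.sqrt ((N+1 : ℕ):ℝ) - 2 * Real.sqrt (N:ℝ) := by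
      rw [div_le_iff₀ h1]
      nlinarith [sq_nonneg (Real.sqrt ((N+1 : ℕ):ℝ) - Real.sqrt (N:ℝ))]
    linarith

lemma sum_Ap_sqrt {x : ℝ} (hx : 0 ≤ x) : ∑ p ∈ Ap x, (1:ℝ)/Real.sqrt p ≤ 2 * Real.sqrt x := by
  have h1 : ∑ p ∈ Ap x, (1:ℝ)/Real.sqrt p ≤ ∑ n ∈ Icc 1 ⌊x⌋₊, (1:ℝ)/Real.sqrt n :=
    Finset.sum_le_sum_of_subset_of_nonneg (filter_subset _ _) fun p _ _ => by positivity
  refine h1.trans ((sum_inv_sqrt _).trans ?_)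
  have := Real.sqrt_le_sqrt (Nat.floor_le hx)
  linarith

lemma sum_three_halves : ∃ C : ℝ, 0 ≤ C ∧ ∀ A : Finset ℕ, ∑ p ∈ A, (p:ℝ)^(-(3/2):ℝ) ≤ C := by
  have h : Summable fun n : ℕ => (n:ℝ)^(-(3/2):ℝ) := Real.summable_nat_rpow.mpr (by norm_num)
  exact ⟨∑' n : ℕ, (n:ℝ)^(-(3/2):ℝ), tsum_nonneg fun n => by positivity, fun A => h.sum_le_tsum A fun n _ => by positivity⟩

end HP

open Complex Real Finset
namespace HP
set_option linter.unusedSectionVars false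

noncomputable def av (w i : ℕ) : ℝ := 2^i * w
noncomputable def xs (L : ℝ) (w I i : ℕ) : ℝ := if i ≤ I then Real.exp (L / (20 * (av w i)^4)) else 0
noncomputable def blk (L : ℝ) (w I i : ℕ) : Finset ℕ := Ap (xs L w I i) \ Ap (xs L w I (i+1))
noncomputable def Ms (L K : ℝ) (w I i : ℕ) : ℕ := if i < I then 10 * (2^i * w)^3 else ⌈40 * K * Real.sqrt L⌉₊
noncomputable def Vs (L K : ℝ) (w I i : ℕ) : ℝ := if i < I then (av w i)^3 else 4 * K * Real.sqrt L

structure Lev (L K X0 : ℝ) (w I : ℕ) : Prop where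
  hw : 4 ≤ w
  hK : 1 ≤ K
  hX : 3 ≤ X0
  hL : 1 ≤ L
  h1 : xs L w I I ≤ L
  h2 : X0 ≤ xs L w I I
  h3 : 2 * (40 * K * Real.sqrt L + 1) * (L / (20 * (av w I)^4)) ≤ L / 10

section
variable {L K X0 : ℝ} {w I : ℕ}

lemma av_pos (h : Lev L K X0 w I) (i : ℕ) : 0 < av w i := by
  have : 0 < w := by have := h.hw; omega
  unfold av; positivity

lemma av_ge (h : Lev L K X0 w I) (i : ℕ) : 4 * 2^i ≤ av w i := by
  have : (4:ℝ) ≤ w := by exact_mod_cast h.hw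
  unfold av; rw [mul_comm]; exact mul_le_mul_of_nonneg_left this (by positivity)

lemma av_succ (h : Lev L K X0 w I) (i : ℕ) : av w (i+1) = 2 * av w i := by unfold av; ring

lemma xs_of_le (h : Lev L K X0 w I) {i : ℕ} (hi : i ≤ I) : xs L w I i = Real.exp (L / (20 * (av w i)^4)) := by simp [xs, hi]

lemma xs_nonneg (h : Lev L K X0 w I) (i : ℕ) : 0 ≤ xs L w I i := by unfold xs; split_ifs <;> positivity

lemma xs_step (h : Lev L K X0 w I) {i : ℕ} (hi : i < I) : xs L w I i = xs L w I (i+1) ^ 16 := by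
  rw [xs_of_le h hi.le, xs_of_le h (by omega), ← Real.exp_nat_mul, av_succ h]
  have := av_pos h i
  congr 1
  field_simp; push_cast; ring

lemma xs_succ_le (h : Lev L K X0 w I) (i : ℕ) : xs L w I (i+1) ≤ xs L w I i := by
  by_cases hi : i + 1 ≤ I
  · rw [xs_of_le h hi, xs_of_le h (by omega), av_succ h]
    apply Real.exp_le_exp.mpr
    have := av_pos h i
    have := h.hL
    apply div_le_div_of_nonneg_left (by linarith) (by positivity)
    have : av w i ≤ 2 * av w i := by linarith
    gcongr
  · have : xs L w I (i+1) = 0 := by simp [xs, hi]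
    rw [this]; exact xs_nonneg h i

lemma xs_anti (h : Lev L K X0 w I) : Antitone (xs L w I) := antitone_nat_of_succ_le (xs_succ_le h)

lemma Ap_mono (h : Lev L K X0 w I) {x y : ℝ} (hx : 0 ≤ x) (hxy : x ≤ y) : Ap x ⊆ Ap y := by
  intro p hp
  rw [mem_Ap hx] at hp
  rw [mem_Ap (hx.trans hxy)]; exact ⟨hp.1, hp.2.trans hxy⟩

lemma blk_sub (h : Lev L K X0 w I) (i : ℕ) : blk L w I i ⊆ Ap (xs L w I i) := sdiff_subset

lemma blk_disj (h : Lev L K X0 w I) {i j : ℕ} (hij : i < j) : Disjoint (blk L w I i) (blk L w I j) := by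
  rw [Finset.disjoint_left]
  intro p hp hp'
  have h1 := Ap_mono h (xs_nonneg h j) (xs_anti h (show i + 1 ≤ j by omega)) (blk_sub h j hp')
  exact (mem_sdiff.mp hp).2 h1

lemma blk_disj' (h : Lev L K X0 w I) {i j : ℕ} (hij : i ≠ j) : Disjoint (blk L w I i) (blk L w I j) := by
  rcases lt_or_gt_of_ne hij with h' | h'
  · exact blk_disj h h'
  · exact (blk_disj h h').symm

lemma sum_split (h : Lev L K X0 w I) {β : Type*} [AddCommGroup β] (f : ℕ → β) {i : ℕ} (hi : i ≤ I) :
    ∑ p ∈ Ap (xs L w I i), f p = ∑ j ∈ Icc i I, ∑ p ∈ blk L w I j, f p := by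
  have e : ∀ j, ∑ p ∈ blk L w I j, f p = ∑ p ∈ Ap (xs L w I j), f p - ∑ p ∈ Ap (xs L w I (j+1)), f p := by
    intro j
    rw [eq_sub_iff_add_eq]
    exact Finset.sum_sdiff (Ap_mono h (xs_nonneg h _) (xs_succ_le h j))
  have e2 : ∀ n, i ≤ n → ∑ j ∈ Ico i n, ∑ p ∈ blk L w I j, f p = ∑ p ∈ Ap (xs L w I i), f p - ∑ p ∈ Ap (xs L w I n), f p := by
    intro n hn
    induction n, hn using Nat.le_induction with
    | base => simp
    | succ n hn ih => rw [Finset.sum_Ico_succ_top hn, ih, e n]; abel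
  have e3 : Ap (xs L w I (I+1)) = ∅ := by
    have : xs L w I (I+1) = 0 := by simp [xs]
    rw [this]; simp [Ap]
  have : Icc i I = Ico i (I+1) := by ext; simp
  rw [this, e2 (I+1) (by omega), e3]; simp

lemma xs_ge (h : Lev L K X0 w I) {i : ℕ} (hi : i ≤ I) : X0 ≤ xs L w I i := h.h2.trans (xs_anti h hi)

lemma Vs_pos (h : Lev L K X0 w I) (i : ℕ) : 0 < Vs L K w I i := by
  have := av_pos h i
  have := h.hK
  have := h.hL
  unfold Vs; split_ifs <;> positivity

lemma Ms_ge (h : Lev L K X0 w I) (i : ℕ) : 10 * Vs L K w I i ≤ Ms L K w I i := by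
  unfold Ms Vs; split_ifs
  · unfold av; push_cast; exact le_rfl
  · refine le_trans (le_of_eq ?_) (Nat.le_ceil _); ring

lemma sum_inv_Vs (h : Lev L K X0 w I) {i : ℕ} (hi : i ≤ I) : ∑ j ∈ Icc i I, 2 / Vs L K w I j ≤ 6 := by
  have b1 : ∀ j, j < I → 2 / Vs L K w I j ≤ 2 * (1/2:ℝ)^j := by
    intro j hj
    have h0 : Vs L K w I j = (av w j)^3 := by simp [Vs, hj]
    have h1 : (2:ℝ)^j ≤ (av w j)^3 := by
      have h3 := av_ge h j
      have h2 : (1:ℝ) ≤ 2^j := one_le_pow₀ (by norm_num)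
      have h4 : (2:ℝ)^j ≤ av w j := by linarith
      calc (2:ℝ)^j ≤ av w j := h4
        _ = (av w j)^1 := by ring
        _ ≤ (av w j)^3 := pow_le_pow_right₀ (by linarith) (by norm_num)
    rw [h0, one_div, inv_pow, ← div_eq_mul_inv]
    exact div_le_div_of_nonneg_left (by norm_num) (by positivity) h1
  have b2 : 2 / Vs L K w I I ≤ 2 := by
    have h0 : Vs L K w I I = 4 * K * Real.sqrt L := by simp [Vs]
    have h1 : 1 ≤ Real.sqrt L := by rw [Real.one_le_sqrt]; exact h.hL
    have := h.hK
    rw [h0, div_le_iff₀ (by positivity)]; nlinarith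
  have e : Icc i I = Ico i (I+1) := by ext; simp
  rw [e, Finset.sum_Ico_succ_top hi]
  have s1 : ∑ j ∈ Ico i I, 2 / Vs L K w I j ≤ ∑ j ∈ range I, 2 * (1/2:ℝ)^j := by
    refine (Finset.sum_le_sum fun j hj => b1 j (by simp at hj; omega)).trans ?_
    refine Finset.sum_le_sum_of_subset_of_nonneg (fun j hj => by simp at hj ⊢; omega) fun j _ _ => by positivity
  have s2 : ∑ j ∈ range I, 2 * (1/2:ℝ)^j ≤ 4 := by
    rw [← Finset.mul_sum]
    have := sum_geometric_two_le I
    linarith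
  linarith

lemma exp_blocks (h : Lev L K X0 w I) {q : ℕ} [NeZero q] (c e : ℕ → ℂ) (χ : DirichletCharacter ℂ q) {i : ℕ} (hi : i ≤ I)
    (hg : ∀ j ∈ Icc i I, ‖PX c e (blk L w I j) χ‖ ≤ Vs L K w I j) :
    Real.exp (PX c e (Ap (xs L w I i)) χ).re ≤ Real.exp 6 * ∏ j ∈ Icc i I, ‖Tr (Ms L K w I j) (PX c e (blk L w I j) χ / 2)‖^2 := by
  unfold PX
  rw [sum_split h _ hi, Complex.re_sum, Real.exp_sum]
  calc _ ≤ ∏ j ∈ Icc i I, (Real.exp (2 / Vs L K w I j) * ‖Tr (Ms L K w I j) (PX c e (blk L w I j) χ / 2)‖^2) := by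
        refine Finset.prod_le_prod (fun _ _ => (Real.exp_pos _).le) fun j hj => ?_
        exact Tr_lower (Vs_pos h j) (hg j hj) (Ms_ge h j)
    _ = Real.exp (∑ j ∈ Icc i I, 2 / Vs L K w I j) * ∏ j ∈ Icc i I, ‖Tr (Ms L K w I j) (PX c e (blk L w I j) χ / 2)‖^2 := by
        rw [Finset.prod_mul_distrib, Real.exp_sum]
    _ ≤ _ := by
        refine mul_le_mul_of_nonneg_right (Real.exp_le_exp.mpr (sum_inv_Vs h hi)) (Finset.prod_nonneg fun _ _ => by positivity)

lemma deg_blocks (h : Lev L K X0 w I) {i : ℕ} (hi : i ≤ I) : ∏ j ∈ Icc i I, (xs L w I j ^ 2) ^ Ms L K w I j ≤ Real.exp (6/10 * L) := by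
  have hL := h.hL
  have e0 : ∀ j ∈ Icc i I, (xs L w I j ^ 2) ^ Ms L K w I j = Real.exp (2 * Ms L K w I j * (L / (20 * (av w j)^4))) := by
    intro j hj
    rw [mem_Icc] at hj
    rw [xs_of_le h hj.2, ← pow_mul, ← Real.exp_nat_mul]; push_cast; ring_nf
  rw [Finset.prod_congr rfl e0, ← Real.exp_sum]
  apply Real.exp_le_exp.mpr
  have b1 : ∀ j, j < I → 2 * Ms L K w I j * (L / (20 * (av w j)^4)) ≤ L/4 * (1/2:ℝ)^j := by
    intro j hj
    have h0 : (Ms L K w I j : ℝ) = 10 * (av w j)^3 := by simp [Ms, hj, av]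
    have hp := av_pos h j
    have : 2 * (10 * (av w j)^3) * (L / (20 * (av w j)^4)) = L / av w j := by field_simp; ring
    rw [h0, this]
    have : L/4 * (1/2:ℝ)^j = L / (4 * 2^j) := by rw [one_div, inv_pow]; field_simp
    rw [this]
    exact div_le_div_of_nonneg_left (by linarith) (by positivity) (av_ge h j)
  have b2 : 2 * Ms L K w I I * (L / (20 * (av w I)^4)) ≤ L/10 := by
    refine le_trans ?_ h.h3
    have h0 : (Ms L K w I I : ℝ) ≤ 40 * K * Real.sqrt L + 1 := by
      have : Ms L K w I I = ⌈40 * K * Real.sqrt L⌉₊ := by simp [Ms]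
      rw [this]
      have hK := h.hK
      exact (Nat.ceil_lt_add_one (by positivity)).le
    have hp := av_pos h I
    refine mul_le_mul_of_nonneg_right (by linarith) (by positivity)
  have e : Icc i I = Ico i (I+1) := by ext; simp
  rw [e, Finset.sum_Ico_succ_top hi]
  have s1 : ∑ j ∈ Ico i I, 2 * Ms L K w I j * (L / (20 * (av w j)^4)) ≤ ∑ j ∈ range I, L/4 * (1/2:ℝ)^j := by
    refine (Finset.sum_le_sum fun j hj => b1 j (by simp at hj; omega)).trans ?_
    refine Finset.sum_le_sum_of_subset_of_nonneg (fun j hj => by simp at hj ⊢; omega) fun j _ _ => by positivity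
  have s2 : ∑ j ∈ range I, L/4 * (1/2:ℝ)^j ≤ L/4*2 := by
    rw [← Finset.mul_sum]
    have := sum_geometric_two_le I
    exact mul_le_mul_of_nonneg_left this (by linarith)
  linarith

end

/-- Product of one-prime factors. -/
lemma prod_E5 (K : ℝ) (hK : 1 ≤ K) : ∃ C2 : ℝ, ∀ (m : ℕ → ℝ) (A B : Finset ℕ), A ⊆ B → (∀ p, 0 ≤ m p) → (∀ p ∈ B, p.Prime) →
    (∀ p, m p ≤ K / Real.sqrt p) → ∏ p ∈ A, E5 1 (m p) (K/p) ≤ Real.exp (1/4 * ∑ p ∈ B, m p^2 + C2) := by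
  obtain ⟨C, hC, hC'⟩ := sum_three_halves
  refine ⟨(K^2 + 8 * K^3 * Real.exp (2*K)) * C, ?_⟩
  intro m A B hAB hm hB hmK
  have h1 : ∀ p ∈ A, E5 1 (m p) (K/p) ≤ Real.exp (1/4 * m p^2 + (K^2 + 8 * K^3 * Real.exp (2*K)) * (p:ℝ)^(-(3/2):ℝ)) := by
    intro p hp
    have hp1 := (hB p (hAB hp)).one_le
    have hp1r : (1:ℝ) ≤ p := by exact_mod_cast hp1
    have hs : 1 ≤ Real.sqrt p := by rw [Real.one_le_sqrt]; exact hp1r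
    have hss : Real.sqrt p ^ 2 = p := Real.sq_sqrt (by linarith)
    have hr : (p:ℝ)^(-(3/2):ℝ) = 1 / Real.sqrt p ^ 3 := by
      rw [Real.sqrt_eq_rpow, ← Real.rpow_natCast, ← Real.rpow_mul (by linarith), Real.rpow_neg (by linarith), one_div]
      norm_num
    refine (E5_one (hm p) (by positivity)).trans (Real.exp_le_exp.mpr ?_)
    have hKp : K/p ≤ K / Real.sqrt p := by
      apply div_le_div_of_nonneg_left (by linarith) (by linarith)
      nlinarith
    have hmd : m p + K/p ≤ 2*K / Real.sqrt p := by
      have := hmK p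
      have e : 2*K / Real.sqrt p = K / Real.sqrt p + K / Real.sqrt p := by ring
      rw [e]; linarith
    have hmd0 : 0 ≤ m p + K/p := add_nonneg (hm p) (by positivity)
    have hmd2 : m p + K/p ≤ 2*K := hmd.trans (div_le_self (by linarith) hs)
    have i1 : (K/p)^2/4 ≤ K^2 * (1 / Real.sqrt p ^ 3) := by
      have : (K/p)^2/4 = K^2 * (1/(4 * Real.sqrt p ^ 4)) := by
        have : Real.sqrt p ^ 4 = (p:ℝ)^2 := by
          calc Real.sqrt p ^ 4 = (Real.sqrt p ^ 2)^2 := by ring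
            _ = _ := by rw [hss]
        rw [this]; ring
      rw [this]
      refine mul_le_mul_of_nonneg_left ?_ (by positivity)
      apply one_div_le_one_div_of_le (by positivity)
      have : 0 < Real.sqrt p ^ 3 := by positivity
      nlinarith
    have i2 : (m p + K/p)^3 * Real.exp (m p + K/p) ≤ 8 * K^3 * Real.exp (2*K) * (1 / Real.sqrt p ^ 3) := by
      calc (m p + K/p)^3 * Real.exp (m p + K/p) ≤ (2*K / Real.sqrt p)^3 * Real.exp (2*K) :=
            mul_le_mul (pow_le_pow_left₀ hmd0 hmd 3) (Real.exp_le_exp.mpr hmd2) (Real.exp_pos _).le (by positivity)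
        _ = _ := by rw [div_pow]; ring
    rw [hr]; linarith
  calc ∏ p ∈ A, E5 1 (m p) (K/p) ≤ ∏ p ∈ A, Real.exp (1/4 * m p^2 + (K^2 + 8 * K^3 * Real.exp (2*K)) * (p:ℝ)^(-(3/2):ℝ)) :=
        Finset.prod_le_prod (fun p _ => (E5_pos _ _ _).le) h1
    _ = Real.exp (1/4 * ∑ p ∈ A, m p^2 + (K^2 + 8 * K^3 * Real.exp (2*K)) * ∑ p ∈ A, (p:ℝ)^(-(3/2):ℝ)) := by
        rw [← Real.exp_sum, Finset.sum_add_distrib, Finset.mul_sum, Finset.mul_sum]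
    _ ≤ _ := by
        apply Real.exp_le_exp.mpr
        have j1 : ∑ p ∈ A, m p^2 ≤ ∑ p ∈ B, m p^2 := Finset.sum_le_sum_of_subset_of_nonneg hAB fun _ _ _ => by positivity
        have j2 := mul_le_mul_of_nonneg_left (hC' A) (show 0 ≤ (K^2 + 8 * K^3 * Real.exp (2*K)) by positivity)
        linarith

/-- Extra block factor. -/
lemma prod_E5_extra {K x l : ℝ} (hK : 1 ≤ K) (hx : 3 ≤ x) (m : ℕ → ℝ) (hm : ∀ p, 0 ≤ m p) (hmK : ∀ p, m p ≤ K / Real.sqrt p) :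
    ∏ p ∈ Ap (x^16) \ Ap x, E5 (2*l) (m p) (K/p) ≤ Real.exp (152 * K^2 * l^2) := by
  have h1 : ∀ p ∈ Ap (x^16) \ Ap x, E5 (2*l) (m p) (K/p) ≤ Real.exp (8 * K^2 * l^2 * (1/p)) := by
    intro p hp
    rw [mem_sdiff, mem_Ap (by positivity)] at hp
    have hp1r : (1:ℝ) ≤ p := by exact_mod_cast hp.1.1.one_le
    have hs : 1 ≤ Real.sqrt p := by rw [Real.one_le_sqrt]; exact hp1r
    have hss : Real.sqrt p ^ 2 = p := Real.sq_sqrt (by linarith)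
    refine (E5_hoeff (hm p) (by positivity)).trans (Real.exp_le_exp.mpr ?_)
    have hKp : K/p ≤ K / Real.sqrt p := by
      apply div_le_div_of_nonneg_left (by linarith) (by linarith)
      nlinarith
    have hmd : m p + K/p ≤ 2*K / Real.sqrt p := by
      have := hmK p
      have e : 2*K / Real.sqrt p = K / Real.sqrt p + K / Real.sqrt p := by ring
      rw [e]; linarith
    have hmd0 : 0 ≤ m p + K/p := add_nonneg (hm p) (by positivity)
    have := pow_le_pow_left₀ hmd0 hmd 2
    rw [div_pow, hss] at this
    calc (2*l*(m p + K/p))^2/2 = 2*l^2*(m p + K/p)^2 := by ring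
      _ ≤ 2*l^2*((2*K)^2/p) := mul_le_mul_of_nonneg_left this (by positivity)
      _ = _ := by ring
  refine (Finset.prod_le_prod (fun p _ => (E5_pos _ _ _).le) h1).trans ?_
  rw [← Real.exp_sum, ← Finset.mul_sum]
  apply Real.exp_le_exp.mpr
  have := mul_le_mul_of_nonneg_left (block_sum hx) (show 0 ≤ 8 * K^2 * l^2 by positivity)
  linarith

end HP

open Complex Real Finset
namespace HP
set_option linter.unusedSectionVars false

section
variable {L K X0 : ℝ} {w I : ℕ} {q : ℕ} [NeZero q]

lemma q_eq (h : Lev L K X0 w I) (hq : Real.log q = L) : (q:ℝ) = Real.exp L := by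
  have : 0 < (q:ℝ) := by exact_mod_cast Nat.pos_of_ne_zero (NeZero.ne q)
  rw [← hq, Real.exp_log this]

lemma xs_le_q (h : Lev L K X0 w I) (hq : Real.log q = L) (i : ℕ) : xs L w I i ≤ q := by
  rw [q_eq h hq]
  unfold xs
  split_ifs with hi
  · apply Real.exp_le_exp.mpr
    have h1 := av_ge h i
    have h2 : (1:ℝ) ≤ 2^i := one_le_pow₀ (by norm_num)
    have h3 : 1 ≤ av w i := by linarith
    have h4 : 1 ≤ (av w i)^4 := one_le_pow₀ h3
    have := h.hL
    exact div_le_self (by linarith) (by linarith)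
  · positivity

lemma blk_mem (h : Lev L K X0 w I) (hq : Real.log q = L) {i p : ℕ} (hp : p ∈ blk L w I i) : p.Prime ∧ (p:ℝ) ≤ xs L w I i ∧ p ≤ q := by
  have h1 := blk_sub h i hp
  rw [mem_Ap (xs_nonneg h i)] at h1
  exact ⟨h1.1, h1.2, by exact_mod_cast h1.2.trans (xs_le_q h hq i)⟩

lemma last_good (h : Lev L K X0 w I) (c e : ℕ → ℂ) (m : ℕ → ℝ) (hc : ∀ p, ‖c p‖ ≤ m p) (hm : ∀ p, m p ≤ K / Real.sqrt p)
    (he : ∀ p, ‖e p‖ ≤ K / p) (χ : DirichletCharacter ℂ q) : ‖PX c e (blk L w I I) χ‖ ≤ Vs L K w I I := by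
  have hK := h.hK
  have h0 : Vs L K w I I = 4 * K * Real.sqrt L := by simp [Vs]
  unfold PX
  calc _ ≤ ∑ p ∈ blk L w I I, (2 * K) * (1 / Real.sqrt p) := by
        refine norm_sum_le_of_le _ fun p hp => ?_
        have h1 := blk_sub h I hp
        rw [mem_Ap (xs_nonneg h I)] at h1
        have hp1r : (1:ℝ) ≤ p := by exact_mod_cast h1.1.one_le
        have hs : 1 ≤ Real.sqrt p := by rw [Real.one_le_sqrt]; exact hp1r
        have hss : Real.sqrt p ^ 2 = p := Real.sq_sqrt (by linarith)
        have hKp : K/p ≤ K / Real.sqrt p := by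
          apply div_le_div_of_nonneg_left (by linarith) (by linarith)
          nlinarith
        have hx1 : ‖χ p‖ ≤ 1 := DirichletCharacter.norm_le_one χ _
        calc ‖c p * χ p + e p * χ p ^ 2‖ ≤ ‖c p‖ * ‖χ p‖ + ‖e p‖ * ‖χ p‖^2 := by
              refine (norm_add_le _ _).trans ?_
              rw [norm_mul, norm_mul, norm_pow]
          _ ≤ ‖c p‖ * 1 + ‖e p‖ * 1 := add_le_add (mul_le_mul_of_nonneg_left hx1 (norm_nonneg _))
              (mul_le_mul_of_nonneg_left (pow_le_one₀ (norm_nonneg _) hx1) (norm_nonneg _))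
          _ ≤ K / Real.sqrt p + K / Real.sqrt p := by
              have := hc p; have := hm p; have := he p; linarith
          _ = _ := by ring
    _ = (2*K) * ∑ p ∈ blk L w I I, 1 / Real.sqrt p := by rw [mul_sum]
    _ ≤ (2*K) * (2 * Real.sqrt L) := by
        refine mul_le_mul_of_nonneg_left ?_ (by linarith)
        refine (Finset.sum_le_sum_of_subset_of_nonneg (blk_sub h I) fun _ _ _ => by positivity).trans ?_
        refine (sum_Ap_sqrt (xs_nonneg h I)).trans ?_
        exact mul_le_mul_of_nonneg_left (Real.sqrt_le_sqrt h.h1) (by norm_num)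
    _ = _ := by rw [h0]; ring

/-- Pointwise bound. -/
lemma moment_pt (h : Lev L K X0 w I) (C1 : ℝ) (c e : ℕ → ℕ → ℂ) (m : ℕ → ℝ) (hc : ∀ i p, ‖c i p‖ ≤ m p) (hm : ∀ p, m p ≤ K / Real.sqrt p)
    (he : ∀ i p, ‖e i p‖ ≤ K / p) (χ : DirichletCharacter ℂ q) (Q : ℝ)
    (hQ : ∀ i ≤ I, Q ≤ Real.exp ((PX (c i) (e i) (Ap (xs L w I i)) χ).re + C1 * (20 * (av w i)^4))) :
    Q ≤ Real.exp (C1 * (20 * (av w 0)^4)) * Real.exp 6 * ((∏ j ∈ Icc 0 I, ‖Tr (Ms L K w I j) (PX (c 0) (e 0) (blk L w I j) χ / 2)‖^2) *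
          ‖PX (c 0) (e 0) ∅ χ‖ ^ (2*0)) +
      ∑ i ∈ range I, ∑ l ∈ range (i+1), Real.exp (C1 * (20 * (av w (i+1))^4)) * Real.exp 6 / (av w i ^ 3)^(2 * (2^i*w)^4) *
        ((∏ j ∈ Icc (i+1) I, ‖Tr (Ms L K w I j) (PX (c (i+1)) (e (i+1)) (blk L w I j) χ / 2)‖^2) *
          ‖PX (c l) (e l) (blk L w I i) χ‖ ^ (2 * (2^i*w)^4)) := by
  classical
  have key : ∀ i ≤ I, (∀ j ∈ Icc i I, ‖PX (c i) (e i) (blk L w I j) χ‖ ≤ Vs L K w I j) →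
      Q ≤ Real.exp (C1 * (20 * (av w i)^4)) * Real.exp 6 * ∏ j ∈ Icc i I, ‖Tr (Ms L K w I j) (PX (c i) (e i) (blk L w I j) χ / 2)‖^2 := by
    intro i hi hg
    refine (hQ i hi).trans ?_
    rw [Real.exp_add, mul_comm, mul_assoc]
    exact mul_le_mul_of_nonneg_left (exp_blocks h _ _ χ hi hg) (Real.exp_pos _).le
  have nn : ∀ i ∈ range I, ∀ l ∈ range (i+1), 0 ≤ Real.exp (C1 * (20 * (av w (i+1))^4)) * Real.exp 6 / (av w i ^ 3)^(2 * (2^i*w)^4) *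
        ((∏ j ∈ Icc (i+1) I, ‖Tr (Ms L K w I j) (PX (c (i+1)) (e (i+1)) (blk L w I j) χ / 2)‖^2) *
          ‖PX (c l) (e l) (blk L w I i) χ‖ ^ (2 * (2^i*w)^4)) := by
    intro i _ l _
    have := av_pos h i
    positivity
  obtain ⟨Bad, hBad⟩ : ∃ Bad : Finset ℕ, ∀ i, i ∈ Bad ↔ i ∈ range I ∧ ∃ l ∈ range (i+1), Vs L K w I i < ‖PX (c l) (e l) (blk L w I i) χ‖ :=
    ⟨(range I).filter (fun i => ∃ l ∈ range (i+1), Vs L K w I i < ‖PX (c l) (e l) (blk L w I i) χ‖), fun i => by simp⟩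
  have good : ∀ j ≤ I, j ∉ Bad → ∀ l ≤ j, ‖PX (c l) (e l) (blk L w I j) χ‖ ≤ Vs L K w I j := by
    intro j hj hb l hl
    rcases hj.eq_or_lt with rfl | hj
    · exact last_good h _ _ m (hc l) hm (he l) χ
    · by_contra hcon
      push Not at hcon
      exact hb (by rw [hBad]; exact ⟨mem_range.mpr hj, l, mem_range.mpr (by omega), hcon⟩)
  by_cases hne : Bad.Nonempty
  · set i := Bad.max' hne with hi
    have hiB : i ∈ Bad := Bad.max'_mem hne
    have hiB' := hiB
    rw [hBad] at hiB'
    obtain ⟨hiI, l, hl, hV⟩ := hiB'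
    have hiI' := mem_range.mp hiI
    have hk := key (i+1) (by omega) (by
      intro j hj
      rw [mem_Icc] at hj
      refine good j hj.2 (fun hb => ?_) _ hj.1
      have := Bad.le_max' j hb
      omega)
    have hVe : Vs L K w I i = av w i ^ 3 := by simp [Vs, hiI']
    rw [hVe] at hV
    have ha := av_pos h i
    refine le_trans ?_ (le_add_of_nonneg_left (by positivity))
    refine le_trans ?_ (Finset.single_le_sum (fun i hi => Finset.sum_nonneg (nn i hi)) hiI)
    refine le_trans ?_ (Finset.single_le_sum (nn i hiI) hl)
    refine hk.trans ?_
    have h1 : 1 ≤ ‖PX (c l) (e l) (blk L w I i) χ‖ ^ (2 * (2^i*w)^4) / (av w i ^ 3)^(2 * (2^i*w)^4) := by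
      rw [one_le_div (by positivity)]
      exact pow_le_pow_left₀ (by positivity) hV.le _
    calc _ ≤ (Real.exp (C1 * (20 * (av w (i+1))^4)) * Real.exp 6 * ∏ j ∈ Icc (i+1) I, ‖Tr (Ms L K w I j) (PX (c (i+1)) (e (i+1)) (blk L w I j) χ / 2)‖^2) *
          (‖PX (c l) (e l) (blk L w I i) χ‖ ^ (2 * (2^i*w)^4) / (av w i ^ 3)^(2 * (2^i*w)^4)) :=
          le_mul_of_one_le_right (by positivity) h1
      _ = _ := by ring
  · have hk := key 0 (by omega) (by
      intro j hj
      rw [mem_Icc] at hj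
      refine good j hj.2 (fun hb => hne ⟨j, hb⟩) _ hj.1)
    refine le_trans ?_ (le_add_of_nonneg_right (Finset.sum_nonneg fun i hi => Finset.sum_nonneg (nn i hi)))
    simpa using hk

lemma blk_sub_q (h : Lev L K X0 w I) (hq : Real.log q = L) (J : Finset ℕ) : J.biUnion (blk L w I) ⊆ Ap q := by
  intro p hp
  rw [mem_biUnion] at hp
  obtain ⟨j, _, hj⟩ := hp
  have := blk_mem h hq hj
  rw [mem_Ap (by positivity)]
  exact ⟨this.1, by exact_mod_cast this.2.2⟩

lemma prod_J (h : Lev L K X0 w I) (hq : Real.log q = L) {C2 : ℝ} {m : ℕ → ℝ} (hm0 : ∀ p, 0 ≤ m p) (hm : ∀ p, m p ≤ K / Real.sqrt p)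
    (hC2 : ∀ (m : ℕ → ℝ) (A B : Finset ℕ), A ⊆ B → (∀ p, 0 ≤ m p) → (∀ p ∈ B, p.Prime) →
    (∀ p, m p ≤ K / Real.sqrt p) → ∏ p ∈ A, E5 1 (m p) (K/p) ≤ Real.exp (1/4 * ∑ p ∈ B, m p^2 + C2)) (J : Finset ℕ) :
    ∏ j ∈ J, ∏ p ∈ blk L w I j, E5 1 (m p) (K/p) ≤ Real.exp (1/4 * ∑ p ∈ Ap q, m p^2 + C2) := by
  rw [← Finset.prod_biUnion (fun i _ j _ hij => blk_disj' h hij)]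
  exact hC2 m _ _ (blk_sub_q h hq J) hm0 (fun p hp => ((mem_Ap (by positivity)).mp hp).1) hm

lemma T0_bd (h : Lev L K X0 w I) (hq : Real.log q = L) {C2 : ℝ} {m : ℕ → ℝ} (hm0 : ∀ p, 0 ≤ m p) (hm : ∀ p, m p ≤ K / Real.sqrt p)
    (hC2 : ∀ (m : ℕ → ℝ) (A B : Finset ℕ), A ⊆ B → (∀ p, 0 ≤ m p) → (∀ p ∈ B, p.Prime) →
    (∀ p, m p ≤ K / Real.sqrt p) → ∏ p ∈ A, E5 1 (m p) (K/p) ≤ Real.exp (1/4 * ∑ p ∈ B, m p^2 + C2))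
    (c e : ℕ → ℂ) (hc : ∀ p, ‖c p‖ ≤ m p) (he : ∀ p, ‖e p‖ ≤ K / p) :
    ∑ χ : DirichletCharacter ℂ q, ((∏ j ∈ Icc 0 I, ‖Tr (Ms L K w I j) (PX c e (blk L w I j) χ / 2)‖^2) * ‖PX c e ∅ χ‖ ^ (2*0)) ≤
      q.totient * Real.exp (1/4 * ∑ p ∈ Ap q, m p^2 + C2) := by
  have h0 := MV_main (q := q) (Icc 0 I) (blk L w I) (xs L w I) (Ms L K w I) ∅ 1 0 1 one_pos c e c e m (fun p => K/p) hc he hc he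
    (fun j hj => by
      have := xs_ge h (mem_Icc.mp hj).2
      have := h.hX; linarith) le_rfl (fun j _ p hp => blk_mem h hq hp) (by simp)
    (fun i _ j _ hij => blk_disj' h hij) (by simp) (by
      have := deg_blocks h (Nat.zero_le I)
      simp only [pow_zero, mul_one]
      refine this.trans_lt ?_
      rw [q_eq h hq]
      have := h.hL
      exact Real.exp_lt_exp.mpr (by linarith))
  refine h0.trans ?_
  refine mul_le_mul_of_nonneg_left ?_ (by positivity)
  simpa using prod_J h hq hm0 hm hC2 (Icc 0 I)

lemma Ti_bd (h : Lev L K X0 w I) (hq : Real.log q = L) {C2 : ℝ} {m : ℕ → ℝ} (hm0 : ∀ p, 0 ≤ m p) (hm : ∀ p, m p ≤ K / Real.sqrt p)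
    (hC2 : ∀ (m : ℕ → ℝ) (A B : Finset ℕ), A ⊆ B → (∀ p, 0 ≤ m p) → (∀ p ∈ B, p.Prime) →
    (∀ p, m p ≤ K / Real.sqrt p) → ∏ p ∈ A, E5 1 (m p) (K/p) ≤ Real.exp (1/4 * ∑ p ∈ B, m p^2 + C2))
    (c e c' e' : ℕ → ℂ) (hc : ∀ p, ‖c p‖ ≤ m p) (he : ∀ p, ‖e p‖ ≤ K / p) (hc' : ∀ p, ‖c' p‖ ≤ m p) (he' : ∀ p, ‖e' p‖ ≤ K / p)
    {i : ℕ} (hi : i < I) (N : ℕ) (hN : N = (2^i*w)^4) :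
    ∑ χ : DirichletCharacter ℂ q, ((∏ j ∈ Icc (i+1) I, ‖Tr (Ms L K w I j) (PX c e (blk L w I j) χ / 2)‖^2) * ‖PX c' e' (blk L w I i) χ‖ ^ (2*N)) ≤
      q.totient * ((N:ℝ)^N * (Real.exp (1/4 * ∑ p ∈ Ap q, m p^2 + C2) * Real.exp (152 * K^2 * N))) := by
  have hNr : (N:ℝ) = (av w i)^4 := by rw [hN]; push_cast; rfl
  have ha := av_pos h i
  have hN0 : (0:ℝ) < N := by rw [hNr]; positivity
  have h0 := MV_main (q := q) (Icc (i+1) I) (blk L w I) (xs L w I) (Ms L K w I) (blk L w I i) (xs L w I i) N (Real.sqrt N) (by positivity)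
    c e c' e' m (fun p => K/p) hc he hc' he'
    (fun j hj => by
      have := xs_ge h (mem_Icc.mp hj).2
      have := h.hX; linarith) (by
      have := xs_ge h hi.le
      have := h.hX; linarith) (fun j _ p hp => blk_mem h hq hp) (fun p hp => blk_mem h hq hp)
    (fun i _ j _ hij => blk_disj' h hij) (fun j hj => blk_disj' h (by rw [mem_Icc] at hj; omega)) (by
      have h1 := deg_blocks h (show i+1 ≤ I by omega)
      have hL := h.hL
      have h2 : (xs L w I i ^ 2)^N = Real.exp (L/10) := by
        rw [xs_of_le h hi.le, ← pow_mul, ← Real.exp_nat_mul]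
        congr 1
        push_cast; rw [hNr]; field_simp; ring
      rw [h2, q_eq h hq]
      calc _ ≤ Real.exp (6/10*L) * Real.exp (L/10) := mul_le_mul_of_nonneg_right h1 (Real.exp_pos _).le
        _ = Real.exp (7/10*L) := by rw [← Real.exp_add]; ring_nf
        _ < _ := Real.exp_lt_exp.mpr (by linarith))
  refine h0.trans ?_
  refine mul_le_mul_of_nonneg_left ?_ (by positivity)
  refine mul_le_mul ?_ ?_ (mul_nonneg (Finset.prod_nonneg fun _ _ => Finset.prod_nonneg fun _ _ => (E5_pos _ _ _).le) (Finset.prod_nonneg fun _ _ => (E5_pos _ _ _).le)) (by positivity)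
  · rw [div_pow, div_le_iff₀ (by positivity), ← pow_mul, mul_comm N 2, pow_mul, Real.sq_sqrt hN0.le]
    have : (N.factorial:ℝ) ≤ (N:ℝ)^N := by exact_mod_cast Nat.factorial_le_pow N
    calc (N.factorial:ℝ)^2 ≤ ((N:ℝ)^N)^2 := pow_le_pow_left₀ (by positivity) this 2
      _ = _ := by ring
  · refine mul_le_mul (prod_J h hq hm0 hm hC2 _) ?_ (Finset.prod_nonneg fun _ _ => (E5_pos _ _ _).le) (Real.exp_pos _).le
    have h3 := prod_E5_extra (l := Real.sqrt N) h.hK (h.hX.trans (xs_ge h (show i+1 ≤ I by omega))) m hm0 hm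
    rw [← xs_step h hi, Real.sq_sqrt hN0.le] at h3
    exact h3

/-- numeric bound -/
lemma num_i (h : Lev L K X0 w I) {C1 : ℝ} (hD : 2 * Real.exp (320 * C1 + 152 * K^2) ≤ (w:ℝ)^2) (i N : ℕ) (hN : N = (2^i*w)^4) :
    Real.exp (C1 * (20 * (av w (i+1))^4)) / (av w i ^ 3)^(2 * N) * ((N:ℝ)^N * Real.exp (152 * K^2 * N)) ≤ (1/2:ℝ)^(2*i) := by
  have hNr : (N:ℝ) = (av w i)^4 := by rw [hN]; push_cast; rfl
  have ha := av_pos h i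
  have hwr : (4:ℝ) ≤ w := by exact_mod_cast h.hw
  have e1 : Real.exp (C1 * (20 * (av w (i+1))^4)) = Real.exp (320 * C1) ^ N := by
    rw [← Real.exp_nat_mul, hNr, av_succ h]; congr 1; ring
  have e2 : Real.exp (152 * K^2 * N) = Real.exp (152 * K^2)^N := by
    rw [← Real.exp_nat_mul]; congr 1; ring
  have e3 : Real.exp (C1 * (20 * (av w (i+1))^4)) / (av w i ^ 3)^(2 * N) * ((N:ℝ)^N * Real.exp (152 * K^2 * N)) =
      (Real.exp (320 * C1 + 152 * K^2) / (av w i)^2)^N := by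
    rw [e1, e2, hNr, div_pow, Real.exp_add, mul_pow, ← pow_mul, ← pow_mul, ← pow_mul, div_mul_eq_mul_div, div_eq_div_iff (by positivity) (by positivity)]
    have : av w i ^ (3 * (2*N)) = av w i ^ (4*N) * av w i ^ (2*N) := by rw [← pow_add]; congr 1; ring
    rw [this]; ring
  rw [e3]
  have h1 : Real.exp (320 * C1 + 152 * K^2) / (av w i)^2 ≤ 1/2 := by
    rw [div_le_iff₀ (by positivity)]
    have : (w:ℝ) ≤ av w i := by
      unfold av
      exact le_mul_of_one_le_left (by positivity) (one_le_pow₀ (by norm_num))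
    have := pow_le_pow_left₀ (by positivity) this 2
    linarith
  refine (pow_le_pow_left₀ (by positivity) h1 N).trans ?_
  apply pow_le_pow_of_le_one (by norm_num) (by norm_num)
  rw [hN]
  have hi : i < 2^i := Nat.lt_two_pow_self
  have hw := h.hw
  have h5 : 2 * i ≤ 2^i*w := by nlinarith
  have h6 : 1 ≤ 2^i*w := by nlinarith
  calc 2*i ≤ 2^i*w := h5
    _ = (2^i*w)^1 := by ring
    _ ≤ _ := Nat.pow_le_pow_right h6 (by norm_num)

set_option maxHeartbeats 1000000 in
lemma moment_core (h : Lev L K X0 w I) {C1 C2 : ℝ} (hq : Real.log q = L) (hC1 : 0 ≤ C1) (hD : 2 * Real.exp (320 * C1 + 152 * K^2) ≤ (w:ℝ)^2) {m : ℕ → ℝ} (hm : ∀ p, m p ≤ K / Real.sqrt p)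
    (hC2 : ∀ (m : ℕ → ℝ) (A B : Finset ℕ), A ⊆ B → (∀ p, 0 ≤ m p) → (∀ p ∈ B, p.Prime) →
    (∀ p, m p ≤ K / Real.sqrt p) → ∏ p ∈ A, E5 1 (m p) (K/p) ≤ Real.exp (1/4 * ∑ p ∈ B, m p^2 + C2))
    (c e : ℝ → ℕ → ℂ) (hc : ∀ x p, ‖c x p‖ ≤ m p) (he : ∀ x p, ‖e x p‖ ≤ K / p)
    (S : Finset (DirichletCharacter ℂ q)) (Q : DirichletCharacter ℂ q → ℝ)
    (hQ : ∀ χ ∈ S, ∀ x : ℝ, X0 ≤ x → x ≤ q → Q χ ≤ Real.exp ((PX (c x) (e x) (Ap x) χ).re + C1 * Real.log q / Real.log x)) :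
    ∑ χ ∈ S, Q χ ≤ (Real.exp (C1 * (20 * (w:ℝ)^4)) + 2) * Real.exp 6 * Real.exp C2 * q.totient * Real.exp (1/4 * ∑ p ∈ Ap q, m p^2) := by
  classical
  have hL := h.hL
  have hm0 : ∀ p, 0 ≤ m p := fun p => (norm_nonneg _).trans (hc 0 p)
  have hQ' : ∀ χ ∈ S, ∀ i ≤ I, Q χ ≤ Real.exp ((PX (c (xs L w I i)) (e (xs L w I i)) (Ap (xs L w I i)) χ).re + C1 * (20 * (av w i)^4)) := by
    intro χ hχ i hi
    refine (hQ χ hχ (xs L w I i) (xs_ge h hi) (xs_le_q h hq i)).trans (le_of_eq ?_)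
    have ha := av_pos h i
    congr 2
    rw [hq, xs_of_le h hi, Real.log_exp]
    field_simp
  have hpt := fun χ hχ => moment_pt h C1 (fun i => c (xs L w I i)) (fun i => e (xs L w I i)) m (fun i p => hc _ p) hm (fun i p => he _ p) χ (Q χ) (hQ' χ hχ)
  set F0 : DirichletCharacter ℂ q → ℝ := fun χ => (∏ j ∈ Icc 0 I, ‖Tr (Ms L K w I j) (PX (c (xs L w I 0)) (e (xs L w I 0)) (blk L w I j) χ / 2)‖^2) *
          ‖PX (c (xs L w I 0)) (e (xs L w I 0)) ∅ χ‖ ^ (2*0) with hF0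
  set F : ℕ → ℕ → DirichletCharacter ℂ q → ℝ := fun i l χ => (∏ j ∈ Icc (i+1) I, ‖Tr (Ms L K w I j) (PX (c (xs L w I (i+1))) (e (xs L w I (i+1))) (blk L w I j) χ / 2)‖^2) *
          ‖PX (c (xs L w I l)) (e (xs L w I l)) (blk L w I i) χ‖ ^ (2 * (2^i*w)^4) with hF
  set G := Real.exp (1/4 * ∑ p ∈ Ap q, m p^2 + C2) with hG
  have b0 : ∑ χ, F0 χ ≤ q.totient * G := T0_bd h hq hm0 hm hC2 _ _ (hc _) (he _)
  have bF : ∀ i ∈ range I, ∀ l ∈ range (i+1), Real.exp (C1 * (20 * (av w (i+1))^4)) * Real.exp 6 / (av w i ^ 3)^(2 * (2^i*w)^4) * ∑ χ, F i l χ ≤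
      Real.exp 6 * q.totient * G * (1/2:ℝ)^(2*i) := by
    intro i hi l hl
    have h1 := Ti_bd h hq hm0 hm hC2 (c (xs L w I (i+1))) (e (xs L w I (i+1))) (c (xs L w I l)) (e (xs L w I l)) (hc _) (he _) (hc _) (he _) (mem_range.mp hi) _ rfl
    have h2 := num_i h hD i _ rfl
    have ha := av_pos h i
    refine (mul_le_mul_of_nonneg_left h1 (by positivity)).trans ?_
    have h3 := mul_le_mul_of_nonneg_left h2 (show 0 ≤ Real.exp 6 * q.totient * G by positivity)
    refine le_trans (le_of_eq ?_) h3
    ring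
  have nF0 : ∀ χ, 0 ≤ F0 χ := fun χ => by rw [hF0]; positivity
  have nF : ∀ i l χ, 0 ≤ F i l χ := fun i l χ => by rw [hF]; positivity
  calc ∑ χ ∈ S, Q χ ≤ ∑ χ ∈ S, (Real.exp (C1 * (20 * (av w 0)^4)) * Real.exp 6 * F0 χ +
      ∑ i ∈ range I, ∑ l ∈ range (i+1), Real.exp (C1 * (20 * (av w (i+1))^4)) * Real.exp 6 / (av w i ^ 3)^(2 * (2^i*w)^4) * F i l χ) :=
        Finset.sum_le_sum fun χ hχ => hpt χ hχ
    _ ≤ ∑ χ, (Real.exp (C1 * (20 * (av w 0)^4)) * Real.exp 6 * F0 χ +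
      ∑ i ∈ range I, ∑ l ∈ range (i+1), Real.exp (C1 * (20 * (av w (i+1))^4)) * Real.exp 6 / (av w i ^ 3)^(2 * (2^i*w)^4) * F i l χ) := by
        refine Finset.sum_le_sum_of_subset_of_nonneg (subset_univ _) fun χ _ _ => ?_
        refine add_nonneg (mul_nonneg (by positivity) (nF0 χ)) (Finset.sum_nonneg fun i _ => Finset.sum_nonneg fun l _ => mul_nonneg ?_ (nF i l χ))
        have ha := av_pos h i
        positivity
    _ = Real.exp (C1 * (20 * (av w 0)^4)) * Real.exp 6 * ∑ χ, F0 χ +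
      ∑ i ∈ range I, ∑ l ∈ range (i+1), Real.exp (C1 * (20 * (av w (i+1))^4)) * Real.exp 6 / (av w i ^ 3)^(2 * (2^i*w)^4) * ∑ χ, F i l χ := by
        rw [Finset.sum_add_distrib, Finset.mul_sum, Finset.sum_comm]
        congr 1
        refine Finset.sum_congr rfl fun i _ => ?_
        rw [Finset.sum_comm]
        refine Finset.sum_congr rfl fun l _ => ?_
        rw [Finset.mul_sum]
    _ ≤ Real.exp (C1 * (20 * (av w 0)^4)) * Real.exp 6 * (q.totient * G) + ∑ i ∈ range I, Real.exp 6 * q.totient * G * (1/2:ℝ)^i := by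
        refine add_le_add (mul_le_mul_of_nonneg_left b0 (by positivity)) (Finset.sum_le_sum fun i hi => ?_)
        refine (Finset.sum_le_sum (bF i hi)).trans ?_
        rw [Finset.sum_const, card_range, nsmul_eq_mul]
        have h1 : ((i+1 : ℕ):ℝ) ≤ 2^i := by exact_mod_cast Nat.lt_two_pow_self (n := i)
        have h2 : ((i+1 : ℕ):ℝ) * (1/2:ℝ)^(2*i) ≤ (1/2:ℝ)^i := by
          calc ((i+1 : ℕ):ℝ) * (1/2:ℝ)^(2*i) ≤ 2^i * (1/2:ℝ)^(2*i) := mul_le_mul_of_nonneg_right h1 (by positivity)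
            _ = (1/2:ℝ)^i := by rw [two_mul i, pow_add, ← mul_assoc, ← mul_pow]; norm_num
        have h3 := mul_le_mul_of_nonneg_left h2 (show 0 ≤ Real.exp 6 * q.totient * G by positivity)
        refine le_trans (le_of_eq ?_) h3
        ring
    _ ≤ Real.exp (C1 * (20 * (av w 0)^4)) * Real.exp 6 * (q.totient * G) + Real.exp 6 * q.totient * G * 2 := by
        rw [← Finset.mul_sum]
        have := mul_le_mul_of_nonneg_left (sum_geometric_two_le I) (show 0 ≤ Real.exp 6 * q.totient * G by positivity)
        linarith
    _ = _ := by
        have : av w 0 = w := by simp [av]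
        rw [this, hG, Real.exp_add]; ring

end

lemma exists_Lev (K X0 : ℝ) (hK : 1 ≤ K) (hX : 3 ≤ X0) (w : ℕ) (hw : 4 ≤ w) : ∃ L0 : ℝ, ∀ L ≥ L0, ∃ I, Lev L K X0 w I := by
  have hwr : (4:ℝ) ≤ w := by exact_mod_cast hw
  have l1 : (fun x : ℝ => Real.log x) =o[Filter.atTop] fun x => x := Real.isLittleO_log_id_atTop
  have l2 : (fun x : ℝ => Real.log x) =o[Filter.atTop] fun x => x^(1/2:ℝ) := isLittleO_log_rpow_atTop (by norm_num)
  have e1 := l1.bound (show (0:ℝ) < 1 / (20 * (w:ℝ)^4) by positivity)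
  have e2 := l2.bound (show (0:ℝ) < 1 / (20 * (40 * K + 1)) by positivity)
  have e3 : ∀ᶠ L in Filter.atTop, 16 * Real.log X0 ≤ Real.log L := Real.tendsto_log_atTop.eventually_ge_atTop _
  have e4 : ∀ᶠ L : ℝ in Filter.atTop, 1 ≤ L := Filter.eventually_ge_atTop 1
  have e5 : ∀ᶠ L in Filter.atTop, 1 ≤ Real.log L := Real.tendsto_log_atTop.eventually_ge_atTop _
  obtain ⟨L0, hL0⟩ := Filter.eventually_atTop.mp (e1.and (e2.and (e3.and (e4.and e5))))
  refine ⟨L0, fun L hL => ?_⟩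
  obtain ⟨f1, f2, f3, f4, f5⟩ := hL0 L hL
  rw [Real.norm_of_nonneg (by linarith), Real.norm_of_nonneg (by linarith)] at f1
  rw [← Real.sqrt_eq_rpow, Real.norm_of_nonneg (by linarith), Real.norm_of_nonneg (by positivity)] at f2
  have hex : ∃ I : ℕ, L ≤ 20 * (av w I)^4 * Real.log L := by
    obtain ⟨I, hI⟩ := pow_unbounded_of_one_lt L (show (1:ℝ) < 2 by norm_num)
    refine ⟨I, hI.le.trans ?_⟩
    have h0 : (1:ℝ) ≤ 2^I := one_le_pow₀ (by norm_num)
    have h1 : (2:ℝ)^I ≤ av w I := by unfold av; nlinarith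
    have h2 : av w I ≤ (av w I)^4 := le_self_pow₀ (by linarith) (by norm_num)
    have h3 : 0 ≤ (av w I)^4 := by positivity
    nlinarith
  classical
  set I := Nat.find hex with hI
  have hI1 : L ≤ 20 * (av w I)^4 * Real.log L := Nat.find_spec hex
  have hapos : ∀ i, 0 < av w i := fun i => by unfold av; positivity
  have hI0 : I ≠ 0 ∨ L = 20 * (av w 0)^4 * Real.log L := by
    by_cases h0 : I = 0
    · right
      rw [h0] at hI1
      have : av w 0 = w := by simp [av]
      rw [this] at hI1 ⊢
      have := mul_le_mul_of_nonneg_left f1 (show 0 ≤ 20 * (w:ℝ)^4 by positivity)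
      have e : 20 * (w:ℝ)^4 * (1 / (20 * (w:ℝ)^4) * L) = L := by field_simp
      linarith
    · exact Or.inl h0
  have hlow : Real.log L / 16 ≤ L / (20 * (av w I)^4) := by
    have := hapos I
    rw [div_le_div_iff₀ (by norm_num) (by positivity)]
    rcases hI0 with h0 | h0
    · obtain ⟨j, hj⟩ := Nat.exists_eq_succ_of_ne_zero h0
      have := Nat.find_min hex (m := j) (by omega)
      push Not at this
      have e : av w I = 2 * av w j := by rw [hj]; simp only [av, pow_succ]; ring
      rw [e]; nlinarith
    · by_cases h1 : I = 0
      · rw [h1]; nlinarith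
      · obtain ⟨j, hj⟩ := Nat.exists_eq_succ_of_ne_zero h1
        have := Nat.find_min hex (m := j) (by omega)
        push Not at this
        have e : av w I = 2 * av w j := by rw [hj]; simp only [av, pow_succ]; ring
        rw [e]; nlinarith
  have hup : L / (20 * (av w I)^4) ≤ Real.log L := by
    have := hapos I
    rw [div_le_iff₀ (by positivity)]; linarith
  have hxs : xs L w I I = Real.exp (L / (20 * (av w I)^4)) := by simp [xs]
  refine ⟨I, hw, hK, hX, f4, ?_, ?_, ?_⟩
  · rw [hxs]
    calc _ ≤ Real.exp (Real.log L) := Real.exp_le_exp.mpr hup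
      _ = L := Real.exp_log (by linarith)
  · rw [hxs, ← Real.log_le_iff_le_exp (by linarith)]
    linarith
  · have hs1 : 1 ≤ Real.sqrt L := by rw [Real.one_le_sqrt]; exact f4
    have hss : Real.sqrt L * Real.sqrt L = L := Real.mul_self_sqrt (by linarith)
    calc 2 * (40 * K * Real.sqrt L + 1) * (L / (20 * (av w I)^4)) ≤ 2 * ((40 * K + 1) * Real.sqrt L) * (1 / (20 * (40 * K + 1)) * Real.sqrt L) := by
          refine mul_le_mul (by nlinarith) (hup.trans f2) ?_ (by positivity)
          have := hapos I
          positivity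
      _ = (Real.sqrt L * Real.sqrt L) / 10 := by field_simp; ring
      _ = L/10 := by rw [hss]

/-- The moment lemma. -/
lemma moment (K C1 X0 : ℝ) (hK : 1 ≤ K) (hC1 : 0 ≤ C1) (hX : 3 ≤ X0) : ∃ (C : ℝ) (q0 : ℕ), 0 < C ∧ ∀ (q : ℕ) [NeZero q], q0 ≤ q →
    ∀ (m : ℕ → ℝ) (c e : ℝ → ℕ → ℂ), (∀ p, m p ≤ K / Real.sqrt p) → (∀ x p, ‖c x p‖ ≤ m p) → (∀ x p, ‖e x p‖ ≤ K / p) →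
    ∀ (S : Finset (DirichletCharacter ℂ q)) (Q : DirichletCharacter ℂ q → ℝ),
    (∀ χ ∈ S, ∀ x : ℝ, X0 ≤ x → x ≤ q → Q χ ≤ Real.exp ((PX (c x) (e x) (Ap x) χ).re + C1 * Real.log q / Real.log x)) →
    ∑ χ ∈ S, Q χ ≤ C * q.totient * Real.exp (1/4 * ∑ p ∈ Ap q, m p^2) := by
  obtain ⟨C2, hC2⟩ := prod_E5 K hK
  obtain ⟨w, hw⟩ := exists_nat_ge (max 4 (2 * Real.exp (320 * C1 + 152 * K^2)))
  have hw4 : (4:ℝ) ≤ w := (le_max_left _ _).trans hw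
  have hw4' : 4 ≤ w := by exact_mod_cast hw4
  have hD : 2 * Real.exp (320 * C1 + 152 * K^2) ≤ (w:ℝ)^2 := by
    have := (le_max_right _ _).trans hw
    nlinarith
  obtain ⟨L0, hL0⟩ := exists_Lev K X0 hK hX w hw4'
  obtain ⟨q0, hq0⟩ := exists_nat_ge (Real.exp L0)
  refine ⟨(Real.exp (C1 * (20 * (w:ℝ)^4)) + 2) * Real.exp 6 * Real.exp C2, q0, by positivity, ?_⟩
  intro q _ hq m c e hm hc he S Q hQ
  have hqr : Real.exp L0 ≤ q := hq0.trans (by exact_mod_cast hq)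
  obtain ⟨I, hI⟩ := hL0 (Real.log q) (by rw [ge_iff_le, Real.le_log_iff_exp_le ((Real.exp_pos _).trans_le hqr)]; exact hqr)
  exact moment_core hI rfl hC1 hD hm hC2 c e hc he S Q hQ

end HP

open Complex Real Finset
namespace HP
set_option linter.unusedSectionVars false

lemma lc_prime_pow {p k : ℕ} (hp : p.Prime) (hk : k ≠ 0) : lc (p^k) = 1/k := by
  unfold lc
  rw [ArithmeticFunction.vonMangoldt_apply_pow hk, ArithmeticFunction.vonMangoldt_apply_prime hp]
  push_cast
  rw [Real.log_pow]
  have : 0 < Real.log p := Real.log_pos (by exact_mod_cast hp.one_lt)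
  field_simp

lemma geom_tail {p : ℕ} (hp : p.Prime) (N : ℕ) : ∑ k ∈ Icc 3 N, ((p:ℝ)^k)^(-(1/2):ℝ) ≤ 4 * (p:ℝ)^(-(3/2):ℝ) := by
  have hp2 : (2:ℝ) ≤ p := by exact_mod_cast hp.two_le
  set u := (p:ℝ)^(-(1/2):ℝ) with hu
  have hu0 : 0 < u := by positivity
  have hu2 : u^2 ≤ 1/2 := by
    rw [hu, ← Real.rpow_natCast, ← Real.rpow_mul (by positivity)]
    norm_num
    rw [Real.rpow_neg_one]
    rw [one_div]; exact inv_anti₀ (by norm_num) hp2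
  have hu1 : u ≤ 3/4 := by nlinarith
  have e1 : ∀ k ∈ Icc 3 N, ((p:ℝ)^k)^(-(1/2):ℝ) = u^k := by
    intro k _
    rw [hu, ← Real.rpow_natCast, ← Real.rpow_natCast, ← Real.rpow_mul (by positivity), ← Real.rpow_mul (by positivity)]
    congr 1; ring
  have e2 : (p:ℝ)^(-(3/2):ℝ) = u^3 := by
    rw [hu, ← Real.rpow_natCast, ← Real.rpow_mul (by positivity)]; norm_num
  rw [Finset.sum_congr rfl e1, e2]
  have e3 : Icc 3 N = Ico 3 (N+1) := by ext; simp
  rw [e3]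
  have := geom_sum_Ico_le_of_lt_one (m := 3) (n := N+1) hu0.le (by linarith)
  refine this.trans ?_
  rw [div_le_iff₀ (by linarith)]
  have : 0 < u^3 := by positivity
  nlinarith

lemma split_pp : ∃ C3 : ℝ, 0 ≤ C3 ∧ ∀ (f : ℕ → ℂ) (R x : ℝ), 0 ≤ R → 3 ≤ x → (∀ n : ℕ, 1 ≤ n → ‖f n‖ ≤ R * (n:ℝ)^(-(1/2):ℝ)) →
    ‖∑ n ∈ Icc 1 ⌊x⌋₊, (lc n : ℂ) * f n - ∑ p ∈ Ap x, (f p + if p ∈ Ap (x^(1/2:ℝ)) then (1/2:ℂ) * f (p^2) else 0)‖ ≤ R * C3 := by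
  obtain ⟨C, hC, hC'⟩ := sum_three_halves
  refine ⟨4 * C, by positivity, ?_⟩
  intro f R x hR hx hf
  set N := max 3 ⌊Real.log x / Real.log 2⌋₊ with hN
  have h1 : ∑ n ∈ Icc 1 ⌊x⌋₊, (lc n : ℂ) * f n = ∑ n ∈ Ioc 0 ⌊x⌋₊ with IsPrimePow n, (lc n : ℂ) * f n := by
    have : Icc 1 ⌊x⌋₊ = Ioc 0 ⌊x⌋₊ := by ext; simp [Nat.succ_le_iff]
    rw [this, Finset.sum_filter]
    refine Finset.sum_congr rfl fun n _ => ?_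
    split_ifs with h
    · rfl
    · simp [lc, ArithmeticFunction.vonMangoldt_apply, h]
  have hAp : ∀ y : ℝ, (Ioc 0 ⌊y⌋₊).filter Nat.Prime = Ap y := by
    intro y; unfold Ap; congr 1
  have h2 := Chebyshev.sum_PrimePow_eq_sum_sum' (fun n => (lc n : ℂ) * f n) (show 0 ≤ x by linarith) (le_max_right 3 _ : _ ≤ N)
  have h3 : ∑ n ∈ Icc 1 ⌊x⌋₊, (lc n : ℂ) * f n = ∑ k ∈ Icc 1 N, ∑ p ∈ Ap (x^(1/(k:ℝ))), (1/(k:ℂ)) * f (p^k) := by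
    rw [h1, h2]
    refine Finset.sum_congr rfl fun k hk => ?_
    rw [hAp]
    refine Finset.sum_congr rfl fun p hp => ?_
    rw [mem_Icc] at hk
    rw [mem_Ap (by positivity)] at hp
    rw [lc_prime_pow hp.1 (by omega)]; push_cast; rfl
  have sub : ∀ k : ℕ, 1 ≤ k → Ap (x^(1/(k:ℝ))) ⊆ Ap x := by
    intro k hk p hp
    rw [mem_Ap (by positivity)] at hp
    rw [mem_Ap (by linarith)]
    refine ⟨hp.1, hp.2.trans ?_⟩
    calc x^(1/(k:ℝ)) ≤ x^(1:ℝ) := Real.rpow_le_rpow_of_exponent_le (by linarith) (by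
          rw [div_le_one (by positivity)]; exact_mod_cast hk)
      _ = x := Real.rpow_one x
  have h4 : Icc 1 N = {1, 2} ∪ Icc 3 N := by
    have : 3 ≤ N := le_max_left _ _
    ext k; simp; omega
  have hdis : Disjoint ({1, 2} : Finset ℕ) (Icc 3 N) := by
    rw [Finset.disjoint_left]; intro k; simp; omega
  rw [h3, h4, Finset.sum_union hdis, Finset.sum_pair (by norm_num), Finset.sum_add_distrib, ← Finset.sum_filter]
  have h5 : (Ap x).filter (fun p => p ∈ Ap (x^(1/2:ℝ))) = Ap (x^(1/2:ℝ)) := by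
    ext p
    rw [mem_filter]
    have := sub 2 (by norm_num)
    exact ⟨fun h => h.2, fun h => ⟨this (by exact_mod_cast h), h⟩⟩
  have h6 : ∑ p ∈ Ap (x^(1/((1:ℕ):ℝ))), (1/((1:ℕ):ℂ)) * f (p^1) = ∑ p ∈ Ap x, f p := by
    simp
  rw [h5, h6]
  push_cast
  rw [add_sub_cancel_left]
  calc ‖∑ k ∈ Icc 3 N, ∑ p ∈ Ap (x^(1/(k:ℝ))), (1/(k:ℂ)) * f (p^k)‖ ≤ ∑ k ∈ Icc 3 N, ∑ p ∈ Ap x, R * ((p:ℝ)^k)^(-(1/2):ℝ) := by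
        refine norm_sum_le_of_le _ fun k hk => ?_
        rw [mem_Icc] at hk
        refine (norm_sum_le _ _).trans ?_
        refine le_trans (Finset.sum_le_sum (g := fun p : ℕ => R * ((p:ℝ)^k)^(-(1/2):ℝ)) fun p hp => ?_)
          (Finset.sum_le_sum_of_subset_of_nonneg (sub k (by omega)) fun _ _ _ => by positivity)
        rw [mem_Ap (by positivity)] at hp
        have := hf (p^k) (Nat.one_le_pow _ _ hp.1.pos)
        push_cast at this
        have hk1 : (1:ℝ) ≤ k := by exact_mod_cast (by omega : 1 ≤ k)
        rw [norm_mul]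
        have h7 : ‖(1/(k:ℂ))‖ ≤ 1 := by
          rw [norm_div, norm_one, Complex.norm_natCast, div_le_one (by linarith)]; exact hk1
        calc _ ≤ 1 * ‖f (p^k)‖ := mul_le_mul_of_nonneg_right h7 (norm_nonneg _)
          _ ≤ _ := by rw [one_mul]; exact this
    _ = R * ∑ p ∈ Ap x, ∑ k ∈ Icc 3 N, ((p:ℝ)^k)^(-(1/2):ℝ) := by
        rw [Finset.sum_comm, Finset.mul_sum]; simp_rw [Finset.mul_sum]
    _ ≤ R * ∑ p ∈ Ap x, 4 * (p:ℝ)^(-(3/2):ℝ) := by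
        refine mul_le_mul_of_nonneg_left (Finset.sum_le_sum fun p hp => ?_) hR
        rw [mem_Ap (by linarith)] at hp
        exact geom_tail hp.1 N
    _ ≤ R * (4 * C) := by
        rw [← Finset.mul_sum]
        exact mul_le_mul_of_nonneg_left (mul_le_mul_of_nonneg_left (hC' _) (by norm_num)) hR

set_option maxHeartbeats 1000000 in
/-- Moments of products of L-functions near the critical line, in terms of prime sums. -/
lemma L_moment (R : ℝ) (hR : 0 ≤ R) : ∃ (C : ℝ) (q0 : ℕ), 0 < C ∧ ∀ (q : ℕ) [NeZero q], q0 ≤ q →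
    (∀ χ : DirichletCharacter ℂ q, dirichletRH χ) → ∀ (a : ℝ), 0 < a → a ≤ 1/2 → ∀ (N : ℕ) (r t : Fin N → ℝ),
    (∀ u, 0 ≤ r u) → ∑ u, r u = R → (∀ u, |t u| ≤ (q:ℝ)^2) → ∀ S : Finset (DirichletCharacter ℂ q), (∀ χ ∈ S, χ ≠ 1) →
    ∑ χ ∈ S, ∏ u, ‖χ.LFunction (1/2 + a + t u * I)‖ ^ (r u) ≤
      C * q.totient * Real.exp (1/4 * ∑ p ∈ Ap q, ((p:ℝ)^(-(1/2+a)) * ‖∑ u, (r u : ℂ) * (p:ℂ)^(-(t u * I))‖)^2) := by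
  obtain ⟨w, B, C, X0, hB, hC, hX0, hw, hlog⟩ := logL_bound
  obtain ⟨C3, hC3, hsp⟩ := split_pp
  obtain ⟨C', q0, hC', hmom⟩ := moment (max 1 R) (4 * C * R + R * C3) X0 (le_max_left _ _) (by positivity) hX0
  refine ⟨C', max q0 3, hC', ?_⟩
  intro q _ hq hRH a ha ha2 N r t hr hrR ht S hS
  have hq3 : (3:ℝ) ≤ q := by exact_mod_cast (le_max_right _ _).trans hq
  have hK1 : R ≤ max 1 R := le_max_right _ _
  set K := max 1 R
  have nT : ∀ n : ℕ, 1 ≤ n → ‖∑ u, (r u : ℂ) * (n:ℂ)^(-(t u * I))‖ ≤ R := by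
    intro n hn
    rw [← hrR]
    refine norm_sum_le_of_le _ fun u _ => ?_
    rw [norm_mul, Complex.norm_natCast_cpow_of_pos (by omega), Complex.norm_real, Real.norm_of_nonneg (hr u)]
    simp
  set f : ℝ → ℕ → ℂ := fun x n => if X0 ≤ x then w (Real.log n / Real.log x) * (n:ℂ)^(-((1/2 + a + B / Real.log x : ℝ) : ℂ)) *
      ∑ u, (r u : ℂ) * (n:ℂ)^(-(t u * I)) else 0 with hf
  have lx : ∀ x, X0 ≤ x → 0 < Real.log x := fun x hx => Real.log_pos (by linarith)
  have f1 : ∀ x (n : ℕ), 1 ≤ n → ‖f x n‖ ≤ (n:ℝ)^(-(1/2+a)) * ‖∑ u, (r u : ℂ) * (n:ℂ)^(-(t u * I))‖ := by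
    intro x n hn
    have hn1 : (1:ℝ) ≤ n := by exact_mod_cast hn
    simp only [hf]
    split_ifs with hx
    · have := lx x hx
      rw [norm_mul, norm_mul, Complex.norm_natCast_cpow_of_pos (by omega)]
      refine mul_le_mul_of_nonneg_right ?_ (norm_nonneg _)
      calc _ ≤ 1 * (n:ℝ)^(-(1/2+a)) := by
            refine mul_le_mul (hw _) ?_ (by positivity) (by norm_num)
            apply Real.rpow_le_rpow_of_exponent_le hn1
            rw [← Complex.ofReal_neg, Complex.ofReal_re]
            have : 0 ≤ B / Real.log x := by positivity
            linarith
        _ = _ := one_mul _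
    · rw [norm_zero]; positivity
  have f2 : ∀ x (n : ℕ), 1 ≤ n → ‖f x n‖ ≤ R * (n:ℝ)^(-(1/2):ℝ) := by
    intro x n hn
    have hn1 : (1:ℝ) ≤ n := by exact_mod_cast hn
    refine (f1 x n hn).trans ?_
    rw [mul_comm]
    refine mul_le_mul (nT n hn) ?_ (by positivity) hR
    apply Real.rpow_le_rpow_of_exponent_le hn1; linarith
  set m : ℕ → ℝ := fun p => if p.Prime then (p:ℝ)^(-(1/2+a)) * ‖∑ u, (r u : ℂ) * (p:ℂ)^(-(t u * I))‖ else 0 with hm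
  set c : ℝ → ℕ → ℂ := fun x p => if p.Prime then f x p else 0 with hc
  set e : ℝ → ℕ → ℂ := fun x p => if p.Prime ∧ p ∈ Ap (x^(1/2:ℝ)) then (1/2:ℂ) * f x (p^2) else 0 with he
  have hsum : ∑ p ∈ Ap q, ((p:ℝ)^(-(1/2+a)) * ‖∑ u, (r u : ℂ) * (p:ℂ)^(-(t u * I))‖)^2 = ∑ p ∈ Ap q, m p^2 := by
    refine Finset.sum_congr rfl fun p hp => ?_
    rw [mem_Ap (by positivity)] at hp
    simp only [hm, hp.1, if_true]
  rw [hsum]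
  refine hmom q ((le_max_left _ _).trans hq) m c e ?_ ?_ ?_ S _ ?_
  · intro p
    simp only [hm]
    split_ifs with hp
    · have hp1 : (1:ℝ) ≤ p := by exact_mod_cast hp.one_le
      have hsq : K / Real.sqrt p = K * (p:ℝ)^(-(1/2):ℝ) := by
        rw [Real.sqrt_eq_rpow, Real.rpow_neg (by positivity)]; rfl
      rw [hsq, mul_comm]
      refine mul_le_mul ((nT p hp.one_le).trans hK1) ?_ (by positivity) (by positivity)
      apply Real.rpow_le_rpow_of_exponent_le hp1; linarith
    · positivity
  · intro x p
    simp only [hc, hm]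
    split_ifs with hp
    · exact f1 x p hp.one_le
    · simp
  · intro x p
    simp only [he]
    split_ifs with hp
    · have h1 := f2 x (p^2) (Nat.one_le_pow _ _ hp.1.pos)
      have hp1 : (1:ℝ) ≤ p := by exact_mod_cast hp.1.one_le
      have : ((p^2 : ℕ):ℝ)^(-(1/2):ℝ) = 1/p := by
        push_cast
        rw [← Real.rpow_natCast, ← Real.rpow_mul (by positivity)]
        norm_num
        rw [Real.rpow_neg_one]
      rw [this] at h1
      rw [norm_mul]
      have h2 : ‖(1/2:ℂ)‖ ≤ 1 := by norm_num
      calc _ ≤ 1 * (R * (1/p)) := mul_le_mul h2 h1 (norm_nonneg _) (by norm_num)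
        _ = R / p := by ring
        _ ≤ _ := by apply div_le_div_of_nonneg_right hK1 (by positivity)
    · rw [norm_zero]; positivity
  · intro χ hχ x hx hxq
    have hlx := lx x hx
    have hlq : Real.log x ≤ Real.log q := Real.log_le_log (by linarith) hxq
    have hone : 1 ≤ Real.log q / Real.log x := by rw [one_le_div hlx]; exact hlq
    have hLL : ∀ u, LL q (t u) ≤ 4 * Real.log q := by
      intro u
      unfold LL
      have : 4 * Real.log q = Real.log ((q:ℝ)^4) := by rw [Real.log_pow]; norm_num
      rw [this]
      apply Real.log_le_log (by positivity)
      have := ht u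
      calc (q:ℝ) * (|t u| + 3) ≤ q * (q^2 + 3) := mul_le_mul_of_nonneg_left (by linarith) (by positivity)
        _ = q^3 + 3 * q := by ring
        _ ≤ q^4 := by nlinarith [pow_pos (show (0:ℝ) < q by positivity) 3, pow_pos (show (0:ℝ) < q by positivity) 2]
    have s1 : ∏ u, ‖χ.LFunction (1/2 + a + t u * I)‖ ^ (r u) ≤ Real.exp (∑ u, r u * Real.log ‖χ.LFunction (1/2 + a + t u * I)‖) := by
      rw [Real.exp_sum]
      refine Finset.prod_le_prod (fun u _ => by positivity) fun u _ => ?_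
      rcases (norm_nonneg (χ.LFunction (1/2 + a + t u * I))).eq_or_lt with h0 | h0
      · rw [← h0]; simp
        exact Real.zero_rpow_le_one _
      · rw [Real.rpow_def_of_pos h0, mul_comm]
    refine s1.trans (Real.exp_le_exp.mpr ?_)
    have s2 : ∑ u, r u * Real.log ‖χ.LFunction (1/2 + a + t u * I)‖ ≤
        (∑ n ∈ Icc 1 ⌊x⌋₊, (lc n : ℂ) * (f x n * χ n)).re + 4 * C * R * Real.log q / Real.log x := by
      calc _ ≤ ∑ u, r u * ((∑ n ∈ Icc 1 ⌊x⌋₊, (lc n : ℂ) * χ n * w (Real.log n / Real.log x) *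
        (n:ℂ) ^ (-((1/2 + a + B / Real.log x : ℝ) + t u * I : ℂ))).re + C * (4 * Real.log q) / Real.log x) := by
            refine Finset.sum_le_sum fun u _ => mul_le_mul_of_nonneg_left ?_ (hr u)
            refine (hlog q χ (hS χ hχ) (hRH χ) a (t u) x ha ha2 hx).trans ?_
            refine add_le_add le_rfl ?_
            apply div_le_div_of_nonneg_right _ hlx.le
            exact mul_le_mul_of_nonneg_left (hLL u) hC.le
        _ = _ := by
            simp_rw [mul_add]
            rw [Finset.sum_add_distrib, ← Finset.sum_mul, hrR]
            congr 1
            · have e1 : ∀ u, r u * (∑ n ∈ Icc 1 ⌊x⌋₊, (lc n : ℂ) * χ n * w (Real.log n / Real.log x) *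
                  (n:ℂ) ^ (-((1/2 + a + B / Real.log x : ℝ) + t u * I : ℂ))).re = ((r u : ℂ) * ∑ n ∈ Icc 1 ⌊x⌋₊, (lc n : ℂ) * χ n * w (Real.log n / Real.log x) *
                  (n:ℂ) ^ (-((1/2 + a + B / Real.log x : ℝ) + t u * I : ℂ))).re := fun u => by rw [Complex.re_ofReal_mul]
              simp_rw [e1]
              rw [← Complex.re_sum]
              congr 1
              simp_rw [Finset.mul_sum]
              rw [Finset.sum_comm]
              refine Finset.sum_congr rfl fun n hn => ?_
              have hn0 : (n:ℂ) ≠ 0 := by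
                rw [mem_Icc] at hn
                exact_mod_cast (by omega : n ≠ 0)
              simp only [hf, hx, if_true]
              rw [Finset.mul_sum, Finset.sum_mul, Finset.mul_sum]
              refine Finset.sum_congr rfl fun u _ => ?_
              rw [neg_add, Complex.cpow_add _ _ hn0]; ring
            · ring
    refine s2.trans ?_
    have s3 := hsp (fun n => f x n * χ n) R x hR (hX0.trans hx) (fun n hn => by
      rw [norm_mul]
      calc _ ≤ ‖f x n‖ * 1 := mul_le_mul_of_nonneg_left (DirichletCharacter.norm_le_one χ _) (norm_nonneg _)
        _ ≤ _ := by rw [mul_one]; exact f2 x n hn)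
    have s4 : PX (c x) (e x) (Ap x) χ = ∑ p ∈ Ap x, (f x p * χ p + if p ∈ Ap (x^(1/2:ℝ)) then (1/2:ℂ) * (f x (p^2) * χ (p^2 : ℕ)) else 0) := by
      unfold PX
      refine Finset.sum_congr rfl fun p hp => ?_
      rw [mem_Ap (by linarith)] at hp
      simp only [hc, he, hp.1, true_and, if_true]
      congr 1
      split_ifs
      · push_cast; rw [map_pow]; ring
      · simp
    rw [← s4] at s3
    have s5 := (Complex.abs_re_le_norm _).trans s3
    rw [Complex.sub_re] at s5
    have s6 := (abs_le.mp s5).2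
    have s7 : R * C3 ≤ R * C3 * (Real.log q / Real.log x) := le_mul_of_one_le_right (by positivity) hone
    have s8 : (4 * C * R + R * C3) * Real.log q / Real.log x = 4 * C * R * Real.log q / Real.log x + R * C3 * (Real.log q / Real.log x) := by ring
    rw [s8]; linarith

end HP

open Complex Real Finset
namespace HP
set_option linter.unusedSectionVars false

lemma cpow_diff {s : ℂ} (hs : 1 < s.re) (n : ℕ) (hn : 1 ≤ n) :
    ‖(n:ℂ)^(-s) - ((n:ℂ)^(1-s) - ((n+1:ℕ):ℂ)^(1-s)) / (s-1)‖ ≤ ‖s‖ * (1 / (n:ℝ)^2) := by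
  have hn1 : (1:ℝ) ≤ n := by exact_mod_cast hn
  have hs1 : s - 1 ≠ 0 := by
    intro h; rw [sub_eq_zero] at h; rw [h] at hs; simp at hs
  have hs0 : s ≠ 0 := by rintro rfl; simp at hs; linarith
  have d1 : ∀ t ∈ Set.Icc (n:ℝ) (n+1), ‖(t:ℂ)^(-s) - (n:ℂ)^(-s)‖ ≤ ‖s‖ * (1 / (n:ℝ)^2) := by
    intro t ht
    have hd : ∀ x ∈ Set.Icc (n:ℝ) (n+1), HasDerivWithinAt (fun y : ℝ => (y:ℂ)^(-s)) (-s * (x:ℂ)^(-s-1)) (Set.Icc (n:ℝ) (n+1)) x := by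
      intro x hx
      have hx0 : x ≠ 0 := by have := hx.1; linarith
      have h0 := hasDerivAt_ofReal_cpow_const (r := -s) hx0 (neg_ne_zero.mpr hs0)
      exact h0.hasDerivWithinAt
    have hb : ∀ x ∈ Set.Icc (n:ℝ) (n+1), ‖-s * (x:ℂ)^(-s-1)‖ ≤ ‖s‖ * (1 / (n:ℝ)^2) := by
      intro x hx
      have hx1 : (1:ℝ) ≤ x := hn1.trans hx.1
      rw [norm_mul, norm_neg, Complex.norm_cpow_eq_rpow_re_of_pos (by linarith)]
      refine mul_le_mul_of_nonneg_left ?_ (norm_nonneg _)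
      calc x^((-s-1).re) ≤ x^(-2:ℝ) := Real.rpow_le_rpow_of_exponent_le hx1 (by simp; linarith)
        _ = 1 / x^2 := by rw [Real.rpow_neg (by linarith), one_div]; norm_num
        _ ≤ _ := one_div_le_one_div_of_le (by positivity) (pow_le_pow_left₀ (by positivity) hx.1 2)
    have := (convex_Icc (n:ℝ) (n+1)).norm_image_sub_le_of_norm_hasDerivWithin_le hd hb ⟨le_rfl, by linarith⟩ ht
    simp only [Complex.ofReal_natCast] at this
    refine this.trans (mul_le_of_le_one_right (by positivity) ?_)
    rw [Real.norm_of_nonneg (by linarith [ht.1])]; linarith [ht.2]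
  have hd : ∀ x ∈ Set.Icc (n:ℝ) (n+1), HasDerivWithinAt (fun y : ℝ => (y:ℂ)^(1-s)/(1-s) - y * (n:ℂ)^(-s)) ((x:ℂ)^(-s) - (n:ℂ)^(-s)) (Set.Icc (n:ℝ) (n+1)) x := by
    intro x hx
    have hx0 : x ≠ 0 := by have := hx.1; linarith
    have hs1' : 1 - s ≠ 0 := by rw [← neg_sub]; exact neg_ne_zero.mpr hs1
    have h0 := (hasDerivAt_ofReal_cpow_const (r := 1-s) hx0 hs1').div_const (1-s)
    have e : (1-s) * (x:ℂ)^(1-s-1) / (1-s) = (x:ℂ)^(-s) := by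
      rw [mul_div_cancel_left₀ _ hs1']; congr 1; ring
    rw [e] at h0
    have h1 := (Complex.ofRealCLM.hasDerivAt (x := x)).mul_const ((n:ℂ)^(-s))
    simp only [Complex.ofRealCLM_apply, Complex.ofReal_one, one_mul] at h1
    exact (h0.sub h1).hasDerivWithinAt
  have := (convex_Icc (n:ℝ) (n+1)).norm_image_sub_le_of_norm_hasDerivWithin_le hd d1 ⟨le_rfl, by linarith⟩ (show (n:ℝ)+1 ∈ Set.Icc (n:ℝ) (n+1) from ⟨by linarith, le_rfl⟩)
  rw [add_sub_cancel_left, norm_one, mul_one] at this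
  rw [← norm_neg]
  refine le_trans (le_of_eq ?_) this
  congr 1
  have e : ∀ z : ℂ, z / (1 - s) = -(z / (s-1)) := fun z => by rw [← neg_sub s 1, div_neg]
  rw [e, e]
  push_cast
  ring

lemma sum_inv_sq_tail (N M : ℕ) (hN : 1 ≤ N) : ∑ n ∈ Ico N M, 1 / (n:ℝ)^2 ≤ 2 / (N:ℝ) := by
  have h0 := sum_Ioo_inv_sq_le (α := ℝ) (N-1) M
  have e : Ioo (N-1) M = Ico N M := by ext; simp; omega
  have e2 : ((N-1 : ℕ):ℝ) + 1 = N := by rw [Nat.cast_sub hN]; simp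
  rw [e, e2] at h0
  simpa using h0

lemma zeta_le {s : ℂ} (hs : 1 < s.re) (N : ℕ) (hN : 1 ≤ N) :
    ‖riemannZeta s‖ ≤ ∑ n ∈ Ico 1 N, 1 / (n:ℝ) + 2 / ‖s-1‖ + 2 * ‖s‖ / N := by
  have hs1 : s - 1 ≠ 0 := by
    intro h; rw [sub_eq_zero] at h; rw [h] at hs; simp at hs
  have hs0 : s ≠ 0 := by rintro rfl; simp at hs; linarith
  have hsum : Summable fun n : ℕ => 1 / (n:ℂ)^s := Complex.summable_one_div_nat_cpow.mpr hs
  have hz := zeta_eq_tsum_one_div_nat_cpow hs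
  have ht := hsum.hasSum.tendsto_sum_nat
  rw [← hz] at ht
  refine le_of_tendsto ht.norm ?_
  filter_upwards [Filter.eventually_ge_atTop N] with M hM
  have e1 : ∑ n ∈ range M, 1 / (n:ℂ)^s = ∑ n ∈ Ico 1 N, (n:ℂ)^(-s) + ∑ n ∈ Ico N M, (n:ℂ)^(-s) := by
    rw [Finset.sum_Ico_consecutive _ hN hM, range_eq_Ico, Finset.sum_eq_sum_Ico_succ_bot (by omega)]
    simp [hs0, Complex.cpow_neg]
  have e2 : ∀ M, N ≤ M → ∑ n ∈ Ico N M, (n:ℂ)^(-s) = ((N:ℂ)^(1-s) - (M:ℂ)^(1-s))/(s-1) +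
      ∑ n ∈ Ico N M, ((n:ℂ)^(-s) - ((n:ℂ)^(1-s) - ((n+1:ℕ):ℂ)^(1-s)) / (s-1)) := by
    intro M hM
    induction M, hM using Nat.le_induction with
    | base => simp
    | succ M hM ih =>
      rw [Finset.sum_Ico_succ_top hM, ih, Finset.sum_Ico_succ_top hM]
      ring
  rw [e1, e2 M hM]
  have n1 : ∀ n : ℕ, 1 ≤ n → ‖(n:ℂ)^(1-s)‖ ≤ 1 := by
    intro n hn
    rw [Complex.norm_natCast_cpow_of_pos (by omega)]
    apply Real.rpow_le_one_of_one_le_of_nonpos (by exact_mod_cast hn)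
    simp; linarith
  have b1 : ‖∑ n ∈ Ico 1 N, (n:ℂ)^(-s)‖ ≤ ∑ n ∈ Ico 1 N, 1 / (n:ℝ) := by
    refine norm_sum_le_of_le _ fun n hn => ?_
    rw [mem_Ico] at hn
    have hn1 : (1:ℝ) ≤ n := by exact_mod_cast hn.1
    rw [Complex.norm_natCast_cpow_of_pos (by omega), one_div, ← Real.rpow_neg_one]
    exact Real.rpow_le_rpow_of_exponent_le hn1 (by simp; linarith)
  have b2 : ‖((N:ℂ)^(1-s) - (M:ℂ)^(1-s))/(s-1)‖ ≤ 2 / ‖s-1‖ := by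
    rw [norm_div]
    refine div_le_div_of_nonneg_right ?_ (norm_nonneg _)
    have := norm_sub_le ((N:ℂ)^(1-s)) ((M:ℂ)^(1-s))
    have := n1 N hN
    have := n1 M (by omega)
    linarith
  have b3 : ‖∑ n ∈ Ico N M, ((n:ℂ)^(-s) - ((n:ℂ)^(1-s) - ((n+1:ℕ):ℂ)^(1-s)) / (s-1))‖ ≤ 2 * ‖s‖ / N := by
    calc _ ≤ ∑ n ∈ Ico N M, ‖s‖ * (1 / (n:ℝ)^2) := norm_sum_le_of_le _ fun n hn => cpow_diff hs n (by rw [mem_Ico] at hn; omega)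
      _ ≤ ‖s‖ * (2 / N) := by rw [← Finset.mul_sum]; exact mul_le_mul_of_nonneg_left (sum_inv_sq_tail N M hN) (norm_nonneg _)
      _ = _ := by ring
  refine (norm_add_le _ _).trans ?_
  have := norm_add_le (((N:ℂ)^(1-s) - (M:ℂ)^(1-s))/(s-1)) (∑ n ∈ Ico N M, ((n:ℂ)^(-s) - ((n:ℂ)^(1-s) - ((n+1:ℕ):ℂ)^(1-s)) / (s-1)))
  linarith

lemma zeta_log {a Δ : ℝ} (ha : 0 < a) (ha2 : a ≤ 1/2) :
    ‖riemannZeta (1 + 2 * a + Δ * I)‖ ≤ 2 / ‖(2 * a + Δ * I : ℂ)‖ + 3 + Real.log (4 + |Δ|) := by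
  have hs : 1 < (1 + 2 * a + Δ * I : ℂ).re := by simp; linarith
  have hn : ‖(1 + 2 * a + Δ * I : ℂ)‖ ≤ 2 + |Δ| := by
    have : (1 + 2 * a + Δ * I : ℂ) = ((1 + 2*a : ℝ) : ℂ) + (Δ:ℂ) * I := by push_cast; ring
    rw [this]
    refine (norm_add_le _ _).trans ?_
    rw [norm_mul, Complex.norm_I, Complex.norm_real, Complex.norm_real, Real.norm_of_nonneg (by positivity), Real.norm_eq_abs]
    linarith
  have habs := abs_nonneg Δ
  set N := ⌈2 + |Δ|⌉₊ with hN
  have hN1 : 2 + |Δ| ≤ N := Nat.le_ceil _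
  have hN2 : (N:ℝ) < 3 + |Δ| := by
    have := Nat.ceil_lt_add_one (show 0 ≤ 2 + |Δ| by positivity); linarith
  have hN0 : (0:ℝ) < N := by linarith
  have h1 := zeta_le hs N (by exact_mod_cast hN0)
  have e : (1 + 2 * a + Δ * I : ℂ) - 1 = 2 * a + Δ * I := by ring
  rw [e] at h1
  have h2 : ∑ n ∈ Ico 1 N, 1 / (n:ℝ) ≤ 1 + Real.log (4 + |Δ|) := by
    have h3 := harmonic_le_one_add_log N
    have h4 : ∑ n ∈ Ico 1 N, 1 / (n:ℝ) ≤ (harmonic N : ℝ) := by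
      rw [harmonic_eq_sum_Icc]
      push_cast
      simp only [one_div]
      refine Finset.sum_le_sum_of_subset_of_nonneg (fun n hn => ?_) fun _ _ _ => by positivity
      rw [mem_Ico] at hn; rw [mem_Icc]; omega
    have h5 : Real.log N ≤ Real.log (4 + |Δ|) := Real.log_le_log hN0 (by linarith)
    linarith
  have h6 : 2 * ‖(1 + 2 * a + Δ * I : ℂ)‖ / N ≤ 2 := by
    rw [div_le_iff₀ hN0]; linarith
  linarith

noncomputable def Dt (ℓ Δ : ℝ) : ℝ := max 1 (min (ℓ * |Δ|) ℓ)

lemma one_le_Dt (ℓ Δ : ℝ) : 1 ≤ Dt ℓ Δ := le_max_left _ _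

lemma Dt_le {ℓ : ℝ} (h : 1 ≤ ℓ) (Δ : ℝ) : Dt ℓ Δ ≤ ℓ := max_le h (min_le_right _ _)

lemma Dt_neg (ℓ Δ : ℝ) : Dt ℓ (-Δ) = Dt ℓ Δ := by simp [Dt]

lemma Dt_zero {ℓ : ℝ} (h : 1 ≤ ℓ) : Dt ℓ 0 = 1 := by
  unfold Dt; simp

lemma zetaD (A η : ℝ) (hA : 0 < A) (hη : 0 < η) (hη1 : η < 1) : ∃ C : ℝ, 1 ≤ C ∧ ∀ ℓ Δ : ℝ, 2 ≤ ℓ → |Δ| ≤ 2 * ℓ^A →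
    ‖riemannZeta (1 + 2 * (1/ℓ : ℝ) + Δ * I)‖ ≤ C * (ℓ * Dt ℓ Δ ^ (-(1-η))) := by
  refine ⟨8 + A/η, by have := div_pos hA hη; linarith, ?_⟩
  intro ℓ Δ hℓ hΔ
  have hℓ0 : 0 < ℓ := by linarith
  have hD1 := one_le_Dt ℓ Δ
  have hD2 := Dt_le (by linarith : 1 ≤ ℓ) Δ
  set D := Dt ℓ Δ with hD
  have h0 := zeta_log (a := 1/ℓ) (Δ := Δ) (by positivity) (by rw [div_le_div_iff₀ hℓ0 (by norm_num)]; linarith)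
  have h1 : D / ℓ ≤ ‖(2 * (1/ℓ : ℝ) + Δ * I : ℂ)‖ := by
    have g1 : |Δ| ≤ ‖(2 * (1/ℓ : ℝ) + Δ * I : ℂ)‖ := by
      have := Complex.abs_im_le_norm (2 * (1/ℓ : ℝ) + Δ * I : ℂ)
      simpa using this
    have g2 : 1/ℓ ≤ ‖(2 * (1/ℓ : ℝ) + Δ * I : ℂ)‖ := by
      have := (le_abs_self _).trans (Complex.abs_re_le_norm (2 * (1/ℓ : ℝ) + Δ * I : ℂ))
      have e : (2 * (1/ℓ : ℝ) + Δ * I : ℂ).re = 2 * (1/ℓ) := by simp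
      rw [e] at this
      have : 0 < 1/ℓ := by positivity
      linarith
    rw [div_le_iff₀ hℓ0, hD, Dt]
    apply max_le
    · rwa [div_le_iff₀ hℓ0] at g2
    · refine (min_le_left _ _).trans ?_
      rw [mul_comm]; exact mul_le_mul_of_nonneg_right g1 hℓ0.le
  have h2 : 2 / ‖(2 * (1/ℓ : ℝ) + Δ * I : ℂ)‖ ≤ 2 * (ℓ * D^(-(1-η))) := by
    calc 2 / ‖(2 * (1/ℓ : ℝ) + Δ * I : ℂ)‖ ≤ 2 / (D/ℓ) := div_le_div_of_nonneg_left (by norm_num) (by positivity) h1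
      _ = 2 * (ℓ * D^(-1:ℝ)) := by rw [Real.rpow_neg_one]; field_simp
      _ ≤ _ := by
        refine mul_le_mul_of_nonneg_left (mul_le_mul_of_nonneg_left ?_ hℓ0.le) (by norm_num)
        exact Real.rpow_le_rpow_of_exponent_le hD1 (by linarith)
  have h3 : ℓ^η ≤ ℓ * D^(-(1-η)) := by
    calc ℓ^η = ℓ^(1 + -(1-η)) := by ring_nf
      _ = ℓ * ℓ^(-(1-η)) := by rw [Real.rpow_add hℓ0, Real.rpow_one]
      _ ≤ _ := mul_le_mul_of_nonneg_left (Real.rpow_le_rpow_of_nonpos (by linarith) hD2 (by linarith)) hℓ0.le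
  have h4 : 1 ≤ ℓ^η := Real.one_le_rpow (by linarith) hη.le
  have h5 : Real.log (4 + |Δ|) ≤ 3 + A/η * ℓ^η := by
    have hA1 : 1 ≤ ℓ^A := Real.one_le_rpow (by linarith) hA.le
    have g1 : Real.log (4 + |Δ|) ≤ Real.log (6 * ℓ^A) := Real.log_le_log (by positivity) (by linarith)
    rw [Real.log_mul (by norm_num) (by positivity), Real.log_rpow hℓ0] at g1
    have g2 : Real.log 6 ≤ 3 := by
      rw [Real.log_le_iff_le_exp (by norm_num)]
      have := Real.add_one_le_exp 1
      have e : Real.exp 3 = Real.exp 1 ^ 3 := by rw [← Real.exp_nat_mul]; norm_num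
      rw [e]
      have : (2:ℝ)^3 ≤ Real.exp 1 ^ 3 := pow_le_pow_left₀ (by norm_num) (by linarith) 3
      linarith
    have g3 : Real.log ℓ ≤ ℓ^η/η := Real.log_le_rpow_div hℓ0.le hη
    have g4 := mul_le_mul_of_nonneg_left g3 hA.le
    have e : A * (ℓ^η/η) = A/η * ℓ^η := by ring
    linarith
  have h6 : (6 + A/η) * ℓ^η ≤ (6 + A/η) * (ℓ * D^(-(1-η))) := mul_le_mul_of_nonneg_left h3 (by positivity)
  calc _ ≤ _ := h0
    _ ≤ 2 * (ℓ * D^(-(1-η))) + (6 + A/η) * (ℓ * D^(-(1-η))) := by nlinarith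
    _ = _ := by ring

end HP

open Complex Real Finset
namespace HP
set_option linter.unusedSectionVars false

lemma summable_prime_cpow {s : ℂ} (hs : 1 < s.re) : Summable fun p : Nat.Primes => ((p:ℕ):ℂ)^(-s) := by
  refine Summable.of_norm ?_
  have : ∀ p : Nat.Primes, ‖((p:ℕ):ℂ)^(-s)‖ = ((p:ℕ):ℝ)^(-s.re) := fun p => by
    rw [Complex.norm_natCast_cpow_of_pos p.2.pos]; simp
  simp_rw [this]
  exact Nat.Primes.summable_rpow.mpr (by linarith)

lemma log_zeta : ∃ C4 : ℝ, 0 ≤ C4 ∧ ∀ s : ℂ, 1 < s.re →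
    (∑' p : Nat.Primes, ((p:ℕ):ℂ)^(-s)).re ≤ Real.log ‖riemannZeta s‖ + C4 := by
  have hs2 : Summable fun p : Nat.Primes => ((p:ℕ):ℝ)^(-2:ℝ) := Nat.Primes.summable_rpow.mpr (by norm_num)
  refine ⟨∑' p : Nat.Primes, ((p:ℕ):ℝ)^(-2:ℝ), tsum_nonneg fun p => by positivity, ?_⟩
  intro s hs
  have h1 := summable_prime_cpow hs
  set D : Nat.Primes → ℂ := fun p => -Complex.log (1 - ((p:ℕ):ℂ)^(-s)) - ((p:ℕ):ℂ)^(-s) with hD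
  have hDb : ∀ p, ‖D p‖ ≤ ((p:ℕ):ℝ)^(-2:ℝ) := by
    intro p
    have hp1 : (1:ℝ) ≤ (p:ℕ) := by exact_mod_cast p.2.one_le
    have hp2 : (2:ℝ) ≤ (p:ℕ) := by exact_mod_cast p.2.two_le
    have hz : ‖((p:ℕ):ℂ)^(-s)‖ ≤ ((p:ℕ):ℝ)⁻¹ := by
      rw [Complex.norm_natCast_cpow_of_pos p.2.pos, ← Real.rpow_neg_one]
      exact Real.rpow_le_rpow_of_exponent_le hp1 (by simp; linarith)
    have hz2 : ‖((p:ℕ):ℂ)^(-s)‖ ≤ 1/2 := hz.trans (by rw [one_div]; exact inv_anti₀ (by norm_num) hp2)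
    set z := ((p:ℕ):ℂ)^(-s)
    have h2 := Complex.norm_log_one_add_sub_self_le (z := -z) (by rw [norm_neg]; linarith)
    rw [norm_neg] at h2
    have e : D p = -(Complex.log (1 + -z) - -z) := by simp only [hD]; ring_nf; rfl
    rw [e, norm_neg]
    refine h2.trans ?_
    have h3 : (1 - ‖z‖)⁻¹ ≤ 2 := by
      rw [inv_le_comm₀ (by linarith) (by norm_num)]; linarith
    have h4 : ‖z‖^2 ≤ (((p:ℕ):ℝ)⁻¹)^2 := pow_le_pow_left₀ (norm_nonneg _) hz 2
    have e2 : ((p:ℕ):ℝ)^(-2:ℝ) = (((p:ℕ):ℝ)⁻¹)^2 := by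
      rw [Real.rpow_neg (by linarith), inv_pow]; norm_num
    rw [e2]
    nlinarith [sq_nonneg ‖z‖]
  have hDs : Summable D := Summable.of_norm_bounded hs2 hDb
  have hz := riemannZeta_eulerProduct_exp_log hs
  have e : ∑' p : Nat.Primes, -Complex.log (1 - ((p:ℕ):ℂ)^(-s)) = ∑' p, D p + ∑' p : Nat.Primes, ((p:ℕ):ℂ)^(-s) := by
    rw [← hDs.tsum_add h1]
    refine tsum_congr fun p => ?_
    simp only [hD]; ring
  rw [← hz, Complex.norm_exp, Real.log_exp, e, Complex.add_re]
  have h5 : ‖∑' p, D p‖ ≤ ∑' p : Nat.Primes, ((p:ℕ):ℝ)^(-2:ℝ) := tsum_of_norm_bounded hs2.hasSum hDb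
  have h6 := (abs_le.mp ((Complex.abs_re_le_norm _).trans h5)).1
  linarith

lemma prime_quad {N : ℕ} (r t : Fin N → ℝ) (a : ℝ) {p : ℕ} (hp : p.Prime) :
    ((p:ℝ)^(-(1/2+a)) * ‖∑ u, (r u : ℂ) * (p:ℂ)^(-(t u * I))‖)^2 =
      ∑ u, ∑ v, r u * r v * ((p:ℂ)^(-(1 + 2 * a + ((t u - t v : ℝ):ℂ) * I))).re := by
  have hp0 : (0:ℝ) < p := by exact_mod_cast hp.pos
  have hpc : (p:ℂ) ≠ 0 := by exact_mod_cast hp.ne_zero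
  set Z := ∑ u, (r u : ℂ) * (p:ℂ)^(-(t u * I)) with hZ
  have e1 : ((p:ℝ)^(-(1/2+a)))^2 = (p:ℝ)^(-(1+2*a)) := by
    rw [← Real.rpow_natCast, ← Real.rpow_mul hp0.le]; congr 1; push_cast; ring
  have e2 : ‖Z‖^2 = (Z * (starRingEnd ℂ) Z).re := by
    rw [Complex.mul_conj, Complex.normSq_eq_norm_sq]; simp [← Complex.ofReal_pow]
  have e3 : (starRingEnd ℂ) Z = ∑ v, (r v : ℂ) * (p:ℂ)^(t v * I) := by
    rw [hZ, map_sum]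
    refine Finset.sum_congr rfl fun v _ => ?_
    have harg : (p:ℂ).arg ≠ Real.pi := by rw [Complex.natCast_arg]; exact Real.pi_pos.ne
    have e := Complex.cpow_conj (p:ℂ) (-(t v * I)) harg
    rw [Complex.conj_natCast] at e
    rw [map_mul, Complex.conj_ofReal, ← e]
    simp
  rw [mul_pow, e1, e2, e3, hZ, ← Complex.re_ofReal_mul, Finset.sum_mul_sum, Finset.mul_sum, Complex.re_sum]
  refine Finset.sum_congr rfl fun u _ => ?_
  rw [Finset.mul_sum, Complex.re_sum]
  refine Finset.sum_congr rfl fun v _ => ?_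
  rw [← Complex.re_ofReal_mul (r u * r v)]
  congr 1
  have e4 : -(1 + 2 * a + ((t u - t v : ℝ):ℂ) * I) = ((-(1+2*a) : ℝ):ℂ) + (-(t u * I) + t v * I) := by push_cast; ring
  rw [e4, Complex.cpow_add _ _ hpc, Complex.cpow_add _ _ hpc, Complex.ofReal_cpow hp0.le]
  push_cast; ring

lemma prime_sum : ∃ C4 : ℝ, 0 ≤ C4 ∧ ∀ (N : ℕ) (r t : Fin N → ℝ) (a x : ℝ), 0 < a → 0 ≤ x → (∀ u, 0 ≤ r u) →
    ∑ p ∈ Ap x, ((p:ℝ)^(-(1/2+a)) * ‖∑ u, (r u : ℂ) * (p:ℂ)^(-(t u * I))‖)^2 ≤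
      ∑ u, ∑ v, r u * r v * Real.log ‖riemannZeta (1 + 2 * a + ((t u - t v : ℝ):ℂ) * I)‖ + C4 * (∑ u, r u)^2 := by
  obtain ⟨C4, hC4, hz⟩ := log_zeta
  refine ⟨C4, hC4, ?_⟩
  intro N r t a x ha hx hr
  have hs : ∀ u v, 1 < (1 + 2 * a + ((t u - t v : ℝ):ℂ) * I).re := fun u v => by simp; linarith
  set g : ℕ → ℝ := fun p => ((p:ℝ)^(-(1/2+a)) * ‖∑ u, (r u : ℂ) * (p:ℂ)^(-(t u * I))‖)^2 with hg
  have hS : HasSum (fun p : Nat.Primes => g p) (∑ u, ∑ v, r u * r v * (∑' p : Nat.Primes, ((p:ℕ):ℂ)^(-(1 + 2 * a + ((t u - t v : ℝ):ℂ) * I))).re) := by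
    have : (fun p : Nat.Primes => g p) = fun p : Nat.Primes => ∑ u, ∑ v, r u * r v * (((p:ℕ):ℂ)^(-(1 + 2 * a + ((t u - t v : ℝ):ℂ) * I))).re := by
      funext p; exact prime_quad r t a p.2
    rw [this]
    refine hasSum_sum fun u _ => hasSum_sum fun v _ => HasSum.mul_left _ ?_
    exact Complex.hasSum_re (summable_prime_cpow (hs u v)).hasSum
  have h1 : ∑ p ∈ Ap x, g p ≤ ∑ u, ∑ v, r u * r v * (∑' p : Nat.Primes, ((p:ℕ):ℂ)^(-(1 + 2 * a + ((t u - t v : ℝ):ℂ) * I))).re := by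
    have hpr : ∀ p ∈ Ap x, p.Prime := fun p hp => ((mem_Ap hx).mp hp).1
    have : ∑ p ∈ Ap x, g p = ∑ p ∈ (Ap x).subtype Nat.Prime, g p := by
      rw [Finset.sum_subtype_of_mem g hpr]
    rw [this]
    exact sum_le_hasSum (f := fun p : Nat.Primes => g p) _ (fun p _ => by rw [hg]; positivity) hS
  refine h1.trans ?_
  have h2 : C4 * (∑ u, r u)^2 = ∑ u, ∑ v, r u * r v * C4 := by
    rw [sq, Finset.sum_mul_sum, Finset.mul_sum]
    refine Finset.sum_congr rfl fun u _ => ?_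
    rw [Finset.mul_sum]
    refine Finset.sum_congr rfl fun v _ => by ring
  rw [h2, ← Finset.sum_add_distrib]
  refine Finset.sum_le_sum fun u _ => ?_
  rw [← Finset.sum_add_distrib]
  refine Finset.sum_le_sum fun v _ => ?_
  rw [← mul_add]
  exact mul_le_mul_of_nonneg_left (hz _ (hs u v)) (mul_nonneg (hr u) (hr v))

/-- Part C: the moment bound with distances. -/
lemma L_moment2 (R A η : ℝ) (hR : 0 ≤ R) (hA : 0 < A) (hη : 0 < η) (hη1 : η < 1) : ∃ (C : ℝ) (q0 : ℕ), 0 < C ∧ ∀ (q : ℕ) [NeZero q], q0 ≤ q →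
    (∀ χ : DirichletCharacter ℂ q, dirichletRH χ) → ∀ (ℓ : ℝ), 2 ≤ ℓ → ∀ (N : ℕ) (r t : Fin N → ℝ),
    (∀ u, 0 ≤ r u) → ∑ u, r u = R → (∀ u, |t u| ≤ (q:ℝ)^2) → (∀ u v, |t u - t v| ≤ 2 * ℓ^A) →
    ∀ S : Finset (DirichletCharacter ℂ q), (∀ χ ∈ S, χ ≠ 1) →
    ∑ χ ∈ S, ∏ u, ‖χ.LFunction (1/2 + (1/ℓ : ℝ) + t u * I)‖ ^ (r u) ≤
      C * q.totient * ℓ^(R^2/4) * ∏ u, ∏ v, Dt ℓ (t u - t v) ^ (-((1-η) * (r u * r v) / 4)) := by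
  obtain ⟨C, q0, hC, hL⟩ := L_moment R hR
  obtain ⟨C4, hC4, hP⟩ := prime_sum
  obtain ⟨C5, hC5, hZ⟩ := zetaD A η hA hη hη1
  refine ⟨C * Real.exp (1/4 * (C4 * R^2)) * C5^(R^2/4), q0, by positivity, ?_⟩
  intro q _ hq hRH ℓ hℓ N r t hr hrR ht htt S hS
  have hℓ0 : 0 < ℓ := by linarith
  have h1 := hL q hq hRH (1/ℓ) (by positivity) (by rw [div_le_div_iff₀ hℓ0 (by norm_num)]; linarith) N r t hr hrR ht S hS
  refine h1.trans ?_
  have h2 := hP N r t (1/ℓ) q (by positivity) (by positivity) hr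
  rw [hrR] at h2
  have h3 : ∀ u v, r u * r v * Real.log ‖riemannZeta (1 + 2 * (1/ℓ : ℝ) + ((t u - t v : ℝ):ℂ) * I)‖ ≤
      r u * r v * (Real.log C5 + Real.log ℓ + (-(1-η)) * Real.log (Dt ℓ (t u - t v))) := by
    intro u v
    refine mul_le_mul_of_nonneg_left ?_ (mul_nonneg (hr u) (hr v))
    have hD := one_le_Dt ℓ (t u - t v)
    have hs : 1 < (1 + 2 * (1/ℓ : ℝ) + ((t u - t v : ℝ):ℂ) * I).re := by
      have : 0 < ℓ⁻¹ := by positivity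
      simp; linarith
    have h4 := hZ ℓ (t u - t v) hℓ (htt u v)
    have h5 : 0 < ‖riemannZeta (1 + 2 * (1/ℓ : ℝ) + ((t u - t v : ℝ):ℂ) * I)‖ := norm_pos_iff.mpr (riemannZeta_ne_zero_of_one_le_re hs.le)
    have h6 := Real.log_le_log h5 h4
    rwa [Real.log_mul (by positivity) (by positivity), Real.log_mul (by positivity) (by positivity), Real.log_rpow (by positivity), ← add_assoc] at h6
  have h7 : ∑ p ∈ Ap q, ((p:ℝ)^(-(1/2+1/ℓ)) * ‖∑ u, (r u : ℂ) * (p:ℂ)^(-(t u * I))‖)^2 ≤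
      R^2 * Real.log C5 + R^2 * Real.log ℓ + ∑ u, ∑ v, (r u * r v) * ((-(1-η)) * Real.log (Dt ℓ (t u - t v))) + C4 * R^2 := by
    refine h2.trans (add_le_add ?_ le_rfl)
    refine (Finset.sum_le_sum fun u _ => Finset.sum_le_sum fun v _ => h3 u v).trans (le_of_eq ?_)
    have e : R^2 = ∑ u, ∑ v, r u * r v := by rw [sq, ← hrR, Finset.sum_mul_sum]
    rw [e, Finset.sum_mul, Finset.sum_mul, ← Finset.sum_add_distrib, ← Finset.sum_add_distrib]
    refine Finset.sum_congr rfl fun u _ => ?_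
    rw [Finset.sum_mul, Finset.sum_mul, ← Finset.sum_add_distrib, ← Finset.sum_add_distrib]
    refine Finset.sum_congr rfl fun v _ => by ring
  calc _ ≤ C * q.totient * Real.exp (1/4 * (R^2 * Real.log C5 + R^2 * Real.log ℓ + ∑ u, ∑ v, (r u * r v) * ((-(1-η)) * Real.log (Dt ℓ (t u - t v))) + C4 * R^2)) := by
        refine mul_le_mul_of_nonneg_left (Real.exp_le_exp.mpr ?_) (by positivity)
        linarith
    _ = _ := by
        have e1 : ∏ u, ∏ v, Dt ℓ (t u - t v) ^ (-((1-η) * (r u * r v) / 4)) = Real.exp (∑ u, ∑ v, (1/4) * ((r u * r v) * ((-(1-η)) * Real.log (Dt ℓ (t u - t v))))) := by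
          rw [Real.exp_sum]
          refine Finset.prod_congr rfl fun u _ => ?_
          rw [Real.exp_sum]
          refine Finset.prod_congr rfl fun v _ => ?_
          have hD := one_le_Dt ℓ (t u - t v)
          rw [Real.rpow_def_of_pos (by linarith)]; congr 1; ring
        simp_rw [← Finset.mul_sum] at e1
        rw [e1, Real.rpow_def_of_pos (by linarith), Real.rpow_def_of_pos hℓ0, mul_add, mul_add, mul_add, Real.exp_add, Real.exp_add, Real.exp_add]
        have e2 : Real.log C5 * (R^2/4) = 1/4 * (R^2 * Real.log C5) := by ring
        have e3 : Real.log ℓ * (R^2/4) = 1/4 * (R^2 * Real.log ℓ) := by ring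
        rw [e2, e3]
        ring

/-- single point moments -/
lemma L_moment1 (R : ℝ) (hR : 0 ≤ R) : ∃ (C : ℝ) (q0 : ℕ), 0 < C ∧ ∀ (q : ℕ) [NeZero q], q0 ≤ q →
    (∀ χ : DirichletCharacter ℂ q, dirichletRH χ) → ∀ (ℓ : ℝ), 2 ≤ ℓ → ∀ t : ℝ, |t| ≤ (q:ℝ)^2 →
    ∀ S : Finset (DirichletCharacter ℂ q), (∀ χ ∈ S, χ ≠ 1) →
    ∑ χ ∈ S, ‖χ.LFunction (1/2 + (1/ℓ : ℝ) + t * I)‖ ^ R ≤ C * q.totient * ℓ^(R^2/4) := by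
  obtain ⟨C, q0, hC, h⟩ := L_moment2 R 1 (1/2) hR one_pos (by norm_num) (by norm_num)
  refine ⟨C, q0, hC, ?_⟩
  intro q _ hq hRH ℓ hℓ t ht S hS
  have := h q hq hRH ℓ hℓ 1 (fun _ => R) (fun _ => t) (fun _ => hR) (by simp) (fun _ => ht) (fun _ _ => by simp; linarith) S hS
  simpa [Dt_zero (show 1 ≤ ℓ by linarith)] using this

end HP

open Complex Real Finset

namespace HP
set_option linter.unusedSectionVars false
open Metric MeasureTheory FourierTransform SchwartzMap

lemma kernel2 : ∃ ψ : ℝ → ℝ, ∃ Ψ : ℝ → ℂ, Continuous ψ ∧ (∀ v, 0 ≤ ψ v) ∧ (∀ v, 1 ≤ |v| → ψ v = 0) ∧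
    (∫ v, ψ v = 1) ∧ Integrable ψ ∧ Continuous Ψ ∧ (∀ m : ℕ, ∃ C : ℝ, 0 < C ∧ ∀ t, ‖Ψ t‖ ≤ C / (1 + |t|)^m) ∧
    (∀ x : ℝ, ∫ t, Ψ t * Complex.exp ((t * x : ℝ) * I) = ψ x) := by
  let φ : ContDiffBump (0:ℝ) := ⟨1/2, 1, by norm_num, by norm_num⟩
  let ψ : ℝ → ℝ := φ.normed volume
  have hφc : HasCompactSupport (fun x : ℝ => ((ψ x : ℝ) : ℂ)) :=
    (φ.hasCompactSupport_normed).comp_left (g := fun x : ℝ => (x:ℂ)) (by simp)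
  have hφs : ContDiff ℝ (⊤ : ℕ∞) (fun x : ℝ => ((ψ x : ℝ) : ℂ)) :=
    Complex.ofRealCLM.contDiff.comp φ.contDiff_normed
  let f : 𝓢(ℝ, ℂ) := hφc.toSchwartzMap hφs
  let F : 𝓢(ℝ, ℂ) := 𝓕 f
  have hinv : ∀ x : ℝ, ∫ v, Complex.exp (↑(2 * π * v * x) * I) • F v = ψ x := by
    intro x
    have h : 𝓕⁻ F = f := FourierTransform.fourierInv_fourier_eq f
    have h2 : (𝓕⁻ F) x = (ψ x : ℂ) := by rw [h]; rfl
    rw [SchwartzMap.fourierInv_coe, Real.fourierInv_eq'] at h2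
    rw [← h2]
    congr 1; ext v
    congr 3
    simp; ring
  have hdec : ∀ m : ℕ, ∃ C : ℝ, 0 < C ∧ ∀ t, ‖F t‖ ≤ C / (1 + |t|)^m := by
    intro m
    refine ⟨2 ^ m * ((Finset.Iic (m, 0)).sup fun m => SchwartzMap.seminorm ℝ m.1 m.2) F + 1, by positivity, fun t => ?_⟩
    have := SchwartzMap.one_add_le_sup_seminorm_apply (𝕜 := ℝ) (m := (m, 0)) (k := m) (n := 0) le_rfl le_rfl F t
    rw [le_div_iff₀ (by positivity)]
    simp only [norm_iteratedFDeriv_zero, Real.norm_eq_abs] at this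
    rw [mul_comm]
    linarith
  refine ⟨ψ, fun t => F (t / (2 * π)) / (2 * π), φ.continuous_normed, fun v => φ.nonneg_normed v, ?_, φ.integral_normed, φ.integrable_normed, ?_, ?_, ?_⟩
  · intro v hv
    have : v ∉ Function.support ψ := by
      rw [ContDiffBump.support_normed_eq]
      simpa using hv
    simpa using this
  · have := F.continuous
    fun_prop
  · intro m
    obtain ⟨C, hC, h⟩ := hdec m
    refine ⟨C * (2 * π)^m, by positivity, fun t => ?_⟩
    have h1 := h (t / (2 * π))
    have hpi : 1 ≤ 2 * π := by linarith [Real.pi_gt_three]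
    rw [norm_div]
    have e : ‖(2 * π : ℂ)‖ = 2 * π := by
      rw [show (2 * π : ℂ) = ((2 * π : ℝ) : ℂ) by push_cast; rfl, Complex.norm_real, Real.norm_of_nonneg (by positivity)]
    rw [e]
    refine (div_le_self (norm_nonneg _) hpi).trans (h1.trans ?_)
    rw [div_le_div_iff₀ (by positivity) (by positivity), mul_assoc, ← mul_pow]
    refine mul_le_mul_of_nonneg_left (pow_le_pow_left₀ (by positivity) ?_ m) hC.le
    rw [abs_div, abs_of_pos (by positivity : 0 < 2 * π), mul_add, mul_div_cancel₀ _ (by positivity)]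
    linarith
  · intro x
    rw [← hinv x]
    have h := Measure.integral_comp_div (fun v : ℝ => Complex.exp (↑(2 * π * v * x) * I) • F v) (2 * π)
    rw [abs_of_pos (by positivity)] at h
    have hpi : (2 * π : ℂ) ≠ 0 := by exact_mod_cast (by positivity : (2 * π) ≠ 0)
    have h' : ∫ v, Complex.exp (↑(2 * π * v * x) * I) • F v = (1/(2 * π : ℂ)) * ∫ (v : ℝ), Complex.exp (↑(2 * π * (v / (2 * π)) * x) * I) • F (v / (2 * π)) := by
      rw [h, Complex.real_smul, ← mul_assoc, show (1/(2 * π : ℂ)) * ((2 * π : ℝ) : ℂ) = 1 by push_cast; field_simp, one_mul]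
    rw [h', ← integral_const_mul]
    congr 1; ext v
    rw [show 2 * π * (v / (2 * π)) * x = v * x by field_simp]
    simp only [smul_eq_mul]
    ring

variable {q : ℕ} [NeZero q]

lemma LF_exp (χ : DirichletCharacter ℂ q) (hχ : χ ≠ 1) {σ : ℝ} (hσ : 0 < σ) (t : ℝ) :
    χ.LFunction (σ + t * I) / (σ + t * I) =
      ∫ v : ℝ, (Fr χ (Real.exp v) * (Real.exp (-σ * v) : ℂ)) * Complex.exp ((-(t * v) : ℝ) * I) := by
  have hs : 0 < ((σ:ℂ) + t * I).re := by simpa using hσ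
  have hne : ((σ:ℂ) + t * I) ≠ 0 := by intro h; rw [h] at hs; simp at hs
  have key : ∀ s : ℂ, ∫ t in Set.Ioi (1 : ℝ), Fr χ t * (t : ℂ) ^ (-(s + 1))
      = mellin (Fr χ) (-s) := by
    intro s
    unfold mellin
    rw [← integral_indicator measurableSet_Ioi, ← integral_indicator measurableSet_Ioi]
    apply integral_congr_ae
    have : ({1} : Set ℝ)ᶜ ∈ ae (volume : Measure ℝ) := by
      simp [mem_ae_iff]
    filter_upwards [this] with t ht
    rcases lt_or_gt_of_ne (show t ≠ 1 from ht) with h | h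
    · rw [Set.indicator_of_notMem (by simp; linarith)]
      simp [Set.indicator_apply, Fr_eq_zero χ h]
    · rw [Set.indicator_of_mem (by simpa using h), Set.indicator_of_mem (by simp; linarith)]
      rw [smul_eq_mul, mul_comm]; congr 2; ring
  rw [LF_eq χ hχ hs, mul_div_cancel_left₀ _ hne, key, mellin_eq_fourier, Real.fourier_real_eq_integral_exp_smul,
    ← integral_neg_eq_self]
  congr 1; ext v
  simp only [smul_eq_mul, neg_neg, Complex.neg_re, Complex.neg_im, Complex.add_re, Complex.ofReal_re, Complex.mul_re,
    Complex.I_re, Complex.ofReal_im, Complex.I_im, Complex.add_im, Complex.mul_im, Complex.real_smul]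
  rw [show -2 * π * -v * (-(0 + (t * 1 + 0 * 0)) / (2 * π)) = -(t * v) by field_simp; ring,
    show (σ + (t * 0 - 0 * 1)) * -v = -σ * v by ring]
  ring

lemma integrable_g (χ : DirichletCharacter ℂ q) (hχ : χ ≠ 1) {σ : ℝ} (hσ : 0 < σ) :
    Integrable fun v : ℝ => Fr χ (Real.exp v) * (Real.exp (-σ * v) : ℂ) := by
  have h0 : IntegrableOn (fun v : ℝ => q * Real.exp (-σ * v)) (Set.Ioi 0) :=
    (integrableOn_exp_mul_Ioi (by linarith) 0).const_mul _
  have hq : (0:ℝ) ≤ q := by positivity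
  have h1 : Integrable (Set.indicator (Set.Ici 0) (fun v : ℝ => q * Real.exp (-σ * v))) := by
    rw [integrable_indicator_iff measurableSet_Ici, integrableOn_Ici_iff_integrableOn_Ioi]; exact h0
  refine h1.mono' ?_ (Filter.Eventually.of_forall fun v => ?_)
  · refine Measurable.aestronglyMeasurable ?_
    have := (measurable_Fr χ).comp Real.measurable_exp
    have h2 : Measurable fun v : ℝ => ((Real.exp (-σ * v) : ℝ) : ℂ) := by fun_prop
    exact Measurable.mul this h2
  · by_cases hv : 0 ≤ v
    · rw [Set.indicator_of_mem (by exact hv), norm_mul, Complex.norm_real, Real.norm_of_nonneg (Real.exp_pos _).le]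
      exact mul_le_mul_of_nonneg_right (norm_Fr_le χ hχ _) (Real.exp_pos _).le
    · rw [Fr_eq_zero χ (by rw [Real.exp_lt_one_iff]; linarith)]
      simp only [zero_mul, norm_zero]
      exact Set.indicator_nonneg (fun _ _ => by positivity) _

lemma smooth_id (χ : DirichletCharacter ℂ q) (hχ : χ ≠ 1) {σ : ℝ} (hσ : 0 < σ) {ψ : ℝ → ℝ} {Ψ : ℝ → ℂ} (hΨ : Integrable Ψ)
    (hinv : ∀ x : ℝ, ∫ t, Ψ t * Complex.exp ((t * x : ℝ) * I) = ψ x) {δ : ℝ} (hδ : 0 < δ) (V : ℝ) :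
    ∫ t : ℝ, χ.LFunction (σ + t * I) / (σ + t * I) * (Complex.exp ((t * V : ℝ) * I) * Ψ (δ * t)) =
      ∫ u : ℝ, (Fr χ (Real.exp (V - δ * u)) * (Real.exp (-σ * (V - δ * u)) : ℂ)) * ψ u := by
  set g : ℝ → ℂ := fun v => Fr χ (Real.exp v) * (Real.exp (-σ * v) : ℂ) with hg
  have hgi : Integrable g := integrable_g χ hχ hσ
  have hΨδ : Integrable fun t => Ψ (δ * t) := hΨ.comp_mul_left' hδ.ne'
  have hexp : ∀ x y : ℝ, Complex.exp (x * I) * Complex.exp (y * I) = Complex.exp ((x + y : ℝ) * I) := by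
    intro x y; rw [← Complex.exp_add]; congr 1; push_cast; ring
  have h1 : ∀ t : ℝ, χ.LFunction (σ + t * I) / (σ + t * I) * (Complex.exp ((t * V : ℝ) * I) * Ψ (δ * t)) =
      ∫ v, Complex.exp ((t * (V - v) : ℝ) * I) * (Ψ (δ * t) * g v) := by
    intro t
    rw [LF_exp χ hχ hσ, ← integral_mul_const]
    congr 1; ext v
    have := hexp (-(t * v)) (t * V)
    rw [show -(t * v) + t * V = t * (V - v) by ring] at this
    rw [← this]
    simp only [hg]; ring
  simp_rw [h1]
  rw [integral_integral_swap]
  swap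
  · have h2 := hΨδ.mul_prod hgi
    refine h2.bdd_mul (c := 1) ?_ (Filter.Eventually.of_forall fun z => ?_)
    · refine Continuous.aestronglyMeasurable ?_
      fun_prop
    · exact (Complex.norm_exp_ofReal_mul_I _).le
  have h3 : ∀ v, ∫ t, Complex.exp ((t * (V - v) : ℝ) * I) * (Ψ (δ * t) * g v) = (δ:ℂ)⁻¹ * (g v * ψ ((V - v) / δ)) := by
    intro v
    have e := Measure.integral_comp_mul_left (fun s : ℝ => Ψ s * Complex.exp ((s * ((V - v) / δ) : ℝ) * I)) δ
    rw [hinv, abs_of_pos (by positivity), Complex.real_smul] at e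
    have : ∀ t : ℝ, δ * t * ((V - v) / δ) = t * (V - v) := fun t => by field_simp
    simp_rw [this] at e
    calc _ = g v * ∫ t, Ψ (δ * t) * Complex.exp ((t * (V - v) : ℝ) * I) := by
          rw [← integral_const_mul]; congr 1; ext t; ring
      _ = _ := by rw [e]; push_cast; ring
  simp_rw [h3]
  rw [integral_const_mul]
  have h4 := Measure.integral_comp_mul_left (fun x : ℝ => g (V - x) * (ψ (x / δ) : ℂ)) δ
  have h5 := integral_sub_left_eq_self (fun v : ℝ => g v * (ψ ((V - v) / δ) : ℂ)) volume V
  simp only [sub_sub_cancel] at h5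
  rw [h5, abs_of_pos (by positivity), Complex.real_smul] at h4
  push_cast at h4
  rw [← h4]
  congr 1; ext u
  rw [mul_div_cancel_left₀ _ hδ.ne']

end HP

open Complex Real Finset

namespace HP
set_option linter.unusedSectionVars false
open Metric MeasureTheory

noncomputable def bw (t : ℝ) : ℝ := 1 / (1 + |t|)
noncomputable def kap (m : ℕ) (δ t : ℝ) : ℝ := 1 / (1 + δ * |t|)^m

lemma bw_pos (t : ℝ) : 0 < bw t := by unfold bw; positivity
lemma kap_pos (m : ℕ) {δ : ℝ} (hδ : 0 ≤ δ) (t : ℝ) : 0 < kap m δ t := by unfold kap; positivity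
lemma bw_le_one (t : ℝ) : bw t ≤ 1 := by
  unfold bw; rw [div_le_one (by positivity)]; linarith [abs_nonneg t]
lemma continuous_bw : Continuous bw := by
  unfold bw
  exact continuous_const.div (by fun_prop) (fun t => by positivity)
lemma continuous_kap (m : ℕ) {δ : ℝ} (hδ : 0 ≤ δ) : Continuous (kap m δ) := by
  unfold kap
  exact continuous_const.div (by fun_prop) (fun t => by positivity)

lemma integrable_kap {m : ℕ} (hm : 2 ≤ m) {δ : ℝ} (hδ : 0 < δ) : Integrable (kap m δ) := by
  have h : Integrable (fun t : ℝ => (1 + ‖t‖)^(-(2:ℝ))) := integrable_one_add_norm (by simp)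
  have h2 := h.comp_mul_left' hδ.ne'
  refine h2.mono' (continuous_kap m hδ.le).aestronglyMeasurable (Filter.Eventually.of_forall fun t => ?_)
  rw [Real.norm_of_nonneg (kap_pos m hδ.le t).le]
  unfold kap
  rw [Real.rpow_neg (by positivity), norm_mul, Real.norm_of_nonneg hδ.le, Real.norm_eq_abs, one_div]
  rw [show (2:ℝ) = (2:ℕ) by norm_num, Real.rpow_natCast]
  have : 0 ≤ δ * |t| := by positivity
  exact inv_anti₀ (by positivity) (pow_le_pow_right₀ (by linarith) hm)

variable {q : ℕ} [NeZero q]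

lemma continuous_LF (χ : DirichletCharacter ℂ q) (hχ : χ ≠ 1) (σ : ℝ) : Continuous fun t : ℝ => χ.LFunction (σ + t * I) :=
  (DirichletCharacter.differentiable_LFunction hχ).continuous.comp (by fun_prop)

lemma bL_le (χ : DirichletCharacter ℂ q) (hχ : χ ≠ 1) {σ : ℝ} (hσ : 1/2 ≤ σ) (hσ1 : σ ≤ 1) (t : ℝ) :
    bw t * ‖χ.LFunction (σ + t * I)‖ ≤ 2 * q := by
  have h := norm_LF_le χ hχ (s := σ + t * I) (by simp; linarith)
  have hn : ‖(σ + t * I : ℂ)‖ ≤ 1 + |t| := by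
    refine (norm_add_le _ _).trans ?_
    rw [norm_mul, Complex.norm_I, mul_one, Complex.norm_real, Complex.norm_real, Real.norm_of_nonneg (by linarith), Real.norm_eq_abs]
    linarith
  have e : (σ + t * I : ℂ).re = σ := by simp
  rw [e] at h
  have h2 : ‖(σ + t * I : ℂ)‖ * q / σ ≤ (1 + |t|) * q * 2 := by
    rw [div_le_iff₀ (by linarith), mul_assoc _ 2 σ]
    have h3 : ‖(σ + t * I : ℂ)‖ * q ≤ (1 + |t|) * q := mul_le_mul_of_nonneg_right hn (by positivity)
    exact h3.trans (le_mul_of_one_le_right (by positivity) (by linarith))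
  unfold bw
  rw [div_mul_eq_mul_div, one_mul, div_le_iff₀ (by positivity)]
  linarith

lemma integrable_bL (χ : DirichletCharacter ℂ q) (hχ : χ ≠ 1) {σ : ℝ} (hσ : 1/2 ≤ σ) (hσ1 : σ ≤ 1) {m : ℕ} (hm : 2 ≤ m) {δ : ℝ} (hδ : 0 < δ) :
    Integrable fun t => bw t * ‖χ.LFunction (σ + t * I)‖ * kap m δ t := by
  refine ((integrable_kap hm hδ).const_mul (2 * q)).mono' ?_ (Filter.Eventually.of_forall fun t => ?_)
  · exact ((continuous_bw.mul (continuous_LF χ hχ σ).norm).mul (continuous_kap m hδ.le)).aestronglyMeasurable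
  · have h0 := (kap_pos m hδ.le t).le
    have h1 := (bw_pos t).le
    rw [Real.norm_of_nonneg (by positivity)]
    exact mul_le_mul_of_nonneg_right (bL_le χ hχ hσ hσ1 t) h0

lemma measurable_FrD (χ : DirichletCharacter ℂ q) (y δ : ℝ) : Measurable fun u : ℝ => Fr χ (y * Real.exp (-(δ * u))) :=
  (measurable_Fr χ).comp (by fun_prop)

set_option maxHeartbeats 1000000 in
lemma smoothing {m : ℕ} (hm : 2 ≤ m) : ∃ (ψ : ℝ → ℝ) (C : ℝ), 0 < C ∧ Continuous ψ ∧ (∀ v, 0 ≤ ψ v) ∧ (∀ v, 1 ≤ |v| → ψ v = 0) ∧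
    (∫ v, ψ v = 1) ∧ Integrable ψ ∧ ∀ (q : ℕ) [NeZero q] (χ : DirichletCharacter ℂ q), χ ≠ 1 → ∀ σ δ y : ℝ, 1/2 ≤ σ → σ ≤ 1 → 0 < δ → δ ≤ 1 → 0 < y →
      ‖Fr χ y‖ ≤ C * y^σ * (∫ t, bw t * ‖χ.LFunction (σ + t * I)‖ * kap m δ t) +
        9 * ∫ u, ψ u * ‖Fr χ y - Fr χ (y * Real.exp (-(δ * u)))‖ := by
  obtain ⟨ψ, Ψ, hψc, hψ0, hψs, hψ1, hψi, hΨc, hΨd, hinv⟩ := kernel2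
  obtain ⟨C, hC, hΨm⟩ := hΨd m
  refine ⟨ψ, 9 * C, by positivity, hψc, hψ0, hψs, hψ1, hψi, ?_⟩
  intro q _ χ hχ σ δ y hσ hσ1 hδ hδ1 hy
  have hq : (0:ℝ) ≤ q := by positivity
  have hΨi : Integrable Ψ := by
    refine ((integrable_kap hm one_pos).const_mul C).mono' hΨc.aestronglyMeasurable (Filter.Eventually.of_forall fun t => ?_)
    refine (hΨm t).trans_eq ?_
    unfold kap; rw [one_mul]; ring
  have hid := smooth_id χ hχ (by linarith : 0 < σ) hΨi hinv hδ (Real.log y)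
  have e1 : ∀ u, Real.exp (Real.log y - δ * u) = y * Real.exp (-(δ * u)) := fun u => by
    rw [sub_eq_add_neg, Real.exp_add, Real.exp_log hy]
  have e2 : ∀ u, Real.exp (-σ * (Real.log y - δ * u)) = y^(-σ) * Real.exp (σ * δ * u) := fun u => by
    rw [Real.rpow_def_of_pos hy, ← Real.exp_add]; congr 1; ring
  simp_rw [e1, e2] at hid
  set h : ℝ → ℝ := fun u => Real.exp (σ * δ * u) * ψ u with hh
  have hsu : ∀ u, |u| < 1 → |σ * δ * u| ≤ 1 := fun u hu => by
    rw [abs_mul, abs_of_pos (by positivity)]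
    have : σ * δ ≤ 1 := mul_le_one₀ hσ1 hδ.le hδ1
    have h3 : 0 < σ * δ := by positivity
    nlinarith [abs_nonneg u]
  have hlo : ∀ u, Real.exp (-1) * ψ u ≤ h u := fun u => by
    by_cases hu : 1 ≤ |u|
    · simp [hh, hψs u hu]
    · refine mul_le_mul_of_nonneg_right (Real.exp_le_exp.mpr ?_) (hψ0 u)
      linarith [(abs_le.mp (hsu u (by linarith))).1]
  have hhi : ∀ u, h u ≤ Real.exp 1 * ψ u := fun u => by
    by_cases hu : 1 ≤ |u|
    · simp [hh, hψs u hu]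
    · refine mul_le_mul_of_nonneg_right (Real.exp_le_exp.mpr ?_) (hψ0 u)
      linarith [(abs_le.mp (hsu u (by linarith))).2]
  have hh0 : ∀ u, 0 ≤ h u := fun u => mul_nonneg (Real.exp_pos _).le (hψ0 u)
  have hhc : Continuous h := by fun_prop
  have hhint : Integrable h := by
    refine (hψi.const_mul (Real.exp 1)).mono' hhc.aestronglyMeasurable (Filter.Eventually.of_forall fun u => ?_)
    rw [Real.norm_of_nonneg (hh0 u)]; exact hhi u
  have hc : Real.exp (-1) ≤ ∫ u, h u := by
    calc Real.exp (-1) = ∫ u, Real.exp (-1) * ψ u := by rw [integral_const_mul, hψ1, mul_one]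
      _ ≤ _ := integral_mono (hψi.const_mul _) hhint hlo
  set D : ℝ → ℂ := fun u => Fr χ (y * Real.exp (-(δ * u))) with hD
  have hDm : Measurable D := measurable_FrD χ y δ
  have hDb : ∀ u, ‖D u‖ ≤ q := fun u => norm_Fr_le χ hχ _
  have hhC : Integrable fun u => (h u : ℂ) := hhint.ofReal
  have i1 : Integrable fun u => D u * (h u : ℂ) := hhC.bdd_mul hDm.aestronglyMeasurable (Filter.Eventually.of_forall hDb)
  have i2 : Integrable fun u => (Fr χ y - D u) * (h u : ℂ) := by
    refine hhC.bdd_mul (c := 2 * q) (by fun_prop) (Filter.Eventually.of_forall fun u => ?_)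
    refine (norm_sub_le _ _).trans ?_
    linarith [hDb u, norm_Fr_le χ hχ y]
  have i3 : Integrable fun u => ψ u * ‖Fr χ y - D u‖ := by
    refine (hψi.mul_const (2 * q)).mono' ?_ (Filter.Eventually.of_forall fun u => ?_)
    · exact hψc.aestronglyMeasurable.mul (by fun_prop)
    · rw [Real.norm_of_nonneg (mul_nonneg (hψ0 u) (norm_nonneg _))]
      refine mul_le_mul_of_nonneg_left ?_ (hψ0 u)
      refine (norm_sub_le _ _).trans ?_
      linarith [hDb u, norm_Fr_le χ hχ y]
  have hsum : Fr χ y * ((∫ u, h u : ℝ) : ℂ) = (∫ u, D u * (h u : ℂ)) + ∫ u, (Fr χ y - D u) * (h u : ℂ) := by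
    rw [← integral_add i1 i2, ← integral_complex_ofReal, ← integral_const_mul]
    congr 1; ext u; ring
  have hfirst : (∫ u, D u * (h u : ℂ)) = (y^σ : ℝ) * ∫ t : ℝ, χ.LFunction (σ + t * I) / (σ + t * I) * (Complex.exp ((t * Real.log y : ℝ) * I) * Ψ (δ * t)) := by
    rw [hid, ← integral_const_mul]
    congr 1; ext u
    have : (y^σ : ℝ) * y^(-σ) = 1 := by rw [← Real.rpow_add hy]; simp
    have hc : ((y^σ : ℝ) : ℂ) * ((y^(-σ) : ℝ) : ℂ) = 1 := by exact_mod_cast this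
    simp only [hh, hD]
    push_cast at hc ⊢
    linear_combination (-(Fr χ (y * Real.exp (-(δ * u))) * Complex.exp (σ * δ * u) * ψ u)) * hc
  have n1 : ‖∫ t : ℝ, χ.LFunction (σ + t * I) / (σ + t * I) * (Complex.exp ((t * Real.log y : ℝ) * I) * Ψ (δ * t))‖ ≤
      3 * C * ∫ t, bw t * ‖χ.LFunction (σ + t * I)‖ * kap m δ t := by
    rw [← integral_const_mul]
    refine norm_integral_le_of_norm_le ((integrable_bL χ hχ hσ hσ1 hm hδ).const_mul _) (Filter.Eventually.of_forall fun t => ?_)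
    rw [norm_mul, norm_mul, Complex.norm_exp_ofReal_mul_I, one_mul, norm_div]
    have a1 : (1 + |t|) / 3 ≤ ‖(σ + t * I : ℂ)‖ := by
      have b1 := Complex.abs_re_le_norm (σ + t * I : ℂ)
      have b2 := Complex.abs_im_le_norm (σ + t * I : ℂ)
      simp only [Complex.add_re, Complex.ofReal_re, Complex.mul_re, Complex.I_re, Complex.ofReal_im, Complex.I_im, Complex.add_im, Complex.mul_im] at b1 b2
      simp only [mul_zero, mul_one, sub_zero, add_zero, zero_add] at b1 b2
      rw [abs_of_pos (by linarith)] at b1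
      linarith
    have a2 := hΨm (δ * t)
    rw [abs_mul, abs_of_pos hδ] at a2
    have a3 : ‖χ.LFunction (σ + t * I)‖ / ‖(σ + t * I : ℂ)‖ ≤ 3 * (bw t * ‖χ.LFunction (σ + t * I)‖) := by
      refine (div_le_div_of_nonneg_left (norm_nonneg _) (by positivity) a1).trans_eq ?_
      unfold bw; field_simp
    refine (mul_le_mul a3 a2 (norm_nonneg _) (by have := bw_pos t; positivity)).trans_eq ?_
    unfold kap; ring
  have n2 : ‖∫ u, (Fr χ y - D u) * (h u : ℂ)‖ ≤ Real.exp 1 * ∫ u, ψ u * ‖Fr χ y - D u‖ := by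
    rw [← integral_const_mul]
    refine norm_integral_le_of_norm_le (i3.const_mul _) (Filter.Eventually.of_forall fun u => ?_)
    rw [norm_mul, Complex.norm_real, Real.norm_of_nonneg (hh0 u)]
    calc _ ≤ ‖Fr χ y - D u‖ * (Real.exp 1 * ψ u) := mul_le_mul_of_nonneg_left (hhi u) (norm_nonneg _)
      _ = _ := by ring
  have hN := congrArg norm hsum
  rw [norm_mul, Complex.norm_real, Real.norm_of_nonneg ((Real.exp_pos _).le.trans hc), hfirst] at hN
  have n3 := norm_add_le (((y^σ : ℝ) : ℂ) * ∫ t : ℝ, χ.LFunction (σ + t * I) / (σ + t * I) * (Complex.exp ((t * Real.log y : ℝ) * I) * Ψ (δ * t))) (∫ u, (Fr χ y - D u) * (h u : ℂ))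
  rw [← hN, norm_mul, Complex.norm_real, Real.norm_of_nonneg (by positivity)] at n3
  have hy' : 0 ≤ y^σ := by positivity
  have n4 : ‖Fr χ y‖ * Real.exp (-1) ≤ y^σ * (3 * C * ∫ t, bw t * ‖χ.LFunction (σ + t * I)‖ * kap m δ t) + Real.exp 1 * ∫ u, ψ u * ‖Fr χ y - D u‖ :=
    (mul_le_mul_of_nonneg_left hc (norm_nonneg _)).trans (n3.trans (add_le_add (mul_le_mul_of_nonneg_left n1 hy') n2))
  have hX : 0 ≤ ∫ t, bw t * ‖χ.LFunction (σ + t * I)‖ * kap m δ t := integral_nonneg fun t => by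
    have := bw_pos t; have := kap_pos m hδ.le t; positivity
  have hZ : 0 ≤ ∫ u, ψ u * ‖Fr χ y - D u‖ := integral_nonneg fun u => mul_nonneg (hψ0 u) (norm_nonneg _)
  have e1 : Real.exp 1 ≤ 3 := by linarith [Real.exp_one_lt_d9]
  have e0 : Real.exp 1 * Real.exp (-1) = 1 := by rw [← Real.exp_add]; simp
  have n5 := mul_le_mul_of_nonneg_left n4 (Real.exp_pos 1).le
  rw [show Real.exp 1 * (‖Fr χ y‖ * Real.exp (-1)) = ‖Fr χ y‖ * (Real.exp 1 * Real.exp (-1)) by ring, e0, mul_one] at n5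
  refine n5.trans ?_
  generalize (∫ t, bw t * ‖χ.LFunction (σ + t * I)‖ * kap m δ t) = X at *
  generalize (∫ u, ψ u * ‖Fr χ y - D u‖) = Z at *
  have p0 := Real.exp_pos 1
  have p1 : Real.exp 1 * (y^σ * (3 * C * X)) ≤ 3 * (y^σ * (3 * C * X)) := mul_le_mul_of_nonneg_right e1 (by positivity)
  have p2 : Real.exp 1 * (Real.exp 1 * Z) ≤ 3 * (3 * Z) := mul_le_mul e1 (mul_le_mul_of_nonneg_right e1 hZ) (by positivity) (by norm_num)
  linarith

end HP

open Complex Real Finset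

namespace HP
set_option linter.unusedSectionVars false
open Metric MeasureTheory

lemma tangent {A f P : ℝ} (hA : 0 < A) (hf : 0 ≤ f) (hP : 1 ≤ P) : (1 - P) * A^P + P * A^(P-1) * f ≤ f^P := by
  have h := one_add_mul_self_le_rpow_one_add (s := f / A - 1) (by have : 0 ≤ f / A := by positivity
                                                                  linarith) hP
  rw [add_sub_cancel, Real.div_rpow hf hA.le, le_div_iff₀ (by positivity)] at h
  refine le_trans (le_of_eq ?_) h
  rw [Real.rpow_sub_one hA.ne']
  field_simp
  ring

lemma jensen {α : Type*} [MeasurableSpace α] {μ : Measure α} {w f : α → ℝ} {W P : ℝ} (hP : 1 ≤ P) (hW : 0 < W)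
    (hw : ∀ t, 0 ≤ w t) (hf : ∀ t, 0 ≤ f t) (iw : Integrable w μ) (iwf : Integrable (fun t => w t * f t) μ)
    (iwp : Integrable (fun t => w t * f t ^ P) μ) (hwW : ∫ t, w t ∂μ ≤ W) :
    (∫ t, w t * f t ∂μ)^P ≤ W^(P-1) * ∫ t, w t * f t ^ P ∂μ := by
  set X := ∫ t, w t * f t ∂μ with hX
  have hX0 : 0 ≤ X := integral_nonneg fun t => mul_nonneg (hw t) (hf t)
  have hY0 : 0 ≤ ∫ t, w t * f t ^ P ∂μ := integral_nonneg fun t => mul_nonneg (hw t) (Real.rpow_nonneg (hf t) _)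
  rcases hX0.eq_or_lt with h0 | h0
  · rw [← h0, Real.zero_rpow (by linarith)]; positivity
  set A := X / W with hA
  have hA0 : 0 < A := by positivity
  have h1 : ∫ t, ((1 - P) * A^P * w t + P * A^(P-1) * (w t * f t)) ∂μ ≤ ∫ t, w t * f t ^ P ∂μ := by
    refine integral_mono ((iw.const_mul _).add (iwf.const_mul _)) iwp fun t => ?_
    have := mul_le_mul_of_nonneg_left (tangent hA0 (hf t) hP) (hw t)
    simp only at this ⊢
    linarith
  rw [integral_add (iw.const_mul _) (iwf.const_mul _), integral_const_mul, integral_const_mul, ← hX] at h1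
  have hAP : 0 < A^P := by positivity
  have h2 : (1 - P) * A^P * W ≤ (1 - P) * A^P * ∫ t, w t ∂μ := by
    have : (P - 1) * A^P * ∫ t, w t ∂μ ≤ (P - 1) * A^P * W := mul_le_mul_of_nonneg_left hwW (mul_nonneg (by linarith) hAP.le)
    linarith
  have h3 : P * A^(P-1) * X = P * A^P * W := by
    rw [Real.rpow_sub_one hA0.ne', show X = A * W by rw [hA]; field_simp]; field_simp
  have h4 : A^P * W ≤ ∫ t, w t * f t ^ P ∂μ := by linarith
  calc X^P = W^(P-1) * (A^P * W) := by
        rw [hA, Real.div_rpow hX0 hW.le, Real.rpow_sub_one hW.ne']; field_simp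
    _ ≤ _ := mul_le_mul_of_nonneg_left h4 (by positivity)

lemma jensen_sum {ι α : Type*} [MeasurableSpace α] {μ : Measure α} {w : α → ℝ} {f : ι → α → ℝ} (S : Finset ι) {W P M : ℝ}
    (hP : 1 ≤ P) (hW : 0 < W) (hM : 0 ≤ M)
    (hw : ∀ t, 0 ≤ w t) (hf : ∀ i t, 0 ≤ f i t) (iw : Integrable w μ) (iwf : ∀ i ∈ S, Integrable (fun t => w t * f i t) μ)
    (iwp : ∀ i ∈ S, Integrable (fun t => w t * f i t ^ P) μ) (hwW : ∫ t, w t ∂μ ≤ W)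
    (h : ∀ᵐ t ∂μ, w t * ∑ i ∈ S, f i t ^ P ≤ w t * M) :
    ∑ i ∈ S, (∫ t, w t * f i t ∂μ)^P ≤ W^P * M := by
  calc ∑ i ∈ S, (∫ t, w t * f i t ∂μ)^P ≤ ∑ i ∈ S, W^(P-1) * ∫ t, w t * f i t ^ P ∂μ :=
        Finset.sum_le_sum fun i hi => jensen hP hW hw (hf i) iw (iwf i hi) (iwp i hi) hwW
    _ = W^(P-1) * ∫ t, w t * ∑ i ∈ S, f i t ^ P ∂μ := by
        rw [← Finset.mul_sum, ← integral_finset_sum S iwp]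
        congr 2; ext t; rw [Finset.mul_sum]
    _ ≤ W^(P-1) * ∫ t, w t * M ∂μ := by
        refine mul_le_mul_of_nonneg_left (integral_mono_ae ?_ (iw.mul_const _) h) (by positivity)
        have := integrable_finset_sum S iwp
        refine this.congr (Filter.Eventually.of_forall fun t => ?_)
        simp only [Finset.mul_sum]
    _ ≤ W^(P-1) * (W * M) := by
        rw [integral_mul_const]
        exact mul_le_mul_of_nonneg_left (mul_le_mul_of_nonneg_right hwW hM) (by positivity)
    _ = _ := by rw [Real.rpow_sub_one hW.ne']; field_simp

lemma int_b {θ : ℝ} (hθ : 0 < θ) : Integrable (fun t : ℝ => (1 + |t|)^(-(1+θ))) ∧ ∫ t : ℝ, (1 + |t|)^(-(1+θ)) = 2 / θ := by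
  constructor
  · have := integrable_one_add_norm (E := ℝ) (μ := volume) (r := 1 + θ) (by simp; linarith)
    simpa using this
  · rw [integral_comp_abs (f := fun t => (1 + t)^(-(1+θ)))]
    have h := (measurePreserving_add_right volume (1:ℝ)).setIntegral_preimage_emb (measurableEmbedding_addRight 1) (fun t : ℝ => t^(-(1+θ))) (Set.Ioi 1)
    have e : (fun x : ℝ => x + 1) ⁻¹' Set.Ioi 1 = Set.Ioi 0 := by ext x; simp
    rw [e, integral_Ioi_rpow_of_lt (by linarith) one_pos] at h
    have e2 : ∀ x : ℝ, (1 + x) = x + 1 := fun x => add_comm _ _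
    simp_rw [e2] at h ⊢
    rw [h]
    rw [show -(θ + 1) + 1 = -θ by ring, Real.one_rpow]
    field_simp

/-- total weight -/
lemma int_bk {θ δ : ℝ} (hθ : 0 < θ) (hθ1 : θ ≤ 1) (hδ : 0 < δ) (hδ1 : δ ≤ 1) {m : ℕ} (hm : 1 ≤ m) (t : ℝ) :
    bw t * kap m δ t ≤ δ^(-θ) * (1 + |t|)^(-(1+θ)) := by
  have h0 : 0 ≤ δ * |t| := by positivity
  have h1 : kap m δ t ≤ (δ * (1 + |t|))^(-θ) := by
    unfold kap
    rw [Real.rpow_neg (by positivity), ← one_div]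
    refine one_div_le_one_div_of_le (by positivity) ?_
    calc (δ * (1 + |t|))^θ ≤ (1 + δ * |t|)^θ := Real.rpow_le_rpow (by positivity) (by nlinarith) hθ.le
      _ ≤ (1 + δ * |t|)^(m:ℝ) := Real.rpow_le_rpow_of_exponent_le (by linarith) (hθ1.trans (by exact_mod_cast hm))
      _ = _ := Real.rpow_natCast _ _
  refine (mul_le_mul_of_nonneg_left h1 (bw_pos t).le).trans_eq ?_
  rw [Real.mul_rpow hδ.le (by positivity), neg_add, Real.rpow_add (by positivity), Real.rpow_neg_one]
  unfold bw; ring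

lemma integrable_bk {δ : ℝ} (hδ : 0 < δ) {m : ℕ} (hm : 2 ≤ m) : Integrable fun t => bw t * kap m δ t := by
  refine (integrable_kap hm hδ).mono' (continuous_bw.mul (continuous_kap m hδ.le)).aestronglyMeasurable (Filter.Eventually.of_forall fun t => ?_)
  have h1 := kap_pos m hδ.le t
  rw [Real.norm_of_nonneg (by have := bw_pos t; positivity)]
  exact mul_le_of_le_one_left h1.le (bw_le_one t)

variable {q : ℕ} [NeZero q]

/-- far tail -/
lemma far_tail (χ : DirichletCharacter ℂ q) (hχ : χ ≠ 1) {σ : ℝ} (hσ : 1/2 ≤ σ) (hσ1 : σ ≤ 1) {m : ℕ} (hm : 4 ≤ m) {δ : ℝ} (hδ : 0 < δ)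
    (hδq : 1 ≤ δ^2 * q) : ∫ t in (Set.Icc (-(q:ℝ)^2) ((q:ℝ)^2))ᶜ, bw t * ‖χ.LFunction (σ + t * I)‖ * kap m δ t ≤ 4 := by
  have hq : (1:ℝ) ≤ q := by exact_mod_cast NeZero.one_le
  have hi : Integrable fun t : ℝ => 2 * q * (δ * q^2)⁻¹^2 * (1 + |δ * t|)^(-(1+(1:ℝ))) :=
    ((int_b one_pos).1.comp_mul_left' hδ.ne').const_mul _
  calc _ ≤ ∫ t in (Set.Icc (-(q:ℝ)^2) ((q:ℝ)^2))ᶜ, 2 * q * (δ * q^2)⁻¹^2 * (1 + |δ * t|)^(-(1+(1:ℝ))) := by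
        refine setIntegral_mono_on (integrable_bL χ hχ hσ hσ1 (by omega) hδ).integrableOn hi.integrableOn measurableSet_Icc.compl fun t ht => ?_
        have ht' : (q:ℝ)^2 ≤ |t| := by
          by_contra hc
          push Not at hc
          exact ht ⟨by linarith [(abs_lt.mp hc).1], (abs_lt.mp hc).2.le⟩
        have hk : kap m δ t ≤ (δ * q^2)⁻¹^2 * (1 + |δ * t|)^(-(1+(1:ℝ))) := by
          unfold kap
          have h0 : 0 ≤ δ * |t| := by positivity
          rw [abs_mul, abs_of_pos hδ, show -(1+(1:ℝ)) = -((2:ℕ):ℝ) by norm_num, Real.rpow_neg (by positivity), Real.rpow_natCast, inv_pow, ← mul_inv, one_div]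
          refine inv_anti₀ (by positivity) ?_
          calc (δ * q^2)^2 * (1 + δ * |t|)^2 ≤ (1 + δ * |t|)^2 * (1 + δ * |t|)^2 := by
                refine mul_le_mul_of_nonneg_right (pow_le_pow_left₀ (by positivity) ?_ 2) (by positivity)
                have := mul_le_mul_of_nonneg_left ht' hδ.le
                linarith
            _ = (1 + δ * |t|)^4 := by ring
            _ ≤ _ := pow_le_pow_right₀ (by linarith) hm
        refine (mul_le_mul (bL_le χ hχ hσ hσ1 t) hk (kap_pos m hδ.le t).le (by positivity)).trans_eq ?_
        ring
    _ ≤ ∫ t : ℝ, 2 * q * (δ * q^2)⁻¹^2 * (1 + |δ * t|)^(-(1+(1:ℝ))) :=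
        setIntegral_le_integral hi (Filter.Eventually.of_forall fun t => by positivity)
    _ = 4 / (δ * q)^3 := by
        rw [integral_const_mul]
        have := Measure.integral_comp_mul_left (fun t : ℝ => (1 + |t|)^(-(1+(1:ℝ)))) δ
        rw [this, (int_b one_pos).2, abs_of_pos (by positivity), smul_eq_mul]
        field_simp
        norm_num
    _ ≤ 4 := by
        have h1 : 1 ≤ δ * q := by
          by_contra hc
          push Not at hc
          have h2 : δ ^ 2 * q * q < 1 := by
            have : δ ^ 2 * q * q = (δ * q)^2 := by ring
            rw [this]
            have : 0 ≤ δ * q := by positivity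
            nlinarith
          nlinarith
        exact div_le_self (by norm_num) (one_le_pow₀ h1)

/-- orthogonality -/
lemma second_moment (S : Finset (DirichletCharacter ℂ q)) {y y' : ℝ} (hy : 0 ≤ y) (hyy : y ≤ y') (hq : y' < q) :
    ∑ χ ∈ S, ‖Fr χ y - Fr χ y'‖^2 ≤ q.totient * (y' - y + 1) := by
  have e : ∀ χ : DirichletCharacter ℂ q, Fr χ y' - Fr χ y = ∑ n ∈ Ioc ⌊y⌋₊ ⌊y'⌋₊, χ (n : ZMod q) := by
    intro χ
    have h := Nat.floor_le_floor hyy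
    unfold Fr psum
    rw [sub_eq_iff_eq_add]
    have e1 : ∀ n, Icc 1 n = Ioc 0 n := fun n => by ext; simp; omega
    rw [e1, e1, add_comm, ← Finset.sum_union]
    · congr 1
      rw [Finset.Ioc_union_Ioc_eq_Ioc (Nat.zero_le _) h]
    · rw [Finset.disjoint_left]; intro a; simp; omega
  set J := Ioc ⌊y⌋₊ ⌊y'⌋₊ with hJ
  have hJq : ∀ n ∈ J, n < q := fun n hn => by
    rw [hJ, Finset.mem_Ioc] at hn
    have h1 : (n:ℝ) ≤ y' := (Nat.cast_le.mpr hn.2).trans (Nat.floor_le (hy.trans hyy))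
    exact_mod_cast h1.trans_lt hq
  have h1 : ∑ χ ∈ S, ‖Fr χ y - Fr χ y'‖^2 ≤ ∑ χ : DirichletCharacter ℂ q, ‖Fr χ y - Fr χ y'‖^2 :=
    Finset.sum_le_sum_of_subset_of_nonneg (Finset.subset_univ _) fun _ _ _ => by positivity
  have h2 : ∑ χ : DirichletCharacter ℂ q, ‖Fr χ y - Fr χ y'‖^2 ≤ q.totient * (J.card : ℝ) := by
    have h3 : ((∑ χ : DirichletCharacter ℂ q, ‖Fr χ y - Fr χ y'‖^2 : ℝ) : ℂ) = ∑ n ∈ J, ∑ m ∈ J, ∑ χ : DirichletCharacter ℂ q, χ n * (starRingEnd ℂ) (χ m) := by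
      push_cast
      have : ∀ χ : DirichletCharacter ℂ q, ((‖Fr χ y - Fr χ y'‖ : ℝ) : ℂ)^2 = ∑ n ∈ J, ∑ m ∈ J, χ n * (starRingEnd ℂ) (χ m) := by
        intro χ
        rw [norm_sub_rev, e χ, ← Complex.mul_conj', map_sum, Finset.sum_mul_sum]
      simp_rw [this]
      rw [Finset.sum_comm]
      refine Finset.sum_congr rfl fun n _ => ?_
      rw [Finset.sum_comm]
    have h4 : (∑ χ : DirichletCharacter ℂ q, ‖Fr χ y - Fr χ y'‖^2 : ℝ) = ‖((∑ χ : DirichletCharacter ℂ q, ‖Fr χ y - Fr χ y'‖^2 : ℝ) : ℂ)‖ := by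
      rw [Complex.norm_real, Real.norm_of_nonneg (Finset.sum_nonneg fun _ _ => by positivity)]
    rw [h4, h3]
    refine (norm_sum_le _ _).trans ?_
    calc _ ≤ ∑ n ∈ J, (q.totient : ℝ) := by
          refine Finset.sum_le_sum fun n hn => ?_
          refine (norm_sum_le _ _).trans ((Finset.sum_le_sum fun m hm => sum_char_conj (hJq n hn) (hJq m hm)).trans ?_)
          rw [Finset.sum_ite_eq, if_pos hn]
      _ = _ := by rw [Finset.sum_const, nsmul_eq_mul, mul_comm]
  refine h1.trans (h2.trans (mul_le_mul_of_nonneg_left ?_ (by positivity)))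
  rw [hJ, Nat.card_Ioc, Nat.cast_sub (Nat.floor_le_floor hyy)]
  have := Nat.floor_le (hy.trans hyy)
  have := Nat.lt_floor_add_one y
  linarith

lemma Fr_diff (χ : DirichletCharacter ℂ q) {y y' : ℝ} (hy : 0 ≤ y) (hyy : y ≤ y') : ‖Fr χ y - Fr χ y'‖ ≤ y' - y + 1 := by
  have h := Nat.floor_le_floor hyy
  have e : Fr χ y' - Fr χ y = ∑ n ∈ Ioc ⌊y⌋₊ ⌊y'⌋₊, χ (n : ZMod q) := by
    unfold Fr psum
    rw [sub_eq_iff_eq_add]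
    have e1 : ∀ n, Icc 1 n = Ioc 0 n := fun n => by ext; simp; omega
    rw [e1, e1, add_comm, ← Finset.sum_union]
    · congr 1
      rw [Finset.Ioc_union_Ioc_eq_Ioc (Nat.zero_le _) h]
    · rw [Finset.disjoint_left]; intro a; simp; omega
  rw [norm_sub_rev, e]
  refine (norm_sum_le _ _).trans ((Finset.sum_le_sum (fun k _ => χ.norm_le_one _)).trans ?_)
  rw [Finset.sum_const, nsmul_eq_mul, mul_one, Nat.card_Ioc, Nat.cast_sub h]
  have := Nat.floor_le (hy.trans hyy)
  have := Nat.lt_floor_add_one y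
  linarith

end HP

open Complex Real Finset

namespace HP
set_option linter.unusedSectionVars false
open Metric MeasureTheory

lemma rpow_add_le2 {a b P : ℝ} (ha : 0 ≤ a) (hb : 0 ≤ b) (hP : 0 ≤ P) : (a + b)^P ≤ 2^P * (a^P + b^P) := by
  have h1 : a + b ≤ 2 * max a b := by linarith [le_max_left a b, le_max_right a b]
  refine (Real.rpow_le_rpow (by positivity) h1 hP).trans ?_
  rw [Real.mul_rpow (by norm_num) (le_max_of_le_left ha)]
  refine mul_le_mul_of_nonneg_left ?_ (by positivity)
  rcases max_choice a b with h | h <;> rw [h]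
  · linarith [Real.rpow_nonneg hb P]
  · linarith [Real.rpow_nonneg ha P]

lemma card_le_totient {q : ℕ} [NeZero q] (S : Finset (DirichletCharacter ℂ q)) : (S.card : ℝ) ≤ q.totient := by
  classical
  have h : Nat.card (DirichletCharacter ℂ q) = q.totient := DirichletCharacter.card_eq_totient_of_hasEnoughRootsOfUnity ℂ q
  rw [Nat.card_eq_fintype_card] at h
  rw [← h]
  exact_mod_cast Finset.card_le_univ S

lemma L_range (P : ℝ) (hP : 1 ≤ P) : ∃ (C : ℝ) (q0 : ℕ), 0 < C ∧ ∀ (q : ℕ) [NeZero q], q0 ≤ q →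
    (∀ χ : DirichletCharacter ℂ q, dirichletRH χ) → ∀ (ℓ : ℝ), 2 ≤ ℓ → ∀ (m : ℕ) (δ : ℝ), 2 ≤ m → 0 < δ → ∀ (E : Set ℝ), MeasurableSet E →
    E ⊆ Set.Icc (-(q:ℝ)^2) ((q:ℝ)^2) → ∀ W : ℝ, 0 < W → ∫ t in E, bw t * kap m δ t ≤ W →
    ∀ S : Finset (DirichletCharacter ℂ q), (∀ χ ∈ S, χ ≠ 1) →
    ∑ χ ∈ S, (∫ t in E, bw t * ‖χ.LFunction ((1/2 + 1/ℓ : ℝ) + t * I)‖ * kap m δ t) ^ P ≤ W^P * (C * q.totient * ℓ^(P^2/4)) := by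
  obtain ⟨C, q0, hC, h⟩ := L_moment1 P (by linarith)
  refine ⟨C, q0, hC, ?_⟩
  intro q _ hq hRH ℓ hℓ m δ hm hδ E hE hEq W hW hWE S hS
  have hcast : ((1/2 + 1/ℓ : ℝ) : ℂ) = 1/2 + ((1/ℓ : ℝ) : ℂ) := by push_cast; ring
  have hcomm : ∀ χ : DirichletCharacter ℂ q, (fun t : ℝ => bw t * ‖χ.LFunction ((1/2 + 1/ℓ : ℝ) + t * I)‖ * kap m δ t) =
      fun t : ℝ => (bw t * kap m δ t) * ‖χ.LFunction ((1/2 + 1/ℓ : ℝ) + t * I)‖ := fun χ => by ext t; ring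
  simp_rw [hcomm]
  have hcont : ∀ χ ∈ S, ∀ g : ℝ → ℝ, Continuous g → IntegrableOn (fun t : ℝ => bw t * kap m δ t * g t) E := by
    intro χ hχ g hg
    refine IntegrableOn.mono_set ?_ hEq
    exact ((continuous_bw.mul (continuous_kap m hδ.le)).mul hg).integrableOn_Icc
  refine jensen_sum S hP hW (by positivity) (fun t => (mul_pos (bw_pos t) (kap_pos m hδ.le t)).le) (fun _ _ => norm_nonneg _)
    (integrable_bk hδ hm).integrableOn ?_ ?_ hWE ?_
  · intro χ hχ
    exact hcont χ hχ _ (continuous_LF χ (hS χ hχ) _).norm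
  · intro χ hχ
    exact hcont χ hχ _ ((continuous_LF χ (hS χ hχ) _).norm.rpow_const fun _ => Or.inr (by linarith))
  · filter_upwards [ae_restrict_mem hE] with t ht
    refine mul_le_mul_of_nonneg_left ?_ (mul_pos (bw_pos t) (kap_pos m hδ.le t)).le
    have ht' := hEq ht
    have := h q hq hRH ℓ hℓ t (abs_le.mpr ⟨by linarith [ht'.1], ht'.2⟩) S hS
    rw [hcast]
    exact this

lemma FrD_bound {q : ℕ} [NeZero q] (χ : DirichletCharacter ℂ q) {y δ u : ℝ} (hy : 0 < y) (hδ : 0 < δ) (hδ1 : δ ≤ 1) (hu : |u| ≤ 1) :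
    |y - y * Real.exp (-(δ * u))| ≤ 2 * y * δ ∧ ‖Fr χ y - Fr χ (y * Real.exp (-(δ * u)))‖ ≤ 2 * y * δ + 1 := by
  have h1 : |-(δ * u)| ≤ δ := by
    rw [abs_neg, abs_mul, abs_of_pos hδ]; exact mul_le_of_le_one_right hδ.le hu
  have h2 := Real.abs_exp_sub_one_le (h1.trans hδ1)
  have h3 : |y - y * Real.exp (-(δ * u))| ≤ 2 * y * δ := by
    rw [show y - y * Real.exp (-(δ * u)) = -(y * (Real.exp (-(δ * u)) - 1)) by ring, abs_neg, abs_mul, abs_of_pos hy]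
    calc _ ≤ y * (2 * |-(δ * u)|) := mul_le_mul_of_nonneg_left h2 hy.le
      _ ≤ y * (2 * δ) := mul_le_mul_of_nonneg_left (by linarith) hy.le
      _ = _ := by ring
  refine ⟨h3, ?_⟩
  rcases le_total y (y * Real.exp (-(δ * u))) with h | h
  · refine (Fr_diff χ hy.le h).trans ?_
    have := neg_abs_le (y - y * Real.exp (-(δ * u)))
    linarith
  · rw [norm_sub_rev]
    refine (Fr_diff χ (by positivity) h).trans ?_
    have := le_abs_self (y - y * Real.exp (-(δ * u)))
    linarith

set_option maxHeartbeats 1000000 in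
lemma lossy (P : ℝ) (hP : 1 ≤ P) : ∃ (C : ℝ) (q0 : ℕ), 0 < C ∧ ∀ (q : ℕ) [NeZero q], q0 ≤ q →
    (∀ χ : DirichletCharacter ℂ q, dirichletRH χ) → ∀ Y : ℝ, 0 < Y → 2 ≤ Real.log Y → Y ≤ q →
    ∀ S : Finset (DirichletCharacter ℂ q), (∀ χ ∈ S, χ ≠ 1) →
    ∑ χ ∈ S, ‖Fr χ Y‖ ^ P ≤ C * q.totient * Y^(P/2) * (Real.log Y)^(P + P^2/4) := by
  obtain ⟨C1, q0, hC1, hL⟩ := L_range P hP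
  obtain ⟨ψ, C2, hC2, hψc, hψ0, hψs, hψ1, hψi, hsm⟩ := smoothing (m := 4) (by norm_num)
  set C3 := C2 * 12 + 27 with hC3
  have hC30 : 0 < C3 := by positivity
  refine ⟨C3^P * 2^P * (4^P * C1 + 1), q0, by positivity, ?_⟩
  intro q _ hq hRH Y hY hℓ hYq S hS
  set ℓ := Real.log Y with hℓd
  have hY1 : 1 ≤ Y := by
    rw [← Real.log_nonneg_iff hY]; linarith
  set δ := Y^(-(1/2):ℝ) with hδd
  have hδ : 0 < δ := by positivity
  have hδ1 : δ ≤ 1 := Real.rpow_le_one_of_one_le_of_nonpos hY1 (by norm_num)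
  set rY := Y^(1/2:ℝ) with hrY
  have hrY1 : 1 ≤ rY := Real.one_le_rpow hY1 (by norm_num)
  have hYδ : Y * δ = rY := by
    rw [hδd, hrY]; nth_rewrite 1 [← Real.rpow_one Y]; rw [← Real.rpow_add hY]; norm_num
  have hδ2 : δ^2 = Y⁻¹ := by
    rw [hδd, ← Real.rpow_natCast, ← Real.rpow_mul hY.le]; norm_num; exact Real.rpow_neg_one Y
  have hδq : 1 ≤ δ^2 * q := by
    rw [hδ2, inv_mul_eq_div, le_div_iff₀ hY]; linarith
  have hl : 1/ℓ ≤ 1/2 := one_div_le_one_div_of_le (by norm_num) hℓ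
  have hl0 : 0 < 1/ℓ := by positivity
  set σ := 1/2 + 1/ℓ with hσ
  have hYσ : Y^σ ≤ 3 * rY := by
    rw [hσ, Real.rpow_add hY, ← hrY]
    have : Y^(1/ℓ) = Real.exp 1 := by
      rw [Real.rpow_def_of_pos hY, ← hℓd]; congr 1; field_simp
    rw [this]
    have := Real.exp_one_lt_d9
    nlinarith
  set E := Set.Icc (-(q:ℝ)^2) ((q:ℝ)^2) with hE
  set I1 : DirichletCharacter ℂ q → ℝ := fun χ => ∫ t in E, bw t * ‖χ.LFunction (σ + t * I)‖ * kap 4 δ t with hI1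
  have hnn : ∀ (χ : DirichletCharacter ℂ q) t, 0 ≤ bw t * ‖χ.LFunction (σ + t * I)‖ * kap 4 δ t := fun χ t => by
    have := bw_pos t; have := kap_pos 4 hδ.le t; positivity
  have hI10 : ∀ χ, 0 ≤ I1 χ := fun χ => integral_nonneg (hnn χ)
  have hpt : ∀ χ ∈ S, ‖Fr χ Y‖ ≤ C3 * rY * (I1 χ + 1) := by
    intro χ hχ
    have h1 := hsm q χ (hS χ hχ) σ δ Y (by linarith) (by linarith) hδ hδ1 hY
    have h2 : ∫ t, bw t * ‖χ.LFunction (σ + t * I)‖ * kap 4 δ t ≤ I1 χ + 4 := by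
      rw [← integral_add_compl (measurableSet_Icc : MeasurableSet E) (integrable_bL χ (hS χ hχ) (by linarith) (by linarith) (by norm_num) hδ)]
      exact add_le_add le_rfl (far_tail χ (hS χ hχ) (by linarith) (by linarith) le_rfl hδ hδq)
    have h3 : ∫ u, ψ u * ‖Fr χ Y - Fr χ (Y * Real.exp (-(δ * u)))‖ ≤ 3 * rY := by
      calc _ ≤ ∫ u, ψ u * (3 * rY) := by
            refine integral_mono_of_nonneg (Filter.Eventually.of_forall fun u => mul_nonneg (hψ0 u) (norm_nonneg _)) (hψi.mul_const _) (Filter.Eventually.of_forall fun u => ?_)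
            by_cases hu : 1 ≤ |u|
            · simp [hψs u hu]
            · refine mul_le_mul_of_nonneg_left ((FrD_bound χ hY hδ hδ1 (by linarith)).2.trans ?_) (hψ0 u)
              rw [mul_assoc, hYδ]; linarith
        _ = _ := by rw [integral_mul_const, hψ1, one_mul]
    have h4 : C2 * Y^σ * (∫ t, bw t * ‖χ.LFunction (σ + t * I)‖ * kap 4 δ t) ≤ C2 * (3 * rY) * (I1 χ + 4) :=
      mul_le_mul (mul_le_mul_of_nonneg_left hYσ hC2.le) h2 (integral_nonneg (hnn χ)) (by positivity)
    have h5 := hI10 χ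
    have h6 : C2 * (3 * rY) * (I1 χ + 4) + 27 * rY ≤ C3 * rY * (I1 χ + 1) := by
      have : C3 * rY * (I1 χ + 1) - (C2 * (3 * rY) * (I1 χ + 4) + 27 * rY) = 9 * C2 * rY * I1 χ + 27 * rY * I1 χ := by rw [hC3]; ring
      have : 0 ≤ 9 * C2 * rY * I1 χ + 27 * rY * I1 χ := by positivity
      linarith
    linarith
  have hW : ∫ t in E, bw t * kap 4 δ t ≤ 4 * ℓ := by
    have hb := int_b hl0
    calc _ ≤ ∫ t, bw t * kap 4 δ t := setIntegral_le_integral (integrable_bk hδ (by norm_num)) (Filter.Eventually.of_forall fun t => (mul_pos (bw_pos t) (kap_pos 4 hδ.le t)).le)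
      _ ≤ ∫ t, δ^(-(1/ℓ)) * (1 + |t|)^(-(1+1/ℓ)) :=
          integral_mono (integrable_bk hδ (by norm_num)) (hb.1.const_mul _) (fun t => int_bk hl0 (by linarith) hδ hδ1 (by norm_num) t)
      _ = δ^(-(1/ℓ)) * (2 * ℓ) := by rw [integral_const_mul, hb.2]; field_simp
      _ ≤ 2 * (2 * ℓ) := by
          refine mul_le_mul_of_nonneg_right ?_ (by linarith)
          rw [hδd, ← Real.rpow_mul hY.le, Real.rpow_def_of_pos hY, ← hℓd]
          have : ℓ * (-(1/2) * -(1/ℓ)) = 1/2 := by field_simp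
          rw [this]
          have h1 := Real.exp_one_lt_d9
          have h2 : Real.exp (1/2) ^ 2 = Real.exp 1 := by rw [← Real.exp_nat_mul]; norm_num
          nlinarith [Real.exp_pos (1/2)]
      _ = _ := by ring
  have hmain := hL q hq hRH ℓ hℓ 4 δ (by norm_num) hδ E measurableSet_Icc le_rfl (4 * ℓ) (by linarith) hW S hS
  have hcard := card_le_totient S
  calc ∑ χ ∈ S, ‖Fr χ Y‖ ^ P ≤ ∑ χ ∈ S, C3^P * Y^(P/2) * (2^P * (I1 χ ^ P + 1)) := by
        refine Finset.sum_le_sum fun χ hχ => ?_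
        have h5 := hI10 χ
        refine (Real.rpow_le_rpow (norm_nonneg _) (hpt χ hχ) (by linarith)).trans ?_
        rw [Real.mul_rpow (by positivity) (by positivity), Real.mul_rpow hC30.le (by positivity), hrY, ← Real.rpow_mul hY.le]
        rw [show 1/2 * P = P/2 by ring]
        refine mul_le_mul_of_nonneg_left ?_ (by positivity)
        have := rpow_add_le2 h5 zero_le_one (by linarith : 0 ≤ P)
        rwa [Real.one_rpow] at this
    _ = C3^P * Y^(P/2) * 2^P * (∑ χ ∈ S, I1 χ ^ P + S.card) := by
        rw [← Finset.mul_sum, ← Finset.mul_sum, Finset.sum_add_distrib]; simp; ring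
    _ ≤ C3^P * Y^(P/2) * 2^P * ((4 * ℓ)^P * (C1 * q.totient * ℓ^(P^2/4)) + q.totient * ℓ^(P + P^2/4)) := by
        refine mul_le_mul_of_nonneg_left (add_le_add hmain ?_) (by positivity)
        refine hcard.trans (le_mul_of_one_le_right (by positivity) (Real.one_le_rpow (by linarith) (by positivity)))
    _ = _ := by
        rw [Real.mul_rpow (by norm_num) (by linarith), Real.rpow_add (by linarith)]; ring

end HP

open Complex Real Finset

namespace HP
set_option linter.unusedSectionVars false
open Metric MeasureTheory
open scoped ENNReal

noncomputable def nu (T : ℝ) : Measure ℝ := (volume.restrict (Set.Icc (-T) T)).withDensity (fun t => ENNReal.ofReal (bw t))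

lemma measurable_ofReal_bw : Measurable fun t => ENNReal.ofReal (bw t) := continuous_bw.measurable.ennreal_ofReal

lemma lintegral_nu (T : ℝ) {f : ℝ → ℝ≥0∞} (hf : Measurable f) :
    ∫⁻ t, f t ∂(nu T) = ∫⁻ t in Set.Icc (-T) T, ENNReal.ofReal (bw t) * f t := by
  unfold nu
  rw [lintegral_withDensity_eq_lintegral_mul _ measurable_ofReal_bw hf]
  rfl

instance (T : ℝ) : SFinite (nu T) := by unfold nu; infer_instance

lemma continuous_Dt (ℓ : ℝ) : Continuous (Dt ℓ) := by unfold Dt; fun_prop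

noncomputable def Kf (ℓ s a b : ℝ) : ℝ≥0∞ := ENNReal.ofReal (Dt ℓ (a - b) ^ (-s))

lemma Kf_symm (ℓ s a b : ℝ) : Kf ℓ s a b = Kf ℓ s b a := by
  unfold Kf; rw [← Dt_neg, neg_sub]

lemma measurable_Kf (ℓ s : ℝ) : Measurable (Function.uncurry (Kf ℓ s)) := by
  unfold Kf
  refine Continuous.measurable ?_
  refine ENNReal.continuous_ofReal.comp ?_
  refine Continuous.rpow_const ?_ fun z => Or.inl ?_
  · exact (continuous_Dt ℓ).comp (by fun_prop)
  · have := one_le_Dt ℓ (z.1 - z.2)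
    linarith

/-- bound for weight on a window -/
lemma bw_window {θ T t : ℝ} (hθ : 0 < θ) (ht : |t| ≤ T) : bw t ≤ (1 + T)^θ * (1 + |t|)^(-(1+θ)) := by
  have h0 := abs_nonneg t
  rw [neg_add, Real.rpow_add (by positivity), Real.rpow_neg_one, Real.rpow_neg (by positivity)]
  have h1 : (1 + |t|)^θ ≤ (1 + T)^θ := Real.rpow_le_rpow (by positivity) (by linarith) hθ.le
  have h2 : 0 < (1 + |t|)^θ := by positivity
  have h3 : 1 ≤ (1 + T)^θ * ((1 + |t|)^θ)⁻¹ := by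
    rw [← div_eq_mul_inv, le_div_iff₀ h2]; linarith
  calc bw t = 1 * bw t := (one_mul _).symm
    _ ≤ ((1 + T)^θ * ((1 + |t|)^θ)⁻¹) * bw t := mul_le_mul_of_nonneg_right h3 (bw_pos t).le
    _ = _ := by unfold bw; ring

lemma window_pow {A θ ℓ : ℝ} (hA : 0 < A) (hθ : 0 < θ) (hℓ : 1 ≤ ℓ) : (1 + ℓ^A)^θ ≤ 2^θ * ℓ^(A * θ) := by
  have h : 1 ≤ ℓ^A := Real.one_le_rpow hℓ hA.le
  rw [Real.rpow_mul (by linarith), ← Real.mul_rpow (by norm_num) (by linarith)]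
  exact Real.rpow_le_rpow (by linarith) (by linarith) hθ.le

lemma Dt_split {ℓ s : ℝ} (hℓ : 1 ≤ ℓ) (hs : 1 < s) (t t' : ℝ) :
    bw t' * Dt ℓ (t - t')^(-s) ≤ 2^(s+1) * bw t * (1 + |ℓ * (t' - t)|)^(-s) + ℓ^(-s) * bw t' := by
  have hb := bw_pos t
  have hb' := bw_pos t'
  have hD1 := one_le_Dt ℓ (t - t')
  rw [abs_mul, abs_of_pos (by linarith : 0 < ℓ), abs_sub_comm t' t]
  have hn := abs_nonneg (t - t')
  by_cases h : |t - t'| ≤ 1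
  · have e1 : (1 + ℓ * |t - t'|) / 2 ≤ Dt ℓ (t - t') := by
      have : ℓ * |t - t'| ≤ Dt ℓ (t - t') := by
        refine le_trans ?_ (le_max_right _ _)
        exact le_min le_rfl (mul_le_of_le_one_right (by linarith) h)
      linarith
    have e2 : Dt ℓ (t - t')^(-s) ≤ 2^s * (1 + ℓ * |t - t'|)^(-s) := by
      have e3 : 0 < (1 + ℓ * |t - t'|) := by positivity
      refine (Real.rpow_le_rpow_of_nonpos (by positivity) e1 (by linarith)).trans_eq ?_
      rw [Real.div_rpow e3.le (by norm_num), Real.rpow_neg (by norm_num : (0:ℝ) ≤ 2), div_inv_eq_mul]; ring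
    have e4 : bw t' ≤ 2 * bw t := by
      unfold bw
      rw [← mul_div_assoc, div_le_div_iff₀ (by positivity) (by positivity)]
      have := abs_sub_abs_le_abs_sub t t'
      linarith [abs_nonneg t']
    calc _ ≤ (2 * bw t) * (2^s * (1 + ℓ * |t - t'|)^(-s)) := mul_le_mul e4 e2 (by positivity) (by positivity)
      _ = 2^(s+1) * bw t * (1 + ℓ * |t - t'|)^(-s) := by rw [Real.rpow_add (by norm_num), Real.rpow_one]; ring
      _ ≤ _ := le_add_of_nonneg_right (by positivity)
  · push Not at h
    have e1 : ℓ ≤ Dt ℓ (t - t') := by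
      refine le_trans ?_ (le_max_right _ _)
      exact le_min (le_mul_of_one_le_right (by linarith) h.le) le_rfl
    have e2 : Dt ℓ (t - t')^(-s) ≤ ℓ^(-s) := Real.rpow_le_rpow_of_nonpos (by linarith) e1 (by linarith)
    calc _ ≤ bw t' * ℓ^(-s) := mul_le_mul_of_nonneg_left e2 hb'.le
      _ = ℓ^(-s) * bw t' := by ring
      _ ≤ _ := le_add_of_nonneg_left (by positivity)

lemma hker (s A : ℝ) (hs : 1 < s) (hA : 0 < A) : ∃ C : ℝ, 0 < C ∧ ∀ ℓ t : ℝ, 1 ≤ ℓ →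
    ∫⁻ t', Kf ℓ s t t' ∂(nu (ℓ^A)) ≤ ENNReal.ofReal (C / ℓ * (bw t + ℓ^(-((s-1)/2)))) := by
  set θ := (s - 1) / (2 * A) with hθd
  have hθ : 0 < θ := div_pos (by linarith) (by positivity)
  have hs1 : 0 < s - 1 := by linarith
  have c1 : 0 < 2^(s+1) * (2 / (s - 1)) := by positivity
  have c2 : 0 < 2^θ * (2 / θ) := by positivity
  refine ⟨2^(s+1) * (2 / (s - 1)) + 2^θ * (2 / θ), by positivity, ?_⟩
  intro ℓ t hℓ
  have hℓ0 : 0 < ℓ := by linarith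
  have hb := bw_pos t
  rw [lintegral_nu _ ((measurable_Kf ℓ s).of_uncurry_left)]
  set G : ℝ → ℝ := fun t' => 2^(s+1) * bw t * (1 + |ℓ * (t' - t)|)^(-s) + ℓ^(-s) * (1 + ℓ^A)^θ * (1 + |t'|)^(-(1+θ)) with hG
  have i0 : Integrable (fun x : ℝ => (1 + |x|)^(-s)) ∧ ∫ x : ℝ, (1 + |x|)^(-s) = 2 / (s - 1) := by
    have := int_b hs1
    rwa [show 1 + (s - 1) = s by ring] at this
  have i1 : Integrable fun t' : ℝ => 2^(s+1) * bw t * (1 + |ℓ * (t' - t)|)^(-s) :=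
    ((i0.1.comp_mul_left' hℓ0.ne').comp_sub_right t).const_mul _
  have i2 : Integrable fun t' : ℝ => ℓ^(-s) * (1 + ℓ^A)^θ * (1 + |t'|)^(-(1+θ)) := (int_b hθ).1.const_mul _
  have hG0 : ∀ x, 0 ≤ G x := fun x => by positivity
  have hintegr : ∫ x, G x = 2^(s+1) * bw t * (ℓ⁻¹ * (2 / (s-1))) + ℓ^(-s) * (1 + ℓ^A)^θ * (2 / θ) := by
    rw [hG, integral_add i1 i2, integral_const_mul, integral_const_mul, (int_b hθ).2]
    have h1 := integral_sub_right_eq_self (μ := volume) (fun x : ℝ => (1 + |ℓ * x|)^(-s)) t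
    have h2 := Measure.integral_comp_mul_left (fun x : ℝ => (1 + |x|)^(-s)) ℓ
    rw [h1, h2, i0.2, abs_of_pos (by positivity), smul_eq_mul]
  calc _ ≤ ∫⁻ t' in Set.Icc (-ℓ^A) (ℓ^A), ENNReal.ofReal (G t') := by
        refine setLIntegral_mono' measurableSet_Icc fun x hx => ?_
        unfold Kf
        rw [← ENNReal.ofReal_mul (bw_pos x).le]
        refine ENNReal.ofReal_le_ofReal ((Dt_split hℓ hs t x).trans ?_)
        refine add_le_add le_rfl ?_
        rw [mul_assoc (ℓ^(-s))]
        exact mul_le_mul_of_nonneg_left (bw_window hθ (abs_le.mpr hx)) (by positivity)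
    _ ≤ ∫⁻ t', ENNReal.ofReal (G t') := setLIntegral_le_lintegral _ _
    _ = ENNReal.ofReal (∫ x, G x) := (ofReal_integral_eq_lintegral_ofReal (i1.add i2) (Filter.Eventually.of_forall hG0)).symm
    _ ≤ _ := by
        refine ENNReal.ofReal_le_ofReal ?_
        rw [hintegr]
        have e1 : ℓ^(-s) * (1 + ℓ^A)^θ ≤ 2^θ * (ℓ⁻¹ * ℓ^(-((s-1)/2))) := by
          refine (mul_le_mul_of_nonneg_left (window_pow hA hθ hℓ) (by positivity)).trans_eq ?_
          rw [show A * θ = (s-1)/2 by rw [hθd]; field_simp, ← Real.rpow_neg_one, ← Real.rpow_add hℓ0,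
            show (-1 + -((s-1)/2)) = -s + (s-1)/2 by ring, Real.rpow_add hℓ0]
          ring
        have e2 := mul_le_mul_of_nonneg_right e1 (by positivity : 0 ≤ 2 / θ)
        have hz : 0 < ℓ^(-((s-1)/2)) := by positivity
        generalize ℓ^(-((s-1)/2)) = z at *
        have : (2^(s+1) * (2 / (s - 1)) + 2^θ * (2 / θ)) / ℓ * (bw t + z) - (2^(s+1) * bw t * (ℓ⁻¹ * (2 / (s-1))) + 2^θ * (ℓ⁻¹ * z) * (2 / θ)) =
          2^(s+1) * (2 / (s - 1)) / ℓ * z + 2^θ * (2 / θ) / ℓ * bw t := by field_simp; ring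
        have : 0 ≤ 2^(s+1) * (2 / (s - 1)) / ℓ * z + 2^θ * (2 / θ) / ℓ * bw t := by positivity
        linarith

lemma hmass (κ A : ℝ) (hκ : 0 < κ) (hA : 0 < A) : ∃ C : ℝ, 0 < C ∧ ∀ ℓ : ℝ, 1 ≤ ℓ →
    ∫⁻ t, ENNReal.ofReal (bw t + ℓ^(-κ)) ∂(nu (ℓ^A)) ≤ ENNReal.ofReal C := by
  set θ := κ / A with hθd
  have hθ : 0 < θ := div_pos hκ hA
  refine ⟨2 + 2^θ * (2 / θ), by positivity, ?_⟩
  intro ℓ hℓ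
  have hℓ0 : 0 < ℓ := by linarith
  have hmeas : Measurable fun t => ENNReal.ofReal (bw t + ℓ^(-κ)) := by
    refine Measurable.ennreal_ofReal ?_
    exact continuous_bw.measurable.add_const _
  rw [lintegral_nu _ hmeas]
  set G : ℝ → ℝ := fun t' => (1 + |t'|)^(-(1+(1:ℝ))) + ℓ^(-κ) * (1 + ℓ^A)^θ * (1 + |t'|)^(-(1+θ)) with hG
  have i1 := (int_b one_pos).1
  have i2 : Integrable fun t' : ℝ => ℓ^(-κ) * (1 + ℓ^A)^θ * (1 + |t'|)^(-(1+θ)) := (int_b hθ).1.const_mul _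
  have hG0 : ∀ x, 0 ≤ G x := fun x => by positivity
  have hintegr : ∫ x, G x = 2 + ℓ^(-κ) * (1 + ℓ^A)^θ * (2 / θ) := by
    rw [hG, integral_add i1 i2, integral_const_mul, (int_b hθ).2, (int_b one_pos).2]; norm_num
  calc _ ≤ ∫⁻ t' in Set.Icc (-ℓ^A) (ℓ^A), ENNReal.ofReal (G t') := by
        refine setLIntegral_mono' measurableSet_Icc fun x hx => ?_
        rw [← ENNReal.ofReal_mul (bw_pos x).le]
        refine ENNReal.ofReal_le_ofReal ?_
        rw [mul_add]
        refine add_le_add (le_of_eq ?_) ?_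
        · rw [show -(1+(1:ℝ)) = -((2:ℕ):ℝ) by norm_num, Real.rpow_neg (by positivity), Real.rpow_natCast]
          unfold bw; rw [← sq]; simp
        · have := mul_le_mul_of_nonneg_left (bw_window hθ (abs_le.mpr hx)) (by positivity : 0 ≤ ℓ^(-κ))
          linarith
    _ ≤ ∫⁻ t', ENNReal.ofReal (G t') := setLIntegral_le_lintegral _ _
    _ = ENNReal.ofReal (∫ x, G x) := (ofReal_integral_eq_lintegral_ofReal (i1.add i2) (Filter.Eventually.of_forall hG0)).symm
    _ ≤ _ := by
        refine ENNReal.ofReal_le_ofReal ?_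
        rw [hintegr]
        refine add_le_add le_rfl (mul_le_mul_of_nonneg_right ?_ (by positivity))
        refine (mul_le_mul_of_nonneg_left (window_pow hA hθ hℓ) (by positivity)).trans_eq ?_
        rw [show A * θ = κ by rw [hθd]; field_simp, mul_left_comm, ← Real.rpow_add hℓ0]
        simp

end HP

open Complex Real Finset

namespace HP
set_option linter.unusedSectionVars false
open Metric MeasureTheory
open scoped ENNReal

lemma holderW {ν : Measure ℝ} {r : ℝ} (hr : 1 < r) {f w : ℝ → ℝ≥0∞} (hf : Measurable f) (hw : Measurable w)
    (hw0 : ∀ t, w t ≠ 0) (hwt : ∀ t, w t ≠ ∞) :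
    (∫⁻ t, f t ∂ν)^r ≤ (∫⁻ t, w t ∂ν)^(r-1) * ∫⁻ t, f t^r * w t^(1-r) ∂ν := by
  have hr0 : 0 < r := by linarith
  have hr1 : 0 < r - 1 := by linarith
  have hc : r.HolderConjugate (r / (r-1)) := by
    have := Real.HolderConjugate.conjExponent hr
    simpa [Real.conjExponent] using this
  have h := ENNReal.lintegral_mul_le_Lp_mul_Lq ν hc (f := fun t => f t * w t^(-((r-1)/r))) (g := fun t => w t^((r-1)/r))
    ((hf.mul (hw.pow_const _)).aemeasurable) (hw.pow_const _).aemeasurable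
  have e1 : ∀ t, ((fun t => f t * w t^(-((r-1)/r))) * (fun t => w t^((r-1)/r))) t = f t := by
    intro t
    simp only [Pi.mul_apply]
    rw [mul_assoc, ← ENNReal.rpow_add _ _ (hw0 t) (hwt t)]
    simp
  have e2 : ∀ t, (f t * w t^(-((r-1)/r)))^r = f t^r * w t^(1-r) := by
    intro t
    rw [ENNReal.mul_rpow_of_nonneg _ _ hr0.le, ← ENNReal.rpow_mul]
    congr 2; field_simp; ring
  have e3 : ∀ t, (w t^((r-1)/r))^(r/(r-1)) = w t := by
    intro t
    rw [← ENNReal.rpow_mul, show (r-1)/r * (r/(r-1)) = 1 by field_simp, ENNReal.rpow_one]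
  simp only [e1, e2, e3] at h
  have h2 := ENNReal.rpow_le_rpow h hr0.le
  refine h2.trans_eq ?_
  rw [ENNReal.mul_rpow_of_nonneg _ _ hr0.le, ← ENNReal.rpow_mul, ← ENNReal.rpow_mul,
    show 1 / r * r = 1 by field_simp, show 1 / (r/(r-1)) * r = r - 1 by field_simp, ENNReal.rpow_one, mul_comm]

lemma sum_lintegral_le {ι : Type*} (S : Finset ι) (ν : Measure ℝ) (g : ι → ℝ → ℝ≥0∞) :
    ∑ i ∈ S, ∫⁻ t, g i t ∂ν ≤ ∫⁻ t, ∑ i ∈ S, g i t ∂ν := by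
  classical
  induction S using Finset.induction_on with
  | empty => simp
  | insert a S ha ih =>
    simp only [Finset.sum_insert ha]
    exact (add_le_add le_rfl ih).trans (le_lintegral_add _ _)

lemma fourfold {ι : Type*} (S : Finset ι) {ν : Measure ℝ} {r : ℝ} (hr : 1 < r) {f : ι → ℝ → ℝ≥0∞}
    (hf : ∀ i, Measurable (f i)) (w : ℝ → ℝ → ℝ → ℝ → ℝ≥0∞) (hw : ∀ a b c, Measurable (w a b c))
    (hw0 : ∀ a b c d, w a b c d ≠ 0) (hwt : ∀ a b c d, w a b c d ≠ ∞) {W : ℝ≥0∞}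
    (hW : ∀ a b c, ∫⁻ d, w a b c d ∂ν ≤ W) {M : ℝ → ℝ → ℝ → ℝ → ℝ≥0∞}
    (hM : ∀ a b c d, ∑ i ∈ S, f i a * (f i b * (f i c * (W^(r-1) * (f i d^r * w a b c d^(1-r))))) ≤ M a b c d) :
    ∑ i ∈ S, (∫⁻ t, f i t ∂ν)^(3+r) ≤ ∫⁻ a, ∫⁻ b, ∫⁻ c, ∫⁻ d, M a b c d ∂ν ∂ν ∂ν ∂ν := by
  have key : ∀ i, (∫⁻ t, f i t ∂ν)^(3+r) ≤
      ∫⁻ a, ∫⁻ b, ∫⁻ c, ∫⁻ d, f i a * (f i b * (f i c * (W^(r-1) * (f i d^r * w a b c d^(1-r))))) ∂ν ∂ν ∂ν ∂ν := by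
    intro i
    set F := ∫⁻ t, f i t ∂ν with hF
    have e0 : F^(3+r) = F * (F * (F * F^r)) := by
      rw [ENNReal.rpow_add_of_nonneg _ _ (by norm_num) (by linarith)]
      rw [show (3:ℝ) = ((3:ℕ):ℝ) by norm_num, ENNReal.rpow_natCast]; ring
    rw [e0, hF, ← lintegral_mul_const _ (hf i)]
    refine lintegral_mono fun a => ?_
    rw [← lintegral_mul_const _ (hf i)]
    refine (lintegral_const_mul_le _ _).trans (lintegral_mono fun b => ?_)
    rw [← lintegral_mul_const _ (hf i)]
    refine (mul_le_mul_right (lintegral_const_mul_le _ _) _).trans ?_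
    refine (lintegral_const_mul_le _ _).trans (lintegral_mono fun c => ?_)
    have h := holderW (ν := ν) hr (hf i) (hw a b c) (hw0 a b c) (hwt a b c)
    have h2 : (∫⁻ t, w a b c t ∂ν)^(r-1) ≤ W^(r-1) := ENNReal.rpow_le_rpow (hW a b c) (by linarith)
    have h3 := h.trans (mul_le_mul_left h2 _)
    have h4 : (∫⁻ t, f i t ∂ν)^r ≤ ∫⁻ d, W^(r-1) * (f i d^r * w a b c d^(1-r)) ∂ν :=
      h3.trans (lintegral_const_mul_le _ _)
    calc f i a * (f i b * (f i c * (∫⁻ t, f i t ∂ν)^r)) ≤ f i a * (f i b * (f i c * ∫⁻ d, W^(r-1) * (f i d^r * w a b c d^(1-r)) ∂ν)) := by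
          gcongr
      _ ≤ f i a * (f i b * (∫⁻ d, f i c * (W^(r-1) * (f i d^r * w a b c d^(1-r))) ∂ν)) := by
          gcongr; exact lintegral_const_mul_le _ _
      _ ≤ f i a * ((∫⁻ d, f i b * (f i c * (W^(r-1) * (f i d^r * w a b c d^(1-r)))) ∂ν)) := by
          gcongr; exact lintegral_const_mul_le _ _
      _ ≤ _ := lintegral_const_mul_le _ _
  refine (Finset.sum_le_sum fun i _ => key i).trans ?_
  refine (sum_lintegral_le _ _ _).trans (lintegral_mono fun a => ?_)
  refine (sum_lintegral_le _ _ _).trans (lintegral_mono fun b => ?_)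
  refine (sum_lintegral_le _ _ _).trans (lintegral_mono fun c => ?_)
  exact (sum_lintegral_le _ _ _).trans (lintegral_mono fun d => hM a b c d)

lemma lint_add4 {ν : Measure ℝ} {f g k l : ℝ → ℝ≥0∞} (hf : Measurable f) (hg : Measurable g) (hk : Measurable k) :
    ∫⁻ x, (f x + g x + k x + l x) ∂ν = ∫⁻ x, f x ∂ν + ∫⁻ x, g x ∂ν + ∫⁻ x, k x ∂ν + ∫⁻ x, l x ∂ν := by
  have h1 : Measurable fun x => f x + g x := hf.add hg
  have h2 : Measurable fun x => f x + g x + k x := h1.add hk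
  rw [lintegral_add_left h2, lintegral_add_left h1, lintegral_add_left hf]

section star
variable {ν : Measure ℝ} [SFinite ν] {K : ℝ → ℝ → ℝ≥0∞}

lemma star_swap (hK : Measurable (Function.uncurry K)) (hs : ∀ a b, K a b = K b a) {g g' : ℝ → ℝ≥0∞} (hg : Measurable g) (hg' : Measurable g') :
    ∫⁻ x, ∫⁻ z, K x z * (g z * g' z) ∂ν ∂ν = ∫⁻ z, (∫⁻ x, K z x ∂ν) * (g z * g' z) ∂ν := by
  rw [lintegral_lintegral_swap]
  · refine lintegral_congr fun z => ?_
    rw [lintegral_mul_const _ hK.of_uncurry_right]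
    congr 1
    exact lintegral_congr fun x => hs _ _
  · exact (hK.mul ((hg.mul hg').comp measurable_snd)).aemeasurable

lemma star_sum (hK : Measurable (Function.uncurry K)) (hs : ∀ a b, K a b = K b a) :
    ∫⁻ a, ∫⁻ b, ∫⁻ c, ∫⁻ d, (K a b * K a c * K a d + K a b * K b c * K b d + K a c * K b c * K c d + K a d * K b d * K c d) ∂ν ∂ν ∂ν ∂ν
      = 4 * ∫⁻ x, (∫⁻ z, K x z ∂ν)^3 ∂ν := by
  set h : ℝ → ℝ≥0∞ := fun x => ∫⁻ z, K x z ∂ν with hh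
  have mh : Measurable h := hK.lintegral_prod_right
  have ml : ∀ a, Measurable (K a) := fun a => hK.of_uncurry_left
  have mr : ∀ a, Measurable (fun x => K x a) := fun a => hK.of_uncurry_right
  have m2 : ∀ {f g : ℝ → ℝ}, Measurable f → Measurable g → Measurable fun x => K (f x) (g x) := fun hf hg => hK.comp (hf.prodMk hg)
  have s1 : ∀ a b c, ∫⁻ d, (K a b * K a c * K a d + K a b * K b c * K b d + K a c * K b c * K c d + K a d * K b d * K c d) ∂ν
      = K a b * K a c * h a + K a b * K b c * h b + K a c * K b c * h c + ∫⁻ d, K c d * (K b d * K a d) ∂ν := by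
    intro a b c
    rw [lint_add4 ((ml a).const_mul _) ((ml b).const_mul _) ((ml c).const_mul _), lintegral_const_mul _ (ml a), lintegral_const_mul _ (ml b), lintegral_const_mul _ (ml c)]
    congr 1
    exact lintegral_congr fun d => by ring
  have s2 : ∀ a b, ∫⁻ c, (K a b * K a c * h a + K a b * K b c * h b + K a c * K b c * h c + ∫⁻ d, K c d * (K b d * K a d) ∂ν) ∂ν
      = K a b * h a * h a + K a b * h b * h b + ∫⁻ c, K b c * (K a c * h c) ∂ν + ∫⁻ d, K b d * (h d * K a d) ∂ν := by
    intro a b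
    have q1 : Measurable fun c => K a b * K a c * h a := ((ml a).const_mul _).mul_const _
    have q2 : Measurable fun c => K a b * K b c * h b := ((ml b).const_mul _).mul_const _
    have q3 : Measurable fun c => K a c * K b c * h c := ((ml a).mul (ml b)).mul mh
    rw [lint_add4 q1 q2 q3,
      lintegral_mul_const _ ((ml a).const_mul _), lintegral_mul_const _ ((ml b).const_mul _), lintegral_const_mul _ (ml a), lintegral_const_mul _ (ml b),
      star_swap hK hs (ml b) (ml a)]
    congr 1
    · congr 1
      exact lintegral_congr fun d => by ring
    · exact lintegral_congr fun d => by ring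
  have s3 : ∀ a, ∫⁻ b, (K a b * h a * h a + K a b * h b * h b + ∫⁻ c, K b c * (K a c * h c) ∂ν + ∫⁻ d, K b d * (h d * K a d) ∂ν) ∂ν
      = h a * h a * h a + ∫⁻ b, K a b * (h b * h b) ∂ν + ∫⁻ c, K a c * (h c * h c) ∂ν + ∫⁻ d, K a d * (h d * h d) ∂ν := by
    intro a
    have q1 : Measurable fun b => K a b * h a * h a := ((ml a).mul_const _).mul_const _
    have q2 : Measurable fun b => K a b * h b * h b := ((ml a).mul mh).mul mh
    have q3 : Measurable fun b => ∫⁻ c, K b c * (K a c * h c) ∂ν := by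
      refine Measurable.lintegral_prod_right (f := fun b c => K b c * (K a c * h c)) ?_
      exact hK.mul (((ml a).mul mh).comp measurable_snd)
    rw [lint_add4 q1 q2 q3,
      lintegral_mul_const _ ((ml a).mul_const _), lintegral_mul_const _ (ml a),
      star_swap hK hs (ml a) mh, star_swap hK hs mh (ml a)]
    congr 1
    · congr 1
      · congr 1
        exact lintegral_congr fun d => by ring
      · exact lintegral_congr fun d => by ring
    · exact lintegral_congr fun d => by ring
  simp only [s1, s2, s3]
  have q : Measurable fun a => ∫⁻ b, K a b * (h b * h b) ∂ν := by
    refine Measurable.lintegral_prod_right (f := fun b c => K b c * (h c * h c)) ?_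
    exact hK.mul ((mh.mul mh).comp measurable_snd)
  have q1 : Measurable fun a => h a * h a * h a := (mh.mul mh).mul mh
  rw [lint_add4 q1 q q, star_swap hK hs mh mh]
  have e : ∫⁻ z, (∫⁻ x, K z x ∂ν) * (h z * h z) ∂ν = ∫⁻ x, h x^3 ∂ν := lintegral_congr fun d => by ring
  have e' : ∫⁻ z, h z * h z * h z ∂ν = ∫⁻ x, h x^3 ∂ν := lintegral_congr fun d => by ring
  rw [e, e']; ring
end star

lemma star_amgm {a e s : ℝ} (ha : 0 ≤ a) (has : 3 * a ≤ 2 * s) (hs : 0 < s) (hae : s = a + e) {x12 x13 x14 x23 x24 x34 : ℝ}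
    (h12 : 0 < x12) (h13 : 0 < x13) (h14 : 0 < x14) (h23 : 0 < x23) (h24 : 0 < x24) (h34 : 0 < x34) :
    x12^(-a) * x13^(-a) * x23^(-a) * x14^(-e) * x24^(-e) * x34^(-e) ≤
    x12^(-s) * x13^(-s) * x14^(-s) + x12^(-s) * x23^(-s) * x24^(-s) + x13^(-s) * x23^(-s) * x34^(-s) + x14^(-s) * x24^(-s) * x34^(-s) := by
  obtain ⟨l12, rfl⟩ : ∃ l, x12 = Real.exp l := ⟨_, (Real.exp_log h12).symm⟩
  obtain ⟨l13, rfl⟩ : ∃ l, x13 = Real.exp l := ⟨_, (Real.exp_log h13).symm⟩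
  obtain ⟨l14, rfl⟩ : ∃ l, x14 = Real.exp l := ⟨_, (Real.exp_log h14).symm⟩
  obtain ⟨l23, rfl⟩ : ∃ l, x23 = Real.exp l := ⟨_, (Real.exp_log h23).symm⟩
  obtain ⟨l24, rfl⟩ : ∃ l, x24 = Real.exp l := ⟨_, (Real.exp_log h24).symm⟩
  obtain ⟨l34, rfl⟩ : ∃ l, x34 = Real.exp l := ⟨_, (Real.exp_log h34).symm⟩
  simp only [← Real.exp_mul, ← Real.exp_add]
  set lam := a / (2 * s) with hl
  have hl0 : 0 ≤ lam := by positivity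
  have hls : 2 * s * lam = a := by rw [hl]; field_simp
  have hl3 : 3 * lam ≤ 1 := by rw [hl]; rw [← mul_div_assoc, div_le_one (by positivity)]; exact has
  have h := Real.geom_mean_le_arith_mean4_weighted hl0 hl0 hl0 (by linarith : 0 ≤ 1 - 3 * lam)
    (Real.exp_pos (l12 * -s + l13 * -s + l14 * -s)).le (Real.exp_pos (l12 * -s + l23 * -s + l24 * -s)).le
    (Real.exp_pos (l13 * -s + l23 * -s + l34 * -s)).le (Real.exp_pos (l14 * -s + l24 * -s + l34 * -s)).le (by ring)
  simp only [← Real.exp_mul, ← Real.exp_add] at h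
  have he : e = s - 2 * s * lam := by rw [hls]; linarith
  have e1 : l12 * -a + l13 * -a + l23 * -a + l14 * -e + l24 * -e + l34 * -e =
    (l12 * -s + l13 * -s + l14 * -s) * lam + (l12 * -s + l23 * -s + l24 * -s) * lam + (l13 * -s + l23 * -s + l34 * -s) * lam
      + (l14 * -s + l24 * -s + l34 * -s) * (1 - 3 * lam) := by
    rw [he, ← hls]; ring
  rw [e1]
  refine h.trans ?_
  have hl1 : lam ≤ 1 := by linarith
  refine add_le_add (add_le_add (add_le_add ?_ ?_) ?_) ?_
  all_goals exact mul_le_of_le_one_left (Real.exp_pos _).le (by linarith)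

lemma amgm3 {x y z : ℝ} (hx : 0 ≤ x) (hy : 0 ≤ y) (hz : 0 ≤ z) : x^((1:ℝ)/3) * y^((1:ℝ)/3) * z^((1:ℝ)/3) ≤ x + y + z := by
  have := Real.geom_mean_le_arith_mean3_weighted (by norm_num : (0:ℝ) ≤ 1/3) (by norm_num : (0:ℝ) ≤ 1/3) (by norm_num : (0:ℝ) ≤ 1/3) hx hy hz (by norm_num)
  linarith

end HP

open Complex Real Finset

namespace HP
set_option linter.unusedSectionVars false
open Metric MeasureTheory
open scoped ENNReal

noncomputable def Kr (ℓ s a b : ℝ) : ℝ := Dt ℓ (a - b) ^ (-s)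
lemma Kr_pos (ℓ s a b : ℝ) : 0 < Kr ℓ s a b := Real.rpow_pos_of_pos (by linarith [one_le_Dt ℓ (a-b)]) _
lemma Kf_eq (ℓ s a b : ℝ) : Kf ℓ s a b = ENNReal.ofReal (Kr ℓ s a b) := rfl

noncomputable def w4 (ℓ a b c d : ℝ) : ℝ := Kr ℓ (3/8) a d * Kr ℓ (3/8) b d * Kr ℓ (3/8) c d
lemma w4_pos (ℓ a b c d : ℝ) : 0 < w4 ℓ a b c d := mul_pos (mul_pos (Kr_pos _ _ _ _) (Kr_pos _ _ _ _)) (Kr_pos _ _ _ _)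

lemma w4_le (ℓ a b c d : ℝ) : w4 ℓ a b c d ≤ Kr ℓ (9/8) a d + Kr ℓ (9/8) b d + Kr ℓ (9/8) c d := by
  have h : ∀ x y, Kr ℓ (9/8) x y ^ ((1:ℝ)/3) = Kr ℓ (3/8) x y := by
    intro x y
    unfold Kr
    rw [← Real.rpow_mul (by linarith [one_le_Dt ℓ (x-y)])]; norm_num
  have := amgm3 (Kr_pos ℓ (9/8) a d).le (Kr_pos ℓ (9/8) b d).le (Kr_pos ℓ (9/8) c d).le
  unfold w4
  simpa only [h] using this

noncomputable def st4 (ℓ s a b c d : ℝ) : ℝ := Kr ℓ s a b * Kr ℓ s a c * Kr ℓ s a d + Kr ℓ s a b * Kr ℓ s b c * Kr ℓ s b d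
  + Kr ℓ s a c * Kr ℓ s b c * Kr ℓ s c d + Kr ℓ s a d * Kr ℓ s b d * Kr ℓ s c d

lemma st4_pos (ℓ s a b c d : ℝ) : 0 < st4 ℓ s a b c d := by
  have := Kr_pos ℓ s
  unfold st4
  have h1 := this a b; have h2 := this a c; have h3 := this a d; have h4 := this b c; have h5 := this b d; have h6 := this c d
  positivity

lemma moment4 (r A : ℝ) (hr : 1 < r) (hA : 0 < A) : ∃ (C : ℝ) (q0 : ℕ), 0 < C ∧ ∀ (q : ℕ) [NeZero q], q0 ≤ q →
    (∀ χ : DirichletCharacter ℂ q, dirichletRH χ) → ∀ (ℓ : ℝ), 2 ≤ ℓ → ℓ^A ≤ (q:ℝ)^2 →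
    ∀ S : Finset (DirichletCharacter ℂ q), (∀ χ ∈ S, χ ≠ 1) → ∀ a b c d : ℝ, |a| ≤ ℓ^A → |b| ≤ ℓ^A → |c| ≤ ℓ^A → |d| ≤ ℓ^A →
    ∑ χ ∈ S, ‖χ.LFunction ((1/2 + 1/ℓ : ℝ) + a * I)‖ * (‖χ.LFunction ((1/2 + 1/ℓ : ℝ) + b * I)‖ * (‖χ.LFunction ((1/2 + 1/ℓ : ℝ) + c * I)‖ *
      (‖χ.LFunction ((1/2 + 1/ℓ : ℝ) + d * I)‖^r * w4 ℓ a b c d^(1-r)))) ≤ C * q.totient * ℓ^((3+r)^2/4) * st4 ℓ (1 + (r-1)^2/(16*r)) a b c d := by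
  set η := (r-1)/(8*r) with hη
  have hη0 : 0 < η := div_pos (by linarith) (by linarith)
  have hη1 : η < 1 := by rw [hη, div_lt_one (by linarith)]; linarith
  obtain ⟨C, q0, hC, h⟩ := L_moment2 (3+r) A η (by linarith) hA hη0 hη1
  refine ⟨C, q0, hC, ?_⟩
  intro q _ hq hRH ℓ hℓ hℓq S hS a b c d ha hb hc hd
  have hcast : ((1/2 + 1/ℓ : ℝ) : ℂ) = 1/2 + ((1/ℓ : ℝ) : ℂ) := by push_cast; ring
  have h1 := h q hq hRH ℓ hℓ 4 ![1,1,1,r] ![a,b,c,d] (by intro u; fin_cases u <;> simp <;> linarith) (by simp [Fin.sum_univ_four]; ring)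
    (by intro u; fin_cases u <;> simp <;> linarith)
    (by
      intro u v
      have : ∀ u, |(![a,b,c,d] : Fin 4 → ℝ) u| ≤ ℓ^A := by intro u; fin_cases u <;> simpa
      have := abs_sub (![a,b,c,d] u) (![a,b,c,d] v)
      linarith [‹∀ u, |(![a,b,c,d] : Fin 4 → ℝ) u| ≤ ℓ^A› u, ‹∀ u, |(![a,b,c,d] : Fin 4 → ℝ) u| ≤ ℓ^A› v]) S hS
  simp only [Fin.prod_univ_four, Matrix.cons_val_zero, Matrix.cons_val_one, Matrix.cons_val, sub_self, Dt_zero (show 1 ≤ ℓ by linarith), Real.one_rpow, Real.rpow_one, one_mul, mul_one] at h1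
  rw [← hcast] at h1
  have hw := w4_pos ℓ a b c d
  have hD : ∀ x y, 0 < Dt ℓ (x - y) := fun x y => by linarith [one_le_Dt ℓ (x-y)]
  have sym : ∀ x y, Dt ℓ (x - y) = Dt ℓ (y - x) := fun x y => by rw [← Dt_neg, neg_sub]
  rw [sym b a, sym c a, sym c b, sym d a, sym d b, sym d c] at h1
  have h2 := mul_le_mul_of_nonneg_right h1 (Real.rpow_nonneg hw.le (1-r))
  rw [Finset.sum_mul] at h2
  refine (le_of_eq (Finset.sum_congr rfl fun χ _ => by ring)).trans (h2.trans ?_)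
  rw [mul_assoc (C * q.totient * ℓ^((3+r)^2/4))]
  refine mul_le_mul_of_nonneg_left ?_ (by positivity)
  have hs1 : 0 < (r-1)^2/(16*r) := div_pos (by nlinarith) (by linarith)
  have ham := star_amgm (a := (1-η)/2) (e := 1/2 + (r-1)/16) (s := 1 + (r-1)^2/(16*r)) (by linarith) (by linarith) (by linarith) (by rw [hη]; field_simp; ring)
    (hD a b) (hD a c) (hD a d) (hD b c) (hD b d) (hD c d)
  refine le_trans (le_of_eq ?_) ham
  unfold w4 Kr
  have e1 : ∀ x : ℝ, 0 < x → x^(-((1-η)/4)) * x^(-((1-η)/4)) = x^(-((1-η)/2)) := by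
    intro x hx; rw [← Real.rpow_add hx]; congr 1; ring
  have e2 : ∀ x : ℝ, 0 < x → x^(-((1-η)*r/4)) * x^(-((1-η)*r/4)) * (x^(-(3/8:ℝ)))^(1-r) = x^(-(1/2 + (r-1)/16)) := by
    intro x hx; rw [← Real.rpow_mul hx.le, ← Real.rpow_add hx, ← Real.rpow_add hx]; congr 1
    rw [hη]; field_simp; ring
  rw [Real.mul_rpow (by have := hD a d; have := hD b d; positivity) (by have := hD c d; positivity), Real.mul_rpow (by have := hD a d; positivity) (by have := hD b d; positivity)]
  rw [← e1 _ (hD a b), ← e1 _ (hD a c), ← e1 _ (hD b c), ← e2 _ (hD a d), ← e2 _ (hD b d), ← e2 _ (hD c d)]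
  ring

lemma lint_f (T : ℝ) (hT : 0 ≤ T) {g : ℝ → ℝ} (hg : Continuous g) (hg0 : ∀ t, 0 ≤ g t) :
    ∫⁻ t, (Set.Icc (-T) T).indicator (fun t => ENNReal.ofReal (g t)) t ∂(nu T) = ENNReal.ofReal (∫ t in Set.Icc (-T) T, bw t * g t) := by
  rw [lintegral_nu _ (hg.measurable.ennreal_ofReal.indicator measurableSet_Icc)]
  have hi : IntegrableOn (fun t => bw t * g t) (Set.Icc (-T) T) := (continuous_bw.mul hg).integrableOn_Icc
  rw [ofReal_integral_eq_lintegral_ofReal hi (Filter.Eventually.of_forall fun t => mul_nonneg (bw_pos t).le (hg0 t))]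
  refine setLIntegral_congr_fun measurableSet_Icc fun t ht => ?_
  simp only [Set.indicator_of_mem ht]
  rw [ENNReal.ofReal_mul (bw_pos t).le]

lemma cube_bound (s A : ℝ) (hs : 1 < s) (hA : 0 < A) : ∃ C : ℝ, 0 < C ∧ ∀ ℓ : ℝ, 1 ≤ ℓ →
    ∫⁻ x, (∫⁻ z, Kf ℓ s x z ∂(nu (ℓ^A)))^3 ∂(nu (ℓ^A)) ≤ ENNReal.ofReal (C * ℓ^(-3:ℝ)) := by
  obtain ⟨C1, hC1, h1⟩ := hker s A hs hA
  obtain ⟨C2, hC2, h2⟩ := hmass ((s-1)/2) A (by linarith) hA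
  refine ⟨C1^3 * 4 * C2, by positivity, ?_⟩
  intro ℓ hℓ
  have hℓ0 : 0 < ℓ := by linarith
  calc _ ≤ ∫⁻ x, ENNReal.ofReal ((C1/ℓ)^3 * 4) * ENNReal.ofReal (bw x + ℓ^(-((s-1)/2))) ∂(nu (ℓ^A)) := by
        refine lintegral_mono fun x => ?_
        have hb := bw_pos x
        have hb1 := bw_le_one x
        have hz : ℓ^(-((s-1)/2)) ≤ 1 := Real.rpow_le_one_of_one_le_of_nonpos hℓ (by linarith)
        have hz0 : 0 < ℓ^(-((s-1)/2)) := by positivity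
        refine (pow_le_pow_left' (h1 ℓ x hℓ) 3).trans ?_
        rw [← ENNReal.ofReal_pow (by positivity), ← ENNReal.ofReal_mul (by positivity)]
        refine ENNReal.ofReal_le_ofReal ?_
        generalize ℓ^(-((s-1)/2)) = z at *
        rw [mul_pow, mul_assoc]
        refine mul_le_mul_of_nonneg_left ?_ (by positivity)
        have : (bw x + z)^2 ≤ 2^2 := pow_le_pow_left₀ (by positivity) (by linarith) 2
        nlinarith
    _ = ENNReal.ofReal ((C1/ℓ)^3 * 4) * ∫⁻ x, ENNReal.ofReal (bw x + ℓ^(-((s-1)/2))) ∂(nu (ℓ^A)) :=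
        lintegral_const_mul' _ _ ENNReal.ofReal_ne_top
    _ ≤ ENNReal.ofReal ((C1/ℓ)^3 * 4) * ENNReal.ofReal C2 := mul_le_mul_right (h2 ℓ hℓ) _
    _ = _ := by
        rw [← ENNReal.ofReal_mul (by positivity)]
        congr 1
        rw [show (-3:ℝ) = -((3:ℕ):ℝ) by norm_num, Real.rpow_neg hℓ0.le, Real.rpow_natCast]
        field_simp

set_option maxHeartbeats 1000000 in
lemma main_I (p A : ℝ) (hp : 4 < p) (hA : 0 < A) : ∃ (C : ℝ) (q0 : ℕ), 0 < C ∧ ∀ (q : ℕ) [NeZero q], q0 ≤ q →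
    (∀ χ : DirichletCharacter ℂ q, dirichletRH χ) → ∀ (ℓ : ℝ), 2 ≤ ℓ → ℓ^A ≤ (q:ℝ)^2 →
    ∀ S : Finset (DirichletCharacter ℂ q), (∀ χ ∈ S, χ ≠ 1) →
    ∑ χ ∈ S, (∫ t in Set.Icc (-ℓ^A) (ℓ^A), bw t * ‖χ.LFunction ((1/2 + 1/ℓ : ℝ) + t * I)‖)^p ≤ C * q.totient * ℓ^(p^2/4 - p + 1) := by
  obtain ⟨r, hr, hrp⟩ : ∃ r : ℝ, 1 < r ∧ 3 + r = p := ⟨p - 3, by linarith, by ring⟩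
  have hs : 1 < 1 + (r-1)^2/(16*r) := by
    have : 0 < (r-1)^2/(16*r) := div_pos (by nlinarith) (by linarith)
    linarith
  obtain ⟨C1, q0, hC1, h1⟩ := moment4 r A hr hA
  set s := 1 + (r-1)^2/(16*r) with hsd
  obtain ⟨C2, hC2, h2⟩ := cube_bound s A hs hA
  obtain ⟨C3, hC3, h3⟩ := hker (9/8) A (by norm_num) hA
  refine ⟨(6 * C3)^(r-1) * C1 * (4 * C2), q0, by positivity, ?_⟩
  intro q _ hq hRH ℓ hℓ hℓq S hS
  have hℓ0 : 0 < ℓ := by linarith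
  have hℓ1 : 1 ≤ ℓ := by linarith
  have hT : 0 ≤ ℓ^A := by positivity
  set ν := nu (ℓ^A) with hν
  set g : DirichletCharacter ℂ q → ℝ → ℝ := fun χ t => ‖χ.LFunction ((1/2 + 1/ℓ : ℝ) + t * I)‖ with hg
  have hg0 : ∀ χ t, 0 ≤ g χ t := fun χ t => norm_nonneg _
  have hgc : ∀ χ ∈ S, Continuous (g χ) := fun χ hχ => (continuous_LF χ (hS χ hχ) _).norm
  set E := Set.Icc (-ℓ^A) (ℓ^A) with hE
  classical
  set f : DirichletCharacter ℂ q → ℝ → ℝ≥0∞ := fun χ => if χ ∈ S then E.indicator (fun t => ENNReal.ofReal (g χ t)) else 0 with hf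
  have hfm : ∀ χ, Measurable (f χ) := by
    intro χ
    by_cases h : χ ∈ S
    · simp only [hf, h, if_true]
      exact (hgc χ h).measurable.ennreal_ofReal.indicator measurableSet_Icc
    · simp only [hf, h, if_false]
      exact measurable_zero
  have hKr : ∀ s' a, Continuous fun d => Kr ℓ s' a d := by
    intro s' a
    unfold Kr
    exact ((continuous_Dt ℓ).comp (by fun_prop)).rpow_const fun d => Or.inl (lt_of_lt_of_le one_pos (one_le_Dt ℓ (a-d))).ne'
  set W : ℝ := 6 * C3 / ℓ with hW
  have hW0 : 0 < W := by positivity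
  set Q : ℝ := W^(r-1) * (C1 * q.totient * ℓ^((3+r)^2/4)) with hQ
  have hQ0 : 0 ≤ Q := by positivity
  have hfour := fourfold S (ν := ν) hr hfm (fun a b c d => ENNReal.ofReal (w4 ℓ a b c d))
    (fun a b c => by
      refine Measurable.ennreal_ofReal (Continuous.measurable ?_)
      unfold w4
      exact ((hKr _ _).mul (hKr _ _)).mul (hKr _ _))
    (fun a b c d => by simpa using w4_pos ℓ a b c d) (fun a b c d => ENNReal.ofReal_ne_top) (W := ENNReal.ofReal W)
    (fun a b c => by
      have hk : ∀ x, ∫⁻ d, Kf ℓ (9/8) x d ∂ν ≤ ENNReal.ofReal (2 * C3 / ℓ) := by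
        intro x
        refine (h3 ℓ x hℓ1).trans (ENNReal.ofReal_le_ofReal ?_)
        have hb1 := bw_le_one x
        have hz : ℓ^(-(((9/8:ℝ)-1)/2)) ≤ 1 := Real.rpow_le_one_of_one_le_of_nonpos hℓ1 (by norm_num)
        calc _ ≤ C3 / ℓ * (1 + 1) := mul_le_mul_of_nonneg_left (add_le_add hb1 hz) (by positivity)
          _ = _ := by ring
      have hm : ∀ x, Measurable fun d => Kf ℓ (9/8) x d := fun x => (measurable_Kf ℓ (9/8)).of_uncurry_left
      calc _ ≤ ∫⁻ d, (Kf ℓ (9/8) a d + Kf ℓ (9/8) b d + Kf ℓ (9/8) c d) ∂ν := by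
            refine lintegral_mono fun d => ?_
            have p1 := Kr_pos ℓ (9/8) a d; have p2 := Kr_pos ℓ (9/8) b d; have p3 := Kr_pos ℓ (9/8) c d
            simp only [Kf_eq]
            rw [← ENNReal.ofReal_add p1.le p2.le, ← ENNReal.ofReal_add (by positivity) p3.le]
            exact ENNReal.ofReal_le_ofReal (w4_le ℓ a b c d)
        _ = ∫⁻ d, Kf ℓ (9/8) a d ∂ν + ∫⁻ d, Kf ℓ (9/8) b d ∂ν + ∫⁻ d, Kf ℓ (9/8) c d ∂ν := by
            have hab : Measurable fun d => Kf ℓ (9/8) a d + Kf ℓ (9/8) b d := (hm a).add (hm b)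
            rw [lintegral_add_left hab, lintegral_add_left (hm a)]
        _ ≤ ENNReal.ofReal (2 * C3 / ℓ) + ENNReal.ofReal (2 * C3 / ℓ) + ENNReal.ofReal (2 * C3 / ℓ) :=
            add_le_add (add_le_add (hk a) (hk b)) (hk c)
        _ = ENNReal.ofReal W := by
            rw [← ENNReal.ofReal_add (by positivity) (by positivity), ← ENNReal.ofReal_add (by positivity) (by positivity)]
            congr 1; rw [hW]; ring)
    (M := fun a b c d => ENNReal.ofReal Q * (Kf ℓ s a b * Kf ℓ s a c * Kf ℓ s a d + Kf ℓ s a b * Kf ℓ s b c * Kf ℓ s b d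
      + Kf ℓ s a c * Kf ℓ s b c * Kf ℓ s c d + Kf ℓ s a d * Kf ℓ s b d * Kf ℓ s c d))
    (fun a b c d => by
      by_cases hin : a ∈ E ∧ b ∈ E ∧ c ∈ E ∧ d ∈ E
      · obtain ⟨ha, hb, hc, hd⟩ := hin
        have hm := h1 q hq hRH ℓ hℓ hℓq S hS a b c d (abs_le.mpr ha) (abs_le.mpr hb) (abs_le.mpr hc) (abs_le.mpr hd)
        have hw := w4_pos ℓ a b c d
        have hst : Kf ℓ s a b * Kf ℓ s a c * Kf ℓ s a d + Kf ℓ s a b * Kf ℓ s b c * Kf ℓ s b d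
            + Kf ℓ s a c * Kf ℓ s b c * Kf ℓ s c d + Kf ℓ s a d * Kf ℓ s b d * Kf ℓ s c d = ENNReal.ofReal (st4 ℓ s a b c d) := by
          unfold st4
          have h1 := Kr_pos ℓ s a b; have h2 := Kr_pos ℓ s a c; have h3 := Kr_pos ℓ s a d
          have h4 := Kr_pos ℓ s b c; have h5 := Kr_pos ℓ s b d; have h6 := Kr_pos ℓ s c d
          simp only [Kf_eq]
          rw [ENNReal.ofReal_add (by positivity) (by positivity), ENNReal.ofReal_add (by positivity) (by positivity), ENNReal.ofReal_add (by positivity) (by positivity)]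
          repeat rw [ENNReal.ofReal_mul (by positivity)]
        rw [hst, ← ENNReal.ofReal_mul hQ0]
        have hterm : ∀ χ ∈ S, f χ a * (f χ b * (f χ c * (ENNReal.ofReal W^(r-1) * (f χ d^r * ENNReal.ofReal (w4 ℓ a b c d)^(1-r)))))
            = ENNReal.ofReal (W^(r-1) * (g χ a * (g χ b * (g χ c * (g χ d^r * w4 ℓ a b c d^(1-r)))))) := by
          intro χ hχ
          have hfe : ∀ t ∈ E, f χ t = ENNReal.ofReal (g χ t) := fun t ht => by
            simp only [hf, hχ, if_true, Set.indicator_of_mem ht]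
          rw [hfe a ha, hfe b hb, hfe c hc, hfe d hd, ENNReal.ofReal_rpow_of_pos hW0, ENNReal.ofReal_rpow_of_pos hw,
            ENNReal.ofReal_rpow_of_nonneg (hg0 χ d) (by linarith)]
          have q1 := hg0 χ a; have q2 := hg0 χ b; have q3 := hg0 χ c; have q4 := hg0 χ d
          rw [← ENNReal.ofReal_mul (by positivity), ← ENNReal.ofReal_mul (by positivity), ← ENNReal.ofReal_mul (by positivity),
            ← ENNReal.ofReal_mul (by positivity), ← ENNReal.ofReal_mul (by positivity)]
          congr 1; ring
        rw [Finset.sum_congr rfl hterm, ← ENNReal.ofReal_sum_of_nonneg]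
        · refine ENNReal.ofReal_le_ofReal ?_
          rw [← Finset.mul_sum, hQ, mul_assoc]
          exact mul_le_mul_of_nonneg_left hm (by positivity)
        · intro χ hχ
          have q1 := hg0 χ a; have q2 := hg0 χ b; have q3 := hg0 χ c; have q4 := hg0 χ d
          positivity
      · refine le_trans (le_of_eq (Finset.sum_eq_zero fun χ hχ => ?_)) zero_le
        have hfe : ∀ t, t ∉ E → f χ t = 0 := fun t ht => by
          simp only [hf, hχ, if_true, Set.indicator_of_notMem ht]
        by_cases ha : a ∈ E
        · by_cases hb : b ∈ E
          · by_cases hc : c ∈ E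
            · have hd : d ∉ E := fun hd => hin ⟨ha, hb, hc, hd⟩
              rw [hfe d hd, ENNReal.zero_rpow_of_pos (by linarith)]; simp
            · rw [hfe c hc]; simp
          · rw [hfe b hb]; simp
        · rw [hfe a ha]; simp)
  have hpull : ∀ (F : ℝ → ℝ → ℝ → ℝ → ℝ≥0∞), ∫⁻ a, ∫⁻ b, ∫⁻ c, ∫⁻ d, ENNReal.ofReal Q * F a b c d ∂ν ∂ν ∂ν ∂ν
      = ENNReal.ofReal Q * ∫⁻ a, ∫⁻ b, ∫⁻ c, ∫⁻ d, F a b c d ∂ν ∂ν ∂ν ∂ν := by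
    intro F
    simp only [lintegral_const_mul' _ _ (ENNReal.ofReal_ne_top (r := Q))]
  rw [hpull, star_sum (measurable_Kf ℓ s) (Kf_symm ℓ s)] at hfour
  have hfin := hfour.trans (mul_le_mul_right (mul_le_mul_right (h2 ℓ hℓ1) 4) _)
  have hlhs : ∀ χ ∈ S, (∫⁻ t, f χ t ∂ν)^(3+r) = ENNReal.ofReal ((∫ t in E, bw t * g χ t)^p) := by
    intro χ hχ
    have := lint_f (ℓ^A) hT (hgc χ hχ) (hg0 χ)
    simp only [hf, hχ, if_true]
    rw [this, hrp, ENNReal.ofReal_rpow_of_nonneg _ (by linarith)]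
    exact integral_nonneg fun t => mul_nonneg (bw_pos t).le (hg0 χ t)
  rw [Finset.sum_congr rfl hlhs, ← ENNReal.ofReal_sum_of_nonneg, show (4:ℝ≥0∞) = ENNReal.ofReal 4 by norm_num,
    ← ENNReal.ofReal_mul (by norm_num), ← ENNReal.ofReal_mul hQ0, ENNReal.ofReal_le_ofReal_iff (by positivity)] at hfin
  · refine hfin.trans_eq ?_
    have : ℓ^(p^2/4 - p + 1) = ℓ^((3+r)^2/4) * (ℓ^(-3:ℝ) * ℓ^(-(r-1))) := by
      rw [← Real.rpow_add hℓ0, ← Real.rpow_add hℓ0]; congr 1; rw [← hrp]; ring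
    rw [this, hQ, hW, Real.div_rpow (by positivity) hℓ0.le, Real.rpow_neg hℓ0.le (r-1)]
    ring
  · intro χ hχ
    exact Real.rpow_nonneg (integral_nonneg fun t => mul_nonneg (bw_pos t).le (hg0 χ t)) _

end HP

open Complex Real Finset

namespace HP
set_option linter.unusedSectionVars false
open Metric MeasureTheory

set_option maxHeartbeats 1000000 in
lemma short_part (p B : ℝ) (hp : 4 < p) (hB : B = (2*p-2) + (2*p-2)^2/4) : ∃ (C : ℝ) (q0 : ℕ), 0 < C ∧ ∀ (q : ℕ) [NeZero q], q0 ≤ q →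
    (∀ χ : DirichletCharacter ℂ q, dirichletRH χ) → ∀ y : ℝ, 0 < y → 3 ≤ Real.log y → y^2 ≤ q → Real.log y^B ≤ y →
    ∀ S : Finset (DirichletCharacter ℂ q), (∀ χ ∈ S, χ ≠ 1) → ∀ u : ℝ, |u| ≤ 1 →
    ∑ χ ∈ S, ‖Fr χ y - Fr χ (y * Real.exp (-(Real.log y^(-B) * u)))‖ ^ p ≤ C * q.totient * y^(p/2) := by
  obtain ⟨C1, q0, hC1, hL⟩ := lossy (2*p-2) (by linarith)
  have hB0 : 0 < B := by rw [hB]; nlinarith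
  set C2 := 2^(2*p-2) * (C1 * (1 + Real.exp 1^(p-1) * 2^B)) with hC2
  have hC20 : 0 < C2 := by positivity
  refine ⟨Real.sqrt (3 * C2), q0, by positivity, ?_⟩
  intro q _ hq hRH y hy hℓ hyq hBy S hS u hu
  set ℓ := Real.log y with hℓd
  have hℓ0 : 0 < ℓ := by linarith
  set δ := ℓ^(-B) with hδd
  have hδ : 0 < δ := by positivity
  have hδ1 : δ ≤ 1 := Real.rpow_le_one_of_one_le_of_nonpos (by linarith) (by linarith)
  have hδB : δ * ℓ^B = 1 := by rw [hδd, ← Real.rpow_add hℓ0]; simp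
  have hyδ : 1 ≤ y * δ := by
    calc 1 = ℓ^B * δ := by rw [mul_comm]; exact hδB.symm
      _ ≤ y * δ := mul_le_mul_of_nonneg_right hBy hδ.le
  have hye : Real.exp 3 ≤ y := by
    rw [← Real.exp_log hy]; exact Real.exp_le_exp.mpr hℓ
  have he3 : Real.exp 1 < Real.exp 3 := Real.exp_lt_exp.mpr (by norm_num)
  have he1 : 2 < Real.exp 1 := by have := Real.exp_one_gt_d9; linarith
  set z := -(δ * u) with hz
  have hz1 : |z| ≤ 1 := by
    rw [hz, abs_neg, abs_mul, abs_of_pos hδ]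
    exact mul_le_one₀ hδ1 (abs_nonneg _) hu
  have hza := abs_le.mp hz1
  set y' := y * Real.exp z with hy'
  have hy'0 : 0 < y' := by positivity
  have hy'e : y' ≤ Real.exp 1 * y := by
    rw [hy', mul_comm]; exact mul_le_mul_of_nonneg_right (Real.exp_le_exp.mpr hza.2) hy.le
  have hlogy' : Real.log y' = ℓ + z := by rw [hy', Real.log_mul hy.ne' (Real.exp_ne_zero _), Real.log_exp]
  have hyy : Real.exp 1 * y < q := by nlinarith
  have hyq1 : y < q := by nlinarith
  have hy'q : y' < q := by linarith
  have hdiff := (FrD_bound (1 : DirichletCharacter ℂ q) hy hδ hδ1 hu).1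
  rw [← hz, ← hy'] at hdiff
  have hdiff' := abs_le.mp hdiff
  set D : DirichletCharacter ℂ q → ℝ := fun χ => ‖Fr χ y - Fr χ y'‖ with hD
  have hD0 : ∀ χ, 0 ≤ D χ := fun χ => norm_nonneg _
  set φ : ℝ := (q.totient : ℝ) with hφ
  have hφ0 : 0 ≤ φ := by positivity
  have hX : ∑ χ ∈ S, D χ^2 ≤ φ * (3 * (y * δ)) := by
    have h3 : φ * (2 * y * δ + 1) ≤ φ * (3 * (y * δ)) := mul_le_mul_of_nonneg_left (by linarith) hφ0
    rcases le_total y y' with h | h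
    · refine (second_moment S hy.le h hy'q).trans (le_trans (mul_le_mul_of_nonneg_left ?_ hφ0) h3)
      linarith
    · have := second_moment S hy'0.le h hyq1
      simp only [hD]
      simp only [norm_sub_rev (Fr _ y) (Fr _ y')]
      refine this.trans (le_trans (mul_le_mul_of_nonneg_left ?_ hφ0) h3)
      linarith
  have hY : ∑ χ ∈ S, D χ^(2*p-2) ≤ C2 * φ * y^(p-1) * ℓ^B := by
    have l1 := hL q hq hRH y hy (by linarith) hyq1.le S hS
    have l2 := hL q hq hRH y' hy'0 (by rw [hlogy']; linarith) hy'q.le S hS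
    rw [← hB, show (2*p-2)/2 = p-1 by ring] at l1 l2
    have l3 : y'^(p-1) * Real.log y'^B ≤ (Real.exp 1^(p-1) * y^(p-1)) * (2^B * ℓ^B) := by
      rw [← Real.mul_rpow (by positivity) hy.le, ← Real.mul_rpow (by norm_num) hℓ0.le]
      refine mul_le_mul (Real.rpow_le_rpow hy'0.le hy'e (by linarith)) (Real.rpow_le_rpow ?_ ?_ hB0.le) (Real.rpow_nonneg ?_ _) (by positivity)
      all_goals rw [hlogy']; linarith
    have l4 : C1 * φ * y'^(p-1) * Real.log y'^B ≤ C1 * φ * ((Real.exp 1^(p-1) * y^(p-1)) * (2^B * ℓ^B)) := by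
      rw [mul_assoc (C1 * φ)]; exact mul_le_mul_of_nonneg_left l3 (by positivity)
    calc _ ≤ ∑ χ ∈ S, 2^(2*p-2) * (‖Fr χ y‖^(2*p-2) + ‖Fr χ y'‖^(2*p-2)) := by
          refine Finset.sum_le_sum fun χ _ => ?_
          refine le_trans ?_ (rpow_add_le2 (norm_nonneg _) (norm_nonneg _) (by linarith))
          exact Real.rpow_le_rpow (norm_nonneg _) (norm_sub_le _ _) (by linarith)
      _ = 2^(2*p-2) * (∑ χ ∈ S, ‖Fr χ y‖^(2*p-2) + ∑ χ ∈ S, ‖Fr χ y'‖^(2*p-2)) := by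
          rw [← Finset.mul_sum, Finset.sum_add_distrib]
      _ ≤ 2^(2*p-2) * (C1 * φ * y^(p-1) * ℓ^B + C1 * φ * ((Real.exp 1^(p-1) * y^(p-1)) * (2^B * ℓ^B))) :=
          mul_le_mul_of_nonneg_left (add_le_add l1 (l2.trans l4)) (by positivity)
      _ = _ := by rw [hC2]; ring
  have hcs := Finset.sum_mul_sq_le_sq_mul_sq S D (fun χ => D χ^(p-1))
  have e1 : ∀ χ, D χ * D χ^(p-1) = D χ^p := by
    intro χ
    rcases (hD0 χ).eq_or_lt with h | h
    · rw [← h, Real.zero_rpow (by linarith : p ≠ 0)]; simp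
    · nth_rewrite 1 [← Real.rpow_one (D χ)]; rw [← Real.rpow_add h]; congr 1; ring
  have e2 : ∀ χ, (D χ^(p-1))^2 = D χ^(2*p-2) := by
    intro χ
    rw [← Real.rpow_natCast, ← Real.rpow_mul (hD0 χ)]; congr 1; push_cast; ring
  simp only [e1, e2] at hcs
  have hfin : (∑ χ ∈ S, D χ^p)^2 ≤ (Real.sqrt (3 * C2) * φ * y^(p/2))^2 := by
    refine hcs.trans ((mul_le_mul hX hY (Finset.sum_nonneg fun χ _ => Real.rpow_nonneg (hD0 χ) _) (by positivity)).trans_eq ?_)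
    have a1 : (y^(p/2))^2 = y * y^(p-1) := by
      rw [← Real.rpow_natCast, ← Real.rpow_mul hy.le]
      nth_rewrite 2 [← Real.rpow_one y]
      rw [← Real.rpow_add hy]; congr 1; push_cast; ring
    rw [mul_pow, mul_pow, Real.sq_sqrt (by positivity), a1]
    calc _ = 3 * C2 * φ^2 * (y * y^(p-1)) * (δ * ℓ^B) := by ring
      _ = _ := by rw [hδB]; ring
  exact (sq_le_sq₀ (Finset.sum_nonneg fun χ _ => Real.rpow_nonneg (hD0 χ) _) (by positivity)).mp hfin

end HP

open Complex Real Finset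

namespace HP
set_option linter.unusedSectionVars false
open Metric MeasureTheory

lemma exists_l0 (a : ℝ) : ∃ ℓ0 : ℝ, 3 ≤ ℓ0 ∧ ∀ ℓ, ℓ0 ≤ ℓ → ℓ^a ≤ Real.exp ℓ := by
  have h := (isLittleO_rpow_exp_pos_mul_atTop a one_pos).bound one_pos
  obtain ⟨x0, hx⟩ := Filter.eventually_atTop.mp h
  refine ⟨max 3 x0, le_max_left _ _, fun ℓ hℓ => ?_⟩
  have h1 := hx ℓ ((le_max_right _ _).trans hℓ)
  have h3 : 3 ≤ ℓ := (le_max_left _ _).trans hℓ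
  rw [Real.norm_of_nonneg (by positivity), Real.norm_of_nonneg (by positivity)] at h1
  simpa using h1

/-- weight of the middle range -/
lemma mid_weight {A ℓ δ : ℝ} (hA : 0 < A) (hℓ : 2 ≤ ℓ) (hδd : δ = ℓ^(-A)) {E : Set ℝ} (hE : MeasurableSet E)
    (hET : ∀ t ∈ E, ℓ^(A+1) ≤ |t|) : ∫ t in E, bw t * kap 4 δ t ≤ 2 * Real.exp A * ℓ^(-2:ℝ) := by
  have hℓ0 : 0 < ℓ := by linarith
  have hδ : 0 < δ := by rw [hδd]; positivity
  have hδ1 : δ ≤ 1 := by rw [hδd]; exact Real.rpow_le_one_of_one_le_of_nonpos (by linarith) (by linarith)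
  have hl0 : 0 < 1/ℓ := by positivity
  have hl1 : 1/ℓ ≤ 1 := by rw [div_le_one hℓ0]; linarith
  have hb := int_b hl0
  have hδT : δ * ℓ^(A+1) = ℓ := by rw [hδd, ← Real.rpow_add hℓ0]; simp
  have hδe : δ^(-(1/ℓ)) ≤ Real.exp A := by
    rw [hδd, ← Real.rpow_mul hℓ0.le, Real.rpow_def_of_pos hℓ0]
    refine Real.exp_le_exp.mpr ?_
    have h1 : Real.log ℓ ≤ ℓ := by linarith [Real.log_le_sub_one_of_pos hℓ0]
    rw [show Real.log ℓ * (-A * -(1/ℓ)) = Real.log ℓ / ℓ * A by ring]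
    exact mul_le_of_le_one_left hA.le (by rw [div_le_one hℓ0]; exact h1)
  have hi : Integrable fun t : ℝ => (ℓ^3)⁻¹ * (δ^(-(1/ℓ)) * (1 + |t|)^(-(1+1/ℓ))) := (hb.1.const_mul _).const_mul _
  calc _ ≤ ∫ t in E, (ℓ^3)⁻¹ * (δ^(-(1/ℓ)) * (1 + |t|)^(-(1+1/ℓ))) := by
        refine setIntegral_mono_on (integrable_bk hδ (by norm_num)).integrableOn hi.integrableOn hE fun t ht => ?_
        have h1 := int_bk hl0 hl1 hδ hδ1 (le_refl 1) t
        have h2 : ℓ ≤ 1 + δ * |t| := by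
          have := mul_le_mul_of_nonneg_left (hET t ht) hδ.le
          linarith
        have h3 : kap 4 δ t ≤ (ℓ^3)⁻¹ * kap 1 δ t := by
          unfold kap
          have h4 : ℓ^3 ≤ (1 + δ * |t|)^3 := pow_le_pow_left₀ hℓ0.le h2 3
          have h5 : 0 < 1 + δ * |t| := by linarith
          rw [← one_div, one_div_mul_one_div]
          refine one_div_le_one_div_of_le (by positivity) ?_
          rw [pow_one, show (1 + δ * |t|)^4 = (1 + δ * |t|)^3 * (1 + δ * |t|) by ring]
          exact mul_le_mul_of_nonneg_right h4 h5.le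
        calc bw t * kap 4 δ t ≤ bw t * ((ℓ^3)⁻¹ * kap 1 δ t) := mul_le_mul_of_nonneg_left h3 (bw_pos t).le
          _ = (ℓ^3)⁻¹ * (bw t * kap 1 δ t) := by ring
          _ ≤ _ := mul_le_mul_of_nonneg_left h1 (by positivity)
    _ ≤ ∫ t, (ℓ^3)⁻¹ * (δ^(-(1/ℓ)) * (1 + |t|)^(-(1+1/ℓ))) :=
        setIntegral_le_integral hi (Filter.Eventually.of_forall fun t => by show 0 ≤ (ℓ^3)⁻¹ * (δ^(-(1/ℓ)) * (1 + |t|)^(-(1+1/ℓ))); positivity)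
    _ = (ℓ^3)⁻¹ * (δ^(-(1/ℓ)) * (2 * ℓ)) := by rw [integral_const_mul, integral_const_mul, hb.2]; field_simp
    _ ≤ (ℓ^3)⁻¹ * (Real.exp A * (2 * ℓ)) := mul_le_mul_of_nonneg_left (mul_le_mul_of_nonneg_right hδe (by positivity)) (by positivity)
    _ = _ := by
        rw [show (-2:ℝ) = -((2:ℕ):ℝ) by norm_num, Real.rpow_neg hℓ0.le, Real.rpow_natCast]
        field_simp

set_option maxHeartbeats 2000000 in
lemma sharp (p : ℝ) (hp : 4 < p) : ∃ (C ℓ0 : ℝ) (q0 : ℕ), 0 < C ∧ 3 ≤ ℓ0 ∧ ∀ (q : ℕ) [NeZero q], q0 ≤ q →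
    (∀ χ : DirichletCharacter ℂ q, dirichletRH χ) → ∀ y : ℝ, 0 < y → ℓ0 ≤ Real.log y → y^2 ≤ q →
    ∀ S : Finset (DirichletCharacter ℂ q), (∀ χ ∈ S, χ ≠ 1) →
    ∑ χ ∈ S, ‖Fr χ y‖ ^ p ≤ C * q.totient * y^(p/2) * Real.log y^(p^2/4 - p + 1) := by
  obtain ⟨A, hAd⟩ : ∃ A : ℝ, A = (2*p-2) + (2*p-2)^2/4 := ⟨_, rfl⟩
  have hA : 0 < A := by rw [hAd]; nlinarith
  obtain ⟨C1, q1, hC1, hS1⟩ := short_part p A hp hAd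
  obtain ⟨C2, q2, hC2, hM⟩ := main_I p (A+1) hp (by linarith)
  obtain ⟨C3, q3, hC3, hR⟩ := L_range p (by linarith)
  obtain ⟨ψ, C4, hC4, hψc, hψ0, hψs, hψ1, hψi, hsm⟩ := smoothing (m := 4) (by norm_num)
  obtain ⟨ℓ0, hℓ03, hℓ0e⟩ := exists_l0 (A+1)
  refine ⟨2^p * ((3*C4)^p * (2^p * (C2 + 2^p * ((2 * Real.exp A)^p * C3 + 4^p))) + 9^p * C1), ℓ0, max q1 (max q2 q3), by positivity, hℓ03, ?_⟩
  intro q _ hq hRH y hy hℓ hyq S hS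
  set ℓ := Real.log y with hℓd
  have hℓ3 : 3 ≤ ℓ := hℓ03.trans hℓ
  have hℓp : 0 < ℓ := by linarith
  have hTy : ℓ^(A+1) ≤ y := by
    have := hℓ0e ℓ hℓ
    rwa [hℓd, Real.exp_log hy] at this
  have hAy : ℓ^A ≤ y := (Real.rpow_le_rpow_of_exponent_le (by linarith) (by linarith)).trans hTy
  have hT1 : 1 ≤ ℓ^(A+1) := Real.one_le_rpow (by linarith) (by linarith)
  have hA1 : 1 ≤ ℓ^A := Real.one_le_rpow (by linarith) (by linarith)
  have hy1 : 1 ≤ y := hT1.trans hTy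
  have hq1 : (1:ℝ) ≤ q := by nlinarith
  have hyq1 : y ≤ q := by nlinarith
  have hTq : ℓ^(A+1) ≤ (q:ℝ)^2 := by nlinarith
  set T := ℓ^(A+1) with hT
  set δ := ℓ^(-A) with hδd
  have hδ : 0 < δ := by positivity
  have hδ1 : δ ≤ 1 := Real.rpow_le_one_of_one_le_of_nonpos (by linarith) (by linarith)
  have hδA : δ * ℓ^A = 1 := by rw [hδd, ← Real.rpow_add hℓp]; simp
  have hδq : 1 ≤ δ^2 * q := by
    have h1 : 1 ≤ δ * y := by
      calc 1 = δ * ℓ^A := hδA.symm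
        _ ≤ δ * y := mul_le_mul_of_nonneg_left hAy hδ.le
    calc (1:ℝ) ≤ (δ * y)^2 := one_le_pow₀ h1
      _ = δ^2 * y^2 := by ring
      _ ≤ δ^2 * q := mul_le_mul_of_nonneg_left hyq (by positivity)
  have hl : 1/ℓ ≤ 1/2 := one_div_le_one_div_of_le (by norm_num) (by linarith)
  have hl0 : 0 < 1/ℓ := by positivity
  set σ := 1/2 + 1/ℓ with hσ
  set rY := y^(1/2:ℝ) with hrY
  have hrY0 : 0 < rY := by positivity
  have hYσ : y^σ ≤ 3 * rY := by
    rw [hσ, Real.rpow_add hy, ← hrY]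
    have : y^(1/ℓ) = Real.exp 1 := by
      rw [Real.rpow_def_of_pos hy, ← hℓd]; congr 1; field_simp
    rw [this]
    have := Real.exp_one_lt_d9
    nlinarith
  set E := Set.Icc (-(q:ℝ)^2) ((q:ℝ)^2) with hE
  set E1 := Set.Icc (-T) T with hE1
  have hE1E : E1 ⊆ E := Set.Icc_subset_Icc (by linarith) hTq
  set I1 : DirichletCharacter ℂ q → ℝ := fun χ => ∫ t in E1, bw t * ‖χ.LFunction (σ + t * I)‖ with hI1
  set I2 : DirichletCharacter ℂ q → ℝ := fun χ => ∫ t in E \ E1, bw t * ‖χ.LFunction (σ + t * I)‖ * kap 4 δ t with hI2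
  set D : DirichletCharacter ℂ q → ℝ → ℝ := fun χ u => ‖Fr χ y - Fr χ (y * Real.exp (-(δ * u)))‖ with hD
  set J : DirichletCharacter ℂ q → ℝ := fun χ => ∫ u, ψ u * D χ u with hJ
  have hnn : ∀ (χ : DirichletCharacter ℂ q) t, 0 ≤ bw t * ‖χ.LFunction (σ + t * I)‖ * kap 4 δ t := fun χ t => by
    have := bw_pos t; have := kap_pos 4 hδ.le t; positivity
  have hI10 : ∀ χ, 0 ≤ I1 χ := fun χ => integral_nonneg fun t => mul_nonneg (bw_pos t).le (norm_nonneg _)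
  have hI20 : ∀ χ, 0 ≤ I2 χ := fun χ => integral_nonneg (hnn χ)
  have hJ0 : ∀ χ, 0 ≤ J χ := fun χ => integral_nonneg fun u => mul_nonneg (hψ0 u) (norm_nonneg _)
  have hpt : ∀ χ ∈ S, ‖Fr χ y‖ ≤ (3 * C4) * rY * (I1 χ + (I2 χ + 4)) + 9 * J χ := by
    intro χ hχ
    have h1 := hsm q χ (hS χ hχ) σ δ y (by linarith) (by linarith) hδ hδ1 hy
    have hintegr := integrable_bL χ (hS χ hχ) (σ := σ) (by linarith) (by linarith) (by norm_num : 2 ≤ 4) hδ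
    have h2 : ∫ t, bw t * ‖χ.LFunction (σ + t * I)‖ * kap 4 δ t ≤ I1 χ + (I2 χ + 4) := by
      rw [← integral_add_compl (measurableSet_Icc : MeasurableSet E) hintegr,
        ← integral_inter_add_diff (s := E) (t := E1) measurableSet_Icc hintegr.integrableOn, Set.inter_eq_self_of_subset_right hE1E, add_assoc]
      refine add_le_add ?_ (add_le_add le_rfl (far_tail χ (hS χ hχ) (by linarith) (by linarith) le_rfl hδ hδq))
      refine setIntegral_mono hintegr.integrableOn ?_ fun t => ?_
      · exact (continuous_bw.mul (continuous_LF χ (hS χ hχ) σ).norm).integrableOn_Icc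
      · refine mul_le_of_le_one_right (mul_nonneg (bw_pos t).le (norm_nonneg _)) ?_
        unfold kap
        have : 0 ≤ δ * |t| := by positivity
        rw [div_le_one (by positivity)]
        exact one_le_pow₀ (by linarith)
    have h4 : C4 * y^σ * (∫ t, bw t * ‖χ.LFunction (σ + t * I)‖ * kap 4 δ t) ≤ C4 * (3 * rY) * (I1 χ + (I2 χ + 4)) :=
      mul_le_mul (mul_le_mul_of_nonneg_left hYσ hC4.le) h2 (integral_nonneg (hnn χ)) (by positivity)
    have h5 : C4 * (3 * rY) * (I1 χ + (I2 χ + 4)) = (3 * C4) * rY * (I1 χ + (I2 χ + 4)) := by ring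
    linarith
  have b1 : ∑ χ ∈ S, I1 χ^p ≤ C2 * q.totient * ℓ^(p^2/4 - p + 1) :=
    hM q ((le_max_left _ _).trans ((le_max_right _ _).trans hq)) hRH ℓ (by linarith) hTq S hS
  have hmidW := mid_weight hA (by linarith : 2 ≤ ℓ) hδd (E := E \ E1) (measurableSet_Icc.diff measurableSet_Icc) (fun t ht => by
    by_contra hc
    push Not at hc
    exact ht.2 (abs_le.mp hc.le))
  have b2 : ∑ χ ∈ S, I2 χ^p ≤ (2 * Real.exp A)^p * C3 * q.totient * ℓ^(p^2/4 - p + 1) := by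
    have h := hR q ((le_max_right _ _).trans ((le_max_right _ _).trans hq)) hRH ℓ (by linarith) 4 δ (by norm_num) hδ (E \ E1)
      (measurableSet_Icc.diff measurableSet_Icc) Set.diff_subset (2 * Real.exp A * ℓ^(-2:ℝ)) (by positivity) hmidW S hS
    refine h.trans ?_
    rw [Real.mul_rpow (by positivity) (by positivity), ← Real.rpow_mul hℓp.le]
    calc _ = (2 * Real.exp A)^p * C3 * q.totient * (ℓ^(-2*p) * ℓ^(p^2/4)) := by ring
      _ ≤ _ := by
        refine mul_le_mul_of_nonneg_left ?_ (by positivity)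
        rw [← Real.rpow_add hℓp]
        exact Real.rpow_le_rpow_of_exponent_le (by linarith) (by linarith)
  have b3 : ∑ χ ∈ S, J χ^p ≤ C1 * q.totient * y^(p/2) := by
    have hDm : ∀ χ, Measurable (D χ) := fun χ => ((measurable_FrD χ y δ).const_sub _).norm
    have hDb : ∀ χ ∈ S, ∀ u, D χ u ≤ 2 * q := fun χ hχ u => by
      refine (norm_sub_le _ _).trans ?_
      linarith [norm_Fr_le χ (hS χ hχ) y, norm_Fr_le χ (hS χ hχ) (y * Real.exp (-(δ * u)))]
    have h := jensen_sum (μ := volume) (w := ψ) (f := D) S (by linarith : 1 ≤ p) one_pos (M := C1 * q.totient * y^(p/2)) (by positivity)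
      hψ0 (fun _ _ => norm_nonneg _) hψi
      (fun χ hχ => by
        refine hψi.mul_bdd (c := 2 * q) (hDm χ).aestronglyMeasurable (Filter.Eventually.of_forall fun u => ?_)
        rw [Real.norm_of_nonneg (norm_nonneg _)]; exact hDb χ hχ u)
      (fun χ hχ => by
        refine hψi.mul_bdd (c := (2 * q)^p) ((hDm χ).pow_const p).aestronglyMeasurable (Filter.Eventually.of_forall fun u => ?_)
        have : 0 ≤ D χ u := norm_nonneg _
        rw [Real.norm_of_nonneg (by positivity)]; exact Real.rpow_le_rpow this (hDb χ hχ u) (by linarith))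
      hψ1.le
      (Filter.Eventually.of_forall fun u => by
        by_cases hu : 1 ≤ |u|
        · simp [hψs u hu]
        · exact mul_le_mul_of_nonneg_left (hS1 q ((le_max_left _ _).trans hq) hRH y hy hℓ3 hyq hAy S hS u (by linarith)) (hψ0 u))
    simpa using h
  have b4 : (S.card : ℝ) * 4^p ≤ 4^p * q.totient * ℓ^(p^2/4 - p + 1) := by
    have h1 : 1 ≤ ℓ^(p^2/4 - p + 1) := Real.one_le_rpow (by linarith) (by nlinarith [sq_nonneg (p-2)])
    calc _ ≤ (q.totient : ℝ) * 4^p := mul_le_mul_of_nonneg_right (card_le_totient S) (by positivity)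
      _ = 4^p * q.totient := by ring
      _ ≤ _ := le_mul_of_one_le_right (by positivity) h1
  set L := ℓ^(p^2/4 - p + 1) with hL
  have hL1 : 1 ≤ L := Real.one_le_rpow (by linarith) (by nlinarith [sq_nonneg (p-2)])
  have hp0 : 0 ≤ p := by linarith
  calc ∑ χ ∈ S, ‖Fr χ y‖ ^ p ≤ ∑ χ ∈ S, 2^p * ((3*C4)^p * y^(p/2) * (2^p * (I1 χ^p + 2^p * (I2 χ^p + 4^p))) + 9^p * J χ^p) := by
        refine Finset.sum_le_sum fun χ hχ => ?_
        have i1 := hI10 χ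
        have i2 := hI20 χ
        have i3 := hJ0 χ
        refine (Real.rpow_le_rpow (norm_nonneg _) (hpt χ hχ) hp0).trans ?_
        refine (rpow_add_le2 (by positivity) (by positivity) hp0).trans ?_
        refine mul_le_mul_of_nonneg_left (add_le_add ?_ (le_of_eq ?_)) (by positivity)
        · rw [Real.mul_rpow (by positivity) (by positivity), Real.mul_rpow (by positivity) (by positivity), hrY, ← Real.rpow_mul hy.le,
            show 1/2 * p = p/2 by ring]
          refine mul_le_mul_of_nonneg_left ?_ (by positivity)
          refine (rpow_add_le2 i1 (by positivity) hp0).trans ?_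
          refine mul_le_mul_of_nonneg_left (add_le_add le_rfl ?_) (by positivity)
          exact rpow_add_le2 i2 (by norm_num) hp0
        · rw [Real.mul_rpow (by norm_num) i3]
    _ = 2^p * ((3*C4)^p * y^(p/2) * (2^p * (∑ χ ∈ S, I1 χ^p + 2^p * (∑ χ ∈ S, I2 χ^p + S.card * 4^p))) + 9^p * ∑ χ ∈ S, J χ^p) := by
        simp only [← Finset.mul_sum, Finset.sum_add_distrib, Finset.sum_const, nsmul_eq_mul]
    _ ≤ 2^p * ((3*C4)^p * y^(p/2) * (2^p * (C2 * q.totient * L + 2^p * ((2 * Real.exp A)^p * C3 * q.totient * L + 4^p * q.totient * L))) + 9^p * (C1 * q.totient * y^(p/2) * L)) := by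
        refine mul_le_mul_of_nonneg_left (add_le_add (mul_le_mul_of_nonneg_left (mul_le_mul_of_nonneg_left (add_le_add b1
          (mul_le_mul_of_nonneg_left (add_le_add b2 b4) (by positivity))) (by positivity)) (by positivity))
          (mul_le_mul_of_nonneg_left (b3.trans (le_mul_of_one_le_right (by positivity) hL1)) (by positivity))) (by positivity)
    _ = _ := by ring

end HP

open Classical in
theorem stmt3 (k : ℝ) (hk : 2 < k) :
    ∃ C : ℝ, 0 < C ∧ ∃ q0 : ℕ, ∀ (q : ℕ) [NeZero q], q0 ≤ q →
      (∀ χ : DirichletCharacter ℂ q, dirichletRH χ) →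
      ∀ y : ℝ, 2 ≤ y → y ≤ (q : ℝ) ^ ((1 : ℝ) / 2) →
      ∑ χ ∈ Finset.univ.filter (fun χ : DirichletCharacter ℂ q => χ.IsPrimitive),
        ‖(∑ n ∈ Finset.Icc 1 ⌊y⌋₊, χ n : ℂ)‖ ^ (2 * k)
      ≤ C * (Nat.totient q) * y ^ k * Real.log y ^ ((k - 1) ^ 2) := by
  obtain ⟨C, ℓ0, q0, hC, hℓ0, h⟩ := HP.sharp (2 * k) (by linarith)
  have hl2 : 0 < Real.log 2 := Real.log_pos (by norm_num)
  set C' := Real.exp (ℓ0 * k) / Real.log 2 ^ ((k-1)^2) with hC'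
  have hC'0 : 0 < C' := by positivity
  refine ⟨C + C', by positivity, max q0 2, ?_⟩
  intro q _ hq hRH y hy hyq
  have hq0 : q0 ≤ q := (le_max_left _ _).trans hq
  have hq2 : 2 ≤ q := (le_max_right _ _).trans hq
  have hy0 : 0 < y := by linarith
  have hyq2 : y^2 ≤ q := by
    have := pow_le_pow_left₀ hy0.le hyq 2
    rwa [← Real.rpow_natCast ((q:ℝ)^((1:ℝ)/2)), ← Real.rpow_mul (by positivity), show (1:ℝ)/2 * ((2:ℕ):ℝ) = 1 by norm_num, Real.rpow_one] at this
  have hlog : Real.log 2 ≤ Real.log y := Real.log_le_log (by norm_num) hy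
  have hlogp : 0 < Real.log y := by linarith
  set S := Finset.univ.filter (fun χ : DirichletCharacter ℂ q => χ.IsPrimitive) with hS
  have hS1 : ∀ χ ∈ S, χ ≠ 1 := by
    intro χ hχ h1
    rw [hS, Finset.mem_filter] at hχ
    have h2 := hχ.2
    rw [h1, DirichletCharacter.isPrimitive_def, DirichletCharacter.conductor_one] at h2
    omega
  have hFr : ∀ χ : DirichletCharacter ℂ q, (∑ n ∈ Finset.Icc 1 ⌊y⌋₊, χ n : ℂ) = HP.Fr χ y := fun χ => rfl
  simp only [hFr]
  by_cases hc : ℓ0 ≤ Real.log y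
  · have h1 := h q hq0 hRH y hy0 hc hyq2 S hS1
    rw [show 2 * k / 2 = k by ring, show (2*k)^2/4 - 2*k + 1 = (k-1)^2 by ring] at h1
    refine h1.trans ?_
    rw [mul_assoc, mul_assoc, mul_assoc, mul_assoc]
    exact mul_le_mul_of_nonneg_right (by linarith) (by positivity)
  · push Not at hc
    have hyk : y^k ≤ Real.exp (ℓ0 * k) := by
      rw [Real.rpow_def_of_pos hy0]
      exact Real.exp_le_exp.mpr (mul_le_mul_of_nonneg_right hc.le (by linarith))
    have hterm : ∀ χ ∈ S, ‖HP.Fr χ y‖^(2*k) ≤ y^k * Real.exp (ℓ0 * k) := by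
      intro χ _
      have h1 : ‖HP.Fr χ y‖ ≤ y := (HP.norm_psum_le_self χ _).trans (Nat.floor_le hy0.le)
      refine (Real.rpow_le_rpow (norm_nonneg _) h1 (by linarith)).trans ?_
      rw [two_mul, Real.rpow_add hy0]
      exact mul_le_mul_of_nonneg_left hyk (by positivity)
    have hl : Real.log 2 ^ ((k-1)^2) ≤ Real.log y ^ ((k-1)^2) := Real.rpow_le_rpow hl2.le hlog (by positivity)
    calc _ ≤ ∑ χ ∈ S, y^k * Real.exp (ℓ0 * k) := Finset.sum_le_sum hterm
      _ = S.card * (y^k * Real.exp (ℓ0 * k)) := by rw [Finset.sum_const, nsmul_eq_mul]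
      _ ≤ q.totient * (y^k * Real.exp (ℓ0 * k)) := mul_le_mul_of_nonneg_right (HP.card_le_totient S) (by positivity)
      _ = C' * q.totient * y^k * Real.log 2 ^ ((k-1)^2) := by rw [hC']; field_simp
      _ ≤ C' * q.totient * y^k * Real.log y ^ ((k-1)^2) := mul_le_mul_of_nonneg_left hl (by positivity)
      _ ≤ _ := by
        rw [mul_assoc, mul_assoc, mul_assoc, mul_assoc]
        exact mul_le_mul_of_nonneg_right (by linarith) (by positivity)
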